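/- There exists a function c_2 : ℝ → ℝ such that: (i) for every λ ∈ ℝ, setting M(n) := ⌈(n/2)(1 + λ·n^{−1/3})⌉, one has n^{−1/3} · E_{n,M(n)}[℘] → c_2(λ) as n → ∞; and (ii) |λ| · c_2(λ) → c_1 as λ → −∞, where c_1 = ∫_0^∞ (1 − e^{−E_1(v)}) dv. -/

import Mathlib

open Filter

/-- The maximum block-size of a simple graph `G`: the largest cardinality of a set `S`
of at least two vertices such that the induced subgraph `G[S]` is connected and remains
connected after deleting any single vertex of `S` (`0` if no such set exists). -/
noncomputable def maxBlockSize {V : Type*} (G : SimpleGraph V) : ℕ :=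
  sSup {k | ∃ S : Set V, S.ncard = k ∧ 2 ≤ k ∧ (G.induce S).Connected ∧
    ∀ v ∈ S, (G.induce (S \ {v})).Connected}

/-- The expectation of the maximum block-size over all simple graphs on `{1,…,n}`
with exactly `M` edges, each taken with equal probability `1 / C(C(n,2), M)`. -/
noncomputable def expMaxBlock (n M : ℕ) : ℝ := by
  classical
  exact (∑ G ∈ Finset.univ.filter (fun G : SimpleGraph (Fin n) => G.edgeSet.ncard = M),
      (maxBlockSize G : ℝ)) / ((n.choose 2).choose M : ℝ)

/-- `E_1(x) = (1/2) ∫_x^∞ e^{-t} t^{-1} dt`. -/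
noncomputable def E1 (x : ℝ) : ℝ := (1 / 2) * ∫ t in Set.Ioi x, Real.exp (-t) / t

/-- `c_1 = ∫_0^∞ (1 - e^{-E_1(v)}) dv ≈ 0.378911`. -/
noncomputable def c1 : ℝ := ∫ v in Set.Ioi (0 : ℝ), (1 - Real.exp (-(E1 v)))

open Finset MeasureTheory Real
open Complex (I I_sq I_re I_im I_ne_zero ofReal_cpow ofReal_im abs_re_le_norm add_re
  continuous_ofReal continuous_re div_ofReal_re exp_eq_exp_ℂ normSq_apply normSq_eq_norm_sq
  norm_exp norm_exp_le_exp_norm norm_log_one_add_sub_self_le norm_log_sub_logTaylor_le norm_real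
  ofReal_add ofReal_div ofReal_exp ofReal_inv ofReal_mul ofReal_one ofReal_pow ofReal_re
  ofReal_sum ofReal_zero one_re re re_mul_ofReal re_ofReal_mul real_smul zero_re)

noncomputable section

set_option linter.unusedSectionVars false
set_option linter.unusedVariables false

/-! ### Weighted sums over finite subsets -/

/-- The indicator of a proposition as a real number. -/
def ind (p : Prop) : ℝ := by
  classical
  exact if p then 1 else 0

lemma ind_true {p : Prop} (h : p) : ind p = 1 := by simp [ind, h]
lemma ind_false {p : Prop} (h : ¬p) : ind p = 0 := by simp [ind, h]
lemma ind_nonneg (p : Prop) : 0 ≤ ind p := by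
  by_cases h : p <;> simp [ind, h]
lemma ind_le_one (p : Prop) : ind p ≤ 1 := by
  by_cases h : p <;> simp [ind, h]
lemma ind_mono {p q : Prop} (h : p → q) : ind p ≤ ind q := by
  by_cases hp : p
  · simp [ind, hp, h hp]
  · rw [ind_false hp]; exact ind_nonneg q
lemma ind_congr {p q : Prop} (h : p ↔ q) : ind p = ind q := by rw [h]
lemma ind_and (p q : Prop) : ind (p ∧ q) = ind p * ind q := by
  by_cases hp : p <;> by_cases hq : q <;> simp [ind, hp, hq]
lemma ind_not (p : Prop) : ind (¬p) = 1 - ind p := by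
  by_cases hp : p <;> simp [ind, hp]
lemma ind_or_le (p q : Prop) : ind (p ∨ q) ≤ ind p + ind q := by
  by_cases hp : p <;> by_cases hq : q <;> simp [ind, hp, hq]
lemma ind_mul_congr {p : Prop} {a b : ℝ} (h : p → a = b) : ind p * a = ind p * b := by
  by_cases hp : p
  · rw [h hp]
  · simp [ind_false hp]
lemma sum_ind {α : Type*} (A : Finset α) (p : α → Prop) [DecidablePred p] :
    ∑ a ∈ A, ind (p a) = ((A.filter p).card : ℝ) := by
  rw [card_filter]; push_cast
  exact sum_congr rfl fun a _ => by by_cases h : p a <;> simp [ind, h]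
lemma ind_exists_le {α : Type*} (A : Finset α) (p : α → Prop) :
    ind (∃ a ∈ A, p a) ≤ ∑ a ∈ A, ind (p a) := by
  by_cases h : ∃ a ∈ A, p a
  · obtain ⟨a, ha, hp⟩ := h
    rw [ind_true ⟨a, ha, hp⟩, ← ind_true hp]
    exact single_le_sum (f := fun a => ind (p a)) (fun b _ => ind_nonneg _) ha
  · rw [ind_false h]; exact sum_nonneg fun b _ => ind_nonneg _

section ws
variable {α : Type*} [DecidableEq α]

/-- The sum of `w ^ #S * f S` over the subsets `S` of `A`. -/
def ws (w : ℝ) (A : Finset α) (f : Finset α → ℝ) : ℝ :=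
  ∑ S ∈ A.powerset, w ^ S.card * f S

lemma ws_insert (w : ℝ) {A : Finset α} {e : α} (he : e ∉ A) (f : Finset α → ℝ) :
    ws w (insert e A) f = ws w A f + w * ws w A (fun S => f (insert e S)) := by
  unfold ws
  rw [sum_powerset_insert he, mul_sum]
  congr 1
  refine sum_congr rfl fun S hS => ?_
  grind

@[simp] lemma ws_empty (w : ℝ) (f : Finset α → ℝ) : ws w ∅ f = f ∅ := by simp [ws]

lemma ws_congr {w : ℝ} {A : Finset α} {f g : Finset α → ℝ} (h : ∀ S ⊆ A, f S = g S) :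
    ws w A f = ws w A g :=
  sum_congr rfl fun S hS => by rw [h S (mem_powerset.1 hS)]

lemma ws_mono {w : ℝ} (hw : 0 ≤ w) {A : Finset α} {f g : Finset α → ℝ}
    (h : ∀ S ⊆ A, f S ≤ g S) : ws w A f ≤ ws w A g :=
  sum_le_sum fun S hS =>
    mul_le_mul_of_nonneg_left (h S (mem_powerset.1 hS)) (pow_nonneg hw _)

lemma ws_nonneg {w : ℝ} (hw : 0 ≤ w) {A : Finset α} {f : Finset α → ℝ}
    (h : ∀ S ⊆ A, 0 ≤ f S) : 0 ≤ ws w A f :=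
  sum_nonneg fun S hS => mul_nonneg (pow_nonneg hw _) (h S (mem_powerset.1 hS))

lemma ws_add (w : ℝ) (A : Finset α) (f g : Finset α → ℝ) :
    ws w A (fun S => f S + g S) = ws w A f + ws w A g := by
  simp only [ws, mul_add, sum_add_distrib]

lemma ws_sub (w : ℝ) (A : Finset α) (f g : Finset α → ℝ) :
    ws w A (fun S => f S - g S) = ws w A f - ws w A g := by
  simp only [ws, mul_sub, sum_sub_distrib]

lemma ws_mul_left (w c : ℝ) (A : Finset α) (f : Finset α → ℝ) :
    ws w A (fun S => c * f S) = c * ws w A f := by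
  simp only [ws, mul_sum]
  grind

lemma ws_mul_right (w c : ℝ) (A : Finset α) (f : Finset α → ℝ) :
    ws w A (fun S => f S * c) = ws w A f * c := by
  simp only [ws, sum_mul]
  grind

lemma ws_sum {ι : Type*} (w : ℝ) (A : Finset α) (I : Finset ι) (f : ι → Finset α → ℝ) :
    ws w A (fun S => ∑ i ∈ I, f i S) = ∑ i ∈ I, ws w A (f i) := by
  simp only [ws, mul_sum]
  exact sum_comm

lemma ws_one (w : ℝ) (A : Finset α) : ws w A (fun _ => 1) = (1 + w) ^ A.card := by
  induction A using Finset.induction_on with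
  | empty => simp
  | insert e A he ih => rw [ws_insert w he, ih, card_insert_of_notMem he]; ring

lemma ws_const (w c : ℝ) (A : Finset α) : ws w A (fun _ => c) = (1 + w) ^ A.card * c := by
  have := ws_mul_right w c A (fun _ => 1)
  rw [ws_one] at this
  simpa using this

lemma ws_union (w : ℝ) {A B : Finset α} (h : Disjoint A B) (f : Finset α → ℝ) :
    ws w (A ∪ B) f = ws w A (fun S => ws w B (fun T => f (S ∪ T))) := by
  induction A using Finset.induction_on generalizing f with
  | empty => simp
  | insert e A he ih =>
    rw [disjoint_insert_left] at h
    rw [insert_union, ws_insert w (by simp [he, h.1]), ws_insert w he, ih h.2, ih h.2]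
    simp only [insert_union]

/-- Summing over `S ⊆ A` a function of `S ∩ B` when `B ⊆ A`. -/
lemma ws_inter (w : ℝ) {A B : Finset α} (h : B ⊆ A) (f : Finset α → ℝ) :
    ws w A (fun S => f (S ∩ B)) = (1 + w) ^ (A \ B).card * ws w B f := by
  have hd : Disjoint B (A \ B) := disjoint_sdiff
  conv_lhs => rw [← union_sdiff_of_subset h]
  rw [ws_union w hd, ← ws_mul_left]
  refine ws_congr fun S hS => ?_
  rw [← ws_const w]
  refine ws_congr fun T hT => ?_
  congr 1
  grind

lemma ws_map {β : Type*} [DecidableEq β] (w : ℝ) (σ : α ↪ β) (A : Finset α)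
    (f : Finset β → ℝ) : ws w (A.map σ) f = ws w A (fun S => f (S.map σ)) := by
  induction A using Finset.induction_on generalizing f with
  | empty => simp
  | insert e A he ih =>
    rw [map_insert, ws_insert w (by simpa using he), ws_insert w he, ih, ih]
    simp only [map_insert]

/-- Disjoint occurrence. -/
def Box (P Q : Finset α → Prop) (S : Finset α) : Prop :=
  ∃ X Y, X ⊆ S ∧ Y ⊆ S ∧ Disjoint X Y ∧ P X ∧ Q Y

lemma Box.mono {P Q P' Q' : Finset α → Prop} (hP : ∀ X, P X → P' X) (hQ : ∀ X, Q X → Q' X)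
    {S : Finset α} (h : Box P Q S) : Box P' Q' S := by
  obtain ⟨X, Y, h1, h2, h3, h4, h5⟩ := h
  exact ⟨X, Y, h1, h2, h3, hP _ h4, hQ _ h5⟩

lemma ws_ind_mono {w : ℝ} (hw : 0 ≤ w) {A : Finset α} {P Q : Finset α → Prop}
    (h : ∀ S ⊆ A, P S → Q S) : ws w A (fun S => ind (P S)) ≤ ws w A (fun S => ind (Q S)) :=
  ws_mono hw fun S hS => ind_mono (h S hS)

lemma bk_inequality {w : ℝ} (hw : 0 ≤ w) (hw1 : w ≤ 1) (A : Finset α)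
    (P Q : Finset α → Prop) (hP : Monotone P) (hQ : Monotone Q) :
    ws w A (fun S => ind (Box P Q S)) * (1 + w) ^ A.card ≤
      ws w A (fun S => ind (P S)) * ws w A (fun S => ind (Q S)) := by
  induction A using Finset.induction_on generalizing P Q with
  | empty =>
    simp only [ws_empty, card_empty, pow_zero, mul_one]
    rw [← ind_and]
    refine ind_mono ?_
    rintro ⟨X, Y, h1, h2, -, h4, h5⟩
    exact ⟨hP h1 h4, hQ h2 h5⟩
  | insert e A he ih =>
    set P1 : Finset α → Prop := fun S => P (insert e S) with hP1d
    set Q1 : Finset α → Prop := fun S => Q (insert e S) with hQ1d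
    have hP1 : Monotone P1 := fun X Y h => hP (insert_subset_insert e h)
    have hQ1 : Monotone Q1 := fun X Y h => hQ (insert_subset_insert e h)
    have le1 : ∀ S, P S → P1 S := fun S h => hP (subset_insert e S) h
    have le2 : ∀ S, Q S → Q1 S := fun S h => hQ (subset_insert e S) h
    have key : ws w A (fun S => ind (Box P Q (insert e S))) ≤
        ws w A (fun S => ind (Box P1 Q S)) + ws w A (fun S => ind (Box P Q1 S)) -
          ws w A (fun S => ind (Box P Q S)) := by
      rw [← ws_add, ← ws_sub]
      refine ws_mono hw fun S hS => ?_
      have heS : e ∉ S := fun h => he (hS h)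
      have h1 : Box P Q (insert e S) → Box P1 Q S ∨ Box P Q1 S := by
        rintro ⟨X, Y, hX, hY, hd, h4, h5⟩
        by_cases heX : e ∈ X
        · left
          have heY : e ∉ Y := disjoint_left.1 hd heX
          refine ⟨X.erase e, Y, ?_, ?_, ?_, ?_, h5⟩
          · grind
          · grind
          · exact hd.mono_left (erase_subset _ _)
          simp_all
        · right
          refine ⟨X, Y.erase e, ?_, ?_, ?_, h4, ?_⟩
          · grind
          · grind
          · exact hd.mono_right (erase_subset _ _)
          · exact hQ (fun y hy => by grind) h5
      have h2 : Box P Q S → Box P1 Q S := Box.mono le1 fun _ h => h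
      have h3 : Box P Q S → Box P Q1 S := Box.mono (fun _ h => h) le2
      by_cases h0 : Box P Q S
      · rw [ind_true h0, ind_true (h2 h0), ind_true (h3 h0)]
        linarith [ind_le_one (Box P Q (insert e S))]
      · rw [ind_false h0]
        linarith [(ind_mono h1).trans (ind_or_le _ _)]
    rw [ws_insert w he, ws_insert w he, ws_insert w he, card_insert_of_notMem he]
    have i0 := ih P Q hP hQ
    have i1 := ih P1 Q hP1 hQ
    have i2 := ih P Q1 hP hQ1
    have a01 : ws w A (fun S => ind (P S)) ≤ ws w A (fun S => ind (P1 S)) :=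
      ws_ind_mono hw fun S _ => le1 S
    have b01 : ws w A (fun S => ind (Q S)) ≤ ws w A (fun S => ind (Q1 S)) :=
      ws_ind_mono hw fun S _ => le2 S
    change (_ + w * _) * _ ≤ (_ + w * ws w A (fun S => ind (P1 S))) *
      (_ + w * ws w A (fun S => ind (Q1 S)))
    generalize ws w A (fun S => ind (P S)) = a0 at *
    generalize ws w A (fun S => ind (P1 S)) = a1 at *
    generalize ws w A (fun S => ind (Q S)) = b0 at *
    generalize ws w A (fun S => ind (Q1 S)) = b1 at *
    generalize ws w A (fun S => ind (Box P Q (insert e S))) = x at *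
    generalize ws w A (fun S => ind (Box P Q S)) = p00 at *
    generalize ws w A (fun S => ind (Box P1 Q S)) = p10 at *
    generalize ws w A (fun S => ind (Box P Q1 S)) = p01 at *
    rw [pow_succ']
    have hT : 0 ≤ (1 + w) ^ A.card := by positivity
    generalize (1 + w) ^ A.card = T at *
    have : (p00 + w * x) * T ≤ (1 - w) * (a0 * b0) + w * (a1 * b0) + w * (a0 * b1) := by
      have h1 : x * T ≤ (p10 + p01 - p00) * T := mul_le_mul_of_nonneg_right key hT
      have h2 := mul_le_mul_of_nonneg_left h1 hw
      have h3 := mul_le_mul_of_nonneg_left i0 (sub_nonneg.2 hw1)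
      have h4 := mul_le_mul_of_nonneg_left i1 hw
      have h5 := mul_le_mul_of_nonneg_left i2 hw
      nlinarith
    have h6 := mul_le_mul_of_nonneg_left this (by linarith : 0 ≤ 1 + w)
    have h7 : 0 ≤ w ^ 2 * ((a1 - a0) * (b1 - b0)) :=
      mul_nonneg (sq_nonneg w) (mul_nonneg (by linarith) (by linarith))
    nlinarith

end ws

/-! ### Reachability -/

/-- A finite set of edges on the natural numbers. -/
abbrev EdgeSet := Finset (Sym2 ℕ)

/-- Connection in the graph with edge set `S`. -/
def Rch (S : EdgeSet) : ℕ → ℕ → Prop := Relation.ReflTransGen (fun x y => s(x, y) ∈ S)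

namespace Rch
variable {S T : EdgeSet} {a b c u v x y : ℕ}

@[refl] lemma refl (S : EdgeSet) (a : ℕ) : Rch S a a := Relation.ReflTransGen.refl

lemma trans (h : Rch S a b) (h' : Rch S b c) : Rch S a c := Relation.ReflTransGen.trans h h'

lemma symm (h : Rch S a b) : Rch S b a :=
  by
    induction h with
    | refl => exact refl _ _
    | tail _ hxy ih => exact .head (by rwa [Sym2.eq_swap]) ih

lemma comm : Rch S a b ↔ Rch S b a := ⟨symm, symm⟩

lemma single (h : s(a, b) ∈ S) : Rch S a b := Relation.ReflTransGen.single h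

lemma mono (hST : S ⊆ T) (h : Rch S a b) : Rch T a b :=
  by
    induction h with
    | refl => exact refl _ _
    | tail _ hxy ih => exact .tail ih (hST hxy)

lemma insert_iff : Rch (insert s(u, v) S) a b ↔
    Rch S a b ∨ (Rch S a u ∧ Rch S v b) ∨ (Rch S a v ∧ Rch S u b) := by
  constructor
  · intro h
    induction h with
    | refl => exact Or.inl (refl _ _)
    | tail _ hxy ih =>
      rename_i x y _
      rcases mem_insert.1 hxy with h | h
      · rcases Sym2.eq_iff.1 h with ⟨rfl, rfl⟩ | ⟨rfl, rfl⟩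
        · rcases ih with h | ⟨h, -⟩ | ⟨h, -⟩
          · exact Or.inr (Or.inl ⟨h, refl _ _⟩)
          · exact Or.inr (Or.inl ⟨h, refl _ _⟩)
          · exact Or.inl h
        · rcases ih with h | ⟨h, -⟩ | ⟨h, -⟩
          · exact Or.inr (Or.inr ⟨h, refl _ _⟩)
          · exact Or.inl h
          · exact Or.inr (Or.inr ⟨h, refl _ _⟩)
      · rcases ih with h1 | ⟨h1, h2⟩ | ⟨h1, h2⟩
        · exact Or.inl (h1.trans (single h))
        · exact Or.inr (Or.inl ⟨h1, h2.trans (single h)⟩)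
        · exact Or.inr (Or.inr ⟨h1, h2.trans (single h)⟩)
  · have hs : S ⊆ insert s(u, v) S := subset_insert _ _
    have he : Rch (insert s(u, v) S) u v := single (mem_insert_self _ _)
    rintro (h | ⟨h1, h2⟩ | ⟨h1, h2⟩)
    · exact h.mono hs
    · exact ((h1.mono hs).trans he).trans (h2.mono hs)
    · exact ((h1.mono hs).trans he.symm).trans (h2.mono hs)

/-- A set closed under the edges of `S` contains everything connected to its members. -/
lemma closed {p : ℕ → Prop} (hp : ∀ x y, s(x, y) ∈ S → p x → p y) (h : Rch S a b) (ha : p a) :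
    p b := by
  induction h with
  | refl => exact ha
  | tail _ hxy ih => exact hp _ _ hxy ih

/-- Connection only uses edges inside a closed set. -/
lemma restrict {p : ℕ → Prop} (hp : ∀ x y, s(x, y) ∈ S → p x → p y)
    (hT : ∀ x y, s(x, y) ∈ S → p x → s(x, y) ∈ T) (h : Rch S a b) (ha : p a) : Rch T a b := by
  have : p b ∧ Rch T a b := by
    induction h with
    | refl => exact ⟨ha, refl _ _⟩
    | tail _ hxy ih => exact ⟨hp _ _ hxy ih.1, ih.2.trans (single (hT _ _ hxy ih.1))⟩
  exact this.2

lemma map_iff (σ : Equiv.Perm ℕ) :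
    Rch (S.map ⟨Sym2.map σ, Sym2.map.injective σ.injective⟩) (σ a) (σ b) ↔ Rch S a b := by
  constructor
  · intro h
    have key : ∀ c, Rch (S.map ⟨Sym2.map σ, Sym2.map.injective σ.injective⟩) (σ a) c →
        Rch S a (σ.symm c) := by
      intro c hc
      induction hc with
      | refl => simpa using refl _ _
      | tail _ hxy ih =>
        refine ih.trans (single ?_)
        simp only [Finset.mem_map, Function.Embedding.coeFn_mk] at hxy
        obtain ⟨e, he, h⟩ := hxy
        induction e with
        | _ p q =>
          rw [Sym2.map_mk, Sym2.eq_iff] at h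
          grind
    simpa using key _ h
  · intro h
    induction h with
    | refl => exact refl _ _
    | tail _ hxy ih =>
      refine ih.trans (single ?_)
      simp only [Finset.mem_map, Function.Embedding.coeFn_mk]
      exact ⟨_, hxy, by simp⟩

end Rch

/-! ### Edge sets of complete graphs -/

/-- The edges of the complete graph on `U`. -/
def KK (U : Finset ℕ) : EdgeSet := U.sym2.filter fun e => ¬e.IsDiag

lemma mem_KK {U : Finset ℕ} {a b : ℕ} : s(a, b) ∈ KK U ↔ a ∈ U ∧ b ∈ U ∧ a ≠ b := by
  simp [KK, and_assoc]

lemma KK_mono {U V : Finset ℕ} (h : U ⊆ V) : KK U ⊆ KK V := by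
  intro e he
  induction e with
  | _ a b => rw [mem_KK] at *; grind

lemma card_KK (U : Finset ℕ) : (KK U).card = U.card.choose 2 := by
  have h := U.card_sym2
  have h2 : (U.sym2.filter fun e => e.IsDiag).card = U.card := by
    rw [← card_image_of_injective U (f := fun a => s(a, a))
      (fun a b h => by simpa using h)]
    congr 1
    ext e
    induction e with
    | _ a b =>
      simp only [mem_filter, mk_mem_sym2_iff, Sym2.mk_isDiag_iff, mem_image,
        Sym2.eq_iff]
      grind
  have h3 := card_filter_add_card_filter_not (s := U.sym2) (p := fun e => e.IsDiag)
  have h4 : (U.card + 1).choose 2 = U.card + U.card.choose 2 := by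
    rw [Nat.choose_succ_succ' U.card 1, Nat.choose_one_right]
  rw [h2, h, h4] at h3
  unfold KK
  omega

/-- The edges joining `x` to the members of `U`. -/
def starE (x : ℕ) (U : Finset ℕ) : EdgeSet := U.image fun y => s(x, y)

lemma mem_starE {x : ℕ} {U : Finset ℕ} {a b : ℕ} :
    s(a, b) ∈ starE x U ↔ (a = x ∧ b ∈ U) ∨ (b = x ∧ a ∈ U) := by
  simp only [starE, mem_image, Sym2.eq_iff]
  grind

lemma card_starE (x : ℕ) (U : Finset ℕ) : (starE x U).card = U.card :=
  card_image_of_injective U fun a b h => by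
    grind

lemma KK_insert {x : ℕ} {U : Finset ℕ} (hx : x ∉ U) :
    KK (insert x U) = KK U ∪ starE x U := by
  ext e
  induction e with
  | _ a b =>
    rw [mem_union, mem_KK, mem_KK, mem_starE, mem_insert, mem_insert]
    grind

lemma disjoint_KK_starE {x : ℕ} {U V : Finset ℕ} (hx : x ∉ U) : Disjoint (KK U) (starE x V) := by
  rw [disjoint_left]
  intro e
  induction e with
  | _ a b =>
    rw [mem_KK, mem_starE]
    grind

lemma KK_map (σ : Equiv.Perm ℕ) (U : Finset ℕ) :
    KK (U.map σ.toEmbedding) = (KK U).map ⟨Sym2.map σ, Sym2.map.injective σ.injective⟩ := by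
  ext e
  induction e with
  | _ a b =>
    simp only [mem_KK, Finset.mem_map, Function.Embedding.coeFn_mk]
    constructor
    · rintro ⟨⟨x, hx, rfl⟩, ⟨y, hy, rfl⟩, h⟩
      exact ⟨s(x, y), mem_KK.2 ⟨hx, hy, fun h' => h (by rw [h'])⟩, rfl⟩
    · rintro ⟨e, he, h⟩
      induction e with
      | _ x y =>
        rw [mem_KK] at he
        rw [Sym2.map_mk, Sym2.eq_iff] at h
        rcases h with ⟨rfl, rfl⟩ | ⟨rfl, rfl⟩
        · simp_all
        · exact ⟨⟨y, he.2.1, rfl⟩, ⟨x, he.1, rfl⟩, (σ.injective.ne he.2.2).symm⟩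

lemma Rch.mem_of_KK {U : Finset ℕ} {S : EdgeSet} (hS : S ⊆ KK U) {a b : ℕ}
    (h : Rch S a b) (ha : a ∈ U) : b ∈ U :=
  Rch.closed (p := (· ∈ U)) (fun _ _ hxy _ => (mem_KK.1 (hS hxy)).2.1) h ha

/-! ### Expectations in the binomial random graph -/

/-- The expectation of `f` when every edge of the complete graph on `U` is present with odds `w`. -/
def ev (w : ℝ) (U : Finset ℕ) (f : EdgeSet → ℝ) : ℝ :=
  ws w (KK U) f / (1 + w) ^ (KK U).card

section ev
variable {w : ℝ} {U : Finset ℕ} {f g : EdgeSet → ℝ}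

lemma ev_congr (h : ∀ S ⊆ KK U, f S = g S) : ev w U f = ev w U g := by
  rw [ev, ws_congr h, ev]

lemma ev_mono (hw : 0 ≤ w) (h : ∀ S ⊆ KK U, f S ≤ g S) : ev w U f ≤ ev w U g :=
  div_le_div_of_nonneg_right (ws_mono hw h) (by positivity)

lemma ev_nonneg (hw : 0 ≤ w) (h : ∀ S ⊆ KK U, 0 ≤ f S) : 0 ≤ ev w U f :=
  div_nonneg (ws_nonneg hw h) (by positivity)

lemma ev_add : ev w U (fun S => f S + g S) = ev w U f + ev w U g := by
  rw [ev, ws_add, add_div, ev, ev]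

lemma ev_sub : ev w U (fun S => f S - g S) = ev w U f - ev w U g := by
  rw [ev, ws_sub, sub_div, ev, ev]

lemma ev_mul_right (c : ℝ) : ev w U (fun S => f S * c) = ev w U f * c := by
  rw [ev, ws_mul_right, mul_div_right_comm, ev]

lemma ev_sum {ι : Type*} (I : Finset ι) (f : ι → EdgeSet → ℝ) :
    ev w U (fun S => ∑ i ∈ I, f i S) = ∑ i ∈ I, ev w U (f i) := by
  rw [ev, ws_sum, sum_div]; rfl

lemma ev_const (hw : 0 ≤ w) (c : ℝ) : ev w U (fun _ => c) = c := by
  rw [ev, ws_const, mul_div_cancel_left₀]; positivity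

lemma ev_ind_mono (hw : 0 ≤ w) {P Q : EdgeSet → Prop} (h : ∀ S ⊆ KK U, P S → Q S) :
    ev w U (fun S => ind (P S)) ≤ ev w U (fun S => ind (Q S)) :=
  ev_mono hw fun S hS => ind_mono (h S hS)

lemma ev_map (w : ℝ) (U : Finset ℕ) (σ : Equiv.Perm ℕ) (f : EdgeSet → ℝ) :
    ev w (U.map σ.toEmbedding) f =
      ev w U (fun S => f (S.map ⟨Sym2.map σ, Sym2.map.injective σ.injective⟩)) := by
  rw [ev, KK_map, ws_map, card_map, ev]

lemma ev_box (hw : 0 ≤ w) (hw1 : w ≤ 1) (P Q : EdgeSet → Prop) (hP : Monotone P)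
    (hQ : Monotone Q) : ev w U (fun S => ind (Box P Q S)) ≤
      ev w U (fun S => ind (P S)) * ev w U (fun S => ind (Q S)) := by
  have h := bk_inequality hw hw1 (KK U) P Q hP hQ
  have h0 : 0 < (1 + w) ^ (KK U).card := by positivity
  rw [ev, ev, ev, div_mul_div_comm, div_le_div_iff₀ h0 (mul_pos h0 h0), ← mul_assoc]
  simp_all

end ev

section ws2
variable {α : Type*} [DecidableEq α]

lemma ws_ind_subset (w : ℝ) {A B : Finset α} (h : B ⊆ A) (f : Finset α → ℝ) :
    ws w A (fun S => ind (S ⊆ B) * f S) = ws w B f := by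
  unfold ws
  symm
  refine (sum_congr rfl fun S hS => ?_).trans
    (sum_subset (powerset_mono.2 h) fun S _ hS => ?_)
  · dsimp only
    rw [ind_true (mem_powerset.1 hS), one_mul]
  · dsimp only
    rw [ind_false (fun h => hS (mem_powerset.2 h))]; simp

lemma ws_mono_weight {w w' : ℝ} (hw : 0 ≤ w) (hww : w ≤ w') (A : Finset α) (f : Finset α → ℝ)
    (hf : Monotone f) : ws w A f * (1 + w') ^ A.card ≤ ws w' A f * (1 + w) ^ A.card := by
  induction A using Finset.induction_on generalizing f with
  | empty => simp
  | insert e A he ih =>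
    rw [ws_insert _ he, ws_insert _ he, card_insert_of_notMem he]
    have i0 := ih f hf
    have i1 := ih (fun S => f (insert e S)) fun X Y h => hf (insert_subset_insert e h)
    have i2 : ws w' A f ≤ ws w' A (fun S => f (insert e S)) :=
      ws_mono (hw.trans hww) fun S _ => hf (subset_insert e S)
    have h0 : 0 ≤ (1 + w) ^ A.card := by positivity
    have h1 := mul_le_mul_of_nonneg_right i2 h0
    have h2 := mul_le_mul_of_nonneg_left i1 hw
    have h3 : 0 ≤ 1 + w' := by linarith
    rw [pow_succ', pow_succ']
    nlinarith [mul_le_mul_of_nonneg_left h1 (sub_nonneg.2 hww),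
      mul_le_mul_of_nonneg_left i0 h3, mul_le_mul_of_nonneg_left h2 h3]

end ws2

lemma ev_mono_weight {w w' : ℝ} (hw : 0 ≤ w) (hww : w ≤ w') (U : Finset ℕ)
    (f : EdgeSet → ℝ) (hf : Monotone f) : ev w U f ≤ ev w' U f := by
  have := hw.trans hww
  rw [ev, ev, div_le_div_iff₀ (by positivity) (by positivity)]
  exact ws_mono_weight hw hww _ f hf

/-! ### Relabelling -/

lemma exists_perm {U V : Finset ℕ} (h : U.card = V.card) :
    ∃ σ : Equiv.Perm ℕ, U.map σ.toEmbedding = V := by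
  have inf : ∀ U : Finset ℕ, Infinite {x // x ∉ U} := fun U => by
    have := (finite_toSet U).infinite_compl
    exact this.to_subtype
  have hU := inf U
  have hV := inf V
  let e1 : {x // x ∈ U} ≃ {x // x ∈ V} := equivOfCardEq h
  let d1 : Denumerable {x // x ∉ U} := Denumerable.ofEncodableOfInfinite _
  let d2 : Denumerable {x // x ∉ V} := Denumerable.ofEncodableOfInfinite _
  let e2 : {x // x ∉ U} ≃ {x // x ∉ V} := Denumerable.equiv₂ _ _
  have key : ∀ x ∈ U, Equiv.subtypeCongr e1 e2 x ∈ V := by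
    intro x hx
    have : Equiv.subtypeCongr e1 e2 x = e1 ⟨x, hx⟩ := by
      simp [Equiv.subtypeCongr, Equiv.sumCompl, hx]
    grind
  refine ⟨Equiv.subtypeCongr e1 e2, eq_of_subset_of_card_le ?_ (by simp [h])⟩
  intro y hy
  obtain ⟨x, hx, rfl⟩ := Finset.mem_map.1 hy
  exact key x hx

lemma exists_perm_apply {U V : Finset ℕ} (h : U.card = V.card) {u v : ℕ} (hu : u ∈ U)
    (hv : v ∈ V) : ∃ σ : Equiv.Perm ℕ, U.map σ.toEmbedding = V ∧ σ u = v := by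
  obtain ⟨σ, hσ⟩ := exists_perm h
  have hu' : σ u ∈ V := by rw [← hσ]; simpa using hu
  refine ⟨σ.trans (Equiv.swap (σ u) v), ?_, by simp⟩
  refine eq_of_subset_of_card_le ?_ (by simp [h])
  intro y hy
  obtain ⟨x, hx, rfl⟩ := Finset.mem_map.1 hy
  have hx' : σ x ∈ V := by rw [← hσ]; simpa using hx
  simp only [Equiv.coe_toEmbedding, Equiv.trans_apply]
  grind

lemma exists_perm_apply₂ {U V : Finset ℕ} (h : U.card = V.card) {u v u' v' : ℕ} (hu : u ∈ U)
    (hv : v ∈ V) (hu' : u' ∈ U) (hv' : v' ∈ V) (hne : u ≠ u') (hne' : v ≠ v') :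
    ∃ σ : Equiv.Perm ℕ, U.map σ.toEmbedding = V ∧ σ u = v ∧ σ u' = v' := by
  obtain ⟨σ, hσ, h1⟩ := exists_perm_apply h hu hv
  have hm : ∀ x ∈ U, σ x ∈ V := fun x hx => by rw [← hσ]; simpa using hx
  have hn : σ u' ≠ v := fun h' => hne (σ.injective (h1.trans h'.symm))
  refine ⟨σ.trans (Equiv.swap (σ u') v'), ?_, ?_, by simp⟩
  · refine eq_of_subset_of_card_le ?_ (by simp [h])
    intro y hy
    obtain ⟨x, hx, rfl⟩ := Finset.mem_map.1 hy
    simp only [Equiv.coe_toEmbedding, Equiv.trans_apply]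
    grind
  grind

/-! ### Components -/

open Classical in
/-- The vertices of `U` connected to `v`. -/
def cc (S : EdgeSet) (U : Finset ℕ) (v : ℕ) : Finset ℕ :=
  U.filter fun x => Rch S v x

lemma mem_cc {S : EdgeSet} {U : Finset ℕ} {v x : ℕ} :
    x ∈ cc S U v ↔ x ∈ U ∧ Rch S v x := by simp [cc]

lemma cc_subset (S : EdgeSet) (U : Finset ℕ) (v : ℕ) : cc S U v ⊆ U :=
  fun _ hx => (mem_cc.1 hx).1

lemma self_mem_cc {S : EdgeSet} {U : Finset ℕ} {v : ℕ} (hv : v ∈ U) : v ∈ cc S U v :=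
  mem_cc.2 ⟨hv, Rch.refl _ _⟩

lemma card_cc_pos {S : EdgeSet} {U : Finset ℕ} {v : ℕ} (hv : v ∈ U) :
    0 < (cc S U v).card := card_pos.2 ⟨v, self_mem_cc hv⟩

lemma card_cc_le {S : EdgeSet} {U : Finset ℕ} {v : ℕ} : (cc S U v).card ≤ U.card :=
  card_le_card (cc_subset _ _ _)

lemma cc_mono {S T : EdgeSet} (h : S ⊆ T) (U : Finset ℕ) (v : ℕ) :
    cc S U v ⊆ cc T U v := fun x hx => by
  rw [mem_cc] at *; exact ⟨hx.1, hx.2.mono h⟩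

lemma cc_map (S : EdgeSet) (U : Finset ℕ) (v : ℕ) (σ : Equiv.Perm ℕ) :
    cc (S.map ⟨Sym2.map σ, Sym2.map.injective σ.injective⟩) (U.map σ.toEmbedding) (σ v) =
      (cc S U v).map σ.toEmbedding := by
  ext y
  obtain ⟨x, rfl⟩ := σ.surjective y
  simp [mem_cc, Rch.map_iff]

/-- Law of the size of the component of a vertex in a graph with `n` vertices. -/
def pc (w : ℝ) (n k : ℕ) : ℝ :=
  ev w (range n) fun S => ind ((cc S (range n) 0).card = k)

lemma ev_cc {w : ℝ} {U : Finset ℕ} {v : ℕ} (hv : v ∈ U) (k : ℕ) :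
    ev w U (fun S => ind ((cc S U v).card = k)) = pc w U.card k := by
  obtain ⟨σ, h1, h2⟩ := exists_perm_apply (U := range U.card) (V := U) (by simp)
    (u := 0) (by simpa using ⟨v, hv⟩) hv
  conv_lhs => rw [← h1, ← h2]
  rw [ev_map, pc]
  simp only [cc_map, card_map]

lemma ev_comp_sum {w : ℝ} {U : Finset ℕ} {v : ℕ} (hv : v ∈ U) (g : ℕ → ℝ) :
    ev w U (fun S => g (cc S U v).card) = ∑ k ∈ Icc 1 U.card, pc w U.card k * g k := by
  simp_rw [← ev_cc hv, ← ev_mul_right]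
  rw [← ev_sum]
  refine ev_congr fun S _ => ?_
  rw [sum_eq_single_of_mem (cc S U v).card]
  · rw [ind_true rfl, one_mul]
  · exact mem_Icc.2 ⟨card_cc_pos hv, card_cc_le⟩
  · intro k _ hk
    rw [ind_false (Ne.symm hk), zero_mul]

lemma pc_nonneg {w : ℝ} (hw : 0 ≤ w) (n k : ℕ) : 0 ≤ pc w n k :=
  ev_nonneg hw fun _ _ => ind_nonneg _

lemma sum_pc {w : ℝ} (hw : 0 ≤ w) {n : ℕ} (hn : 0 < n) : ∑ k ∈ Icc 1 n, pc w n k = 1 := by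
  have := ev_comp_sum (w := w) (U := range n) (v := 0) (by simpa using hn) fun _ => 1
  rw [ev_const hw] at this
  simpa using this.symm

/-- Adding edges at a new vertex `x` that miss the component of `v`. -/
lemma rch_union_star {S T : EdgeSet} {U : Finset ℕ} {x v : ℕ} (hS : S ⊆ KK U)
    (hx : x ∉ U) (hv : v ∈ U) (hT : T ⊆ starE x U) :
    ¬Rch (S ∪ T) v x ↔ T ⊆ starE x (U \ cc S U v) := by
  constructor
  · intro h e he
    obtain ⟨y, hy, rfl⟩ := mem_image.1 (hT he)
    refine mem_image.2 ⟨y, Finset.mem_sdiff.2 ⟨hy, fun hc => h ?_⟩, rfl⟩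
    refine ((mem_cc.1 hc).2.mono subset_union_left).trans (Rch.single ?_)
    grind
  · intro h hr
    have := Rch.closed (p := fun z => z ∈ cc S U v) ?_ hr (self_mem_cc hv)
    · exact hx (cc_subset _ _ _ this)
    · intro a b hab ha
      rcases mem_union.1 hab with h1 | h1
      · exact mem_cc.2 ⟨(mem_KK.1 (hS h1)).2.1, (mem_cc.1 ha).2.trans (Rch.single h1)⟩
      · rcases mem_starE.1 (h h1) with ⟨rfl, h2⟩ | ⟨rfl, h2⟩
        · exact absurd (cc_subset _ _ _ ha) hx
        grind

lemma cc_union_star {S T : EdgeSet} {U : Finset ℕ} {x v : ℕ} (hS : S ⊆ KK U)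
    (hx : x ∉ U) (hv : v ∈ U) (hT : T ⊆ starE x (U \ cc S U v)) :
    cc (S ∪ T) (insert x U) v = cc S U v := by
  ext z
  constructor
  · intro hz
    refine Rch.closed (p := fun z => z ∈ cc S U v) ?_ (mem_cc.1 hz).2 (self_mem_cc hv)
    intro a b hab ha
    rcases mem_union.1 hab with h1 | h1
    · exact mem_cc.2 ⟨(mem_KK.1 (hS h1)).2.1, (mem_cc.1 ha).2.trans (Rch.single h1)⟩
    · rcases mem_starE.1 (hT h1) with ⟨rfl, h2⟩ | ⟨rfl, h2⟩
      · exact absurd (cc_subset _ _ _ ha) hx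
      grind
  · intro hz
    rw [mem_cc] at hz ⊢
    exact ⟨mem_insert_of_mem hz.1, hz.2.mono subset_union_left⟩

lemma ev_comp_avoid {w : ℝ} (hw : 0 ≤ w) {U : Finset ℕ} {x v : ℕ} (hx : x ∉ U) (hv : v ∈ U)
    (k : ℕ) : ev w (insert x U) (fun S => ind ((cc S (insert x U) v).card = k ∧ ¬Rch S v x)) =
      ((1 + w) ^ k)⁻¹ * pc w U.card k := by
  have h1w : (1 + w) ≠ 0 := by positivity
  rw [← ev_cc hv, ev, ev, KK_insert hx, ws_union w (disjoint_KK_starE hx),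
    card_union_of_disjoint (disjoint_KK_starE hx), card_starE, mul_div_assoc',
    div_eq_div_iff (by positivity) (by positivity), pow_add]
  rw [← ws_mul_left, ← ws_mul_right, ← ws_mul_right]
  refine ws_congr fun S hS => ?_
  have : ∀ T ⊆ starE x U, ind ((cc (S ∪ T) (insert x U) v).card = k ∧ ¬Rch (S ∪ T) v x) =
      ind (T ⊆ starE x (U \ cc S U v)) * ind ((cc S U v).card = k) := by
    intro T hT
    rw [← ind_and, rch_union_star hS hx hv hT, and_comm]
    refine ind_congr (and_congr_right fun h => ?_)
    rw [cc_union_star hS hx hv h]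
  have hsub : starE x (U \ cc S U v) ⊆ starE x U := image_subset_image sdiff_subset
  rw [ws_congr this, ws_ind_subset w hsub, ws_const,
    card_starE, card_sdiff_of_subset (cc_subset _ _ _)]
  by_cases hk : (cc S U v).card = k
  · rw [ind_true hk, ← hk]
    have := pow_sub_mul_pow (1 + w) (card_cc_le (S := S) (U := U) (v := v))
    field_simp
    exact this
  · rw [ind_false hk]; simp

lemma pc_succ {w : ℝ} (hw : 0 ≤ w) {n : ℕ} (hn : 0 < n) (k : ℕ) :
    pc w (n + 1) k * (n + 1 - k) = n * ((1 + w) ^ k)⁻¹ * pc w n k := by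
  have h1 : ∀ S : EdgeSet, ind ((cc S (range (n + 1)) 0).card = k) * (n + 1 - k) =
      ∑ x ∈ (range (n + 1)).erase 0,
        ind ((cc S (range (n + 1)) 0).card = k ∧ ¬Rch S 0 x) := by
    classical
    intro S
    simp_rw [ind_and]
    rw [← mul_sum]
    refine ind_mul_congr fun hk => ?_
    rw [sum_ind, ← hk]
    have : ((range (n + 1)).erase 0).filter (fun x => ¬Rch S 0 x) =
        range (n + 1) \ cc S (range (n + 1)) 0 := by
      ext x
      simp only [mem_filter, mem_erase, Finset.mem_sdiff, mem_cc]
      constructor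
      · grind
      · rintro ⟨h1, h2⟩
        exact ⟨⟨fun h => h2 ⟨h1, h ▸ Rch.refl _ _⟩, h1⟩, fun h => h2 ⟨h1, h⟩⟩
    rw [this, card_sdiff_of_subset (cc_subset _ _ _), Nat.cast_sub card_cc_le]
    simp
  rw [pc, ← ev_mul_right, ev_congr fun S _ => h1 S, ev_sum]
  rw [sum_congr rfl (g := fun _ => ((1 + w) ^ k)⁻¹ * pc w n k)]
  · rw [sum_const, card_erase_of_mem (by simp)]
    simp; ring
  · intro x hx
    have hx' := mem_of_mem_erase hx
    have h0 : 0 ∈ (range (n + 1)).erase x := by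
      grind
    have := ev_comp_avoid hw (U := (range (n + 1)).erase x) (x := x) (by simp) h0 k
    simp_all

/-- The expected size of a component. -/
def chi (w : ℝ) (n : ℕ) : ℝ := ∑ k ∈ Icc 1 n, pc w n k * k

lemma ev_card_cc {w : ℝ} {U : Finset ℕ} {v : ℕ} (hv : v ∈ U) :
    ev w U (fun S => ((cc S U v).card : ℝ)) = chi w U.card :=
  ev_comp_sum hv fun k => (k : ℝ)

lemma exp_le_inv_one_sub {x : ℝ} (h0 : 0 ≤ x) (h1 : x < 1) :
    exp (x + x ^ 2 / 2) ≤ (1 - x)⁻¹ := by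
  have h := hasSum_pow_div_log_of_abs_lt_one (x := x) (by rwa [abs_of_nonneg h0])
  have := sum_le_hasSum (range 2) (fun i _ => by positivity) h
  rw [sum_range_succ, sum_range_one] at this
  rw [← exp_log (inv_pos.2 (sub_pos.2 h1)), exp_le_exp, log_inv]
  norm_num at this ⊢
  linarith

lemma chi_moment {w : ℝ} (hw : 0 ≤ w) {n : ℕ} (hn : 0 < n) :
    (1 - n * w) * chi w n + (∑ k ∈ Icc 1 n, pc w n k * ((k : ℝ) - 1) ^ 2) / (2 * n) ≤ 1 := by
  have hn' : (0 : ℝ) < n := by exact_mod_cast hn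
  have key : ∀ k ∈ Icc 1 n, pc w n k * (1 + ((k : ℝ) - 1) / n + ((k : ℝ) - 1) ^ 2 / (2 * n ^ 2)
      - w * k) ≤ pc w (n + 1) k := by
    intro k hk
    obtain ⟨hk1, hkn⟩ := mem_Icc.1 hk
    have hk1' : (1 : ℝ) ≤ k := by exact_mod_cast hk1
    have hkn' : (k : ℝ) ≤ n := by exact_mod_cast hkn
    have hpos : (0 : ℝ) < n + 1 - k := by linarith
    have e := pc_succ hw hn k
    have e2 : pc w (n + 1) k = pc w n k * ((1 - ((k : ℝ) - 1) / n)⁻¹ * ((1 + w) ^ k)⁻¹) := by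
      rw [eq_div_of_mul_eq hpos.ne' e]
      grind
    rw [e2]
    refine mul_le_mul_of_nonneg_left ?_ (pc_nonneg hw _ _)
    have hx : ((k : ℝ) - 1) / n < 1 := by rw [div_lt_one hn']; linarith
    have h1 := exp_le_inv_one_sub (div_nonneg (by linarith) hn'.le) hx
    have h2 : exp (-(w * k)) ≤ ((1 + w) ^ k)⁻¹ := by
      rw [exp_neg]
      refine inv_anti₀ (by positivity) ?_
      rw [mul_comm, exp_nat_mul]
      exact pow_le_pow_left₀ (by linarith) (by linarith [add_one_le_exp w]) _
    calc _ = (((k : ℝ) - 1) / n + (((k : ℝ) - 1) / n) ^ 2 / 2 + -(w * k)) + 1 := by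
          field_simp; ring
      _ ≤ _ := add_one_le_exp _
      _ = _ := exp_add _ _
      _ ≤ _ := mul_le_mul h1 h2 (exp_pos _).le (by
          rw [inv_nonneg]; linarith)
  have h1 := sum_le_sum key
  have h2 : ∑ k ∈ Icc 1 n, pc w (n + 1) k ≤ 1 := by
    rw [← sum_pc hw (Nat.succ_pos n)]
    exact sum_le_sum_of_subset_of_nonneg (Icc_subset_Icc le_rfl (Nat.le_succ n))
      fun k _ _ => pc_nonneg hw _ _
  have h3 := sum_pc hw hn
  have e : ∑ k ∈ Icc 1 n, pc w n k * (1 + ((k : ℝ) - 1) / n + ((k : ℝ) - 1) ^ 2 / (2 * n ^ 2)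
      - w * k) = (∑ k ∈ Icc 1 n, pc w n k) * (1 - 1 / n) + chi w n * (1 / n - w) +
        (∑ k ∈ Icc 1 n, pc w n k * ((k : ℝ) - 1) ^ 2) / (2 * n ^ 2) := by
    rw [chi, sum_mul, sum_mul, sum_div, ← sum_add_distrib,
      ← sum_add_distrib]
    grind
  rw [e, h3] at h1
  have h4 := mul_le_mul_of_nonneg_left (h1.trans h2) hn'.le
  generalize (∑ k ∈ Icc 1 n, pc w n k * ((k : ℝ) - 1) ^ 2) = s at *
  have : (n : ℝ) * (1 * (1 - 1 / n) + chi w n * (1 / n - w) + s / (2 * n ^ 2)) =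
      n - 1 + ((1 - n * w) * chi w n + s / (2 * n)) := by
    field_simp; ring
  linarith

lemma chi_nonneg {w : ℝ} (hw : 0 ≤ w) (n : ℕ) : 0 ≤ chi w n :=
  sum_nonneg fun k _ => mul_nonneg (pc_nonneg hw _ _) (Nat.cast_nonneg _)

lemma chi_le_card {w : ℝ} (hw : 0 ≤ w) {n : ℕ} (hn : 0 < n) : chi w n ≤ n := by
  calc chi w n ≤ ∑ k ∈ Icc 1 n, pc w n k * n := sum_le_sum fun k hk =>
        mul_le_mul_of_nonneg_left (by exact_mod_cast (mem_Icc.1 hk).2) (pc_nonneg hw _ _)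
    _ = n := by rw [← sum_mul, sum_pc hw hn, one_mul]

lemma chi_subcritical {w : ℝ} (hw : 0 ≤ w) {n : ℕ} (hn : 0 < n) (h : (n : ℝ) * w < 1) :
    chi w n ≤ (1 - n * w)⁻¹ := by
  have := chi_moment hw hn
  have h2 : 0 ≤ (∑ k ∈ Icc 1 n, pc w n k * ((k : ℝ) - 1) ^ 2) / (2 * (n : ℝ)) :=
    div_nonneg (sum_nonneg fun k _ => mul_nonneg (pc_nonneg hw _ _) (sq_nonneg _))
      (by positivity)
  have h3 : 0 < 1 - (n : ℝ) * w := by linarith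
  rw [← one_div, le_div_iff₀ h3]
  linarith

lemma chi_mono {w w' : ℝ} (hw : 0 ≤ w) (hww : w ≤ w') {n : ℕ} (hn : 0 < n) :
    chi w n ≤ chi w' n := by
  have h0 : 0 ∈ range n := by simpa using hn
  have h1 := ev_card_cc (w := w) h0
  have h2 := ev_card_cc (w := w') h0
  rw [card_range] at h1 h2
  rw [← h1, ← h2]
  exact ev_mono_weight hw hww _ _ fun S T h => by
    exact_mod_cast card_le_card (cc_mono h _ _)

lemma pc_add_le {w : ℝ} (hw : 0 ≤ w) {m : ℕ} (h k : ℕ) (hk1 : 1 ≤ k) (hkm : k < m) :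
    pc w (m + h) k ≤ exp (h * k * (1 / (m - k) - w / (1 + w))) * pc w m k := by
  have hmk : (0 : ℝ) < m - k := by rw [sub_pos]; exact_mod_cast hkm
  have hk1' : (1 : ℝ) ≤ k := by exact_mod_cast hk1
  induction h with
  | zero => simp
  | succ h ih =>
    have e := pc_succ hw (n := m + h) (by omega) k
    have hpos : (0 : ℝ) < (m + h : ℕ) + 1 - k := by grind
    rw [← add_assoc, eq_div_of_mul_eq hpos.ne' e]
    have h1 : ((m + h : ℕ) : ℝ) / ((m + h : ℕ) + 1 - k) ≤ exp (k * (1 / (m - k))) := by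
      have : ((m + h : ℕ) : ℝ) / ((m + h : ℕ) + 1 - k) = (k - 1) / ((m + h : ℕ) + 1 - k) + 1 := by
        field_simp; ring
      rw [this]
      refine le_trans ?_ (add_one_le_exp _)
      rw [mul_one_div]
      have : ((k : ℝ) - 1) / ((m + h : ℕ) + 1 - k) ≤ k / (m - k) :=
        div_le_div₀ (by linarith) (by linarith) hmk (by
          grind)
      linarith
    have h2 : ((1 + w) ^ k)⁻¹ ≤ exp (-(k * (w / (1 + w)))) := by
      rw [exp_neg, exp_nat_mul]
      refine inv_anti₀ (by positivity) (pow_le_pow_left₀ (exp_pos _).le ?_ _)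
      have := add_one_le_exp (-(w / (1 + w)))
      have e : -(w / (1 + w)) + 1 = (1 + w)⁻¹ := by field_simp; ring
      rw [e, exp_neg] at this
      exact (inv_le_inv₀ (by positivity) (exp_pos _)).1 this
    calc _ = (((m + h : ℕ) : ℝ) / ((m + h : ℕ) + 1 - k)) * ((1 + w) ^ k)⁻¹ * pc w (m + h) k := by
          ring
      _ ≤ (exp (k * (1 / (m - k))) * exp (-(k * (w / (1 + w))))) *
          (exp (h * k * (1 / (m - k) - w / (1 + w))) * pc w m k) := by
          refine mul_le_mul (mul_le_mul h1 h2 (by positivity) (exp_pos _).le) ih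
            (pc_nonneg hw _ _) (by positivity)
      _ = _ := by
          rw [← mul_assoc, ← exp_add, ← exp_add]
          grind

lemma chi_le_of_shift {w : ℝ} (hw : 0 ≤ w) {m h : ℕ} (hm : 0 < m) {a E : ℝ} (ha : 0 < a)
    (ham : a < m)
    (hE : ∀ k : ℕ, (k : ℝ) ≤ a → h * k * (1 / (m - k) - w / (1 + w)) ≤ E) :
    chi w (m + h) ≤ exp E * chi w m +
      (2 + 2 * ∑ k ∈ Icc 1 (m + h), pc w (m + h) k * ((k : ℝ) - 1) ^ 2) / a := by
  have key : ∀ k ∈ Icc 1 (m + h), pc w (m + h) k * k ≤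
      (if k ∈ Icc 1 m then exp E * (pc w m k * k) else 0) +
        pc w (m + h) k * (2 + 2 * ((k : ℝ) - 1) ^ 2) / a := by
    intro k hk
    have hk1 : 1 ≤ k := (mem_Icc.1 hk).1
    have hp := pc_nonneg hw (m + h) k
    have hp' := pc_nonneg hw m k
    have hq : 0 ≤ pc w (m + h) k * (2 + 2 * ((k : ℝ) - 1) ^ 2) / a := by positivity
    by_cases hka : (k : ℝ) ≤ a
    · have hkm : k < m := by exact_mod_cast hka.trans_lt ham
      rw [if_pos (mem_Icc.2 ⟨hk1, hkm.le⟩)]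
      have h1 := pc_add_le hw h k hk1 hkm
      have h2 : pc w (m + h) k ≤ exp E * pc w m k :=
        h1.trans (mul_le_mul_of_nonneg_right (exp_le_exp.2 (hE k hka)) hp')
      have := mul_le_mul_of_nonneg_right h2 (Nat.cast_nonneg (α := ℝ) k)
      linarith
    · push Not at hka
      have h0 : 0 ≤ (if k ∈ Icc 1 m then exp E * (pc w m k * k) else 0) := by
        split_ifs <;> positivity
      have : pc w (m + h) k * k ≤ pc w (m + h) k * (2 + 2 * ((k : ℝ) - 1) ^ 2) / a := by
        rw [mul_div_assoc]
        refine mul_le_mul_of_nonneg_left ?_ hp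
        rw [le_div_iff₀ ha]
        nlinarith [sq_nonneg ((k : ℝ) - 2)]
      linarith
  refine (sum_le_sum key).trans ?_
  rw [sum_add_distrib]
  refine add_le_add (le_of_eq ?_) (le_of_eq ?_)
  · rw [sum_ite_mem, inter_eq_right.2 (Icc_subset_Icc le_rfl
      (Nat.le_add_right m h)), ← mul_sum, chi]
  · rw [← sum_div]
    congr 1
    simp_rw [mul_add, mul_left_comm _ (2 : ℝ) _]
    rw [sum_add_distrib, ← sum_mul, sum_pc hw (by omega), one_mul, ← mul_sum]

lemma chi_bound {L : ℝ} (hL : 0 ≤ L) : ∃ C : ℝ, 0 ≤ C ∧ ∀ (n : ℕ) (t w : ℝ), 1 ≤ t → t ^ 3 = n →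
    0 ≤ w → n * w ≤ 1 + L / t → chi w n ≤ C * t := by
  set A : ℝ := 8 * (L + 1) with hA
  set B : ℝ := L + 2 with hB
  set E : ℝ := 2 * B * A * (A + B + 1) with hE
  set T : ℝ := 2 * (A + B) + 1 with hT
  have hA0 : 0 < A := by positivity
  have hB0 : 0 < B := by positivity
  have hT0 : 0 < T := by positivity
  refine ⟨T ^ 2 + 2 * (exp E + 1), by positivity, ?_⟩
  intro n t w0 ht htn hw0 hnw
  have ht0 : 0 < t := by linarith
  have hn : 0 < n := by
    have : (0 : ℝ) < n := by rw [← htn]; positivity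
    exact_mod_cast this
  by_cases hbig : t ≤ T
  · calc chi w0 n ≤ n := chi_le_card hw0 hn
      _ = t ^ 2 * t := by rw [← htn]; ring
      _ ≤ T ^ 2 * t := by gcongr
      _ ≤ _ := by nlinarith [exp_pos E]
  push Not at hbig
  set w : ℝ := (1 + L / t) / n with hw
  have hn' : (0 : ℝ) < n := by exact_mod_cast hn
  have hw_nonneg : 0 ≤ w := by positivity
  have hww : w0 ≤ w := by rw [hw, le_div_iff₀ hn']; linarith
  refine (chi_mono hw0 hww hn).trans ?_
  have hnw' : n * w = 1 + L / t := by rw [hw]; field_simp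
  set h : ℕ := ⌈(L + 1) * t ^ 2⌉₊ with hh
  have h1 : (L + 1) * t ^ 2 ≤ h := Nat.le_ceil _
  have h2 : (h : ℝ) ≤ B * t ^ 2 := by
    have := (Nat.ceil_lt_add_one (by positivity : 0 ≤ (L + 1) * t ^ 2)).le
    rw [← hh] at this
    nlinarith
  have hsum : (A + B) * t ^ 2 ≤ t ^ 3 / 2 := by
    have : (A + B) * t ^ 2 ≤ (t / 2) * t ^ 2 := by gcongr; linarith
    linarith
  have hhn : (h : ℝ) ≤ n := by
    rw [← htn]; linarith [mul_pos hA0 (pow_pos ht0 2), mul_pos hB0 (pow_pos ht0 2)]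
  obtain ⟨m, hm⟩ : ∃ m, n = m + h := ⟨n - h, by
    simp_all⟩
  have hmr : (n : ℝ) = m + h := by rw [hm]; push_cast; ring
  set a : ℝ := A * t ^ 2 with ha
  have ha0 : 0 < a := by positivity
  have ham : a < m := by
    grind
  have hm0 : 0 < m := by
    have : (0 : ℝ) < m := ha0.trans ham
    exact_mod_cast this
  have hEk : ∀ k : ℕ, (k : ℝ) ≤ a → h * k * (1 / (m - k) - w / (1 + w)) ≤ E := by
    intro k hk
    have hmk : (n : ℝ) / 2 ≤ m - k := by linarith
    have hmk0 : (0 : ℝ) < m - k := lt_of_lt_of_le (by positivity) hmk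
    have hw1 : 1 / ((n : ℝ) + 1) ≤ w / (1 + w) := by
      rw [div_le_div_iff₀ (by positivity) (by positivity)]
      have : 0 ≤ L / t := by positivity
      linarith
    have h3 : 1 / ((m : ℝ) - k) - w / (1 + w) ≤ 2 * (h + k + 1) / n ^ 2 := by
      have : 1 / ((m : ℝ) - k) - 1 / ((n : ℝ) + 1) = (h + k + 1) / ((m - k) * (n + 1)) := by
        grind
      have h4 : ((h : ℝ) + k + 1) / ((m - k) * (n + 1)) ≤ (h + k + 1) / (n ^ 2 / 2) := by
        refine div_le_div_of_nonneg_left (by positivity) (by positivity) ?_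
        have := mul_le_mul_of_nonneg_right hmk hn'.le
        linarith
      have h5 : ((h : ℝ) + k + 1) / (n ^ 2 / 2) = 2 * (h + k + 1) / n ^ 2 := by field_simp
      linarith
    calc _ ≤ (h : ℝ) * k * (2 * (h + k + 1) / n ^ 2) := by gcongr
      _ ≤ (B * t ^ 2) * (A * t ^ 2) * (2 * (B * t ^ 2 + A * t ^ 2 + t ^ 2) / n ^ 2) := by
          have : 1 ≤ t ^ 2 := one_le_pow₀ ht
          gcongr
      _ = E := by grind
  have hmain := chi_le_of_shift hw_nonneg hm0 ha0 ham hEk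
  rw [← hm] at hmain
  have hsub : chi w m ≤ t := by
    have : (m : ℝ) * w ≤ 1 - 1 / t := by
      have e1 : (m : ℝ) * w = (1 + L / t) - h * w := by rw [← hnw', hmr]; ring
      have e2 : (L + 1) * t ^ 2 * w ≤ h * w := by gcongr
      have e3 : (L + 1) * t ^ 2 * w = (L + 1) / t * (1 + L / t) := by
        rw [hw, ← htn]; field_simp
      have e4 : (L + 1) / t ≤ (L + 1) / t * (1 + L / t) := by
        have : 0 ≤ (L + 1) / t * (L / t) := by positivity
        linarith
      grind
    have h1t : 0 < 1 / t := by positivity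
    refine (chi_subcritical hw_nonneg hm0 (by linarith)).trans ?_
    have : 1 / t ≤ 1 - m * w := by linarith
    calc (1 - m * w)⁻¹ ≤ (1 / t)⁻¹ := inv_anti₀ h1t this
      _ = t := by simp
  have hmom := chi_moment hw_nonneg hn
  rw [hnw'] at hmom
  set s := ∑ k ∈ Icc 1 n, pc w n k * ((k : ℝ) - 1) ^ 2 with hs
  set x := chi w n with hx
  have hs2 : s ≤ 2 * n + 2 * n * (L / t) * x := by
    have : s / (2 * n) ≤ 1 + L / t * x := by linarith
    rw [div_le_iff₀ (by positivity)] at this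
    linarith
  have hx0 : 0 ≤ x := chi_nonneg hw_nonneg n
  have hfin : (2 + 2 * s) / a ≤ t + x / 2 := by
    rw [div_le_iff₀ ha0, ha]
    have e : 2 * (n : ℝ) * (L / t) * x = 2 * L * t ^ 2 * x := by rw [← htn]; field_simp
    rw [e, ← htn] at hs2
    have h1 : 1 ≤ t ^ 3 := one_le_pow₀ ht
    have h2 : 0 ≤ t ^ 2 * x := by positivity
    have e2 : (t + x / 2) * (A * t ^ 2) =
        8 * t ^ 3 + 8 * (L * t ^ 3) + 4 * (t ^ 2 * x) + 2 * (2 * L * t ^ 2 * x) := by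
      rw [hA]; ring
    have h3 := mul_nonneg hL (pow_nonneg ht0.le 3)
    linarith
  have : exp E * chi w m ≤ exp E * t := by gcongr
  have hT2 : 0 ≤ T ^ 2 * t := by positivity
  linarith

/-! ### Bridges and the bridgeless core -/

/-- The endpoints of `e` are connected in `S`. -/
def Jn (S : EdgeSet) (e : Sym2 ℕ) : Prop := ∃ u v, e = s(u, v) ∧ Rch S u v

lemma jn_mk {S : EdgeSet} {u v : ℕ} : Jn S s(u, v) ↔ Rch S u v := by
  constructor
  · rintro ⟨x, y, h, hr⟩
    rcases Sym2.eq_iff.1 h with ⟨rfl, rfl⟩ | ⟨rfl, rfl⟩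
    · exact hr
    · exact hr.symm
  · exact fun h => ⟨u, v, rfl, h⟩

lemma Jn.mono {S T : EdgeSet} (h : S ⊆ T) {e : Sym2 ℕ} (hj : Jn S e) : Jn T e := by
  obtain ⟨u, v, rfl, hr⟩ := hj
  exact ⟨u, v, rfl, hr.mono h⟩

lemma jn_of_mem {S : EdgeSet} {e : Sym2 ℕ} (h : e ∈ S) : Jn S e := by
  induction e with
  | _ u v => exact jn_mk.2 (Rch.single h)

/-- If `b` is not needed to join the ends of itself, it can be dropped; otherwise a cycle through
`e` and `b` would join them. -/
lemma jn_drop {T : EdgeSet} {e b : Sym2 ℕ} (h : Jn (insert b T) e)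
    (hb : ¬Jn (insert e T) b) : Jn T e := by
  induction e with
  | _ x y =>
    induction b with
    | _ u v =>
      rw [jn_mk] at *
      rcases Rch.insert_iff.1 h with h | ⟨h1, h2⟩ | ⟨h1, h2⟩
      · exact h
      · refine absurd (Rch.insert_iff.2 (Or.inr (Or.inl ⟨h1.symm, h2.symm⟩))) hb
      · refine absurd (Rch.insert_iff.2 (Or.inr (Or.inr ⟨h2, h1⟩))) hb

/-- No edge of `H` is a bridge. -/
def Bless (H : EdgeSet) : Prop := ∀ e ∈ H, Jn (H.erase e) e

open Classical in
/-- The edges that are not bridges. -/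
def core (S : EdgeSet) : EdgeSet :=
  S.filter fun e => Jn (S.erase e) e

lemma mem_core {S : EdgeSet} {e : Sym2 ℕ} : e ∈ core S ↔ e ∈ S ∧ Jn (S.erase e) e := by
  simp [core]

lemma core_subset (S : EdgeSet) : core S ⊆ S := fun _ h => (mem_core.1 h).1

lemma core_mono {S T : EdgeSet} (h : S ⊆ T) : core S ⊆ core T := fun e he => by
  rw [mem_core] at *
  exact ⟨h he.1, he.2.mono (erase_subset_erase e h)⟩

lemma bless_core (S : EdgeSet) : Bless (core S) := by
  intro e he
  have key : ∀ B : EdgeSet, B ⊆ S \ core S →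
      Jn ((core S ∪ B).erase e) e → Jn ((core S).erase e) e := by
    intro B
    induction B using Finset.induction_on with
    | empty => simp
    | insert b B hb ih =>
      intro hB hj
      refine ih (fun x hx => hB (mem_insert_of_mem hx)) ?_
      have hbS := Finset.mem_sdiff.1 (hB (mem_insert_self _ _))
      have hbr : ¬Jn (S.erase b) b := fun h => hbS.2 (mem_core.2 ⟨hbS.1, h⟩)
      have hne : b ≠ e := fun h => hbS.2 (h ▸ he)
      have hbn : b ∉ core S ∪ B := by simp [hb, hbS.2]
      rw [union_insert, erase_insert_of_ne hne] at hj
      refine jn_drop hj fun h => hbr (h.mono ?_)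
      rw [insert_erase (mem_union_left _ he)]
      intro x hx
      refine mem_erase.2 ⟨fun h => hbn (h ▸ hx), ?_⟩
      rcases mem_union.1 hx with h | h
      · exact core_subset _ h
      grind
  refine key (S \ core S) subset_rfl ?_
  rw [union_sdiff_of_subset (core_subset S)]
  exact (mem_core.1 he).2

/-- The edges of `B` are bridges when added to `H`. -/
def Adm (H B : EdgeSet) : Prop :=
  Disjoint H B ∧ ∀ b ∈ B, ¬Jn ((H ∪ B).erase b) b

lemma adm_core (S : EdgeSet) : Adm (core S) (S \ core S) := by
  refine ⟨disjoint_sdiff, fun b hb h => ?_⟩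
  rw [union_sdiff_of_subset (core_subset S)] at h
  rw [Finset.mem_sdiff] at hb
  exact hb.2 (mem_core.2 ⟨hb.1, h⟩)

lemma core_union {H B : EdgeSet} (hH : Bless H) (h : Adm H B) : core (H ∪ B) = H := by
  ext e
  rw [mem_core, mem_union]
  constructor
  · rintro ⟨h1 | h1, h2⟩
    · exact h1
    · exact absurd h2 (h.2 e h1)
  · intro he
    exact ⟨Or.inl he, (hH e he).mono (erase_subset_erase _ subset_union_left)⟩

/-- The weight of all ways to add bridges to `H`. -/
def brs (w : ℝ) (U : Finset ℕ) (H : EdgeSet) : ℝ :=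
  ws w (KK U) fun B => ind (Adm H B)

lemma ws_core (w : ℝ) (U : Finset ℕ) (f : EdgeSet → ℝ) :
    ws w (KK U) (fun S => f (core S)) =
      ws w (KK U) (fun H => ind (Bless H) * (f H * brs w U H)) := by
  classical
  have h1 : ws w (KK U) (fun H => ind (Bless H) * (f H * brs w U H)) =
      ∑ p ∈ (KK U).powerset ×ˢ (KK U).powerset,
        w ^ p.1.card * w ^ p.2.card * (ind (Bless p.1 ∧ Adm p.1 p.2) * f p.1) := by
    rw [sum_product]
    refine sum_congr rfl fun H _ => ?_
    simp only [brs, ws, mul_sum]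
    refine sum_congr rfl fun B _ => ?_
    rw [ind_and]; ring
  rw [h1, ← sum_filter_of_ne (p := fun p => Bless p.1 ∧ Adm p.1 p.2)]
  · refine sum_bij' (fun S _ => (core S, S \ core S)) (fun p _ => p.1 ∪ p.2) ?_ ?_ ?_ ?_ ?_
    · intro S hS
      rw [mem_powerset] at hS
      simp only [mem_filter, mem_product, mem_powerset]
      exact ⟨⟨(core_subset S).trans hS, sdiff_subset.trans hS⟩, bless_core S, adm_core S⟩
    · grind
    · intro S hS
      exact union_sdiff_of_subset (core_subset S)
    · intro p hp
      simp only [mem_filter, mem_product, mem_powerset] at hp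
      have := core_union hp.2.1 hp.2.2
      simp only [this]
      rw [union_sdiff_cancel_left hp.2.2.1]
    · intro S hS
      rw [ind_true ⟨bless_core S, adm_core S⟩, one_mul, ← pow_add, ← card_union_of_disjoint
        (adm_core S).1, union_sdiff_of_subset (core_subset S)]
  · intro p _ hp
    by_contra h
    exact hp (by rw [ind_false h]; simp)

lemma adm_insert {H S : EdgeSet} {e : Sym2 ℕ} (he : e ∉ S) :
    Adm H (insert e S) ↔ ¬Jn H e ∧ Adm (insert e H) S := by
  have hG : H ∪ insert e S = insert e H ∪ S := by
    rw [union_insert, insert_union]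
  constructor
  · rintro ⟨h1, h2⟩
    rw [hG] at h2
    have heH : e ∉ H := fun h => disjoint_left.1 h1 h (mem_insert_self _ _)
    refine ⟨fun h => h2 e (mem_insert_self _ _) (h.mono ?_), ?_, fun b hb =>
      h2 b (mem_insert_of_mem hb)⟩
    · grind
    grind
  · rintro ⟨h1, h2, h3⟩
    rw [disjoint_insert_left] at h2
    have heH : e ∉ H := fun h => h1 (jn_of_mem h)
    refine ⟨disjoint_insert_right.2 ⟨heH, h2.2⟩, ?_⟩
    rw [hG]
    intro b hb
    rcases mem_insert.1 hb with rfl | hb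
    · have key : ∀ T : EdgeSet, T ⊆ S → Jn (H ∪ T) b → Jn H b := by
        intro T
        induction T using Finset.induction_on with
        | empty => simp
        | insert c T hc ih =>
          intro hT hj
          refine ih (fun x hx => hT (mem_insert_of_mem hx)) ?_
          have hcS := hT (mem_insert_self _ _)
          rw [union_insert] at hj
          refine jn_drop hj fun h => h3 c hcS (h.mono ?_)
          grind
      simp_all
    · exact h3 b hb

lemma hasDerivAt_ws {α : Type*} [DecidableEq α] (A : Finset α) (f : Finset α → ℝ) (w : ℝ) :
    HasDerivAt (fun w => ws w A f)
      (∑ e ∈ A, ws w (A.erase e) (fun S => f (insert e S))) w := by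
  induction A using Finset.induction_on generalizing f with
  | empty => simpa using hasDerivAt_const w (f ∅)
  | insert e A he ih =>
    simp only [ws_insert _ he]
    refine HasDerivAt.congr_deriv
      ((ih f).add ((hasDerivAt_id w).mul (ih fun S => f (insert e S)))) (Eq.symm ?_)
    rw [sum_insert he, erase_insert he, mul_sum, add_left_comm,
      one_mul, ← sum_add_distrib]
    congr 1
    refine sum_congr rfl fun a ha => ?_
    have hne : e ≠ a := fun h => he (h ▸ ha)
    rw [erase_insert_of_ne hne, ws_insert _ (fun h => he (mem_of_mem_erase h))]
    simp only [id, insert_comm a e]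

open Classical in
lemma hasDerivAt_brs (w : ℝ) (U : Finset ℕ) (H : EdgeSet) :
    HasDerivAt (fun w => brs w U H)
      (∑ e ∈ (KK U).filter (fun e => ¬Jn H e), brs w U (insert e H)) w := by
  refine HasDerivAt.congr_deriv (hasDerivAt_ws (KK U) (fun B => ind (Adm H B)) w) (Eq.symm ?_)
  rw [sum_filter]
  refine sum_congr rfl fun e he => ?_
  have h1 : ∀ S ⊆ (KK U).erase e, ind (Adm H (insert e S)) =
      ind (¬Jn H e) * ind (Adm (insert e H) S) := fun S hS => by
    rw [← ind_and, adm_insert (fun h => notMem_erase _ _ (hS h))]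
  rw [ws_congr h1, ws_mul_left]
  split_ifs with hj
  · rw [ind_false (not_not.2 hj), zero_mul]
  · rw [ind_true hj, one_mul, brs, ← insert_erase he, ws_insert _ (notMem_erase _ _),
      erase_insert (notMem_erase _ _)]
    rw [ws_congr (f := fun S => ind (Adm (insert e H) (insert e S))) (g := fun _ => 0), ws_const]
    · simp
    · intro S _
      refine ind_false fun h => ?_
      exact disjoint_left.1 h.1 (mem_insert_self _ _) (mem_insert_self _ _)

lemma brs_zero (U : Finset ℕ) (H : EdgeSet) : brs 0 U H = 1 := by
  rw [brs, ws, sum_eq_single ∅]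
  · rw [ind_true ⟨disjoint_empty_right _, by simp⟩]; simp
  · simp_all
  · simp

/-! ### The weight of the bridges in terms of independent sets -/

/-- No two vertices of `T` are connected in `H`. -/
def Indep (H : EdgeSet) (T : Finset ℕ) : Prop := ∀ a ∈ T, ∀ b ∈ T, a ≠ b → ¬Rch H a b

/-- The vertex `u` is connected to some vertex of `T`. -/
def Hit (H : EdgeSet) (T : Finset ℕ) (u : ℕ) : Prop := ∃ a ∈ T, Rch H a u

lemma hit_of_mem {H : EdgeSet} {T : Finset ℕ} {u : ℕ} (h : u ∈ T) : Hit H T u :=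
  ⟨u, h, Rch.refl _ _⟩

lemma indep_insert {H : EdgeSet} {T : Finset ℕ} {v : ℕ} (hv : v ∉ T) :
    Indep H (insert v T) ↔ Indep H T ∧ ¬Hit H T v := by
  constructor
  · intro h
    refine ⟨fun a ha b hb => h a (mem_insert_of_mem ha) b (mem_insert_of_mem hb), ?_⟩
    rintro ⟨a, ha, hr⟩
    exact h a (mem_insert_of_mem ha) v (mem_insert_self _ _)
      (fun h => hv (h ▸ ha)) hr
  · rintro ⟨h1, h2⟩ a ha b hb hab hr
    rcases mem_insert.1 ha with rfl | ha' <;> rcases mem_insert.1 hb with rfl | hb'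
    · exact hab rfl
    · exact h2 ⟨b, hb', hr.symm⟩
    · exact h2 ⟨a, ha', hr⟩
    · exact h1 a ha' b hb' hab hr

lemma indep_insert_edge {H : EdgeSet} {T : Finset ℕ} {u v : ℕ} (h : ¬Rch H u v) :
    Indep (insert s(u, v) H) T ↔ Indep H T ∧ ¬(Hit H T u ∧ Hit H T v) := by
  constructor
  · intro hI
    refine ⟨fun a ha b hb hab hr => hI a ha b hb hab (hr.mono (subset_insert _ _)), ?_⟩
    rintro ⟨⟨a, ha, hau⟩, ⟨b, hb, hbv⟩⟩
    refine hI a ha b hb ?_ (Rch.insert_iff.2 (Or.inr (Or.inl ⟨hau, hbv.symm⟩)))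
    rintro rfl
    exact h (hau.symm.trans hbv)
  · rintro ⟨h1, h2⟩ a ha b hb hab hr
    rcases Rch.insert_iff.1 hr with hr | ⟨h3, h4⟩ | ⟨h3, h4⟩
    · exact h1 a ha b hb hab hr
    · exact h2 ⟨⟨a, ha, h3⟩, ⟨b, hb, h4.symm⟩⟩
    · exact h2 ⟨⟨b, hb, h4.symm⟩, ⟨a, ha, h3⟩⟩

/-- The number of independent sets of size `k`. -/
def ek (U : Finset ℕ) (H : EdgeSet) (k : ℕ) : ℝ :=
  ∑ T ∈ U.powersetCard k, ind (Indep H T)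

lemma ek_zero (U : Finset ℕ) (H : EdgeSet) : ek U H 0 = 1 := by
  rw [ek, powersetCard_zero, sum_singleton, ind_true]
  intro a ha
  simp at ha

lemma ek_one (U : Finset ℕ) (H : EdgeSet) : ek U H 1 = U.card := by
  rw [ek, sum_congr rfl (g := fun _ => (1 : ℝ))]
  · simp
  · intro T hT
    obtain ⟨a, rfl⟩ := card_eq_one.1 (mem_powersetCard.1 hT).2
    refine ind_true fun x hx y hy hxy => ?_
    grind

lemma ek_of_lt {U : Finset ℕ} (H : EdgeSet) {k : ℕ} (h : U.card < k) : ek U H k = 0 := by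
  rw [ek, powersetCard_eq_empty.2 h, sum_empty]

lemma sum_indep_insert (U : Finset ℕ) (H : EdgeSet) (k : ℕ)
    (g : Finset ℕ → ℕ → ℝ) :
    ∑ T ∈ U.powersetCard k, ∑ v ∈ U, ind (Indep H T) * (ind (¬Hit H T v) * g (insert v T) v) =
      ∑ T ∈ U.powersetCard (k + 1), ∑ v ∈ T, ind (Indep H T) * g T v := by
  have h1 : ∀ T ∈ U.powersetCard k,
      ∑ v ∈ U, ind (Indep H T) * (ind (¬Hit H T v) * g (insert v T) v) =
      ∑ v ∈ U \ T, ind (Indep H (insert v T)) * g (insert v T) v := by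
    intro T hT
    rw [← sum_subset (sdiff_subset (s := U) (t := T))]
    · refine sum_congr rfl fun v hv => ?_
      rw [ind_congr (indep_insert (Finset.mem_sdiff.1 hv).2), ind_and, mul_assoc]
    · intro v hv hv'
      have : v ∈ T := by
        grind
      rw [ind_false (not_not.2 (hit_of_mem this))]; ring
  rw [sum_congr rfl h1, sum_sigma', sum_sigma']
  refine sum_bij' (fun p _ => ⟨insert p.2 p.1, p.2⟩) (fun p _ => ⟨p.1.erase p.2, p.2⟩)
    ?_ ?_ ?_ ?_ ?_
  · grind
  · grind
  · simp_all
  · simp_all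
  · rintro ⟨T, v⟩ h
    rfl

/-- The number of vertices not connected to `T`. -/
def nonhit (U : Finset ℕ) (H : EdgeSet) (T : Finset ℕ) : ℝ :=
  ∑ u ∈ U, ind (¬Hit H T u)

lemma sum_nonhit (U : Finset ℕ) (H : EdgeSet) (k : ℕ) :
    ∑ T ∈ U.powersetCard k, ind (Indep H T) * nonhit U H T = (k + 1) * ek U H (k + 1) := by
  have h := sum_indep_insert U H k (fun _ _ => 1)
  rw [ek, mul_sum]
  convert h using 2 with T hT T hT
  · rw [nonhit, mul_sum]; simp
  simp_all

lemma sum_rch (U : Finset ℕ) {H : EdgeSet} {T : Finset ℕ} (hT : Indep H T) :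
    ∑ v ∈ T, ∑ u ∈ U, ind (¬Rch H v u) = T.card * U.card - (U.card - nonhit U H T) := by
  have h1 : ∀ u, ∑ v ∈ T, ind (Rch H v u) = ind (Hit H T u) := by
    intro u
    by_cases hu : Hit H T u
    · obtain ⟨a, ha, hr⟩ := hu
      rw [ind_true ⟨a, ha, hr⟩, sum_eq_single a, ind_true hr]
      · intro b hb hba
        exact ind_false fun h => hT b hb a ha hba (h.trans hr.symm)
      · exact fun h => absurd ha h
    · rw [ind_false hu]
      exact sum_eq_zero fun a ha => ind_false fun h => hu ⟨a, ha, h⟩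
  rw [sum_comm]
  have h2 : ∀ u ∈ U, ∑ v ∈ T, ind (¬Rch H v u) = (T.card : ℝ) - 1 + ind (¬Hit H T u) := by
    intro u _
    simp only [ind_not, sum_sub_distrib, h1]
    simp
  rw [sum_congr rfl h2, sum_add_distrib, nonhit]
  simp
  ring

lemma sum_KK (U : Finset ℕ) (f : Sym2 ℕ → ℝ) (hf : ∀ u, f s(u, u) = 0) :
    ∑ u ∈ U, ∑ v ∈ U, f s(u, v) = 2 * ∑ e ∈ KK U, f e := by
  induction U using Finset.induction_on with
  | empty => simp [KK]
  | insert x U hx ih =>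
    rw [KK_insert hx, sum_union (disjoint_KK_starE hx), mul_add, ← ih]
    have h1 : ∑ e ∈ starE x U, f e = ∑ y ∈ U, f s(x, y) := by
      rw [starE, sum_image]
      intro a _ b _ h
      grind
    rw [h1, sum_insert hx, sum_insert hx, hf, zero_add]
    have h2 : ∀ u ∈ U, ∑ v ∈ insert x U, f s(u, v) = f s(x, u) + ∑ v ∈ U, f s(u, v) := by
      grind
    rw [sum_congr rfl h2, sum_add_distrib]
    ring

lemma sum_ek_insert (U : Finset ℕ) (H : EdgeSet) (k : ℕ) :
    ∑ e ∈ KK U, ind (¬Jn H e) * ek U (insert e H) k =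
      U.card * k * ek U H (k + 1) - (k + 2) * (k - 1) / 2 * ek U H (k + 2) := by
  have h0 := sum_KK U (fun e => ind (¬Jn H e) * ek U (insert e H) k) fun u => by
    rw [ind_false (not_not.2 (jn_mk.2 (Rch.refl _ _))), zero_mul]
  -- a pair of vertices together with an independent set
  have h1 : ∀ u v, ind (¬Jn H s(u, v)) * ek U (insert s(u, v) H) k =
      ∑ T ∈ U.powersetCard k, ind (Indep H T) * (ind (¬Rch H u v) * ind (¬Hit H T u)
        + ind (¬Hit H T v) * ind (¬Rch H v u)
        - ind (¬Hit H T v) * ind (¬Hit H (insert v T) u)) := by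
    intro u v
    rw [ek, mul_sum]
    refine sum_congr rfl fun T _ => ?_
    have hh : ¬Hit H (insert v T) u ↔ ¬Rch H u v ∧ ¬Hit H T u := by
      simp [Hit, not_or, Rch.comm]
    rw [ind_congr hh, ind_and]
    have hc : ind (¬Rch H v u) = ind (¬Rch H u v) := ind_congr (not_congr Rch.comm)
    rw [hc]
    by_cases hr : Rch H u v
    · rw [ind_false (not_not.2 (jn_mk.2 hr)), ind_false (not_not.2 hr)]; ring
    · rw [ind_true (show ¬Jn H s(u, v) from fun h => hr (jn_mk.1 h)), ind_true hr,
        ind_congr (indep_insert_edge hr), ind_and, ind_not, ind_not, ind_not, ind_and]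
      ring
  simp only [h1] at h0
  have h2 : ∑ u ∈ U, ∑ v ∈ U, ∑ T ∈ U.powersetCard k, ind (Indep H T) *
        (ind (¬Rch H u v) * ind (¬Hit H T u)
        + ind (¬Hit H T v) * ind (¬Rch H v u)
        - ind (¬Hit H T v) * ind (¬Hit H (insert v T) u)) =
      2 * (∑ T ∈ U.powersetCard k, ∑ v ∈ U, ind (Indep H T) * (ind (¬Hit H T v) *
        ∑ u ∈ U, ind (¬Rch H v u)))
      - ∑ T ∈ U.powersetCard k, ∑ v ∈ U, ind (Indep H T) * (ind (¬Hit H T v) *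
        nonhit U H (insert v T)) := by
    simp only [mul_add, mul_sub, sum_add_distrib, sum_sub_distrib]
    have c1 : ∑ u ∈ U, ∑ v ∈ U, ∑ T ∈ U.powersetCard k,
        ind (Indep H T) * (ind (¬Rch H u v) * ind (¬Hit H T u)) =
        ∑ T ∈ U.powersetCard k, ∑ v ∈ U, ind (Indep H T) * (ind (¬Hit H T v) *
        ∑ u ∈ U, ind (¬Rch H v u)) := by
      rw [sum_comm (s := U.powersetCard k)]
      refine sum_congr rfl fun u _ => ?_
      rw [sum_comm]
      refine sum_congr rfl fun T _ => ?_
      rw [mul_sum, mul_sum]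
      grind
    have c2 : ∀ F : Finset ℕ → ℕ → ℕ → ℝ, ∑ u ∈ U, ∑ v ∈ U, ∑ T ∈ U.powersetCard k,
        ind (Indep H T) * (ind (¬Hit H T v) * F T u v) =
        ∑ T ∈ U.powersetCard k, ∑ v ∈ U, ind (Indep H T) * (ind (¬Hit H T v) *
        ∑ u ∈ U, F T u v) := by
      intro F
      rw [sum_comm]
      rw [sum_comm (s := U.powersetCard k)]
      refine sum_congr rfl fun v _ => ?_
      rw [sum_comm]
      refine sum_congr rfl fun T _ => ?_
      rw [mul_sum, mul_sum]
    rw [c1, c2 (fun T u v => ind (¬Rch H v u)), c2 (fun T u v => ind (¬Hit H (insert v T) u))]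
    simp only [nonhit]
    ring
  rw [h2, sum_indep_insert U H k (fun _ v => ∑ u ∈ U, ind (¬Rch H v u)),
    sum_indep_insert U H k (fun T _ => nonhit U H T)] at h0
  have h3 : ∑ T ∈ U.powersetCard (k + 1), ∑ v ∈ T, ind (Indep H T) * nonhit U H T =
      (k + 1) * ((k + 2) * ek U H (k + 2)) := by
    have := sum_nonhit U H (k + 1)
    push_cast at this
    rw [show (k : ℝ) + 2 = k + 1 + 1 by ring, ← this, mul_sum]
    refine sum_congr rfl fun T hT => ?_
    simp_all
  have h4 : ∑ T ∈ U.powersetCard (k + 1), ∑ v ∈ T, ind (Indep H T) *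
      ∑ u ∈ U, ind (¬Rch H v u) =
      k * U.card * ek U H (k + 1) + (k + 2) * ek U H (k + 2) := by
    have := sum_nonhit U H (k + 1)
    push_cast at this
    rw [show (k : ℝ) + 2 = k + 1 + 1 by ring, ← this, ek, mul_sum, ← sum_add_distrib]
    refine sum_congr rfl fun T hT => ?_
    rw [← mul_sum]
    rw [show (k : ℝ) * U.card * ind (Indep H T) + ind (Indep H T) * nonhit U H T =
      ind (Indep H T) * (k * U.card + nonhit U H T) by ring]
    refine ind_mul_congr fun hI => ?_
    rw [sum_rch U hI, (mem_powersetCard.1 hT).2]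
    push_cast; ring
  rw [h3, h4] at h0
  linarith

/-- Hermite-type polynomials. -/
def hk (n w : ℝ) : ℕ → ℝ
  | 0 => 1
  | 1 => w * n
  | (k + 2) => w * n * hk n w (k + 1) - w * (k + 1) * hk n w k

lemma hk_succ (n w : ℝ) (k : ℕ) : hk n w (k + 1) = w * n * hk n w k - w * k * hk n w (k - 1) := by
  cases k with
  | zero => simp [hk]
  | succ k => simp [hk]

lemma hasDerivAt_hk (n w : ℝ) (k : ℕ) : HasDerivAt (fun w => hk n w k)
    (n * k * hk n w (k - 1) - k * (k - 1) / 2 * hk n w (k - 2)) w := by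
  induction k using Nat.twoStepInduction with
  | zero => simpa [hk] using hasDerivAt_const w (1 : ℝ)
  | one => simpa [hk] using (hasDerivAt_id w).mul_const n
  | more k h1 h2 =>
    have h3 := ((hasDerivAt_id w).mul_const n).mul h2
    have h4 := ((hasDerivAt_id w).mul_const ((k : ℝ) + 1)).mul h1
    refine (h3.sub h4).congr_deriv ?_
    have e1 := hk_succ n w k
    simp only [id, one_mul, Nat.add_sub_cancel, show k + 2 - 1 = k + 1 from rfl,
      show k + 1 - 2 = k - 1 by omega]
    push_cast
    rcases Nat.eq_zero_or_pos k with rfl | hk0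
    · simp [hk]
      ring
    · have e2 := hk_succ n w (k - 1)
      rw [Nat.sub_add_cancel hk0, Nat.sub_sub] at e2
      push_cast [Nat.cast_sub hk0] at e2
      grind

/-- The coefficients in the expansion of the weight of bridges. -/
def mu (n w : ℝ) : ℕ → ℝ
  | 0 => 1
  | 1 => 0
  | (k + 2) => w * hk n w k

/-- The derivatives of these coefficients. -/
def dmu (n w : ℝ) : ℕ → ℝ
  | 0 => 0
  | 1 => 0
  | (k + 2) => n * (k + 1) * mu n w (k + 1) - (k + 2) * (k - 1) / 2 * mu n w k

lemma hasDerivAt_mu (n w : ℝ) (k : ℕ) : HasDerivAt (fun w => mu n w k) (dmu n w k) w := by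
  match k with
  | 0 => exact hasDerivAt_const w (1 : ℝ)
  | 1 => exact hasDerivAt_const w (0 : ℝ)
  | 2 =>
    refine ((hasDerivAt_id w).mul (hasDerivAt_hk n w 0)).congr_deriv ?_
    simp [dmu, mu, hk]
  | 3 =>
    refine ((hasDerivAt_id w).mul (hasDerivAt_hk n w 1)).congr_deriv ?_
    simp [dmu, mu, hk]; ring
  | (k + 4) =>
    refine ((hasDerivAt_id w).mul (hasDerivAt_hk n w (k + 2))).congr_deriv ?_
    simp only [id, one_mul, dmu, show k + 2 - 1 = k + 1 from rfl, show k + 2 - 2 = k from rfl, mu, hk]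
    push_cast
    ring

open Classical in
lemma brs_eq (U : Finset ℕ) (H : EdgeSet) (w : ℝ) :
    brs w U H = ∑ k ∈ range (U.card + 1), ek U H k * mu U.card w k := by
  induction hN : ((KK U).filter fun e => ¬Jn H e).card using Nat.strong_induction_on
    generalizing H w with
  | _ N ih =>
    set F : ℝ → ℝ := fun w =>
      brs w U H - ∑ k ∈ range (U.card + 1), ek U H k * mu U.card w k with hF
    have hd : ∀ w, HasDerivAt F 0 w := by
      intro w
      have h2 : HasDerivAt (fun w => ∑ k ∈ range (U.card + 1), ek U H k * mu U.card w k)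
          (∑ k ∈ range (U.card + 1), ek U H k *
            dmu U.card w k) w := by
        refine HasDerivAt.fun_sum fun k _ => ?_
        exact (hasDerivAt_mu U.card w k).const_mul _
      refine ((hasDerivAt_brs w U H).sub h2).congr_deriv ?_
      rw [sub_eq_zero]
      have h3 : ∀ e ∈ (KK U).filter fun e => ¬Jn H e, brs w U (insert e H) =
          ∑ k ∈ range (U.card + 1), mu U.card w k * ek U (insert e H) k := by
        intro e he
        rw [ih _ _ (insert e H) w rfl]
        · grind
        · rw [← hN]
          refine card_lt_card (ssubset_iff_of_subset ?_ |>.2 ⟨e, he, ?_⟩)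
          · intro x hx
            rw [mem_filter] at hx ⊢
            exact ⟨hx.1, fun h => hx.2 (h.mono (subset_insert _ _))⟩
          · simp only [mem_filter, not_and, not_not]
            exact fun _ => jn_of_mem (mem_insert_self _ _)
      rw [sum_congr rfl h3, sum_comm]
      have h4 : ∀ k, ∑ e ∈ (KK U).filter (fun e => ¬Jn H e), mu U.card w k * ek U (insert e H) k =
          mu U.card w k * (U.card * k) * ek U H (k + 1)
          - mu U.card w k * ((k + 2) * (k - 1) / 2) * ek U H (k + 2) := by
        intro k
        have h := sum_ek_insert U H k
        rw [← mul_sum, sum_filter]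
        rw [show ∀ a b c d e : ℝ, a * b * c - a * d * e = a * (b * c - d * e) by intros; ring, ← h]
        congr 1
        refine sum_congr rfl fun e _ => ?_
        split_ifs with h
        · rw [ind_false (not_not.2 h), zero_mul]
        · rw [ind_true h, one_mul]
      simp only [h4, sum_sub_distrib]
      rcases Nat.eq_zero_or_pos U.card with h0 | h0
      · rw [h0]
        have e2 := ek_of_lt (U := U) H (show U.card < 2 by omega)
        simp [e2, dmu]
      obtain ⟨m, hm⟩ : ∃ m, U.card = m + 1 := ⟨U.card - 1, by omega⟩
      have e1 := ek_of_lt (U := U) H (show U.card < m + 1 + 1 by omega)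
      have e2 := ek_of_lt (U := U) H (show U.card < m + 2 + 1 by omega)
      rw [hm, sum_range_succ _ (m + 1), sum_range_succ' _ m,
        sum_range_succ _ (m + 1), sum_range_succ _ m,
        sum_range_succ' _ (m + 1), sum_range_succ' _ m, e1,
        show m + 1 + 2 = m + 2 + 1 from rfl, e2]
      simp only [dmu, mul_zero, add_zero]
      simp only [Nat.cast_zero, mul_zero, zero_mul, add_zero]
      rw [← sum_sub_distrib]
      grind
    have hc := is_const_of_deriv_eq_zero (fun w => (hd w).differentiableAt)
      (fun w => (hd w).deriv) w 0
    have h0 : F 0 = 0 := by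
      simp only [hF]
      rw [brs_zero, sum_range_succ', ek_zero]
      rw [sum_eq_zero]
      · simp [mu]
      · intro k _
        match k with
        | 0 => simp [mu]
        | (k + 1) => simp [mu]
    grind

/-! ### Integral representation -/

/-- The Gaussian kernel on the vertical line through `a`. -/
def gk (n w a t : ℝ) : ℂ := Complex.exp (((a + t * I : ℂ) - w * n) ^ 2 / (2 * w))

lemma norm_gk {w : ℝ} (hw : 0 < w) (n a t : ℝ) :
    ‖gk n w a t‖ = exp (((a - w * n) ^ 2 - t ^ 2) / (2 * w)) := by
  rw [gk, norm_exp]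
  congr 1
  have : ((a + t * I : ℂ) - w * n) ^ 2 / (2 * w) =
      ((((a - w * n) ^ 2 - t ^ 2) / (2 * w) : ℝ) : ℂ) + (((a - w * n) * t / w : ℝ) : ℂ) * I := by
    have hw' : (w : ℂ) ≠ 0 := by exact_mod_cast hw.ne'
    push_cast
    field_simp
    ring_nf
    simp only [I_sq]
    ring
  rw [this, add_re, re_ofReal_mul, I_re, mul_zero, add_zero, ofReal_re]

lemma continuous_gk (n w a : ℝ) : Continuous (gk n w a) := by
  unfold gk
  fun_prop

lemma re_line (a t : ℝ) : (a + t * I : ℂ).re = a := by simp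

lemma line_ne_zero {a : ℝ} (ha : 0 < a) (t : ℝ) : (a + t * I : ℂ) ≠ 0 := by
  intro h
  have := congrArg re h
  simp at this
  exact ha.ne' this

lemma norm_line_ge {a : ℝ} (ha : 0 < a) (t : ℝ) : a ≤ ‖(a + t * I : ℂ)‖ := by
  have := abs_re_le_norm (a + t * I : ℂ)
  rw [re_line, abs_of_pos ha] at this
  exact this

lemma norm_line_le {a : ℝ} (ha : 0 < a) (t : ℝ) : ‖(a + t * I : ℂ)‖ ≤ a + |t| := by
  refine (norm_add_le _ _).trans ?_
  simp [abs_of_pos ha]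

lemma integrable_gk {n w a : ℝ} (hw : 0 < w) (ha : 0 < a) (k : ℕ) :
    Integrable fun t : ℝ =>
      gk n w a t * ((a + t * I : ℂ) ^ k / (a + t * I : ℂ) ^ 2) := by
  set C : ℝ := exp ((a - w * n) ^ 2 / (2 * w)) * (k.factorial * exp (a + w) / a ^ 2)
  have hg : Integrable fun t : ℝ => C * exp (-(1 / (4 * w)) * t ^ 2) :=
    (integrable_exp_neg_mul_sq (by positivity)).const_mul C
  refine hg.mono' ?_ (Eventually.of_forall fun t => ?_)
  · refine Continuous.aestronglyMeasurable ?_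
    refine (continuous_gk n w a).mul (Continuous.div (by fun_prop) (by fun_prop) fun t => ?_)
    exact pow_ne_zero _ (line_ne_zero ha t)
  · rw [norm_mul, norm_gk hw, norm_div, norm_pow, norm_pow]
    have h1 : ‖(a + t * I : ℂ)‖ ^ k ≤ k.factorial * exp (a + |t|) := by
      have h2 : (a + |t|) ^ k / k.factorial ≤ exp (a + |t|) :=
        pow_div_factorial_le_exp _ (by positivity) _
      rw [div_le_iff₀ (by positivity)] at h2
      refine (pow_le_pow_left₀ (norm_nonneg _) (norm_line_le ha t) k).trans (by linarith)
    have h3 : |t| ≤ w + t ^ 2 / (4 * w) := by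
      have h4 : 0 ≤ (|t| - 2 * w) ^ 2 / (4 * w) := by positivity
      have h5 : (|t| - 2 * w) ^ 2 / (4 * w) = t ^ 2 / (4 * w) - |t| + w := by
        grind
      linarith
    have h6 : ‖(a + t * I : ℂ)‖ ^ k / ‖(a + t * I : ℂ)‖ ^ 2 ≤
        k.factorial * exp (a + (w + t ^ 2 / (4 * w))) / a ^ 2 := by
      refine div_le_div₀ (by positivity) (h1.trans ?_) (by positivity)
        (pow_le_pow_left₀ ha.le (norm_line_ge ha t) 2)
      gcongr
    refine (mul_le_mul_of_nonneg_left h6 (exp_pos _).le).trans (le_of_eq ?_)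
    have e1 : exp (((a - w * n) ^ 2 - t ^ 2) / (2 * w)) =
        exp ((a - w * n) ^ 2 / (2 * w)) * exp (-(t ^ 2 / (2 * w))) := by
      rw [← exp_add]; congr 1; ring
    have e2 : exp (a + (w + t ^ 2 / (4 * w))) =
        exp (a + w) * exp (t ^ 2 / (4 * w)) := by
      rw [← exp_add]; congr 1; ring
    have e3 : exp (-(1 / (4 * w)) * t ^ 2) =
        exp (-(t ^ 2 / (2 * w))) * exp (t ^ 2 / (4 * w)) := by
      rw [← exp_add]; congr 1; field_simp; ring
    rw [e1, e2, e3]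
    ring

/-- The moments of the kernel. -/
def jm (n w a : ℝ) (k : ℕ) : ℂ :=
  (w / sqrt (2 * Real.pi * w) : ℝ) *
    ∫ t : ℝ, gk n w a t * ((a + t * I : ℂ) ^ k / (a + t * I : ℂ) ^ 2)

lemma jm_two {n w a : ℝ} (hw : 0 < w) (ha : 0 < a) : jm n w a 2 = w := by
  have hw' : (w : ℂ) ≠ 0 := by exact_mod_cast hw.ne'
  have h1 : ∀ t : ℝ, gk n w a t * ((a + t * I : ℂ) ^ 2 / (a + t * I : ℂ) ^ 2) =
      Complex.exp ((-(1 / (2 * w)) : ℂ) * t ^ 2 + (I * (a - w * n) / w) * t + (a - w * n) ^ 2 / (2 * w)) := by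
    intro t
    rw [div_self (pow_ne_zero _ (line_ne_zero ha t)), mul_one, gk]
    congr 1
    field_simp
    ring_nf
    simp only [I_sq]
    ring
  rw [jm]
  simp only [h1]
  have hre : (-(1 / (2 * w)) : ℂ).re < 0 := by
    simp_all
  rw [integral_cexp_quadratic hre]
  have e1 : ((a - w * n) ^ 2 / (2 * w) - (I * (a - w * n) / w) ^ 2 / (4 * -(1 / (2 * w))) : ℂ) = 0 := by
    field_simp
    simp only [I_sq]
    ring
  have e2 : (Real.pi / - -(1 / (2 * w)) : ℂ) = ((2 * Real.pi * w : ℝ) : ℂ) := by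
    push_cast
    field_simp
  rw [e1, e2, Complex.exp_zero, mul_one]
  rw [show (1 / 2 : ℂ) = ((1 / 2 : ℝ) : ℂ) by push_cast; rfl, ← ofReal_cpow (by positivity),
    ← sqrt_eq_rpow, ← ofReal_mul, div_mul_cancel₀]
  positivity

lemma jm_rec {n w a : ℝ} (hw : 0 < w) (ha : 0 < a) (k : ℕ) :
    jm n w a (k + 2) = w * n * jm n w a (k + 1) - w * (k - 1) * jm n w a k := by
  have hw' : (w : ℂ) ≠ 0 := by exact_mod_cast hw.ne'
  have i2 := integrable_gk (n := n) hw ha (k + 2)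
  have i1 := integrable_gk (n := n) hw ha (k + 1)
  have i0 := integrable_gk (n := n) hw ha k
  set f : ℕ → ℝ → ℂ := fun k t => gk n w a t * ((a + t * I : ℂ) ^ k / (a + t * I : ℂ) ^ 2) with hf
  have hz : ∫ t : ℝ, (I * ((1 / w : ℂ) * f (k + 2) t - n * f (k + 1) t + (k - 1) * f k t)) = 0 := by
    refine integral_eq_zero_of_hasDerivAt_of_integrable
      (f := f (k + 1)) ?_ ?_ i1
    · intro t
      have hl : HasDerivAt (fun t : ℝ => (a + t * I : ℂ)) I t := by
        simpa using ((hasDerivAt_id t).ofReal_comp.mul_const I).const_add (a : ℂ)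
      have h0 := line_ne_zero ha t
      have hg : HasDerivAt (gk n w a)
          (gk n w a t * ((2 * ((a + t * I : ℂ) - w * n) * I) / (2 * w))) t := by
        have := (((hl.sub_const ((w : ℂ) * n)).pow 2).div_const (2 * w : ℂ)).cexp
        refine this.congr_deriv ?_
        simp [gk]
      refine (hg.mul ((hl.pow (k + 1)).div (hl.pow 2) (pow_ne_zero _ h0))).congr_deriv ?_
      simp only [hf, Pi.pow_apply, Pi.div_apply]
      push_cast
      field_simp
      ring
    fun_prop
  have j2 : Integrable fun t => (1 / w : ℂ) * f (k + 2) t := i2.const_mul _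
  have j1 : Integrable fun t => (n : ℂ) * f (k + 1) t := i1.const_mul _
  have j0 : Integrable fun t => (k - 1 : ℂ) * f k t := i0.const_mul _
  have j3 : Integrable fun t => (1 / w : ℂ) * f (k + 2) t - (n : ℂ) * f (k + 1) t :=
    j2.sub j1
  rw [integral_const_mul, integral_add j3 j0,
    integral_sub j2 j1, integral_const_mul,
    integral_const_mul, integral_const_mul, mul_eq_zero] at hz
  have hz := hz.resolve_left I_ne_zero
  have e : ∀ k, jm n w a k = (w / sqrt (2 * Real.pi * w) : ℝ) * ∫ t : ℝ, f k t := fun _ => rfl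
  grind

lemma jm_add_two {n w a : ℝ} (hw : 0 < w) (ha : 0 < a) (k : ℕ) :
    jm n w a (k + 2) = ((w * hk n w k : ℝ) : ℂ) := by
  induction k using Nat.twoStepInduction with
  | zero => rw [jm_two hw ha]; simp [hk]
  | one =>
    rw [jm_rec hw ha, jm_two hw ha]
    simp [hk]
    ring
  | more k h1 h2 =>
    rw [jm_rec hw ha, h1, h2]
    simp only [hk]
    push_cast
    ring

/-- Generating function of the independent sets. -/
def PH (U : Finset ℕ) (H : EdgeSet) (ζ : ℂ) : ℂ :=
  ∑ T ∈ U.powerset, (ind (Indep H T) : ℂ) * ζ ^ T.card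

lemma PH_eq (U : Finset ℕ) (H : EdgeSet) (ζ : ℂ) :
    PH U H ζ = ∑ k ∈ range (U.card + 1), (ek U H k : ℂ) * ζ ^ k := by
  rw [PH, sum_powerset]
  refine sum_congr rfl fun k _ => ?_
  rw [ek, ofReal_sum, sum_mul]
  refine sum_congr rfl fun T hT => ?_
  rw [(mem_powersetCard.1 hT).2]

lemma integrable_gk_PH {n w a : ℝ} (hw : 0 < w) (ha : 0 < a) (U : Finset ℕ)
    (H : EdgeSet) : Integrable fun t : ℝ =>
      gk n w a t * (PH U H (a + t * I) / (a + t * I : ℂ) ^ 2) := by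
  have : (fun t : ℝ => gk n w a t * (PH U H (a + t * I) / (a + t * I : ℂ) ^ 2)) = fun t : ℝ =>
      ∑ k ∈ range (U.card + 1), (ek U H k : ℂ) *
        (gk n w a t * ((a + t * I : ℂ) ^ k / (a + t * I : ℂ) ^ 2)) := by
    funext t
    rw [PH_eq, sum_div, mul_sum]
    grind
  rw [this]
  exact integrable_finsetSum _ fun k _ => (integrable_gk hw ha k).const_mul _

lemma brs_integral {w a : ℝ} (hw : 0 < w) (ha : 0 < a) (U : Finset ℕ) (H : EdgeSet) :
    (brs w U H : ℂ) = (w / sqrt (2 * Real.pi * w) : ℝ) *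
      ∫ t : ℝ, gk U.card w a t * (PH U H (a + t * I) / (a + t * I : ℂ) ^ 2) := by
  have h1 : (fun t : ℝ => gk U.card w a t * (PH U H (a + t * I) / (a + t * I : ℂ) ^ 2)) =
      fun t : ℝ => ∑ k ∈ range (U.card + 1), (ek U H k : ℂ) *
        (gk U.card w a t * ((a + t * I : ℂ) ^ k / (a + t * I : ℂ) ^ 2)) := by
    funext t
    rw [PH_eq, sum_div, mul_sum]
    grind
  rw [h1, integral_finsetSum _ fun k _ => (integrable_gk hw ha k).const_mul _,
    mul_sum]
  have h2 : ∀ k, (w / sqrt (2 * Real.pi * w) : ℝ) *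
      ∫ t : ℝ, (ek U H k : ℂ) * (gk U.card w a t * ((a + t * I : ℂ) ^ k / (a + t * I : ℂ) ^ 2)) =
      ek U H k * jm U.card w a k := by
    intro k
    rw [integral_const_mul, jm]
    ring
  simp only [h2]
  rw [brs_eq]
  push_cast
  rcases Nat.eq_zero_or_pos U.card with h0 | h0
  · have hj := jm_rec (n := U.card) hw ha 0
    rw [jm_two hw ha] at hj
    rw [h0] at hj ⊢
    have hw' : (w : ℂ) ≠ 0 := by exact_mod_cast hw.ne'
    simp [mu] at hj ⊢
    grind
  · obtain ⟨m, hm⟩ : ∃ m, U.card = m + 1 := ⟨U.card - 1, by omega⟩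
    have hr : ∀ g : ℕ → ℂ, ∑ k ∈ range (U.card + 1), g k =
        ∑ k ∈ range m, g (k + 2) + (g 1 + g 0) := by
      intro g
      rw [hm, sum_range_succ', sum_range_succ']
      ring
    rw [hr, hr]
    congr 1
    · refine sum_congr rfl fun k _ => ?_
      rw [jm_add_two hw ha]
      rfl
    · have hj := jm_rec (n := U.card) hw ha 0
      rw [jm_two hw ha] at hj
      have hw' : (w : ℂ) ≠ 0 := by exact_mod_cast hw.ne'
      rw [ek_zero, ek_one]
      simp [mu] at hj ⊢
      grind

/-! ### Decomposition of bridgeless graphs into components -/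

lemma sum_powerset_union {α M : Type*} [DecidableEq α] [AddCommMonoid M] {A B : Finset α}
    (h : Disjoint A B) (f : Finset α → M) :
    ∑ S ∈ (A ∪ B).powerset, f S = ∑ S ∈ A.powerset, ∑ T ∈ B.powerset, f (S ∪ T) := by
  rw [← sum_product']
  refine sum_bij' (fun S _ => (S ∩ A, S ∩ B)) (fun p _ => p.1 ∪ p.2) ?_ ?_ ?_ ?_ ?_
  · grind
  · grind
  · grind
  · intro p hp
    simp only [mem_product, mem_powerset] at hp
    ext x
    · simp only [mem_inter, mem_union]
      constructor
      · rintro ⟨h1 | h1, h2⟩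
        · exact h1
        · exact absurd (hp.2 h1) (disjoint_left.1 h h2)
      grind
    · simp only [mem_inter, mem_union]
      constructor
      · rintro ⟨h1 | h1, h2⟩
        · exact absurd h2 (disjoint_left.1 h (hp.1 h1))
        · exact h1
      grind
  · intro S hS
    rw [← inter_union_distrib_left, inter_eq_left.2 (mem_powerset.1 hS)]

lemma disjoint_KK {A B : Finset ℕ} (h : Disjoint A B) : Disjoint (KK A) (KK B) := by
  rw [disjoint_left]
  intro e
  induction e with
  | _ u v =>
    rw [mem_KK, mem_KK]
    exact fun h1 h2 => disjoint_left.1 h h1.1 h2.1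

section
variable {A B : Finset ℕ} {H₁ H₂ : EdgeSet}

lemma rch_union_left (h : Disjoint A B) (h₁ : H₁ ⊆ KK A) (h₂ : H₂ ⊆ KK B) {a b : ℕ}
    (ha : a ∈ A) : Rch (H₁ ∪ H₂) a b ↔ Rch H₁ a b := by
  refine ⟨fun hr => ?_, fun hr => hr.mono subset_union_left⟩
  refine hr.restrict (p := fun x => x ∈ A) ?_ ?_ ha
  · intro x y hxy hx
    rcases mem_union.1 hxy with h' | h'
    · exact (mem_KK.1 (h₁ h')).2.1
    · exact absurd (mem_KK.1 (h₂ h')).1 (disjoint_left.1 h hx)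
  · intro x y hxy hx
    rcases mem_union.1 hxy with h' | h'
    · exact h'
    · exact absurd (mem_KK.1 (h₂ h')).1 (disjoint_left.1 h hx)

lemma rch_union_right (h : Disjoint A B) (h₁ : H₁ ⊆ KK A) (h₂ : H₂ ⊆ KK B) {a b : ℕ}
    (ha : a ∈ B) : Rch (H₁ ∪ H₂) a b ↔ Rch H₂ a b := by
  rw [union_comm]
  exact rch_union_left h.symm h₂ h₁ ha

lemma cc_union_left (h : Disjoint A B) (h₁ : H₁ ⊆ KK A) (h₂ : H₂ ⊆ KK B) {a : ℕ}
    (ha : a ∈ A) : cc (H₁ ∪ H₂) (A ∪ B) a = cc H₁ A a := by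
  ext x
  rw [mem_cc, mem_cc, rch_union_left h h₁ h₂ ha, mem_union]
  exact ⟨fun hx => ⟨hx.2.mem_of_KK h₁ ha, hx.2⟩, fun hx => ⟨Or.inl hx.1, hx.2⟩⟩

lemma cc_union_right (h : Disjoint A B) (h₁ : H₁ ⊆ KK A) (h₂ : H₂ ⊆ KK B) {a : ℕ}
    (ha : a ∈ B) : cc (H₁ ∪ H₂) (A ∪ B) a = cc H₂ B a := by
  rw [union_comm H₁, union_comm A]
  exact cc_union_left h.symm h₂ h₁ ha

lemma jn_union_erase (h : Disjoint A B) (h₁ : H₁ ⊆ KK A) (h₂ : H₂ ⊆ KK B) {e : Sym2 ℕ}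
    (he : e ∈ H₁) : Jn ((H₁ ∪ H₂).erase e) e ↔ Jn (H₁.erase e) e := by
  have hn : e ∉ H₂ := fun h' => disjoint_left.1 (disjoint_KK h) (h₁ he) (h₂ h')
  rw [erase_union_distrib, erase_eq_of_notMem hn]
  induction e with
  | _ u v =>
    rw [jn_mk, jn_mk, rch_union_left h ((erase_subset _ _).trans h₁) h₂
      (mem_KK.1 (h₁ he)).1]

lemma bless_union (h : Disjoint A B) (h₁ : H₁ ⊆ KK A) (h₂ : H₂ ⊆ KK B) :
    Bless (H₁ ∪ H₂) ↔ Bless H₁ ∧ Bless H₂ := by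
  constructor
  · intro hb
    refine ⟨fun e he => (jn_union_erase h h₁ h₂ he).1 (hb e (mem_union_left _ he)),
      fun e he => ?_⟩
    have := hb e (mem_union_right _ he)
    rw [union_comm] at this
    exact (jn_union_erase h.symm h₂ h₁ he).1 this
  · rintro ⟨b1, b2⟩ e he
    rcases mem_union.1 he with he | he
    · exact (jn_union_erase h h₁ h₂ he).2 (b1 e he)
    · rw [union_comm]
      exact (jn_union_erase h.symm h₂ h₁ he).2 (b2 e he)

lemma PH_union (h : Disjoint A B) (h₁ : H₁ ⊆ KK A) (h₂ : H₂ ⊆ KK B) (ζ : ℂ) :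
    PH (A ∪ B) (H₁ ∪ H₂) ζ = PH A H₁ ζ * PH B H₂ ζ := by
  rw [PH, sum_powerset_union h, PH, PH, sum_mul_sum]
  refine sum_congr rfl fun S hS => sum_congr rfl fun T hT => ?_
  rw [mem_powerset] at hS hT
  have hd : Disjoint S T := disjoint_of_subset_left hS (disjoint_of_subset_right hT h)
  have hI : Indep (H₁ ∪ H₂) (S ∪ T) ↔ Indep H₁ S ∧ Indep H₂ T := by
    constructor
    · intro hI
      refine ⟨fun a ha b hb hab hr => ?_, fun a ha b hb hab hr => ?_⟩
      · exact hI a (mem_union_left _ ha) b (mem_union_left _ hb) hab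
          (hr.mono subset_union_left)
      · exact hI a (mem_union_right _ ha) b (mem_union_right _ hb) hab
          (hr.mono subset_union_right)
    · rintro ⟨i1, i2⟩ a ha b hb hab hr
      rcases mem_union.1 ha with ha | ha
      · rw [rch_union_left h h₁ h₂ (hS ha)] at hr
        rcases mem_union.1 hb with hb | hb
        · exact i1 a ha b hb hab hr
        · exact disjoint_left.1 h (hr.mem_of_KK h₁ (hS ha)) (hT hb)
      · rw [rch_union_right h h₁ h₂ (hT ha)] at hr
        rcases mem_union.1 hb with hb | hb
        · exact disjoint_left.1 h (hS hb) (hr.mem_of_KK h₂ (hT ha))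
        · exact i2 a ha b hb hab hr
  rw [ind_congr hI, ind_and, card_union_of_disjoint hd, pow_add]
  push_cast
  ring

end

/-- All vertices of `C` are connected. -/
def Conn (C : Finset ℕ) (H : EdgeSet) : Prop := ∀ a ∈ C, ∀ b ∈ C, Rch H a b

lemma PH_conn {C : Finset ℕ} {H : EdgeSet} (h : Conn C H) (ζ : ℂ) :
    PH C H ζ = 1 + C.card * ζ := by
  rw [PH_eq]
  have h2 : ∀ k, ek C H (k + 2) = 0 := by
    intro k
    refine sum_eq_zero fun T hT => ind_false fun hI => ?_
    rw [mem_powersetCard] at hT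
    obtain ⟨a, ha, b, hb, hab⟩ := one_lt_card.1 (show 1 < T.card by omega)
    exact hI a ha b hb hab (h a (hT.1 ha) b (hT.1 hb))
  rcases Nat.eq_zero_or_pos C.card with h0 | h0
  · simp [h0, ek_zero]
  · obtain ⟨m, hm⟩ : ∃ m, C.card = m + 1 := ⟨C.card - 1, by omega⟩
    rw [hm, sum_range_succ', sum_range_succ', ek_zero, ek_one, hm]
    simp only [show ∀ k, k + 1 + 1 = k + 2 from fun _ => rfl, h2]
    simp
    ring

/-- All components are smaller than `j`. -/
def SmallC (U : Finset ℕ) (j : ℕ) (H : EdgeSet) : Prop := ∀ v ∈ U, (cc H U v).card < j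

/-- Weight of connected bridgeless graphs on `C`. -/
def theta (w : ℝ) (C : Finset ℕ) : ℝ :=
  ws w (KK C) fun H => ind (Conn C H ∧ Bless H)

/-- Total weight of bridgeless graphs with small components, marked by independent sets. -/
def WW (w : ℝ) (j : ℕ) (ζ : ℂ) (U : Finset ℕ) : ℂ :=
  ∑ H ∈ (KK U).powerset, (w : ℂ) ^ H.card * ((ind (Bless H ∧ SmallC U j H) : ℂ) * PH U H ζ)

lemma WW_empty (w : ℝ) (j : ℕ) (ζ : ℂ) : WW w j ζ ∅ = 1 := by
  have h1 : KK ∅ = ∅ := by simp [KK]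
  rw [WW, h1, powerset_empty, sum_singleton, ind_true]
  · simp [PH, ind, Indep]
  · exact ⟨by simp [Bless], by simp [SmallC]⟩

lemma sum_comp_eq (U C : Finset ℕ) {v : ℕ} (hv : v ∈ C) (hC : C ⊆ U)
    (f : EdgeSet → ℂ) :
    ∑ H ∈ (KK U).powerset, (ind (cc H U v = C) : ℂ) * f H =
      ∑ H₁ ∈ (KK C).powerset, ∑ H₂ ∈ (KK (U \ C)).powerset, (ind (Conn C H₁) : ℂ) * f (H₁ ∪ H₂) := by
  classical
  have hd : Disjoint C (U \ C) := disjoint_sdiff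
  have hu : C ∪ U \ C = U := union_sdiff_of_subset hC
  have this : ∑ H ∈ (KK U).powerset, (ind (cc H U v = C) : ℂ) * f H =
      ∑ H ∈ (KK C ∪ KK (U \ C)).powerset, (ind (cc H U v = C) : ℂ) * f H := by
    rw [eq_comm]
    refine sum_subset ?_ ?_
    · exact powerset_mono.2 (union_subset (KK_mono hC) (KK_mono sdiff_subset))
    · intro H hH hH'
      rw [mem_powerset] at hH hH'
      rw [ind_false, ofReal_zero, zero_mul]
      intro hcc
      refine hH' fun e he => ?_
      induction e with
      | _ x y =>
        have hxy := mem_KK.1 (hH he)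
        by_cases hx : x ∈ C
        · have hy : y ∈ C := by
            rw [← hcc, mem_cc] at hx ⊢
            exact ⟨hxy.2.1, hx.2.trans (Rch.single he)⟩
          exact mem_union_left _ (mem_KK.2 ⟨hx, hy, hxy.2.2⟩)
        · have hy : y ∉ C := by
            intro hy
            refine hx ?_
            rw [← hcc, mem_cc] at hy ⊢
            exact ⟨hxy.1, hy.2.trans (Rch.single he).symm⟩
          exact mem_union_right _ (mem_KK.2 ⟨Finset.mem_sdiff.2 ⟨hxy.1, hx⟩,
            Finset.mem_sdiff.2 ⟨hxy.2.1, hy⟩, hxy.2.2⟩)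
  rw [this, sum_powerset_union (disjoint_KK hd)]
  refine sum_congr rfl fun H₁ h₁ => sum_congr rfl fun H₂ h₂ => ?_
  rw [mem_powerset] at h₁ h₂
  have : cc (H₁ ∪ H₂) U v = C ↔ Conn C H₁ := by
    rw [← hu, cc_union_left hd h₁ h₂ hv]
    constructor
    · intro h a ha b hb
      rw [← h, mem_cc] at ha hb
      exact ha.2.symm.trans hb.2
    · intro h
      refine Subset.antisymm (cc_subset _ _ _) fun x hx => mem_cc.2 ⟨hx, h v hv x hx⟩
  rw [ind_congr this]

lemma conn_bless_map (C : Finset ℕ) (S : EdgeSet) (σ : Equiv.Perm ℕ) :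
    (Conn (C.map σ.toEmbedding) (S.map ⟨Sym2.map σ, Sym2.map.injective σ.injective⟩) ∧
      Bless (S.map ⟨Sym2.map σ, Sym2.map.injective σ.injective⟩)) ↔ Conn C S ∧ Bless S := by
  refine and_congr ?_ ?_
  · constructor
    · intro h a ha b hb
      exact (Rch.map_iff σ).1 (h (σ a) (mem_map_of_mem _ ha) (σ b) (mem_map_of_mem _ hb))
    · intro h a ha b hb
      obtain ⟨a', ha', rfl⟩ := Finset.mem_map.1 ha
      obtain ⟨b', hb', rfl⟩ := Finset.mem_map.1 hb
      exact (Rch.map_iff σ).2 (h a' ha' b' hb')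
  · have key : ∀ e, Jn ((S.map ⟨Sym2.map σ, Sym2.map.injective σ.injective⟩).erase (Sym2.map σ e))
        (Sym2.map σ e) ↔ Jn (S.erase e) e := by
      intro e
      have : (S.map ⟨Sym2.map σ, Sym2.map.injective σ.injective⟩).erase (Sym2.map σ e) =
          (S.erase e).map ⟨Sym2.map σ, Sym2.map.injective σ.injective⟩ :=
        (map_erase ⟨Sym2.map σ, Sym2.map.injective σ.injective⟩ S e).symm
      rw [this]
      induction e with
      | _ u v => rw [Sym2.map_mk, jn_mk, jn_mk]; exact Rch.map_iff σ
    constructor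
    · intro h e he
      exact (key e).1 (h _ (mem_map_of_mem ⟨Sym2.map σ, Sym2.map.injective σ.injective⟩ he))
    · intro h e he
      obtain ⟨e', he', rfl⟩ := Finset.mem_map.1 he
      exact (key e').2 (h e' he')

lemma theta_map (w : ℝ) (C : Finset ℕ) (σ : Equiv.Perm ℕ) :
    theta w (C.map σ.toEmbedding) = theta w C := by
  rw [theta, KK_map, ws_map, theta]
  exact ws_congr fun S hS => ind_congr (conn_bless_map C S σ)

/-- Weight of connected bridgeless graphs on `b` vertices. -/
def th (w : ℝ) (b : ℕ) : ℝ := theta w (range b)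

lemma theta_eq (w : ℝ) (C : Finset ℕ) : theta w C = th w C.card := by
  obtain ⟨σ, hσ⟩ := exists_perm (U := C) (V := range C.card) (by simp)
  rw [th, ← hσ, theta_map]

lemma th_nonneg {w : ℝ} (hw : 0 ≤ w) (b : ℕ) : 0 ≤ th w b :=
  by
  rw [th, theta]
  exact ws_nonneg hw fun _ _ => ind_nonneg _

lemma KK_of_card_le_one {U : Finset ℕ} (h : U.card ≤ 1) : KK U = ∅ := by
  rw [← card_eq_zero, card_KK, Nat.choose_eq_zero_of_lt (by omega)]

lemma th_one (w : ℝ) : th w 1 = 1 := by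
  rw [th, theta, KK_of_card_le_one (by simp), ws, powerset_empty, sum_singleton, ind_true]
  · simp
  · refine ⟨fun a ha b hb => ?_, by simp [Bless]⟩
    simp only [mem_range] at ha hb
    obtain rfl : a = b := by omega
    exact Rch.refl _ _

lemma th_two (w : ℝ) : th w 2 = 0 := by
  rw [th, theta, ws]
  refine sum_eq_zero fun H hH => ?_
  rw [mem_powerset] at hH
  rw [ind_false, mul_zero]
  rintro ⟨h1, h2⟩
  have hE : H.erase s(0, 1) = ∅ := by
    refine eq_empty_of_forall_notMem fun e he => ?_
    rw [mem_erase] at he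
    have h3 := hH he.2
    obtain ⟨h4, h5⟩ := he
    induction e with
    | _ u v =>
      rw [mem_KK, mem_range, mem_range] at h3
      grind
  have hno : ¬Rch ∅ 0 1 := by
    intro h
    have := Rch.closed (p := fun x => x = 0) (by simp) h rfl
    omega
  have h01 := h1 0 (by simp) 1 (by simp)
  by_cases he : s(0, 1) ∈ H
  · have := h2 _ he
    rw [hE, jn_mk] at this
    exact hno this
  · rw [erase_eq_of_notMem he] at hE
    exact hno (hE ▸ h01)

lemma smallC_union {C D : Finset ℕ} (h : Disjoint C D) {H₁ H₂ : EdgeSet} (h₁ : H₁ ⊆ KK C)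
    (h₂ : H₂ ⊆ KK D) {v : ℕ} (hv : v ∈ C) (hc : Conn C H₁) (j : ℕ) :
    SmallC (C ∪ D) j (H₁ ∪ H₂) ↔ C.card < j ∧ SmallC D j H₂ := by
  have hcc : ∀ x ∈ C, cc H₁ C x = C := fun x hx =>
    Subset.antisymm (cc_subset _ _ _) fun y hy => mem_cc.2 ⟨hy, hc x hx y hy⟩
  constructor
  · intro hs
    refine ⟨?_, fun x hx => ?_⟩
    · have := hs v (mem_union_left _ hv)
      rwa [cc_union_left h h₁ h₂ hv, hcc v hv] at this
    · have := hs x (mem_union_right _ hx)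
      rwa [cc_union_right h h₁ h₂ hx] at this
  · rintro ⟨hs1, hs2⟩ x hx
    rcases mem_union.1 hx with hx | hx
    · rwa [cc_union_left h h₁ h₂ hx, hcc x hx]
    · rw [cc_union_right h h₁ h₂ hx]; exact hs2 x hx

lemma WW_rec (w : ℝ) (j : ℕ) (ζ : ℂ) {U : Finset ℕ} {v : ℕ} (hv : v ∈ U) :
    WW w j ζ U = ∑ C ∈ U.powerset.filter (fun C => v ∈ C),
      (ind (C.card < j) : ℂ) * (th w C.card * (1 + C.card * ζ)) * WW w j ζ (U \ C) := by
  classical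
  have h1 : WW w j ζ U = ∑ C ∈ U.powerset.filter (fun C => v ∈ C), ∑ H ∈ (KK U).powerset,
      (ind (cc H U v = C) : ℂ) * ((w : ℂ) ^ H.card * ((ind (Bless H ∧ SmallC U j H) : ℂ) * PH U H ζ)) := by
    rw [sum_comm, WW]
    refine sum_congr rfl fun H hH => ?_
    rw [sum_eq_single (cc H U v)]
    · rw [ind_true rfl, ofReal_one, one_mul]
    · intro C hC hne
      rw [ind_false (fun h => hne h.symm), ofReal_zero, zero_mul]
    · intro h
      exact absurd (mem_filter.2 ⟨mem_powerset.2 (cc_subset _ _ _), self_mem_cc hv⟩) h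
  rw [h1]
  refine sum_congr rfl fun C hC => ?_
  rw [mem_filter, mem_powerset] at hC
  have hd : Disjoint C (U \ C) := disjoint_sdiff
  have hu : C ∪ U \ C = U := union_sdiff_of_subset hC.1
  rw [sum_comp_eq U C hC.2 hC.1, ← theta_eq, theta, ws, WW, ofReal_sum,
    ← mul_assoc, mul_sum (KK C).powerset, sum_mul, sum_mul]
  refine sum_congr rfl fun H₁ h₁ => ?_
  rw [mul_sum]
  refine sum_congr rfl fun H₂ h₂ => ?_
  rw [mem_powerset] at h₁ h₂
  by_cases hc : Conn C H₁
  · have e1 : Bless (H₁ ∪ H₂) ∧ SmallC U j (H₁ ∪ H₂) ↔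
        (Bless H₁ ∧ C.card < j) ∧ (Bless H₂ ∧ SmallC (U \ C) j H₂) := by
      have e2 := smallC_union hd h₁ h₂ hC.2 hc j
      rw [hu] at e2
      rw [bless_union hd h₁ h₂, e2]
      tauto
    have e3 := PH_union hd h₁ h₂ ζ
    rw [hu, PH_conn hc] at e3
    have e4 : (H₁ ∪ H₂).card = H₁.card + H₂.card :=
      card_union_of_disjoint (disjoint_of_subset_left h₁
        (disjoint_of_subset_right h₂ (disjoint_KK hd)))
    rw [ind_congr e1, e3, e4, ind_and (Bless H₁ ∧ C.card < j),
      ind_and (Bless H₁), ind_and (Conn C H₁), ind_true hc]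
    push_cast
    ring
  · rw [ind_false hc, ind_false (show ¬(Conn C H₁ ∧ Bless H₁) from fun h => hc h.1)]
    simp

/-- Normalised weights. -/
def tb (w : ℝ) (ζ : ℂ) (b : ℕ) : ℂ := th w b * (1 + b * ζ) / (b.factorial : ℂ)

lemma WW_rec_card (w : ℝ) (j : ℕ) (ζ : ℂ) (V : ℕ → ℂ) (n : ℕ)
    (hV : ∀ U : Finset ℕ, U.card ≤ n → WW w j ζ U = U.card.factorial * V U.card)
    {U : Finset ℕ} (hU : U.card = n + 1) :
    WW w j ζ U = n.factorial * ∑ m ∈ range (n + 1),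
      (ind (m + 1 < j) : ℂ) * ((m + 1 : ℕ) * tb w ζ (m + 1)) * V (n - m) := by
  classical
  obtain ⟨v, hv⟩ : U.Nonempty := card_pos.1 (by omega)
  have hn : (U.erase v).card = n := by rw [card_erase_of_mem hv, hU]; rfl
  rw [WW_rec w j ζ hv]
  have h1 : ∑ C ∈ U.powerset.filter (fun C => v ∈ C),
      (ind (C.card < j) : ℂ) * (th w C.card * (1 + C.card * ζ)) * WW w j ζ (U \ C) =
      ∑ T ∈ (U.erase v).powerset, (ind (T.card + 1 < j) : ℂ) *
        (th w (T.card + 1) * (1 + (T.card + 1 : ℕ) * ζ)) * ((n - T.card).factorial * V (n - T.card)) := by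
    refine sum_bij' (fun C _ => C.erase v) (fun T _ => insert v T) ?_ ?_ ?_ ?_ ?_
    · grind
    · grind
    · intro C hC
      exact insert_erase (mem_filter.1 hC).2
    · grind
    · intro C hC
      rw [mem_filter, mem_powerset] at hC
      have h2 : (C.erase v).card + 1 = C.card := card_erase_add_one hC.2
      have h3 : (U \ C).card = n - (C.erase v).card := by
        rw [card_sdiff_of_subset hC.1]; omega
      rw [hV (U \ C) (by omega), h3, h2]
  rw [h1, sum_powerset_apply_card (fun m => (ind (m + 1 < j) : ℂ) *
        (th w (m + 1) * (1 + (m + 1 : ℕ) * ζ)) * ((n - m).factorial * V (n - m))), hn, mul_sum]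
  refine sum_congr rfl fun m hm => ?_
  have hmn : m ≤ n := by rw [mem_range] at hm; omega
  have h4 : ((n.choose m : ℕ) : ℂ) * (m.factorial : ℂ) * ((n - m).factorial : ℂ) = (n.factorial : ℂ) := by
    exact_mod_cast Nat.choose_mul_factorial_mul_factorial hmn
  have h5 : ((m + 1 : ℕ) : ℂ) * tb w ζ (m + 1) * (m.factorial : ℂ) =
      th w (m + 1) * (1 + (m + 1 : ℕ) * ζ) := by
    have h6 : (m.factorial : ℂ) ≠ 0 := by exact_mod_cast m.factorial_ne_zero
    have h7 : ((m + 1 : ℕ) : ℂ) ≠ 0 := by exact_mod_cast m.succ_ne_zero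
    rw [tb, Nat.factorial_succ]
    push_cast at h7 ⊢
    field_simp
  rw [nsmul_eq_mul, ← h4, ← h5]
  ring

/-! ### The exponential formula -/

section expform
open PowerSeries
variable (c : ℂ) (t : ℕ → ℂ) (j : ℕ)

/-- Generating polynomial of the nontrivial components. -/
def Tser : PowerSeries ℂ := PowerSeries.mk fun b => if b ∈ Ico 3 j then t b else 0

/-- Contribution of `K` nontrivial components. -/
def aK (K n : ℕ) : ℂ := coeff n (rescale c (PowerSeries.exp ℂ) * Tser t j ^ K)

lemma Tser_eq : Tser t j = X * PowerSeries.mk fun b => if b + 1 ∈ Ico 3 j then t (b + 1) else 0 := by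
  ext n
  cases n with
  | zero => simp [Tser]
  | succ n => rw [coeff_succ_X_mul, Tser, coeff_mk, coeff_mk]

lemma aK_of_lt {K n : ℕ} (h : n < K) : aK c t j K n = 0 := by
  rw [aK, Tser_eq, mul_pow, mul_left_comm, coeff_X_pow_mul', if_neg (by omega)]

lemma aK_zero (n : ℕ) : aK c t j 0 n = c ^ n / n.factorial := by
  rw [aK, pow_zero, mul_one, coeff_rescale, coeff_exp]
  simp [div_eq_mul_inv]

lemma aK_succ (K n : ℕ) : aK c t j (K + 1) n =
    ∑ b ∈ Ico 3 j, if b ≤ n then t b * aK c t j K (n - b) else 0 := by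
  have h0 : aK c t j (K + 1) n = coeff n (Tser t j * (rescale c (PowerSeries.exp ℂ) * Tser t j ^ K)) := by
    rw [aK]; congr 1; ring
  rw [h0, coeff_mul, Finset.Nat.sum_antidiagonal_eq_sum_range_succ_mk, ← sum_filter]
  have h1 : ∀ b ∈ range n.succ, coeff b (Tser t j) * coeff (n - b) (rescale c (PowerSeries.exp ℂ) * Tser t j ^ K)
      = if b ∈ Ico 3 j then t b * aK c t j K (n - b) else 0 := by
    intro b hb
    rw [Tser, coeff_mk, ite_mul, zero_mul]
    rfl
  rw [sum_congr rfl h1, ← sum_filter]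
  refine sum_congr ?_ fun _ _ => rfl
  grind

lemma aK_deriv (K n : ℕ) : aK c t j K (n + 1) * (n + 1) = c * aK c t j K n +
    K * ∑ m ∈ range (n + 1),
      (if m + 1 ∈ Ico 3 j then (m + 1 : ℕ) * t (m + 1) else 0) * aK c t j (K - 1) (n - m) := by
  have hE : derivative ℂ (rescale c (PowerSeries.exp ℂ)) = C c * rescale c (PowerSeries.exp ℂ) := by
    ext n
    rw [coeff_derivative, coeff_rescale, coeff_C_mul, coeff_rescale, coeff_exp, coeff_exp]
    have h1 : (n.factorial : ℂ) ≠ 0 := by exact_mod_cast n.factorial_ne_zero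
    have h2 : (n + 1 : ℂ) ≠ 0 := by exact_mod_cast n.succ_ne_zero
    rw [Nat.factorial_succ]
    simp only [one_div, map_inv₀, map_natCast]
    grind
  have h := congrArg (coeff n) (Derivation.leibniz (derivative ℂ) (rescale c (PowerSeries.exp ℂ)) (Tser t j ^ K))
  rw [coeff_derivative] at h
  change aK c t j K (n + 1) * (n + 1) = _ at h
  rw [h, hE, Derivation.leibniz_pow]
  have e1 : rescale c (PowerSeries.exp ℂ) • K • Tser t j ^ (K - 1) • derivative ℂ (Tser t j) +
      Tser t j ^ K • (C c * rescale c (PowerSeries.exp ℂ)) =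
      C c * (rescale c (PowerSeries.exp ℂ) * Tser t j ^ K) +
      C (K : ℂ) * (derivative ℂ (Tser t j) * (rescale c (PowerSeries.exp ℂ) * Tser t j ^ (K - 1))) := by
    simp only [smul_eq_mul, nsmul_eq_mul, map_natCast]
    ring
  rw [e1, map_add, coeff_C_mul, coeff_C_mul, coeff_mul n (derivative ℂ (Tser t j)),
    Finset.Nat.sum_antidiagonal_eq_sum_range_succ_mk]
  congr 2
  refine sum_congr rfl fun m hm => ?_
  rw [coeff_derivative, Tser, coeff_mk]
  congr 1
  grind

/-- The coefficients of the exponential. -/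
def Vn (n : ℕ) : ℂ := ∑ K ∈ range (n + 1), aK c t j K n / K.factorial

lemma Vn_eq {n M : ℕ} (h : n < M) : Vn c t j n = ∑ K ∈ range M, aK c t j K n / K.factorial := by
  refine sum_subset (range_mono h) fun K _ hK => ?_
  rw [mem_range] at hK
  rw [aK_of_lt c t j (by omega), zero_div]

lemma Vn_zero : Vn c t j 0 = 1 := by
  simp [Vn, aK_zero]

lemma Vn_succ (n : ℕ) : Vn c t j (n + 1) * (n + 1) = c * Vn c t j n +
    ∑ m ∈ range (n + 1),
      (if m + 1 ∈ Ico 3 j then (m + 1 : ℕ) * t (m + 1) else 0) * Vn c t j (n - m) := by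
  rw [Vn_eq c t j (show n + 1 < n + 3 by omega), Vn_eq c t j (show n < n + 3 by omega), sum_mul,
    mul_sum]
  have h1 : ∀ K ∈ range (n + 3), aK c t j K (n + 1) / K.factorial * (n + 1) =
      c * (aK c t j K n / K.factorial) + (K * ∑ m ∈ range (n + 1),
      (if m + 1 ∈ Ico 3 j then (m + 1 : ℕ) * t (m + 1) else 0) * aK c t j (K - 1) (n - m)) / K.factorial := by
    intro K _
    rw [div_mul_eq_mul_div, aK_deriv]
    ring
  rw [sum_congr rfl h1, sum_add_distrib]
  congr 1
  rw [sum_range_succ']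
  simp only [Nat.cast_zero, zero_mul, zero_div, add_zero]
  have h2 : ∀ K ∈ range (n + 2), (((K + 1 : ℕ) : ℂ) * ∑ m ∈ range (n + 1),
      (if m + 1 ∈ Ico 3 j then ((m + 1 : ℕ) : ℂ) * t (m + 1) else 0) * aK c t j (K + 1 - 1) (n - m)) /
      ((K + 1).factorial : ℂ) = ∑ m ∈ range (n + 1),
      (if m + 1 ∈ Ico 3 j then ((m + 1 : ℕ) : ℂ) * t (m + 1) else 0) * (aK c t j K (n - m) / K.factorial) := by
    intro K _
    have h3 : (K.factorial : ℂ) ≠ 0 := by exact_mod_cast K.factorial_ne_zero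
    have h4 : ((K + 1 : ℕ) : ℂ) ≠ 0 := by exact_mod_cast K.succ_ne_zero
    rw [Nat.factorial_succ, Nat.cast_mul, mul_div_mul_left _ _ h4, sum_div, Nat.add_sub_cancel]
    exact sum_congr rfl fun m _ => by ring
  rw [sum_congr rfl h2, sum_comm]
  refine sum_congr rfl fun m _ => ?_
  rw [← mul_sum, ← Vn_eq c t j (show n - m < n + 2 by omega)]

end expform

lemma WW_eq (w : ℝ) {j : ℕ} (hj : 2 ≤ j) (ζ : ℂ) (U : Finset ℕ) :
    WW w j ζ U = U.card.factorial * Vn (1 + ζ) (tb w ζ) j U.card := by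
  suffices ∀ n, ∀ U : Finset ℕ, U.card ≤ n → WW w j ζ U =
      U.card.factorial * Vn (1 + ζ) (tb w ζ) j U.card from this _ _ le_rfl
  intro n
  induction n with
  | zero =>
    intro U hU
    rw [Nat.le_zero, card_eq_zero] at hU
    subst hU
    rw [WW_empty, card_empty, Vn_zero]; simp
  | succ n ih =>
    intro U hU
    rcases Nat.lt_or_ge U.card (n + 1) with h | h
    · exact ih U (by omega)
    · have hU' : U.card = n + 1 := le_antisymm hU h
      rw [WW_rec_card w j ζ (Vn (1 + ζ) (tb w ζ) j) n ih hU', hU', Nat.factorial_succ]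
      push_cast
      rw [mul_comm ((n : ℂ) + 1), mul_assoc, mul_comm ((n : ℂ) + 1), Vn_succ]
      congr 1
      have h1 : tb w ζ 1 = 1 + ζ := by simp [tb, th_one]
      have h2 : tb w ζ 2 = 0 := by simp [tb, th_two]
      rw [sum_range_succ', sum_range_succ' (fun m => (if m + 1 ∈ Ico 3 j then
        ((m + 1 : ℕ) : ℂ) * tb w ζ (m + 1) else 0) * Vn (1 + ζ) (tb w ζ) j (n - m)), add_comm]
      simp only [zero_add, Nat.sub_zero]
      rw [ind_true (show 1 < j by omega), if_neg (by simp), h1, zero_mul, add_zero]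
      push_cast
      rw [zero_add, one_mul, one_mul]
      congr 1
      refine sum_congr rfl fun m _ => ?_
      congr 1
      rcases Nat.eq_zero_or_pos m with rfl | hm
      · simp [h2]
      · by_cases hmj : m + 1 + 1 < j
        · rw [ind_true hmj, if_pos (mem_Ico.2 ⟨by omega, hmj⟩)]
          simp
        · rw [ind_false hmj, if_neg (fun h => hmj (mem_Ico.1 h).2)]
          simp

section expbound
variable {c : ℂ} {t : ℕ → ℂ} {j : ℕ} {X : ℝ} {N : ℕ}

/-- Normalised contributions. -/
def nK (c : ℂ) (t : ℕ → ℂ) (j K n : ℕ) : ℂ := aK c t j K n * n.factorial / c ^ n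

lemma nK_zero (hc : c ≠ 0) (n : ℕ) : nK c t j 0 n = 1 := by
  rw [nK, aK_zero]
  have h1 : (n.factorial : ℂ) ≠ 0 := by exact_mod_cast n.factorial_ne_zero
  field_simp

lemma nK_succ (hc : c ≠ 0) {N : ℕ} (hN : 0 < N) (K n : ℕ) : nK c t j (K + 1) n =
    ∑ b ∈ Ico 3 j, t b * (N / c) ^ b * (((n.descFactorial b : ℝ) / N ^ b : ℝ) : ℂ) *
      nK c t j K (n - b) := by
  rw [nK, aK_succ, mul_div_assoc, sum_mul]
  refine sum_congr rfl fun b _ => ?_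
  have hN' : (N : ℂ) ≠ 0 := by exact_mod_cast hN.ne'
  by_cases hb : b ≤ n
  · rw [if_pos hb, nK]
    have h1 : ((n - b).factorial : ℂ) * (n.descFactorial b : ℂ) = n.factorial := by
      exact_mod_cast Nat.factorial_mul_descFactorial hb
    have h2 : c ^ n = c ^ b * c ^ (n - b) := by rw [← pow_add, Nat.add_sub_cancel' hb]
    rw [← h1, h2, div_pow]
    push_cast
    field_simp
  · rw [if_neg hb, Nat.descFactorial_of_lt (by omega)]
    simp

lemma norm_nK_le (hc : c ≠ 0) (hN : 0 < N) (hX : X = ∑ b ∈ Ico 3 j, ‖t b‖ * ‖(N / c : ℂ)‖ ^ b) (K : ℕ) :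
    ∀ n ≤ N, ‖nK c t j K n‖ ≤ X ^ K := by
  induction K with
  | zero => intro n _; rw [nK_zero hc]; simp
  | succ K ih =>
    intro n hn
    have hX0 : 0 ≤ X := by rw [hX]; positivity
    rw [nK_succ hc hN, pow_succ', hX, sum_mul, ← hX]
    refine norm_sum_le_of_le _ fun b _ => ?_
    rw [norm_mul, norm_mul, norm_mul, norm_pow, norm_real, norm_of_nonneg (by positivity)]
    have hd : (n.descFactorial b : ℝ) / N ^ b ≤ 1 := by
      rw [div_le_one (by positivity)]
      exact_mod_cast (Nat.descFactorial_le_pow n b).trans (Nat.pow_le_pow_left hn b)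
    calc ‖t b‖ * ‖(N / c : ℂ)‖ ^ b * (n.descFactorial b / N ^ b) * ‖nK c t j K (n - b)‖
        ≤ ‖t b‖ * ‖(N / c : ℂ)‖ ^ b * 1 * X ^ K := by
          gcongr
          exact ih _ ((Nat.sub_le _ _).trans hn)
      _ = _ := by ring

lemma one_sub_desc_le {n b : ℕ} (hN : 0 < N) (hn : n ≤ N) (hb : b ≤ n) :
    1 - (n.descFactorial b : ℝ) / N ^ b ≤ b * (N - n + b) / N := by
  have h1 : ((n : ℝ) + 1 - b) ^ b ≤ n.descFactorial b := by
    have := Nat.pow_sub_le_descFactorial n b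
    have h2 : ((n + 1 - b : ℕ) : ℝ) = (n : ℝ) + 1 - b := by
      rw [Nat.cast_sub (by omega)]; push_cast; ring
    rw [← h2]
    exact_mod_cast this
  have hN' : (0 : ℝ) < N := by exact_mod_cast hN
  have hbn : (b : ℝ) ≤ n := by exact_mod_cast hb
  have hnN : (n : ℝ) ≤ N := by exact_mod_cast hn
  have h0 : (0 : ℝ) ≤ ((n : ℝ) - b) / N := div_nonneg (by linarith) hN'.le
  have h3 : ((n : ℝ) - b) ^ b ≤ n.descFactorial b :=
    (pow_le_pow_left₀ (by linarith) (by linarith) b).trans h1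
  have h4 := one_add_mul_le_pow (a := ((n : ℝ) - b) / N - 1) (by linarith) b
  have h5 : (((n : ℝ) - b) / N) ^ b ≤ (n.descFactorial b : ℝ) / N ^ b := by
    rw [div_pow]; gcongr
  rw [add_sub_cancel] at h4
  have h6 : (b : ℝ) * (((n : ℝ) - b) / N - 1) = -(b * (N - n + b) / N) := by
    field_simp; ring
  linarith

lemma norm_nK_sub_le (hc : c ≠ 0) (hN : 0 < N) (hX : X = ∑ b ∈ Ico 3 j, ‖t b‖ * ‖(N / c : ℂ)‖ ^ b) (K : ℕ) :
    ∀ n ≤ N, ‖nK c t j K n - (∑ b ∈ Ico 3 j, t b * (N / c) ^ b) ^ K‖ ≤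
      X ^ K * (K * j * (N - n + K * j) / N) := by
  have hX0 : 0 ≤ X := by rw [hX]; positivity
  have hN' : (0 : ℝ) < N := by exact_mod_cast hN
  set X0 := ∑ b ∈ Ico 3 j, t b * (N / c : ℂ) ^ b with hX0'
  have hXX : ‖X0‖ ≤ X := by
    rw [hX]
    refine norm_sum_le_of_le _ fun b _ => ?_
    rw [norm_mul, norm_pow]
  induction K with
  | zero => intro n _; rw [nK_zero hc]; simp
  | succ K ih =>
    intro n hn
    have hnN : (n : ℝ) ≤ N := by exact_mod_cast hn
    rw [nK_succ hc hN, pow_succ' X0]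
    nth_rewrite 1 [hX0']
    rw [sum_mul, ← sum_sub_distrib, pow_succ', hX, sum_mul, sum_mul, ← hX]
    refine norm_sum_le_of_le _ fun b hb => ?_
    rw [mem_Ico] at hb
    have hbj : (b : ℝ) ≤ j := by exact_mod_cast hb.2.le
    have hb0 : (0 : ℝ) ≤ b := b.cast_nonneg
    have hj3 : (1 : ℝ) ≤ j := by exact_mod_cast (show 1 ≤ j by omega)
    have hj1 : (0 : ℝ) ≤ j := by linarith
    set d : ℝ := (n.descFactorial b : ℝ) / N ^ b with hd'
    have hd0 : 0 ≤ d := by positivity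
    have hd1 : d ≤ 1 := by
      rw [hd', div_le_one (by positivity)]
      exact_mod_cast (Nat.descFactorial_le_pow n b).trans (Nat.pow_le_pow_left hn b)
    have e1 : t b * (N / c) ^ b * (d : ℂ) * nK c t j K (n - b) - t b * (N / c) ^ b * X0 ^ K =
        t b * (N / c) ^ b * ((d : ℂ) * (nK c t j K (n - b) - X0 ^ K) - ((1 - d : ℝ) : ℂ) * X0 ^ K) := by
      push_cast; ring
    rw [e1, norm_mul, norm_mul, norm_pow, mul_assoc (‖t b‖ * ‖(N / c : ℂ)‖ ^ b)]
    refine mul_le_mul_of_nonneg_left ?_ (by positivity)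
    have hXK : 0 ≤ X ^ K := pow_nonneg hX0 K
    have hK0 : (0 : ℝ) ≤ K := K.cast_nonneg
    have e2 : ‖((1 - d : ℝ) : ℂ) * X0 ^ K‖ ≤ (1 - d) * X ^ K := by
      rw [norm_mul, norm_pow, norm_real, norm_of_nonneg (by linarith)]
      exact mul_le_mul_of_nonneg_left (pow_le_pow_left₀ (norm_nonneg _) hXX K) (by linarith)
    refine (norm_sub_le _ _).trans ?_
    rw [norm_mul, norm_real, norm_of_nonneg hd0]
    set Y := ‖nK c t j K (n - b) - X0 ^ K‖ with hY
    have hY0 : 0 ≤ Y := norm_nonneg _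
    rw [Nat.cast_succ]
    refine (add_le_add_right e2 (d * Y)).trans ?_
    by_cases hbn : b ≤ n
    · have i1 := ih (n - b) ((Nat.sub_le _ _).trans hn)
      rw [Nat.cast_sub hbn] at i1
      have i2 := one_sub_desc_le hN hn hbn
      have i3 : d * Y ≤ 1 * Y := mul_le_mul_of_nonneg_right hd1 hY0
      have i4 : (1 - d) * X ^ K ≤ (b * (N - n + b) / N) * X ^ K := mul_le_mul_of_nonneg_right i2 hXK
      have i5 : (K : ℝ) * j * (N - (n - b) + K * j) / N + b * (N - n + b) / N ≤
          (K + 1) * j * (N - n + (K + 1) * j) / N := by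
        rw [← add_div]
        refine div_le_div_of_nonneg_right ?_ hN'.le
        have k1 : (K : ℝ) * j * (N - (n - b) + K * j) ≤ K * j * (N - n + (K + 1) * j) :=
          mul_le_mul_of_nonneg_left (by linarith) (by positivity)
        have k2 : (b : ℝ) * (N - n + b) ≤ j * (N - n + (K + 1) * j) := by
          have : 0 ≤ (K : ℝ) * j := by positivity
          exact mul_le_mul hbj (by linarith) (by linarith) hj1
        linarith
      have i6 := mul_le_mul_of_nonneg_left i5 hXK
      rw [mul_add] at i6
      linarith
    · rw [hd', Nat.descFactorial_of_lt (by omega)]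
      simp only [Nat.cast_zero, zero_div, zero_mul, sub_zero, one_mul, zero_add]
      have : (1 : ℝ) ≤ (K + 1) * j * (N - n + (K + 1) * j) / N := by
        rw [le_div_iff₀ hN', one_mul]
        have hnb : (n : ℝ) ≤ j := by exact_mod_cast (show n ≤ j by omega)
        have k0 : 0 ≤ (K : ℝ) * j := by positivity
        have k1 : (1 : ℝ) ≤ (K + 1) * j := by linarith
        have k2 : (N : ℝ) ≤ N - n + (K + 1) * j := by linarith
        have k3 := mul_le_mul k1 k2 hN'.le (by linarith)
        linarith
      have k4 := mul_le_mul_of_nonneg_left this hXK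
      linarith

lemma norm_sum_nK {M : ℕ} (hM : N < M) :
    N.factorial * Vn c t j N / c ^ N = ∑ K ∈ range M, nK c t j K N / K.factorial := by
  rw [Vn_eq c t j hM, mul_sum, sum_div]
  refine sum_congr rfl fun K _ => ?_
  rw [nK]
  ring

lemma norm_Vn_le (hc : c ≠ 0) (hN : 0 < N) (hX : X = ∑ b ∈ Ico 3 j, ‖t b‖ * ‖(N / c : ℂ)‖ ^ b) :
    ‖N.factorial * Vn c t j N / c ^ N‖ ≤ exp X := by
  have hX0 : 0 ≤ X := by rw [hX]; positivity
  rw [norm_sum_nK (Nat.lt_succ_self N)]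
  refine le_trans (norm_sum_le_of_le _ fun K _ => ?_) (sum_le_exp_of_nonneg hX0 _)
  rw [norm_div, Complex.norm_natCast]
  exact div_le_div_of_nonneg_right (norm_nK_le hc hN hX K N le_rfl) (by positivity)

lemma norm_Vn_sub_le (hc : c ≠ 0) (hN : 0 < N) (hX : X = ∑ b ∈ Ico 3 j, ‖t b‖ * ‖(N / c : ℂ)‖ ^ b) :
    ‖N.factorial * Vn c t j N / c ^ N - Complex.exp (∑ b ∈ Ico 3 j, t b * (N / c) ^ b)‖ ≤
      4 * (j ^ 2 / N * exp (3 / 2 * X)) := by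
  have hX0 : 0 ≤ X := by rw [hX]; positivity
  set X0 := ∑ b ∈ Ico 3 j, t b * (N / c : ℂ) ^ b with hX0'
  have hlim : Tendsto (fun M => ‖N.factorial * Vn c t j N / c ^ N -
      ∑ K ∈ range M, X0 ^ K / K.factorial‖) atTop
      (nhds ‖N.factorial * Vn c t j N / c ^ N - Complex.exp X0‖) := by
    refine (tendsto_const_nhds.sub ?_).norm
    have := (NormedSpace.expSeries_div_hasSum_exp (𝔸 := ℂ) X0).tendsto_sum_nat
    rwa [← exp_eq_exp_ℂ] at this
  refine le_of_tendsto hlim ?_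
  filter_upwards [eventually_gt_atTop N] with M hM
  rw [norm_sum_nK hM, ← sum_sub_distrib]
  have h4 : ∀ K : ℕ, (K : ℝ) ^ 2 ≤ 4 * (3 / 2) ^ K := by
    intro K
    rcases Nat.lt_or_ge K 5 with h | h
    · interval_cases K <;> norm_num
    · induction K, h using Nat.le_induction with
      | base => norm_num
      | succ K hK ih =>
        have h5 : (5 : ℝ) ≤ K := by exact_mod_cast hK
        have h6 : (5 : ℝ) * K ≤ K * K := mul_le_mul_of_nonneg_right h5 (by linarith)
        rw [pow_succ (3 / 2 : ℝ)]
        push_cast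
        linarith
  have hb : ∀ K ∈ range M, ‖nK c t j K N / K.factorial - X0 ^ K / K.factorial‖ ≤
      4 * (j ^ 2 / N) * ((3 / 2 * X) ^ K / K.factorial) := by
    intro K _
    rw [← sub_div, norm_div, Complex.norm_natCast]
    have h1 := norm_nK_sub_le hc hN hX K N le_rfl
    rw [← hX0', sub_self, zero_add] at h1
    calc ‖nK c t j K N - X0 ^ K‖ / K.factorial ≤ X ^ K * (K * j * (K * j) / N) / K.factorial := by gcongr
      _ = j ^ 2 / N * (K ^ 2 * X ^ K / K.factorial) := by ring
      _ ≤ j ^ 2 / N * (4 * (3 / 2) ^ K * X ^ K / K.factorial) := by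
        gcongr
        exact h4 K
      _ = _ := by rw [mul_pow]; ring
  refine (norm_sum_le_of_le _ hb).trans ?_
  rw [← mul_sum, ← mul_assoc]
  exact mul_le_mul_of_nonneg_left (sum_le_exp_of_nonneg (by linarith) _) (by positivity)

end expbound

lemma ws_smallC {w a : ℝ} (hw : 0 < w) (ha : 0 < a) {j : ℕ} (hj : 2 ≤ j) (U : Finset ℕ) :
    (ws w (KK U) (fun S => ind (SmallC U j (core S))) : ℂ) =
      (w / sqrt (2 * Real.pi * w) : ℝ) * ∫ t : ℝ, gk U.card w a t *
        ((U.card.factorial * Vn (1 + (a + t * I)) (tb w (a + t * I)) j U.card) / (a + t * I : ℂ) ^ 2) := by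
  rw [ws_core w U (fun H => ind (SmallC U j H)), ws, ofReal_sum]
  have h1 : ∀ H ∈ (KK U).powerset, ((w ^ H.card * (ind (Bless H) * (ind (SmallC U j H) * brs w U H)) : ℝ) : ℂ) =
      (w / sqrt (2 * Real.pi * w) : ℝ) * ∫ t : ℝ,
        ((w : ℂ) ^ H.card * (ind (Bless H ∧ SmallC U j H) : ℂ)) *
        (gk U.card w a t * (PH U H (a + t * I) / (a + t * I : ℂ) ^ 2)) := by
    intro H _
    rw [integral_const_mul, ind_and]
    push_cast
    rw [brs_integral hw ha U H]
    push_cast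
    ring
  rw [sum_congr rfl h1, ← mul_sum, ← integral_finsetSum]
  · congr 2
    funext t
    rw [← WW_eq w hj, WW, sum_div, mul_sum]
    refine sum_congr rfl fun H _ => ?_
    ring
  · intro H _
    exact (integrable_gk_PH hw ha U H).const_mul _

/-! ### Two edge-disjoint connections -/

/-- There are two edge-disjoint connections between `u` and `v`. -/
def Two (u v : ℕ) (H : EdgeSet) : Prop := Box (fun X => Rch X u v) (fun X => Rch X u v) H

lemma two_of {H X Y : EdgeSet} {u v x : ℕ} (hX : X ⊆ H) (hY : Y ⊆ H) (hd : Disjoint X Y)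
    (hXx : Rch X u x) (hYv : Rch Y u v) (he : s(v, x) ∈ H) (hn : s(v, x) ∉ X) : Two u x H := by
  refine ⟨X, insert s(v, x) Y, hX, insert_subset he hY, ?_, hXx, ?_⟩
  · rw [disjoint_insert_right]
    exact ⟨hn, hd⟩
  · exact (hYv.mono (subset_insert _ _)).trans (Rch.single (mem_insert_self _ _))

lemma two_extend {H X Y Z : EdgeSet} {u v x a : ℕ} (hX : X ⊆ H) (hY : Y ⊆ H) (hZ : Z ⊆ H)
    (hXY : Disjoint X Y) (hZY : Disjoint Z Y) (he : s(v, x) ∈ H) (heX : s(v, x) ∉ X)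
    (heZ : s(v, x) ∉ Z) (hYv : Rch Y u v) (ha : Rch X u a) (hax : Rch Z a x) : Two u x H := by
  refine two_of (X := X ∪ Z) (Y := Y) (union_subset hX hZ) hY ?_ ?_ hYv he ?_
  · exact disjoint_union_left.2 ⟨hXY, hZY⟩
  · exact (ha.mono subset_union_left).trans (hax.mono subset_union_right)
  · rw [mem_union]; tauto

lemma two_step {H : EdgeSet} (hH : Bless H) {u v x : ℕ} (h : Two u v H)
    (he : s(v, x) ∈ H) : Two u x H := by
  classical
  obtain ⟨X, Y, hX, hY, hd, hXv, hYv⟩ := h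
  have key : ∀ X : EdgeSet, Rch X u v →
      Rch (X.erase s(v, x)) u v ∨ Rch (X.erase s(v, x)) u x := by
    intro X h
    have h1 : Rch (insert s(v, x) (X.erase s(v, x))) u v := h.mono (subset_insert_iff.2 subset_rfl)
    rw [Rch.insert_iff] at h1
    rcases h1 with h1 | h1 | h1
    · exact Or.inl h1
    · exact Or.inl h1.1
    · exact Or.inr h1.1
  have hXe : X.erase s(v, x) ⊆ X := erase_subset _ _
  have hYe : Y.erase s(v, x) ⊆ Y := erase_subset _ _
  have hXn : s(v, x) ∉ X.erase s(v, x) := notMem_erase _ _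
  have hYn : s(v, x) ∉ Y.erase s(v, x) := notMem_erase _ _
  by_cases hx1 : Rch (X.erase s(v, x)) u x
  · exact two_of (hXe.trans hX) hY (disjoint_of_subset_left hXe hd) hx1 hYv he hXn
  by_cases hx2 : Rch (Y.erase s(v, x)) u x
  · exact two_of (hYe.trans hY) hX (disjoint_of_subset_left hYe hd.symm) hx2 hXv he hYn
  have hX1 := (key X hXv).resolve_right hx1
  have hY1 := (key Y hYv).resolve_right hx2
  set X1 := (X.erase s(v, x)).filter (fun e => ∃ a ∈ e, Rch (X.erase s(v, x)) u a) with hX1'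
  set Y1 := (Y.erase s(v, x)).filter (fun e => ∃ a ∈ e, Rch (Y.erase s(v, x)) u a) with hY1'
  have memF : ∀ W : EdgeSet, ∀ a b, s(a, b) ∈ W.filter (fun e => ∃ a ∈ e, Rch W u a) →
      Rch (W.filter (fun e => ∃ a ∈ e, Rch W u a)) u a := by
    have h0 : ∀ W : EdgeSet, ∀ z, Rch W u z →
        Rch (W.filter (fun e => ∃ a ∈ e, Rch W u a)) u z := by
      intro W z hz
      refine Rch.restrict (p := fun y => Rch W u y) ?_ ?_ hz (Rch.refl _ _)
      · exact fun a b hab ha => ha.trans (Rch.single hab)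
      · exact fun a b hab ha => mem_filter.2 ⟨hab, a, Sym2.mem_mk_left a b, ha⟩
    intro W a b hab
    obtain ⟨h1, c, hc, h2⟩ := mem_filter.1 hab
    refine h0 W a ?_
    rcases Sym2.mem_iff.1 hc with rfl | rfl
    · exact h2
    · exact h2.trans (Rch.single h1).symm
  have hX1s : X1 ⊆ X.erase s(v, x) := filter_subset _ _
  have hY1s : Y1 ⊆ Y.erase s(v, x) := filter_subset _ _
  have hXv1 : Rch X1 u v := by
    refine Rch.restrict (p := fun y => Rch (X.erase s(v, x)) u y) ?_ ?_ hX1 (Rch.refl _ _)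
    · exact fun a b hab ha => ha.trans (Rch.single hab)
    · exact fun a b hab ha => mem_filter.2 ⟨hab, a, Sym2.mem_mk_left a b, ha⟩
  have hYv1 : Rch Y1 u v := by
    refine Rch.restrict (p := fun y => Rch (Y.erase s(v, x)) u y) ?_ ?_ hY1 (Rch.refl _ _)
    · exact fun a b hab ha => ha.trans (Rch.single hab)
    · exact fun a b hab ha => mem_filter.2 ⟨hab, a, Sym2.mem_mk_left a b, ha⟩
  set Z := (H \ (X1 ∪ Y1)).erase s(v, x) with hZ
  have hZH : Z ⊆ H := (erase_subset _ _).trans sdiff_subset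
  have hZn : s(v, x) ∉ Z := notMem_erase _ _
  have hZX : Disjoint Z X1 := by
    refine disjoint_left.2 fun e he => ?_
    rw [hZ, mem_erase, Finset.mem_sdiff, mem_union] at he
    tauto
  have hZY : Disjoint Z Y1 := by
    refine disjoint_left.2 fun e he => ?_
    rw [hZ, mem_erase, Finset.mem_sdiff, mem_union] at he
    tauto
  have hXY : Disjoint X1 Y1 := disjoint_of_subset_left (hX1s.trans hXe)
    (disjoint_of_subset_right (hY1s.trans hYe) hd)
  have hX1H : X1 ⊆ H := (hX1s.trans hXe).trans hX
  have hY1H : Y1 ⊆ H := (hY1s.trans hYe).trans hY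
  by_contra hcon
  have hA : ∀ a, Rch Z a x → ¬Rch X1 u a ∧ ¬Rch Y1 u a := by
    intro a ha
    constructor
    · exact fun h => hcon (two_extend hX1H hY1H hZH hXY hZY he (fun h' => hXn (hX1s h')) hZn hYv1 h ha)
    · exact fun h => hcon (two_extend hY1H hX1H hZH hXY.symm hZX he (fun h' => hYn (hY1s h')) hZn hXv1 h ha)
  have hvx : Rch (H.erase s(v, x)) x v := ((jn_mk.1 (hH _ he))).symm
  have hZv : Rch Z v x := by
    refine Rch.closed (p := fun y => Rch Z y x) ?_ hvx (Rch.refl _ _)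
    intro a b hab ha
    rw [mem_erase] at hab
    have hna := hA a ha
    have hZab : s(a, b) ∈ Z := by
      grind
    exact (Rch.single hZab).symm.trans ha
  exact (hA v hZv).1 hXv1

lemma two_of_bless {H : EdgeSet} (hH : Bless H) {u v : ℕ} (h : Rch H u v) : Two u v H := by
  induction h with
  | refl => exact ⟨∅, ∅, by simp, by simp, by simp, Rch.refl _ _, Rch.refl _ _⟩
  | tail _ hxy ih => exact two_step hH ih hxy

lemma two_of_core {S : EdgeSet} {u v : ℕ} (h : Rch (core S) u v) : Two u v S := by
  obtain ⟨X, Y, hX, hY, hd, h1, h2⟩ := two_of_bless (bless_core S) h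
  exact ⟨X, Y, hX.trans (core_subset S), hY.trans (core_subset S), hd, h1, h2⟩

/-! ### Blocks and edge-connectivity classes -/

/-- The set `B` induces a `2`-connected graph. -/
def Bi (S : EdgeSet) (B : Finset ℕ) : Prop :=
  2 ≤ B.card ∧ Conn B (S ∩ KK B) ∧ ∀ v ∈ B, Conn (B.erase v) (S ∩ KK (B.erase v))

lemma Bi.mono {S T : EdgeSet} (h : S ⊆ T) {B : Finset ℕ} (hB : Bi S B) : Bi T B := by
  refine ⟨hB.1, fun a ha b hb => (hB.2.1 a ha b hb).mono (inter_subset_inter_right h),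
    fun v hv a ha b hb => (hB.2.2 v hv a ha b hb).mono (inter_subset_inter_right h)⟩

lemma rch_core_of_bi {S : EdgeSet} {B : Finset ℕ} (hB : Bi S B) (h3 : 3 ≤ B.card) :
    Conn B (core S) := by
  have hsub : S ∩ KK B ⊆ core S := by
    intro e he
    induction e with
    | _ x y =>
      rw [mem_inter, mem_KK] at he
      obtain ⟨hS, hx, hy, hxy⟩ := he
      rw [mem_core, jn_mk]
      refine ⟨hS, ?_⟩
      obtain ⟨z, hz⟩ : ((B.erase x).erase y).Nonempty := by
        rw [← card_pos, card_erase_of_mem (mem_erase.2 ⟨hxy.symm, hy⟩),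
          card_erase_of_mem hx]
        omega
      rw [mem_erase, mem_erase] at hz
      have h1 := hB.2.2 y hy x (mem_erase.2 ⟨hxy, hx⟩) z (mem_erase.2 ⟨hz.1, hz.2.2⟩)
      have h2 := hB.2.2 x hx z (mem_erase.2 hz.2) y (mem_erase.2 ⟨hxy.symm, hy⟩)
      have h4 : ∀ v ∈ s(x, y), S ∩ KK (B.erase v) ⊆ S.erase s(x, y) := by
        intro v hv e he
        rw [mem_inter] at he
        refine mem_erase.2 ⟨?_, he.1⟩
        rintro rfl
        have h5 := mem_KK.1 he.2
        grind
      exact (h1.mono (h4 y (Sym2.mem_mk_right _ _))).trans (h2.mono (h4 x (Sym2.mem_mk_left _ _)))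
  exact fun a ha b hb => (hB.2.1 a ha b hb).mono hsub

/-- The vertex `v` lies on a cycle. -/
def Cyc (v : ℕ) (S : EdgeSet) : Prop := ∃ u, u ≠ v ∧ s(v, u) ∈ S ∧ Rch (S.erase s(v, u)) v u

lemma Cyc.mono {v : ℕ} {S T : EdgeSet} (h : S ⊆ T) (hc : Cyc v S) : Cyc v T := by
  obtain ⟨u, hu, h1, h2⟩ := hc
  exact ⟨u, hu, h h1, h2.mono (erase_subset_erase _ h)⟩

/-- Two edge-disjoint cycles meet at a vertex of `U`. -/
def Bad (U : Finset ℕ) (S : EdgeSet) : Prop := ∃ v ∈ U, Box (Cyc v) (Cyc v) S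

open Classical in
lemma cyc_part {H : EdgeSet} (hH : Bless H) {v : ℕ} {A : Finset ℕ} (hvA : v ∉ A)
    {a : ℕ} (ha : a ∈ A) (hav : Rch H a v) (hloop : ∀ e ∈ H, ¬e.IsDiag)
    (hA : ∀ x y, s(x, y) ∈ H → x ∈ A → y = v ∨ y ∈ A) :
    Cyc v (H.filter fun e => ∃ x ∈ e, x ∈ A) := by
  classical
  set X := H.filter fun e => ∃ x ∈ e, x ∈ A with hX
  obtain ⟨u, hu, huv⟩ : ∃ u ∈ A, s(u, v) ∈ H := by
    by_contra hcon
    have : v ∈ A := by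
      refine Rch.closed (p := fun y => y ∈ A) ?_ hav ha
      grind
    exact hvA this
  have huv' : s(v, u) ∈ X :=
    mem_filter.2 ⟨Sym2.eq_swap ▸ huv, u, Sym2.mem_mk_right _ _, hu⟩
  refine ⟨u, ?_, huv', ?_⟩
  · rintro rfl
    exact hvA hu
  · have h1 : Rch (H.erase s(v, u)) u v := by
      have := hH _ huv
      rw [jn_mk] at this
      rwa [Sym2.eq_swap]
    have h2 : ∀ x, Rch (H.erase s(v, u)) u x →
        (x ∈ A ∧ Rch (X.erase s(v, u)) u x) ∨ Rch (X.erase s(v, u)) u v := by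
      intro x hx
      induction hx with
      | refl => exact Or.inl ⟨hu, Rch.refl _ _⟩
      | @tail b c _ hbc ih =>
        rcases ih with ⟨hb, hub⟩ | h
        · rw [mem_erase] at hbc
          have hm : s(b, c) ∈ X.erase s(v, u) :=
            mem_erase.2 ⟨hbc.1, mem_filter.2 ⟨hbc.2, b, Sym2.mem_mk_left _ _, hb⟩⟩
          have huc := hub.trans (Rch.single hm)
          grind
        · exact Or.inr h
    rcases h2 v h1 with h | h
    · exact absurd h.1 hvA
    · exact h.symm

lemma bi_of_not_bad {S : EdgeSet} {U : Finset ℕ} (hS : S ⊆ KK U) (hb : ¬Bad U S)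
    {v₀ : ℕ} (hv₀ : v₀ ∈ U) (h2 : 2 ≤ (cc (core S) U v₀).card) : Bi S (cc (core S) U v₀) := by
  classical
  have hcU : core S ⊆ KK U := (core_subset S).trans hS
  have hcc : ∀ x y, s(x, y) ∈ core S → x ∈ cc (core S) U v₀ → y ∈ cc (core S) U v₀ := by
    intro x y hxy hx
    rw [mem_cc] at hx ⊢
    exact ⟨(mem_KK.1 (hcU hxy)).2.1, hx.2.trans (Rch.single hxy)⟩
  have hCC : ∀ x ∈ cc (core S) U v₀, ∀ y ∈ cc (core S) U v₀, Rch (core S) x y := by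
    intro x hx y hy
    rw [mem_cc] at hx hy
    exact hx.2.symm.trans hy.2
  set C := cc (core S) U v₀ with hC
  have hCU : C ⊆ U := cc_subset _ _ _
  refine ⟨h2, fun a ha b hb => ?_, fun v hv a ha b hb' => ?_⟩
  · refine Rch.restrict (p := fun y => y ∈ C) hcc ?_ (hCC a ha b hb) ha
    intro x y hxy hx
    rw [mem_inter, mem_KK]
    exact ⟨core_subset S hxy, hx, hcc x y hxy hx, (mem_KK.1 (hcU hxy)).2.2⟩
  · by_contra hab
    refine hb ⟨v, hCU hv, ?_⟩
    rw [mem_erase] at ha hb'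
    have part : ∀ a ∈ C.erase v, ∀ x y, s(x, y) ∈ core S →
        x ∈ (C.erase v).filter (fun x => Rch (S ∩ KK (C.erase v)) a x) →
        y = v ∨ y ∈ (C.erase v).filter (fun x => Rch (S ∩ KK (C.erase v)) a x) := by
      intro a ha x y hxy hx
      rw [mem_filter] at hx ⊢
      by_cases hyv : y = v
      · exact Or.inl hyv
      · have hy : y ∈ C.erase v := mem_erase.2 ⟨hyv, hcc x y hxy (mem_erase.1 hx.1).2⟩
        refine Or.inr ⟨hy, hx.2.trans (Rch.single ?_)⟩
        rw [mem_inter, mem_KK]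
        exact ⟨core_subset S hxy, hx.1, hy, (mem_KK.1 (hcU hxy)).2.2⟩
    have hloop : ∀ e ∈ core S, ¬e.IsDiag := by
      intro e he
      induction e with
      | _ x y => exact fun h => (mem_KK.1 (hcU he)).2.2 (Sym2.mk_isDiag_iff.1 h)
    have hvn : ∀ a, v ∉ (C.erase v).filter (fun x => Rch (S ∩ KK (C.erase v)) a x) :=
      fun a h => notMem_erase _ _ (mem_filter.1 h).1
    have ca := cyc_part (bless_core S) (hvn a) (mem_filter.2
      ⟨mem_erase.2 ha, Rch.refl _ a⟩) (hCC a ha.2 v hv) hloop (part a (mem_erase.2 ha))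
    have cb := cyc_part (bless_core S) (hvn b) (mem_filter.2
      ⟨mem_erase.2 hb', Rch.refl _ b⟩) (hCC b hb'.2 v hv) hloop (part b (mem_erase.2 hb'))
    refine ⟨_, _, (filter_subset _ _).trans (core_subset S),
      (filter_subset _ _).trans (core_subset S), ?_, ca, cb⟩
    have hno : ∀ x, x ∈ (C.erase v).filter (fun x => Rch (S ∩ KK (C.erase v)) a x) →
        x ∉ (C.erase v).filter (fun x => Rch (S ∩ KK (C.erase v)) b x) := by
      intro x h1 h2
      exact hab ((mem_filter.1 h1).2.trans (mem_filter.1 h2).2.symm)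
    have hno2 : ∀ x y, s(x, y) ∈ core S →
        x ∈ (C.erase v).filter (fun x => Rch (S ∩ KK (C.erase v)) a x) →
        y ∉ (C.erase v).filter (fun x => Rch (S ∩ KK (C.erase v)) b x) := by
      intro x y hxy hx hy
      rcases part a (mem_erase.2 ha) x y hxy hx with rfl | h
      · exact hvn b hy
      · exact hno y h hy
    refine disjoint_left.2 fun e he1 he2 => ?_
    rw [mem_filter] at he1 he2
    obtain ⟨x, hx, hxA⟩ := he1.2
    obtain ⟨y, hy, hyB⟩ := he2.2
    have hxy : x ≠ y := by rintro rfl; exact hno x hxA hyB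
    have := (Sym2.mem_and_mem_iff hxy).1 ⟨hx, hy⟩
    exact hno2 x y (this ▸ he1.1) hxA hyB

/-- All blocks are smaller than `j`. -/
def SmallB (U : Finset ℕ) (j : ℕ) (S : EdgeSet) : Prop := ∀ B ⊆ U, Bi S B → B.card < j

lemma SmallB.anti {U : Finset ℕ} {j : ℕ} {S T : EdgeSet} (h : S ⊆ T) (hT : SmallB U j T) :
    SmallB U j S := fun B hB hBi => hT B hB (hBi.mono h)

lemma smallB_of_smallC {U : Finset ℕ} {j : ℕ} (hj : 3 ≤ j) {S : EdgeSet}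
    (h : SmallC U j (core S)) : SmallB U j S := by
  intro B hB hBi
  by_contra hcon
  have h3 := rch_core_of_bi hBi (by omega)
  obtain ⟨v, hv⟩ : B.Nonempty := card_pos.1 (by omega)
  have h4 := h v (hB hv)
  have h5 : B ⊆ cc (core S) U v := fun x hx => mem_cc.2 ⟨hB hx, h3 v hv x hx⟩
  have := card_le_card h5
  omega

lemma smallC_of_smallB {U : Finset ℕ} {j : ℕ} (hj : 2 ≤ j) {S : EdgeSet} (hS : S ⊆ KK U)
    (hb : ¬Bad U S) (h : SmallB U j S) : SmallC U j (core S) := by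
  intro v hv
  by_contra hcon
  exact hcon (h _ (cc_subset _ _ _) (bi_of_not_bad hS hb hv (by omega)))

/-- Probability that two given vertices are connected. -/
def tau (w : ℝ) (n : ℕ) : ℝ := (chi w n - 1) / (n - 1)

section
variable {w : ℝ} {U : Finset ℕ}

lemma ev_rch (hw : 0 ≤ w) {u v : ℕ} (hu : u ∈ U) (hv : v ∈ U) (huv : u ≠ v) :
    ev w U (fun S => ind (Rch S u v)) = tau w U.card := by
  classical
  have h1 : ∑ x ∈ U, ev w U (fun S => ind (Rch S u x)) = chi w U.card := by
    rw [← ev_sum, ← ev_card_cc hu]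
    refine ev_congr fun S _ => ?_
    rw [sum_ind]
    congr 1
  have h2 : ∀ x ∈ U.erase u, ev w U (fun S => ind (Rch S u x)) = ev w U (fun S => ind (Rch S u v)) := by
    intro x hx
    rw [mem_erase] at hx
    obtain ⟨σ, h3, h4, h5⟩ := exists_perm_apply₂ (U := U) (V := U) rfl hu hu hx.2 hv hx.1.symm huv
    have h6 := ev_map w U σ (fun S => ind (Rch S u v))
    rw [h3] at h6
    rw [h6]
    refine ev_congr fun S _ => ind_congr ?_
    rw [← Rch.map_iff σ, h4, h5]
  rw [← add_sum_erase U _ hu, sum_congr rfl h2, sum_const, nsmul_eq_mul,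
    card_erase_of_mem hu] at h1
  have h7 : ev w U (fun S => ind (Rch S u u)) = 1 := by
    rw [← ev_const (U := U) hw 1]
    exact ev_congr fun S _ => ind_true (Rch.refl _ _)
  have h8 : 1 < U.card := one_lt_card.2 ⟨u, hu, v, hv, huv⟩
  have h9 : (1 : ℝ) < U.card := by exact_mod_cast h8
  rw [h7, Nat.cast_sub h8.le, Nat.cast_one] at h1
  rw [tau, eq_div_iff (by linarith)]
  linarith

lemma tau_nonneg (hw : 0 ≤ w) {n : ℕ} (hn : 2 ≤ n) : 0 ≤ tau w n := by
  have := ev_rch (U := range n) hw (u := 0) (v := 1) (by simp; omega) (by simp; omega) (by omega)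
  rw [card_range] at this
  rw [← this]
  exact ev_nonneg hw fun S _ => ind_nonneg _

lemma ev_core_le (hw : 0 ≤ w) (hw1 : w ≤ 1) {u v : ℕ} (hu : u ∈ U) (hv : v ∈ U) (huv : u ≠ v) :
    ev w U (fun S => ind (Rch (core S) u v)) ≤ tau w U.card ^ 2 := by
  have hm : Monotone fun X : EdgeSet => Rch X u v := fun X Y h hr => Rch.mono h hr
  have h1 := ev_box (U := U) hw hw1 _ _ hm hm
  rw [ev_rch hw hu hv huv] at h1
  rw [sq]
  exact (ev_ind_mono hw fun S _ h => two_of_core h).trans h1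

lemma not_smallC_le {j : ℕ} (S : EdgeSet) :
    ind (¬SmallC U j S) * (j * (j - 1)) ≤ ∑ u ∈ U, ∑ v ∈ U.erase u, ind (Rch S u v) := by
  classical
  have hnn : 0 ≤ ∑ u ∈ U, ∑ v ∈ U.erase u, ind (Rch S u v) :=
    sum_nonneg fun _ _ => sum_nonneg fun _ _ => ind_nonneg _
  by_cases h : SmallC U j S
  · rw [ind_false (not_not.2 h), zero_mul]; exact hnn
  · rw [ind_true h, one_mul]
    simp only [SmallC, not_forall, not_lt] at h
    obtain ⟨v, hv, hj⟩ := h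
    rcases Nat.eq_zero_or_pos j with rfl | hj0
    · simpa using hnn
    have hC : cc S U v ⊆ U := cc_subset _ _ _
    have h1 : ∑ u ∈ cc S U v, ∑ x ∈ (cc S U v).erase u, ind (Rch S u x) =
        (cc S U v).card * ((cc S U v).card - 1) := by
      rw [← nsmul_eq_mul, ← sum_const]
      refine sum_congr rfl fun u hu => ?_
      have h2 : ∀ x ∈ (cc S U v).erase u, ind (Rch S u x) = 1 := fun x hx =>
        ind_true ((mem_cc.1 hu).2.symm.trans (mem_cc.1 (mem_of_mem_erase hx)).2)
      rw [sum_congr rfl h2, sum_const, nsmul_eq_mul, mul_one,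
        card_erase_of_mem hu, Nat.cast_sub (by omega), Nat.cast_one]
    have hj' : (j : ℝ) ≤ (cc S U v).card := by exact_mod_cast hj
    have hj1 : (1 : ℝ) ≤ j := by exact_mod_cast hj0
    calc (j : ℝ) * (j - 1) ≤ (cc S U v).card * ((cc S U v).card - 1) :=
          mul_le_mul hj' (by linarith) (by linarith) (by linarith)
      _ = ∑ u ∈ cc S U v, ∑ x ∈ (cc S U v).erase u, ind (Rch S u x) := h1.symm
      _ ≤ ∑ u ∈ cc S U v, ∑ x ∈ U.erase u, ind (Rch S u x) :=
          sum_le_sum fun u _ => sum_le_sum_of_subset_of_nonneg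
            (erase_subset_erase _ hC) fun _ _ _ => ind_nonneg _
      _ ≤ _ := sum_le_sum_of_subset_of_nonneg hC fun _ _ _ =>
            sum_nonneg fun _ _ => ind_nonneg _

lemma ev_not_smallC (hw : 0 ≤ w) (hw1 : w ≤ 1) (j : ℕ) :
    ev w U (fun S => ind (¬SmallC U j (core S))) * (j * (j - 1)) ≤
      U.card * (U.card - 1) * tau w U.card ^ 2 := by
  rw [← ev_mul_right]
  refine (ev_mono hw fun S _ => not_smallC_le (core S)).trans ?_
  simp only [ev_sum]
  have h1 : ∀ u ∈ U, ∑ v ∈ U.erase u, ev w U (fun S => ind (Rch (core S) u v)) ≤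
      (U.card - 1) * tau w U.card ^ 2 := by
    intro u hu
    refine (sum_le_sum fun v hv => ev_core_le hw hw1 hu (mem_of_mem_erase hv)
      (ne_of_mem_erase hv).symm).trans ?_
    rw [sum_const, nsmul_eq_mul, card_erase_of_mem hu,
      Nat.cast_sub (card_pos.2 ⟨u, hu⟩), Nat.cast_one]
  refine (sum_le_sum h1).trans ?_
  rw [sum_const, nsmul_eq_mul, mul_assoc]

lemma ev_edge_cycle (hw : 0 ≤ w) {u v : ℕ} (hu : u ∈ U) (hv : v ∈ U) (huv : u ≠ v) :
    ev w U (fun S => ind (s(v, u) ∈ S ∧ Rch (S.erase s(v, u)) v u)) ≤ w * tau w U.card := by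
  rw [← ev_rch hw hv hu huv.symm, ev, ev]
  have hm : s(v, u) ∈ KK U := mem_KK.2 ⟨hv, hu, huv.symm⟩
  have hn : s(v, u) ∉ (KK U).erase s(v, u) := notMem_erase _ _
  rw [← mul_div_assoc]
  refine div_le_div_of_nonneg_right ?_ (by positivity)
  conv_lhs => rw [← insert_erase hm]
  conv_rhs => rw [← insert_erase hm]
  rw [ws_insert w hn, ws_insert w hn]
  have h0 : ws w ((KK U).erase s(v, u)) (fun S => ind (s(v, u) ∈ S ∧ Rch (S.erase s(v, u)) v u)) = 0 := by
    have : ∀ S ⊆ (KK U).erase s(v, u), ind (s(v, u) ∈ S ∧ Rch (S.erase s(v, u)) v u) = (0 : ℝ) :=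
      fun S hS => ind_false fun h => hn (hS h.1)
    rw [ws_congr this, ws_const, mul_zero]
  have h1 : ws w ((KK U).erase s(v, u)) (fun S => ind (s(v, u) ∈ insert s(v, u) S ∧
      Rch ((insert s(v, u) S).erase s(v, u)) v u)) =
      ws w ((KK U).erase s(v, u)) (fun S => ind (Rch S v u)) := by
    refine ws_congr fun S hS => ind_congr ?_
    rw [erase_insert fun h => hn (hS h)]
    simp
  rw [h0, h1, zero_add, mul_add]
  have h2 : 0 ≤ ws w ((KK U).erase s(v, u)) (fun S => ind (Rch (insert s(v, u) S) v u)) :=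
    ws_nonneg hw fun _ _ => ind_nonneg _
  have h3 := mul_nonneg hw (mul_nonneg hw h2)
  linarith

lemma ev_cyc (hw : 0 ≤ w) {v : ℕ} (hv : v ∈ U) :
    ev w U (fun S => ind (Cyc v S)) ≤ (U.card - 1) * (w * tau w U.card) := by
  classical
  have h1 : ∀ S ⊆ KK U, ind (Cyc v S) ≤
      ∑ u ∈ U.erase v, ind (s(v, u) ∈ S ∧ Rch (S.erase s(v, u)) v u) := by
    intro S hS
    refine (ind_mono ?_).trans (ind_exists_le _ _)
    rintro ⟨u, hu, h2, h3⟩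
    exact ⟨u, mem_erase.2 ⟨hu, (mem_KK.1 (hS h2)).2.1⟩, h2, h3⟩
  refine (ev_mono hw h1).trans ?_
  rw [ev_sum]
  refine (sum_le_sum fun u hu => ev_edge_cycle hw (mem_of_mem_erase hu) hv
    (ne_of_mem_erase hu)).trans ?_
  rw [sum_const, nsmul_eq_mul, card_erase_of_mem hv,
      Nat.cast_sub (card_pos.2 ⟨v, hv⟩), Nat.cast_one]

lemma ev_bad (hw : 0 ≤ w) (hw1 : w ≤ 1) :
    ev w U (fun S => ind (Bad U S)) ≤ U.card * ((U.card - 1) * (w * tau w U.card)) ^ 2 := by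
  classical
  refine (ev_mono hw fun S _ => ind_exists_le U _).trans ?_
  rw [ev_sum, ← nsmul_eq_mul, ← sum_const]
  refine sum_le_sum fun v hv => ?_
  have hm : Monotone (Cyc v) := fun X Y h hr => Cyc.mono h hr
  refine (ev_box hw hw1 _ _ hm hm).trans ?_
  rw [sq]
  have h0 : 0 ≤ ev w U (fun S => ind (Cyc v S)) := ev_nonneg hw fun S _ => ind_nonneg _
  exact mul_le_mul (ev_cyc hw hv) (ev_cyc hw hv) h0 (h0.trans (ev_cyc hw hv))

end

/-- Connected and bridgeless. -/
def CB (U : Finset ℕ) (H : EdgeSet) : Prop := Conn U H ∧ Bless H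

/-- The number of connected bridgeless graphs on `b` vertices with `m` edges. -/
def nn (b m : ℕ) : ℝ :=
  ws 1 (KK (range b)) fun H => ind (H.card = m ∧ CB (range b) H)

lemma nn_eq (U : Finset ℕ) (m : ℕ) : ws 1 (KK U) (fun H => ind (H.card = m ∧ CB U H)) = nn U.card m := by
  obtain ⟨σ, hσ⟩ := exists_perm (U := U) (V := range U.card) (by simp)
  rw [nn, ← hσ, KK_map, ws_map]
  refine ws_congr fun S hS => ind_congr ?_
  rw [card_map]
  exact and_congr Iff.rfl (conn_bless_map U S σ).symm

lemma nn_nonneg (b m : ℕ) : 0 ≤ nn b m := ws_nonneg zero_le_one fun _ _ => ind_nonneg _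

lemma th_eq_nn (w : ℝ) (b : ℕ) :
    th w b = ∑ m ∈ range ((b.choose 2) + 1), w ^ m * nn b m := by
  rw [th, theta, ws]
  simp only [nn, ws, one_pow, one_mul, mul_sum]
  rw [sum_comm]
  refine sum_congr rfl fun H hH => ?_
  have hc : H.card ∈ range ((b.choose 2) + 1) := by
    have := card_le_card (mem_powerset.1 hH)
    rw [card_KK, card_range] at this
    exact mem_range.2 (by omega)
  rw [sum_eq_single_of_mem _ hc]
  · congr 1
    exact ind_congr (by simp [CB])
  · intro m _ hm
    rw [ind_false (fun h => hm h.1.symm), mul_zero]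

lemma rch_isolated {T : EdgeSet} {v : ℕ} (hT : ∀ z, s(v, z) ∉ T) {b : ℕ} :
    Rch T v b ↔ b = v := by
  constructor
  · intro h
    exact Rch.closed (p := fun z => z = v) (fun x y hxy hx => absurd hxy (hx ▸ hT y)) h rfl
  · rintro rfl
    exact Rch.refl _ _

lemma rch_path {T : EdgeSet} {v x y a b : ℕ} (hT : ∀ z, s(v, z) ∉ T) (hx : x ≠ v)
    (hy : y ≠ v) (ha : a ≠ v) (hb : b ≠ v) :
    Rch (insert s(v, x) (insert s(v, y) T)) a b ↔ Rch (insert s(x, y) T) a b := by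
  have h1 : ∀ c, c ≠ v → ¬Rch T v c := fun c hc h => hc ((rch_isolated hT).1 h)
  have h2 : ∀ c, c ≠ v → ¬Rch T c v := fun c hc h => h1 c hc h.symm
  have h3 : Rch T v v := Rch.refl _ _
  simp only [Rch.insert_iff, h1 _ hx, h1 _ hy, h1 _ hb, h2 _ hx, h2 _ hy, h2 _ ha, h3]
  tauto

lemma not_mem_of_KK {U : Finset ℕ} {S : EdgeSet} (hS : S ⊆ KK U) {v : ℕ} (hv : v ∉ U)
    (z : ℕ) : s(v, z) ∉ S := fun h => hv (mem_KK.1 (hS h)).1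

lemma cb_path {U : Finset ℕ} {S : EdgeSet} (hS : S ⊆ KK U) {v x y : ℕ} (hv : v ∉ U)
    (hx : x ∈ U) (hy : y ∈ U) (hxy : x ≠ y) :
    CB (insert v U) (insert s(v, x) (insert s(v, y) S)) ↔
      Conn U (insert s(x, y) S) ∧ Rch S x y ∧ ∀ f ∈ S, Jn (insert s(x, y) (S.erase f)) f := by
  have hne : ∀ a ∈ U, a ≠ v := fun a ha h => hv (h ▸ ha)
  have hvS := not_mem_of_KK hS hv
  have hvE : ∀ f z, s(v, z) ∉ S.erase f := fun f z h => hvS z (mem_of_mem_erase h)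
  rw [CB]
  refine and_congr ?_ ?_
  · constructor
    · intro h a ha b hb
      exact (rch_path hvS (hne x hx) (hne y hy) (hne a ha) (hne b hb)).1
        (h a (mem_insert_of_mem ha) b (mem_insert_of_mem hb))
    · intro h
      have h0 : ∀ a ∈ insert v U, Rch (insert s(v, x) (insert s(v, y) S)) a x := by
        intro a ha
        rcases mem_insert.1 ha with rfl | ha
        · exact Rch.single (mem_insert_self _ _)
        · exact (rch_path hvS (hne x hx) (hne y hy) (hne a ha) (hne x hx)).2 (h a ha x hx)
      intro a ha b hb
      exact (h0 a ha).trans (h0 b hb).symm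
  · have hvx : ∀ x y : ℕ, x ∈ U → y ∈ U → x ≠ y →
        (Jn ((insert s(v, x) (insert s(v, y) S)).erase s(v, x)) s(v, x) ↔ Rch S x y) := by
      intro x y hx hy hxy
      have h1 : s(v, x) ∉ insert s(v, y) S := by
        grind
      rw [erase_insert h1, jn_mk, Rch.insert_iff]
      have h2 : ¬Rch S v x := fun h => hne x hx ((rch_isolated hvS).1 h)
      have h3 : Rch S v v := Rch.refl _ _
      simp only [h2, h3, false_or, true_and, and_false, or_false]
      exact Rch.comm
    have hf : ∀ f ∈ S, (Jn ((insert s(v, x) (insert s(v, y) S)).erase f) f ↔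
        Jn (insert s(x, y) (S.erase f)) f) := by
      intro f hf
      have h1 : ∀ z, s(v, z) ≠ f := fun z h => hvS z (h ▸ hf)
      rw [erase_insert_of_ne (h1 _), erase_insert_of_ne (h1 _)]
      induction f with
      | _ c d =>
        have hcd := mem_KK.1 (hS hf)
        rw [jn_mk, jn_mk]
        exact rch_path (hvE _) (hne x hx) (hne y hy) (hne c hcd.1) (hne d hcd.2.1)
    constructor
    · intro h
      refine ⟨(hvx x y hx hy hxy).1 (h _ (mem_insert_self _ _)), fun f hf' => ?_⟩
      exact (hf f hf').1 (h f (mem_insert_of_mem (mem_insert_of_mem hf')))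
    · rintro ⟨h1, h2⟩ f hf'
      rcases mem_insert.1 hf' with rfl | hf'
      · exact (hvx x y hx hy hxy).2 h1
      rcases mem_insert.1 hf' with rfl | hf'
      · rw [insert_comm]
        exact (hvx y x hy hx hxy.symm).2 h1.symm
      · exact (hf f hf').2 (h2 f hf')

lemma cb_path_of_not_mem {U : Finset ℕ} {S : EdgeSet} (hS : S ⊆ KK U) {v x y : ℕ} (hv : v ∉ U)
    (hx : x ∈ U) (hy : y ∈ U) (hxy : x ≠ y) (h : s(x, y) ∉ S) :
    CB (insert v U) (insert s(v, x) (insert s(v, y) S)) ↔ CB U (insert s(x, y) S) := by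
  rw [cb_path hS hv hx hy hxy, CB]
  refine and_congr Iff.rfl ?_
  have hf : ∀ f ∈ S, (insert s(x, y) S).erase f = insert s(x, y) (S.erase f) := fun f hf =>
    erase_insert_of_ne fun h' => h (h' ▸ hf)
  constructor
  · rintro ⟨h1, h2⟩ f hf'
    rcases mem_insert.1 hf' with rfl | hf'
    · rw [erase_insert h]; exact jn_mk.2 h1
    · rw [hf f hf']; exact h2 f hf'
  · intro h1
    refine ⟨?_, fun f hf' => ?_⟩
    · have := h1 _ (mem_insert_self _ _)
      rwa [erase_insert h, jn_mk] at this
    · have := h1 f (mem_insert_of_mem hf')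
      rwa [hf f hf'] at this

lemma cb_path_of_mem {U : Finset ℕ} {S : EdgeSet} (hS : S ⊆ KK U) {v x y : ℕ} (hv : v ∉ U)
    (hx : x ∈ U) (hy : y ∈ U) (hxy : x ≠ y) (h : s(x, y) ∈ S)
    (hc : CB (insert v U) (insert s(v, x) (insert s(v, y) S))) :
    CB U S ∨ (Conn U S ∧ Bless (S.erase s(x, y)) ∧ ¬Rch (S.erase s(x, y)) x y) := by
  rw [cb_path hS hv hx hy hxy, insert_eq_of_mem h] at hc
  obtain ⟨h1, h2, h3⟩ := hc
  have h4 : ∀ f ∈ S, f ≠ s(x, y) → Jn (S.erase f) f := by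
    grind
  by_cases hb : Rch (S.erase s(x, y)) x y
  · left
    refine ⟨h1, fun f hf => ?_⟩
    by_cases hne : f = s(x, y)
    · subst hne; exact jn_mk.2 hb
    · exact h4 f hf hne
  · right
    refine ⟨h1, fun f hf => ?_, hb⟩
    obtain ⟨hne, hf'⟩ := mem_erase.1 hf
    have h5 := h4 f hf' hne
    refine jn_drop (b := s(x, y)) ?_ ?_
    · have : insert s(x, y) ((S.erase s(x, y)).erase f) = S.erase f := by
        grind
      rwa [this]
    · rw [insert_erase hf, jn_mk]; exact hb

/-- Degree. -/
def dg (v : ℕ) (H : EdgeSet) : ℕ := (H.filter fun e => v ∈ e).card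

lemma sum_dg {W : Finset ℕ} {H : EdgeSet} (hH : H ⊆ KK W) : ∑ v ∈ W, dg v H = 2 * H.card := by
  simp only [dg, card_filter]
  rw [sum_comm, mul_comm, ← smul_eq_mul, ← sum_const]
  refine sum_congr rfl fun e he => ?_
  have he := hH he
  induction e with
  | _ a b =>
    obtain ⟨ha, hb, hab⟩ := mem_KK.1 he
    rw [← card_filter, ← card_pair hab]
    congr 1
    grind

lemma exists_edge_of_rch {S : EdgeSet} {v u : ℕ} (h : Rch S v u) (hne : u ≠ v) :
    ∃ x, s(v, x) ∈ S := by
  by_contra hcon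
  push Not at hcon
  exact hne ((rch_isolated hcon).1 h)

lemma two_le_dg {W : Finset ℕ} {H : EdgeSet} (hH : H ⊆ KK W) (hc : CB W H) (hW : 2 ≤ W.card)
    {v : ℕ} (hv : v ∈ W) : 2 ≤ dg v H := by
  obtain ⟨u, hu, hne⟩ := exists_mem_ne (by omega : 1 < W.card) v
  obtain ⟨x, hx⟩ := exists_edge_of_rch (hc.1 v hv u hu) hne
  have h1 := hc.2 _ hx
  rw [jn_mk] at h1
  obtain ⟨y, hy⟩ := exists_edge_of_rch h1 (mem_KK.1 (hH hx)).2.2.symm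
  obtain ⟨h2, h3⟩ := mem_erase.1 hy
  refine one_lt_card.2 ⟨_, mem_filter.2 ⟨hx, by simp⟩, _,
    mem_filter.2 ⟨h3, by simp⟩, h2.symm⟩

lemma three_mul_le {W : Finset ℕ} {H : EdgeSet} (hH : H ⊆ KK W) (hc : CB W H)
    (hW : 2 ≤ W.card) : (3 * W.card - 2 * H.card : ℝ) ≤ ∑ v ∈ W, ind (dg v H = 2) := by
  have h1 : (∑ v ∈ W, dg v H : ℝ) = 2 * H.card := by exact_mod_cast sum_dg hH
  have h2 : ∑ v ∈ W, (3 - ind (dg v H = 2)) ≤ ∑ v ∈ W, (dg v H : ℝ) := by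
    refine sum_le_sum fun v hv => ?_
    have h3 := two_le_dg hH hc hW hv
    by_cases h : dg v H = 2
    · rw [ind_true h, h]; norm_num
    · rw [ind_false h]
      have : (3 : ℝ) ≤ dg v H := by exact_mod_cast (by omega : 3 ≤ dg v H)
      linarith
  rw [sum_sub_distrib, sum_const, nsmul_eq_mul] at h2
  linarith

lemma dg_union {U : Finset ℕ} {S T : EdgeSet} {v : ℕ} (hS : S ⊆ KK U) (hv : v ∉ U)
    (hT : T ⊆ starE v U) : dg v (S ∪ T) = T.card := by
  rw [dg]
  congr 1
  ext e
  induction e with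
  | _ a b =>
    simp only [mem_filter, mem_union, Sym2.mem_iff]
    constructor
    · rintro ⟨h1 | h1, h2⟩
      · have := mem_KK.1 (hS h1)
        grind
      · exact h1
    · intro h
      refine ⟨Or.inr h, ?_⟩
      rcases mem_starE.1 (hT h) with h' | h'
      · exact Or.inl h'.1.symm
      · exact Or.inr h'.1.symm

/-- The two edges joining `v` to the ends of `e`. -/
def vv (v : ℕ) (e : Sym2 ℕ) : EdgeSet := e.toFinset.image fun z => s(v, z)

lemma vv_mk (v x y : ℕ) : vv v s(x, y) = {s(v, x), s(v, y)} := by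
  rw [vv, Sym2.toFinset_mk_eq]
  simp

lemma star_edge_injective (v : ℕ) : Function.Injective fun z : ℕ => s(v, z) := by
  intro a b h
  grind

lemma sum_star_two {U : Finset ℕ} {v : ℕ} (hv : v ∉ U) (f : EdgeSet → ℝ) :
    ∑ T ∈ (starE v U).powerset, ind (T.card = 2) * f T = ∑ e ∈ KK U, f (vv v e) := by
  have h1 : (starE v U).powersetCard 2 = (KK U).image (vv v) := by
    ext T
    simp only [mem_powersetCard, mem_image]
    constructor
    · rintro ⟨hT, hc⟩
      obtain ⟨T', hT', rfl⟩ := subset_image_iff.1 (show T ⊆ U.image fun z => s(v, z) from hT)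
      rw [card_image_of_injective _ (star_edge_injective v), card_eq_two] at hc
      obtain ⟨x, y, hxy, rfl⟩ := hc
      refine ⟨s(x, y), mem_KK.2 ⟨hT' (by simp), hT' (by simp), hxy⟩, ?_⟩
      rw [vv_mk]; simp
    · rintro ⟨e, he, rfl⟩
      induction e with
      | _ x y =>
        obtain ⟨hx, hy, hxy⟩ := mem_KK.1 he
        rw [vv_mk]
        constructor
        · intro e he
          rcases mem_insert.1 he with rfl | he
          · exact mem_starE.2 (Or.inl ⟨rfl, hx⟩)
          · rw [mem_singleton.1 he]
            exact mem_starE.2 (Or.inl ⟨rfl, hy⟩)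
        grind
  have h2 : ∑ T ∈ (starE v U).powerset, ind (T.card = 2) * f T =
      ∑ T ∈ (starE v U).powersetCard 2, f T := by
    rw [← sum_subset (s₁ := (starE v U).powersetCard 2) (fun T hT => mem_powerset.2 (mem_powersetCard.1 hT).1)]
    · refine sum_congr rfl fun T hT => ?_
      rw [ind_true (mem_powersetCard.1 hT).2, one_mul]
    · intro T hT hT'
      rw [ind_false, zero_mul]
      grind
  rw [h2, h1, sum_image]
  intro e he e' he' h
  have h3 : e.toFinset = e'.toFinset := image_injective (star_edge_injective v) h
  exact Sym2.ext fun z => by rw [← Sym2.mem_toFinset, h3, Sym2.mem_toFinset]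

/-- Graphs in which `v` has degree two. -/
def A2 (U : Finset ℕ) (v m : ℕ) : ℝ :=
  ∑ S ∈ (KK U).powerset, ∑ e ∈ KK U, ind (S.card + 2 = m ∧ CB (insert v U) (vv v e ∪ S))

lemma A2_eq {U : Finset ℕ} {v : ℕ} (hv : v ∉ U) (m : ℕ) :
    ws 1 (KK (insert v U)) (fun H => ind (H.card = m ∧ CB (insert v U) H) * ind (dg v H = 2)) = A2 U v m := by
  rw [KK_insert hv, ws_union _ (disjoint_KK_starE hv), A2]
  simp only [ws, one_pow, one_mul]
  refine sum_congr rfl fun S hS => ?_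
  have hS := mem_powerset.1 hS
  rw [← sum_star_two hv (fun T => ind (S.card + 2 = m ∧ CB (insert v U) (T ∪ S)))]
  refine sum_congr rfl fun T hT => ?_
  have hT := mem_powerset.1 hT
  rw [dg_union hS hv hT, mul_comm, union_comm T]
  refine ind_mul_congr fun h2 => ?_
  rw [card_union_of_disjoint ((disjoint_KK_starE hv).mono hS hT), h2]

lemma nn_mul_le (W : Finset ℕ) (hW : 2 ≤ W.card) (m : ℕ) :
    (3 * W.card - 2 * m : ℝ) * nn W.card m ≤ ∑ v ∈ W, A2 (W.erase v) v m := by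
  have h1 : ∀ v ∈ W, A2 (W.erase v) v m =
      ws 1 (KK W) (fun H => ind (H.card = m ∧ CB W H) * ind (dg v H = 2)) := by
    intro v hv
    have := A2_eq (notMem_erase v W) m
    simp_all
  rw [sum_congr rfl h1, ← ws_sum, ← nn_eq, ← ws_mul_left]
  refine ws_mono zero_le_one fun H hH => ?_
  rw [← mul_sum, mul_comm]
  by_cases h : H.card = m ∧ CB W H
  · rw [ind_true h, one_mul, one_mul, ← h.1]
    exact three_mul_le hH h.2 hW
  · rw [ind_false h, zero_mul, zero_mul]

lemma nn_mul_eq (W : Finset ℕ) (hW : 2 ≤ W.card) :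
    (W.card : ℝ) * nn W.card W.card = ∑ v ∈ W, A2 (W.erase v) v W.card := by
  have h1 : ∀ v ∈ W, A2 (W.erase v) v W.card =
      ws 1 (KK W) (fun H => ind (H.card = W.card ∧ CB W H) * ind (dg v H = 2)) := by
    intro v hv
    have := A2_eq (notMem_erase v W) W.card
    simp_all
  rw [sum_congr rfl h1, ← ws_sum, ← nn_eq, ← ws_mul_left]
  refine ws_congr fun H hH => ?_
  rw [← mul_sum, mul_comm]
  refine ind_mul_congr fun h => ?_
  have h2 := sum_dg hH
  have h3 : ∀ v ∈ W, dg v H = 2 := by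
    have h4 : ∑ v ∈ W, 2 = ∑ v ∈ W, dg v H := by
      rw [h2, h.1, sum_const, smul_eq_mul, mul_comm]
    intro v hv
    exact ((sum_eq_sum_iff_of_le fun v hv => two_le_dg hH h.2 hW hv).1 h4 v hv).symm
  rw [sum_congr rfl fun v hv => ind_true (h3 v hv), sum_const, nsmul_eq_mul, mul_one]

lemma card_le_of_cb {U : Finset ℕ} {H : EdgeSet} (hH : H ⊆ KK U) (hc : CB U H) :
    U.card ≤ H.card + 1 := by
  by_cases hU : 2 ≤ U.card
  · have h1 := sum_dg hH
    have h2 : ∑ v ∈ U, 2 ≤ ∑ v ∈ U, dg v H := sum_le_sum fun v hv => two_le_dg hH hc hU hv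
    rw [sum_const, smul_eq_mul, h1] at h2
    omega
  · omega

lemma sum_insert_edge {α : Type*} [DecidableEq α] (A : Finset α) (f : Finset α → α → ℝ) :
    ∑ S ∈ A.powerset, ∑ e ∈ A, ind (e ∉ S) * f (insert e S) e =
      ∑ H ∈ A.powerset, ∑ e ∈ A, ind (e ∈ H) * f H e := by
  rw [sum_comm, sum_comm (s := A.powerset) (t := A)]
  refine sum_congr rfl fun e he => ?_
  have hA : A = insert e (A.erase e) := (insert_erase he).symm
  rw [hA, sum_powerset_insert (notMem_erase e A),
    sum_powerset_insert (notMem_erase e A)]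
  have h1 : ∀ S ∈ (A.erase e).powerset, e ∉ S := fun S hS h =>
    notMem_erase e A (mem_powerset.1 hS h)
  rw [sum_congr rfl fun S hS => by rw [ind_true (h1 S hS), one_mul],
    sum_eq_zero (s := (A.erase e).powerset) (f := fun S => ind (e ∉ insert e S) * f (insert e (insert e S)) e)
      fun S hS => by rw [ind_false (fun h => h (mem_insert_self _ _)), zero_mul],
    sum_eq_zero (s := (A.erase e).powerset) (f := fun S => ind (e ∈ S) * f S e)
      fun S hS => by rw [ind_false (h1 S hS), zero_mul],
    zero_add, add_zero]
  exact sum_congr rfl fun S hS => by rw [ind_true (mem_insert_self e S), one_mul]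

lemma sum_ind_mem {α : Type*} [DecidableEq α] {A H : Finset α} (hH : H ⊆ A) :
    ∑ e ∈ A, ind (e ∈ H) = H.card := by
  rw [sum_ind, filter_mem_eq_inter, inter_eq_right.2 hH]

lemma sum_cb_mem (U : Finset ℕ) (m : ℕ) :
    ∑ H ∈ (KK U).powerset, ∑ e ∈ KK U, ind (e ∈ H) * ind (H.card = m ∧ CB U H) = m * nn U.card m := by
  rw [← nn_eq, ws, mul_sum]
  refine sum_congr rfl fun H hH => ?_
  rw [← sum_mul, sum_ind_mem (mem_powerset.1 hH), mul_comm, one_pow, one_mul, mul_comm (m : ℝ)]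
  exact ind_mul_congr fun h => by rw [h.1]

/-- Weight of the configurations in which the chord is a bridge. -/
def SS (U : Finset ℕ) (m : ℕ) : ℝ :=
  ∑ R ∈ (KK U).powerset, ∑ e ∈ KK U,
    ind (e ∉ R) * ind (R.card + 3 = m ∧ Conn U (insert e R) ∧ Bless R ∧ ¬Jn R e)

lemma cb_vv_of_not_mem {U : Finset ℕ} {S : EdgeSet} (hS : S ⊆ KK U) {v : ℕ} (hv : v ∉ U)
    {e : Sym2 ℕ} (he : e ∈ KK U) (h : e ∉ S) :
    CB (insert v U) (vv v e ∪ S) ↔ CB U (insert e S) := by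
  induction e with
  | _ x y =>
    obtain ⟨hx, hy, hxy⟩ := mem_KK.1 he
    rw [vv_mk, insert_union, singleton_union]
    exact cb_path_of_not_mem hS hv hx hy hxy h

lemma cb_vv_of_mem {U : Finset ℕ} {S : EdgeSet} (hS : S ⊆ KK U) {v : ℕ} (hv : v ∉ U)
    {e : Sym2 ℕ} (he : e ∈ KK U) (h : e ∈ S) (hc : CB (insert v U) (vv v e ∪ S)) :
    CB U S ∨ (Conn U S ∧ Bless (S.erase e) ∧ ¬Jn (S.erase e) e) := by
  induction e with
  | _ x y =>
    obtain ⟨hx, hy, hxy⟩ := mem_KK.1 he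
    rw [vv_mk, insert_union, singleton_union] at hc
    rw [jn_mk]
    exact cb_path_of_mem hS hv hx hy hxy h hc

lemma sum_not_mem (U : Finset ℕ) {v : ℕ} (hv : v ∉ U) (m : ℕ) :
    ∑ S ∈ (KK U).powerset, ∑ e ∈ KK U,
      ind (e ∉ S) * ind (S.card + 2 = m + 1 ∧ CB (insert v U) (vv v e ∪ S)) = m * nn U.card m := by
  rw [← sum_cb_mem, ← sum_insert_edge (KK U) fun H e => ind (H.card = m ∧ CB U H)]
  refine sum_congr rfl fun S hS => sum_congr rfl fun e he => ind_mul_congr fun h => ?_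
  refine ind_congr ?_
  rw [cb_vv_of_not_mem (mem_powerset.1 hS) hv he h, card_insert_of_notMem h]
  refine and_congr ?_ Iff.rfl
  omega

lemma le_A2 (U : Finset ℕ) {v : ℕ} (hv : v ∉ U) (m : ℕ) : m * nn U.card m ≤ A2 U v (m + 1) := by
  rw [← sum_not_mem U hv, A2]
  refine sum_le_sum fun S hS => sum_le_sum fun e he => ?_
  exact mul_le_of_le_one_left (ind_nonneg _) (ind_le_one _)

lemma A2_le (U : Finset ℕ) {v : ℕ} (hv : v ∉ U) (m : ℕ) :
    A2 U v (m + 2) ≤ (m + 1 : ℕ) * nn U.card (m + 1) + (m * nn U.card m + SS U (m + 2)) := by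
  have h1 : SS U (m + 2) = ∑ H ∈ (KK U).powerset, ∑ e ∈ KK U, ind (e ∈ H) *
      ind (H.card + 2 = m + 2 ∧ Conn U H ∧ Bless (H.erase e) ∧ ¬Jn (H.erase e) e) := by
    rw [SS, ← sum_insert_edge (KK U) fun H e =>
      ind (H.card + 2 = m + 2 ∧ Conn U H ∧ Bless (H.erase e) ∧ ¬Jn (H.erase e) e)]
    refine sum_congr rfl fun S hS => sum_congr rfl fun e he => ind_mul_congr fun h => ?_
    rw [erase_insert h, card_insert_of_notMem h]
  rw [h1, ← sum_cb_mem U m, ← sum_not_mem U hv (m + 1), A2]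
  simp only [← sum_add_distrib]
  refine sum_le_sum fun S hS => sum_le_sum fun e he => ?_
  have hS := mem_powerset.1 hS
  by_cases h : e ∈ S
  · rw [ind_false (not_not.2 h), ind_true h, zero_mul, one_mul, one_mul, zero_add]
    refine le_trans (ind_mono ?_) (ind_or_le _ _)
    rintro ⟨h2, h3⟩
    rcases cb_vv_of_mem hS hv he h h3 with h4 | h4
    · exact Or.inl ⟨by omega, h4⟩
    · exact Or.inr ⟨h2, h4⟩
  · rw [ind_true h, ind_false h, zero_mul, one_mul, zero_mul, add_zero, add_zero]

open Classical in
lemma bridge_split {U : Finset ℕ} {R : EdgeSet} (hR : R ⊆ KK U) {v : ℕ} (hv : v ∈ U)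
    {e : Sym2 ℕ} (he : e ∈ KK U) (hc : Conn U (insert e R)) (hj : ¬Jn R e) :
    Conn (U \ cc R U v) R ∧ ∃ x ∈ cc R U v, ∃ y ∈ U \ cc R U v, e = s(x, y) := by
  have key : ∀ x y, x ∈ U → y ∈ U → Conn U (insert s(x, y) R) → ¬Rch R x y → Rch R v x →
      Conn (U \ cc R U v) R ∧ y ∈ U \ cc R U v := by
    intro x y hx hy hc hj hvx
    have h1 : ¬Rch R v y := fun h => hj (hvx.symm.trans h)
    have h2 : ∀ a ∈ U \ cc R U v, Rch R y a := by
      intro a ha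
      obtain ⟨haU, ha⟩ := Finset.mem_sdiff.1 ha
      have h3 : ¬Rch R v a := fun h => ha (mem_cc.2 ⟨haU, h⟩)
      have := Rch.insert_iff.1 (hc v hv a haU)
      tauto
    exact ⟨fun a ha b hb => (h2 a ha).symm.trans (h2 b hb),
      Finset.mem_sdiff.2 ⟨hy, fun h => h1 (mem_cc.1 h).2⟩⟩
  induction e with
  | _ x y =>
    obtain ⟨hx, hy, hxy⟩ := mem_KK.1 he
    rw [jn_mk] at hj
    have h0 : Rch R v x ∨ Rch R v y := by
      have := Rch.insert_iff.1 (hc v hv x hx)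
      tauto
    rcases h0 with h0 | h0
    · obtain ⟨h1, h2⟩ := key x y hx hy hc hj h0
      exact ⟨h1, x, mem_cc.2 ⟨hx, h0⟩, y, h2, rfl⟩
    · obtain ⟨h1, h2⟩ := key y x hy hx (by rwa [Sym2.eq_swap]) (fun h => hj h.symm) h0
      exact ⟨h1, y, mem_cc.2 ⟨hy, h0⟩, x, h2, Sym2.eq_swap⟩

lemma sum_pairs_le (K : EdgeSet) (C D : Finset ℕ) :
    ∑ e ∈ K, ind (∃ x ∈ C, ∃ y ∈ D, e = s(x, y)) ≤ C.card * D.card := by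
  have h1 : ∀ e ∈ K, ind (∃ x ∈ C, ∃ y ∈ D, e = s(x, y)) ≤ ∑ x ∈ C, ∑ y ∈ D, ind (e = s(x, y)) := by
    intro e he
    refine (ind_exists_le C _).trans (sum_le_sum fun x hx => ind_exists_le D _)
  refine (sum_le_sum h1).trans ?_
  rw [sum_comm, ← nsmul_eq_mul, ← sum_const]
  refine sum_le_sum fun x hx => ?_
  rw [sum_comm, card_eq_sum_ones, Nat.cast_sum]
  refine sum_le_sum fun y hy => ?_
  rw [sum_ind, filter_eq']
  split_ifs <;> simp

lemma sum_split_le {U C : Finset ℕ} {v : ℕ} (hv : v ∈ C) (hC : C ⊆ U) {q : ℕ} :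
    ∑ R ∈ (KK U).powerset, ind (cc R U v = C) *
      ind (R.card + 3 = U.card + (q + 1) ∧ Bless R ∧ Conn (U \ C) R) ≤
    ∑ r ∈ HasAntidiagonal.antidiagonal q, nn C.card (C.card + r.1 - 1) *
      nn (U.card - C.card) (U.card - C.card + r.2 - 1) := by
  have h1 : ∑ R ∈ (KK U).powerset, ind (cc R U v = C) *
      ind (R.card + 3 = U.card + (q + 1) ∧ Bless R ∧ Conn (U \ C) R) =
      ∑ H₁ ∈ (KK C).powerset, ∑ H₂ ∈ (KK (U \ C)).powerset, ind (Conn C H₁) *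
        ind ((H₁ ∪ H₂).card + 3 = U.card + (q + 1) ∧ Bless (H₁ ∪ H₂) ∧ Conn (U \ C) (H₁ ∪ H₂)) := by
    have := sum_comp_eq U C hv hC fun R =>
      ((ind (R.card + 3 = U.card + (q + 1) ∧ Bless R ∧ Conn (U \ C) R) : ℝ) : ℂ)
    exact_mod_cast this
  have hd : Disjoint C (U \ C) := disjoint_sdiff
  have hcard : (U \ C).card = U.card - C.card := card_sdiff_of_subset hC
  have hle := card_le_card hC
  have hpos : 0 < C.card := card_pos.2 ⟨v, hv⟩
  rw [h1]
  have h2 : ∑ r ∈ HasAntidiagonal.antidiagonal q, nn C.card (C.card + r.1 - 1) *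
      nn (U.card - C.card) (U.card - C.card + r.2 - 1) =
      ∑ H₁ ∈ (KK C).powerset, ∑ H₂ ∈ (KK (U \ C)).powerset, ∑ r ∈ HasAntidiagonal.antidiagonal q,
        ind (H₁.card = C.card + r.1 - 1 ∧ CB C H₁) *
          ind (H₂.card = U.card - C.card + r.2 - 1 ∧ CB (U \ C) H₂) := by
    rw [sum_congr rfl fun r _ => by rw [← hcard, ← nn_eq, ← nn_eq]]
    simp only [ws, one_pow, one_mul, sum_mul_sum]
    rw [sum_comm]
    refine sum_congr rfl fun H₁ _ => ?_
    rw [sum_comm, hcard]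
  rw [h2]
  refine sum_le_sum fun H₁ hH₁ => sum_le_sum fun H₂ hH₂ => ?_
  have hH₁ := mem_powerset.1 hH₁
  have hH₂ := mem_powerset.1 hH₂
  rw [← ind_and]
  by_cases h : Conn C H₁ ∧ (H₁ ∪ H₂).card + 3 = U.card + (q + 1) ∧ Bless (H₁ ∪ H₂) ∧
      Conn (U \ C) (H₁ ∪ H₂)
  · obtain ⟨h3, h4, h5, h6⟩ := h
    rw [bless_union hd hH₁ hH₂] at h5
    rw [card_union_of_disjoint ((disjoint_KK hd).mono hH₁ hH₂)] at h4
    have hcb1 : CB C H₁ := ⟨h3, h5.1⟩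
    have hcb2 : CB (U \ C) H₂ :=
      ⟨fun a ha b hb => (rch_union_right hd hH₁ hH₂ ha).1 (h6 a ha b hb), h5.2⟩
    have hl1 := card_le_of_cb hH₁ hcb1
    have hl2 := card_le_of_cb hH₂ hcb2
    rw [hcard] at hl2
    have hmem : (H₁.card + 1 - C.card, H₂.card + 1 - (U.card - C.card)) ∈ HasAntidiagonal.antidiagonal q := by
      rw [HasAntidiagonal.mem_antidiagonal]; dsimp only; omega
    refine le_trans (ind_le_one _) ?_
    refine le_trans (le_of_eq ?_) (single_le_sum (fun r _ => mul_nonneg (ind_nonneg _) (ind_nonneg _)) hmem)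
    rw [ind_true ⟨by dsimp only; omega, hcb1⟩, ind_true ⟨by dsimp only; omega, hcb2⟩, one_mul]
  · rw [ind_false h]
    exact sum_nonneg fun r _ => mul_nonneg (ind_nonneg _) (ind_nonneg _)

lemma SS_le {U : Finset ℕ} (hU : U.Nonempty) (q : ℕ) :
    SS U (U.card + (q + 1)) ≤ ∑ b ∈ range (U.card + 1), (U.card.choose b : ℝ) *
      (b * (U.card - b : ℕ) * ∑ r ∈ HasAntidiagonal.antidiagonal q, nn b (b + r.1 - 1) *
        nn (U.card - b) (U.card - b + r.2 - 1)) := by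
  obtain ⟨v, hv⟩ := hU
  set F : ℕ → ℝ := fun b => b * (U.card - b : ℕ) * ∑ r ∈ HasAntidiagonal.antidiagonal q,
    nn b (b + r.1 - 1) * nn (U.card - b) (U.card - b + r.2 - 1) with hF
  have hF0 : ∀ b, 0 ≤ F b := fun b => mul_nonneg (by positivity)
    (sum_nonneg fun r _ => mul_nonneg (nn_nonneg _ _) (nn_nonneg _ _))
  have h0 := sum_powerset_apply_card F (x := U)
  simp only [nsmul_eq_mul] at h0
  rw [← h0, SS]
  have h1 : ∀ R ∈ (KK U).powerset, ∑ e ∈ KK U,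
      ind (e ∉ R) * ind (R.card + 3 = U.card + (q + 1) ∧ Conn U (insert e R) ∧ Bless R ∧ ¬Jn R e) ≤
      ∑ C ∈ U.powerset, ind (v ∈ C) * ((C.card * (U.card - C.card : ℕ)) * (ind (cc R U v = C) *
        ind (R.card + 3 = U.card + (q + 1) ∧ Bless R ∧ Conn (U \ C) R))) := by
    intro R hR
    have hR := mem_powerset.1 hR
    have hmem : cc R U v ∈ U.powerset := mem_powerset.2 (cc_subset _ _ _)
    refine le_trans ?_ (single_le_sum (fun C _ => by
      refine mul_nonneg (ind_nonneg _) (mul_nonneg (by positivity) (mul_nonneg (ind_nonneg _) (ind_nonneg _)))) hmem)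
    rw [ind_true (self_mem_cc hv), ind_true rfl, one_mul, one_mul,
      ← card_sdiff_of_subset (cc_subset R U v)]
    refine le_trans ?_ (mul_le_mul_of_nonneg_right (sum_pairs_le (KK U) _ _) (ind_nonneg _))
    rw [sum_mul]
    refine sum_le_sum fun e he => ?_
    rw [← ind_and, ← ind_and]
    refine ind_mono ?_
    rintro ⟨-, h2, h3, h4, h5⟩
    obtain ⟨h6, h7⟩ := bridge_split hR hv he h3 h5
    exact ⟨h7, h2, h4, h6⟩
  refine (sum_le_sum h1).trans ?_
  rw [sum_comm]
  refine sum_le_sum fun C hC => ?_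
  have hC := mem_powerset.1 hC
  rw [← mul_sum, ← mul_sum]
  by_cases hvC : v ∈ C
  · rw [ind_true hvC, one_mul]
    exact mul_le_mul_of_nonneg_left (sum_split_le hvC hC) (by positivity)
  · rw [ind_false hvC, zero_mul]
    exact hF0 _

/-- Normalised counts of connected bridgeless graphs by cyclomatic number. -/
def uq (q b : ℕ) : ℝ := nn b (b + q - 1) / b.factorial

lemma uq_nonneg (q b : ℕ) : 0 ≤ uq q b := div_nonneg (nn_nonneg _ _) (by positivity)

lemma nn_eq_uq (q b : ℕ) : nn b (b + q - 1) = b.factorial * uq q b := by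
  rw [uq]; field_simp

def cv (q b : ℕ) : ℝ := ∑ c ∈ range (b + 1), (c : ℝ) * (b - c : ℕ) *
  ∑ r ∈ HasAntidiagonal.antidiagonal q, uq r.1 c * uq r.2 (b - c)

lemma SS_le_cv {U : Finset ℕ} (hU : U.Nonempty) (q : ℕ) :
    SS U (U.card + (q + 1)) ≤ U.card.factorial * cv q U.card := by
  refine (SS_le hU q).trans (le_of_eq ?_)
  rw [cv, mul_sum]
  refine sum_congr rfl fun b hb => ?_
  have hb : b ≤ U.card := by have := mem_range.1 hb; omega
  rw [← Nat.choose_mul_factorial_mul_factorial hb, Nat.cast_mul, Nat.cast_mul]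
  simp only [nn_eq_uq, mul_sum]
  refine sum_congr rfl fun r _ => ?_
  ring

lemma uq_rec {b : ℕ} (hb : 1 ≤ b) (q : ℕ) :
    ((b : ℝ) + 1 - 2 * q) * uq (q + 1) (b + 1) ≤
      (b + q) * uq (q + 1) b + ((b + q - 1) * uq q b + cv q b) := by
  have h1 := nn_mul_le (range (b + 1)) (by rw [card_range]; omega) (b + q + 1)
  have h2 : ∀ v ∈ range (b + 1), A2 ((range (b + 1)).erase v) v (b + q + 1) ≤
      b.factorial * ((b + q) * uq (q + 1) b + ((b + q - 1) * uq q b + cv q b)) := by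
    intro v hv
    have hcard : ((range (b + 1)).erase v).card = b := by
      rw [card_erase_of_mem hv, card_range]; rfl
    have h3 := A2_le ((range (b + 1)).erase v) (notMem_erase v _) (b + q - 1)
    have h4 := SS_le_cv (U := (range (b + 1)).erase v) (card_pos.1 (by omega)) q
    have e1 : b + q - 1 + 2 = b + q + 1 := by omega
    have e2 : b + q - 1 + 1 = b + (q + 1) - 1 := by omega
    rw [hcard] at h3 h4
    rw [e1, e2, nn_eq_uq, nn_eq_uq] at h3
    rw [show b + (q + 1) = b + q + 1 by ring] at h4
    have e3 : ((b + q - 1 : ℕ) : ℝ) = b + q - 1 := by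
      rw [Nat.cast_sub (by omega), Nat.cast_add, Nat.cast_one]
    have e4 : ((b + (q + 1) - 1 : ℕ) : ℝ) = b + q := by
      rw [show b + (q + 1) - 1 = b + q by omega, Nat.cast_add]
    rw [e3, e4] at h3
    linarith
  have h3 := h1.trans (sum_le_sum h2)
  rw [sum_const, card_range, nsmul_eq_mul, show b + q + 1 = b + 1 + (q + 1) - 1 by omega,
    nn_eq_uq] at h3
  have h6 : (0 : ℝ) < (b + 1).factorial := by positivity
  have h4 : (3 * ((b + 1 : ℕ) : ℝ) - 2 * ((b + 1 + (q + 1) - 1 : ℕ) : ℝ)) * uq (q + 1) (b + 1) ≤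
      (b + q) * uq (q + 1) b + ((b + q - 1) * uq q b + cv q b) := by
    refine le_of_mul_le_mul_left ?_ h6
    rw [mul_left_comm]
    refine h3.trans (le_of_eq ?_)
    rw [Nat.factorial_succ, Nat.cast_mul]
    ring
  grind

lemma uq_one_ge {b : ℕ} (hb : 1 ≤ b) : b * uq 1 b ≤ (b + 1 : ℕ) * uq 1 (b + 1) := by
  have h1 := nn_mul_eq (range (b + 1)) (by rw [card_range]; omega)
  rw [card_range] at h1
  have h2 : ∀ v ∈ range (b + 1), b * nn b b ≤ A2 ((range (b + 1)).erase v) v (b + 1) := by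
    intro v hv
    have hcard : ((range (b + 1)).erase v).card = b := by
      rw [card_erase_of_mem hv, card_range]; rfl
    have h3 := le_A2 ((range (b + 1)).erase v) (notMem_erase v _) b
    rwa [hcard] at h3
  have h3 := sum_le_sum h2
  rw [← h1, sum_const, card_range, nsmul_eq_mul] at h3
  have h4 := nn_eq_uq 1 b
  have h5 := nn_eq_uq 1 (b + 1)
  rw [Nat.add_sub_cancel] at h4 h5
  rw [h4, h5, Nat.factorial_succ, Nat.cast_mul] at h3
  have h6 : (0 : ℝ) < (b + 1 : ℕ) * b.factorial := by positivity
  refine le_of_mul_le_mul_left ?_ h6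
  calc _ = ((b + 1 : ℕ) : ℝ) * (b * (b.factorial * uq 1 b)) := by ring
    _ ≤ _ := h3
    _ = _ := by ring

lemma nn_of_lt {b m : ℕ} (h : m + 1 < b) : nn b m = 0 := by
  rw [nn]
  refine sum_eq_zero fun H hH => ?_
  refine mul_eq_zero_of_right _ (ind_false ?_)
  rintro ⟨h1, h2⟩
  have := card_le_of_cb (mem_powerset.1 hH) h2
  rw [card_range] at this
  omega

lemma nn_of_eq {b : ℕ} (hb : 2 ≤ b) : nn b (b - 1) = 0 := by
  rw [nn]
  refine sum_eq_zero fun H hH => ?_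
  refine mul_eq_zero_of_right _ (ind_false ?_)
  rintro ⟨h1, h2⟩
  have hH := mem_powerset.1 hH
  have h3 := sum_dg hH
  have h4 : ∑ v ∈ range b, 2 ≤ ∑ v ∈ range b, dg v H :=
    sum_le_sum fun v hv => two_le_dg hH h2 (by rwa [card_range]) hv
  rw [sum_const, smul_eq_mul, h3, card_range] at h4
  omega

lemma uq_zero {b : ℕ} (hb : 2 ≤ b) : uq 0 b = 0 := by
  rw [uq, Nat.add_zero, nn_of_eq hb, zero_div]

lemma uq_zero_one : uq 0 1 = 1 := by
  rw [uq, nn, KK_of_card_le_one (by simp), ws, powerset_empty, sum_singleton, one_pow,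
    one_mul, ind_true]
  · simp
  · refine ⟨by simp, fun a ha b hb => ?_, fun e he => absurd he (by simp)⟩
    rw [mem_range] at ha hb
    rw [show a = b by omega]

lemma nn_three : nn 3 3 = 1 := by
  have hK : (KK (range 3)).card = 3 := by rw [card_KK, card_range]; rfl
  have h1 : nn 3 3 = ind (CB (range 3) (KK (range 3))) := by
    rw [nn, ws, sum_eq_single_of_mem (KK (range 3)) (by simp)]
    · rw [one_pow, one_mul]
      exact ind_congr (by rw [hK]; simp)
    · intro H hH hne
      rw [ind_false, mul_zero]
      intro h
      exact hne (eq_of_subset_of_card_le (mem_powerset.1 hH) (by omega))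
  rw [h1, ind_true]
  have h2 : ∀ a b : ℕ, a < 3 → b < 3 → Rch (KK (range 3)) a b := by
    intro a b ha hb
    by_cases hab : a = b
    · rw [hab]
    · exact Rch.single (mem_KK.2 ⟨mem_range.2 ha, mem_range.2 hb, hab⟩)
  refine ⟨fun a ha b hb => h2 a b (mem_range.1 ha) (mem_range.1 hb), fun e he => ?_⟩
  induction e with
  | _ x y =>
    obtain ⟨hx, hy, hxy⟩ := mem_KK.1 he
    rw [mem_range] at hx hy
    obtain ⟨z, hz, hzx, hzy⟩ : ∃ z, z < 3 ∧ z ≠ x ∧ z ≠ y := by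
      by_contra hcon
      push Not at hcon
      have h0 := hcon 0 (by omega)
      have h1 := hcon 1 (by omega)
      have h2 := hcon 2 (by omega)
      omega
    rw [jn_mk]
    refine (Rch.single (b := z) ?_).trans (Rch.single ?_)
    · refine mem_erase.2 ⟨?_, mem_KK.2 ⟨mem_range.2 hx, mem_range.2 hz, hzx.symm⟩⟩
      simp [hzy, hxy]
    · refine mem_erase.2 ⟨?_, mem_KK.2 ⟨mem_range.2 hz, mem_range.2 hy, hzy⟩⟩
      simp [hzx]
      omega

lemma cv_zero {b : ℕ} (hb : 3 ≤ b) : cv 0 b = 0 := by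
  rw [cv]
  refine sum_eq_zero fun c hc => ?_
  rw [HasAntidiagonal.antidiagonal_zero, sum_singleton]
  rcases Nat.lt_or_ge c 2 with h | h
  · rw [uq_zero (b := b - c) (by omega), mul_zero, mul_zero]
  · rw [uq_zero h, zero_mul, mul_zero]

lemma uq_one {b : ℕ} (hb : 3 ≤ b) : uq 1 b = 1 / (2 * b) := by
  have h : (b : ℝ) * uq 1 b = 1 / 2 := by
    induction b, hb using Nat.le_induction with
    | base =>
      rw [uq, Nat.add_sub_cancel, nn_three]
      norm_num [Nat.factorial]
    | succ b hb ih =>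
      refine le_antisymm ?_ (ih ▸ uq_one_ge (by omega))
      have h1 := uq_rec (b := b) (by omega) 0
      rw [uq_zero (by omega), cv_zero hb] at h1
      grind
  grind

lemma uq_one_small {b : ℕ} (hb : b < 3) : uq 1 b = 0 ∨ b = 0 := by
  rcases Nat.eq_zero_or_pos b with h | h
  · exact Or.inr h
  left
  rw [uq, Nat.add_sub_cancel, nn]
  rw [div_eq_zero_iff]; left
  refine sum_eq_zero fun H hH => ?_
  refine mul_eq_zero_of_right _ (ind_false ?_)
  rintro ⟨h1, -⟩
  have h2 := card_le_card (mem_powerset.1 hH)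
  rw [card_KK, card_range, h1] at h2
  interval_cases b <;> simp at h2

lemma tendsto_of_almost_decreasing {v : ℕ → ℝ} {A : ℝ} (hA : 0 ≤ A) (h0 : ∀ b, 0 ≤ v b) (N : ℕ)
    (h : ∀ b : ℕ, N ≤ b → v (b + 1) ≤ (1 + A / b ^ 2) * v b + A / b ^ 2) :
    ∃ l, 0 ≤ l ∧ Tendsto v atTop (nhds l) := by
  have hanti : Antitone fun i : ℕ => (1 + v (i + (N + 2))) * exp (A / ((i + (N + 2) : ℕ) - 1)) := by
    refine antitone_nat_of_succ_le fun i => ?_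
    rw [show i + 1 + (N + 2) = i + (N + 2) + 1 by ring]
    obtain ⟨b, hb⟩ : ∃ b, b = i + (N + 2) := ⟨_, rfl⟩
    rw [← hb]
    have hb2 : (2 : ℝ) ≤ b := by exact_mod_cast (by omega : 2 ≤ b)
    have h1 := h b (by omega)
    have h2 : 1 + v (b + 1) ≤ (1 + A / b ^ 2) * (1 + v b) := by linarith
    have h3 : 1 + A / b ^ 2 ≤ exp (A / b ^ 2) := by
      have := add_one_le_exp (A / (b : ℝ) ^ 2); linarith
    have h4 : A / b ^ 2 + A / (((b + 1 : ℕ) : ℝ) - 1) ≤ A / ((b : ℝ) - 1) := by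
      have e1 : (((b + 1 : ℕ) : ℝ) - 1) = b := by push_cast; ring
      rw [e1]
      have e2 : A / ((b : ℝ) - 1) - A / b = A / (b * (b - 1)) := by
        have : (b : ℝ) - 1 ≠ 0 := by linarith
        have : (b : ℝ) ≠ 0 := by linarith
        field_simp
        ring
      have e3 : A / (b : ℝ) ^ 2 ≤ A / (b * (b - 1)) := by
        refine div_le_div_of_nonneg_left hA ?_ ?_
        · exact mul_pos (by linarith) (by linarith)
        · rw [sq]; exact mul_le_mul_of_nonneg_left (by linarith) (by linarith)
      linarith
    calc (1 + v (b + 1)) * exp (A / (((b + 1 : ℕ) : ℝ) - 1))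
        ≤ (exp (A / b ^ 2) * (1 + v b)) * exp (A / (((b + 1 : ℕ) : ℝ) - 1)) := by
          refine mul_le_mul_of_nonneg_right (h2.trans ?_) (exp_nonneg _)
          exact mul_le_mul_of_nonneg_right h3 (by linarith [h0 b])
      _ = (1 + v b) * exp (A / b ^ 2 + A / (((b + 1 : ℕ) : ℝ) - 1)) := by
          rw [exp_add]; ring
      _ ≤ _ := mul_le_mul_of_nonneg_left (exp_le_exp.2 h4) (by linarith [h0 b])
  have hbdd : BddBelow (Set.range fun i : ℕ =>
      (1 + v (i + (N + 2))) * exp (A / ((i + (N + 2) : ℕ) - 1))) := by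
    refine ⟨0, ?_⟩
    rintro _ ⟨i, rfl⟩
    exact mul_nonneg (by linarith [h0 (i + (N + 2))]) (exp_nonneg _)
  have ht := tendsto_atTop_ciInf hanti hbdd
  set L := ⨅ i : ℕ, (1 + v (i + (N + 2))) * exp (A / ((i + (N + 2) : ℕ) - 1))
  have hd : Tendsto (fun i : ℕ => ((i + (N + 2) : ℕ) : ℝ) - 1) atTop atTop :=
    tendsto_atTop_add_const_right _ _ (tendsto_natCast_atTop_atTop.comp (tendsto_add_atTop_nat (N + 2)))
  have he : Tendsto (fun i : ℕ => exp (-(A / (((i + (N + 2) : ℕ) : ℝ) - 1)))) atTop (nhds 1) := by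
    have h1 : Tendsto (fun i : ℕ => -(A / (((i + (N + 2) : ℕ) : ℝ) - 1))) atTop (nhds (-0)) :=
      (hd.const_div_atTop A).neg
    have := (continuous_exp.tendsto (-0)).comp h1
    rw [neg_zero, exp_zero] at this
    exact this
  have hv : Tendsto (fun i : ℕ => v (i + (N + 2))) atTop (nhds (L * 1 - 1)) := by
    refine ((ht.mul he).sub_const 1).congr fun i => ?_
    rw [mul_assoc, ← exp_add, add_neg_cancel, exp_zero]
    ring
  rw [tendsto_add_atTop_iff_nat (f := v)] at hv
  exact ⟨_, ge_of_tendsto' hv h0, hv⟩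

lemma sum_inv_sq_le (n : ℕ) : ∑ c ∈ range n, 1 / (c : ℝ) ^ 2 ≤ 2 := by
  have key : ∀ n : ℕ, ∑ c ∈ range (n + 2), 1 / (c : ℝ) ^ 2 ≤ 2 - 1 / (n + 1 : ℝ) := by
    intro n
    induction n with
    | zero => norm_num [sum_range_succ]
    | succ n ih =>
      rw [sum_range_succ]
      have e : 1 / ((n + 2 : ℕ) : ℝ) ^ 2 ≤ 1 / (n + 1 : ℝ) - 1 / ((n + 1 : ℕ) + 1 : ℝ) := by
        have h1 : (0 : ℝ) < n + 1 := by positivity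
        have e2 : 1 / (n + 1 : ℝ) - 1 / ((n + 1 : ℕ) + 1 : ℝ) = 1 / ((n + 1) * (n + 2)) := by
          grind
        rw [e2]
        push_cast
        refine one_div_le_one_div_of_le (by positivity) ?_
        rw [sq]
        exact mul_le_mul_of_nonneg_right (by linarith) (by linarith)
      linarith
  have h2 := key n
  have h3 : ∑ c ∈ range n, 1 / (c : ℝ) ^ 2 ≤ ∑ c ∈ range (n + 2), 1 / (c : ℝ) ^ 2 :=
    sum_le_sum_of_subset_of_nonneg (range_mono (by omega)) fun _ _ _ => by positivity
  have h4 : (0 : ℝ) ≤ 1 / (n + 1 : ℝ) := by positivity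
  linarith

lemma inv_cube_mul_le {c d : ℝ} (hc : 1 ≤ c) (hd : 1 ≤ d) :
    1 / c ^ 3 * (1 / d ^ 3) ≤ 4 / (c + d) ^ 3 * (1 / c ^ 2 + 1 / d ^ 2) := by
  have h1 : 1 / c ^ 2 + 1 / d ^ 2 = (c ^ 2 + d ^ 2) / (c ^ 2 * d ^ 2) := by
    have : c ≠ 0 := by linarith
    have : d ≠ 0 := by linarith
    field_simp
    ring
  have hc0 : 0 < c := by linarith
  have hd0 : 0 < d := by linarith
  have h2 : (c + d) ^ 3 ≤ 4 * (c * d) * (c ^ 2 + d ^ 2) := by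
    have e1 : c + d ≤ 2 * (c * d) := by
      linarith [mul_nonneg (sub_nonneg.2 hc) (sub_nonneg.2 hd), mul_nonneg hc0.le (sub_nonneg.2 hd),
        mul_nonneg hd0.le (sub_nonneg.2 hc)]
    have e2 : (c + d) ^ 2 ≤ 2 * (c ^ 2 + d ^ 2) := by linarith [sq_nonneg (c - d)]
    calc (c + d) ^ 3 = (c + d) * (c + d) ^ 2 := by ring
      _ ≤ (2 * (c * d)) * (2 * (c ^ 2 + d ^ 2)) := mul_le_mul e1 e2 (by positivity) (by positivity)
      _ = _ := by ring
  have e : 4 / (c + d) ^ 3 * ((c ^ 2 + d ^ 2) / (c ^ 2 * d ^ 2)) =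
      (4 * (c * d) * (c ^ 2 + d ^ 2)) / ((c + d) ^ 3 * (c ^ 3 * d ^ 3)) := by
    have : c + d ≠ 0 := by linarith
    field_simp
  rw [h1, e, le_div_iff₀ (by positivity)]
  have e3 : 1 / c ^ 3 * (1 / d ^ 3) * ((c + d) ^ 3 * (c ^ 3 * d ^ 3)) = (c + d) ^ 3 := by
    field_simp
  rw [e3]
  exact h2

lemma cv_le {q : ℕ} {K : ℝ} (hK : 0 ≤ K)
    (h : ∀ r ≤ q, ∀ b : ℕ, 1 ≤ b → uq r b * (b : ℝ) ^ 4 ≤ K * (b : ℝ) ^ (3 * r)) (b : ℕ) (hb : 1 ≤ b) :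
    cv q b ≤ 16 * (q + 1) * K ^ 2 * ((b : ℝ) ^ (3 * q) / (b : ℝ) ^ 3) := by
  have hb0 : (0 : ℝ) < b := by exact_mod_cast hb
  have hu : ∀ r ≤ q, ∀ c : ℕ, 1 ≤ c → (c : ℝ) * uq r c ≤ K * (c : ℝ) ^ (3 * r) * (1 / (c : ℝ) ^ 3) := by
    intro r hr c hc
    have hc0 : (0 : ℝ) < c := by exact_mod_cast hc
    rw [mul_one_div, le_div_iff₀ (by positivity)]
    calc _ = uq r c * (c : ℝ) ^ 4 := by ring
      _ ≤ _ := h r hr c hc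
  have hterm : ∀ c ∈ range (b + 1), (c : ℝ) * (b - c : ℕ) *
      ∑ r ∈ HasAntidiagonal.antidiagonal q, uq r.1 c * uq r.2 (b - c) ≤
      (q + 1) * K ^ 2 * (b : ℝ) ^ (3 * q) * (4 / (b : ℝ) ^ 3 * (1 / (c : ℝ) ^ 2 + 1 / ((b - c : ℕ) : ℝ) ^ 2)) := by
    intro c hc
    have hcb : c ≤ b := by have := mem_range.1 hc; omega
    have hn : 0 ≤ (q + 1) * K ^ 2 * (b : ℝ) ^ (3 * q) *
        (4 / (b : ℝ) ^ 3 * (1 / (c : ℝ) ^ 2 + 1 / ((b - c : ℕ) : ℝ) ^ 2)) := by positivity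
    rcases Nat.eq_zero_or_pos c with h0 | hc1
    · subst h0; simpa using hn
    rcases Nat.eq_zero_or_pos (b - c) with h0 | hd1
    · rw [h0] at hn ⊢; simpa using hn
    obtain ⟨d, hd⟩ : ∃ d, d = b - c := ⟨_, rfl⟩
    rw [← hd] at hd1 ⊢
    have hbcd : (b : ℝ) = c + d := by exact_mod_cast (by omega : b = c + d)
    have hc1' : (1 : ℝ) ≤ c := by exact_mod_cast hc1
    have hd1' : (1 : ℝ) ≤ d := by exact_mod_cast hd1
    have hsum : (c : ℝ) * d * ∑ r ∈ HasAntidiagonal.antidiagonal q, uq r.1 c * uq r.2 d ≤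
        ∑ r ∈ HasAntidiagonal.antidiagonal q,
          K ^ 2 * (b : ℝ) ^ (3 * q) * (4 / (b : ℝ) ^ 3 * (1 / (c : ℝ) ^ 2 + 1 / (d : ℝ) ^ 2)) := by
      rw [mul_sum]
      refine sum_le_sum fun r hr => ?_
      rw [HasAntidiagonal.mem_antidiagonal] at hr
      have e1 := hu r.1 (by omega) c hc1
      have e2 := hu r.2 (by omega) d hd1
      calc (c : ℝ) * d * (uq r.1 c * uq r.2 d) = (c * uq r.1 c) * (d * uq r.2 d) := by ring
        _ ≤ (K * (c : ℝ) ^ (3 * r.1) * (1 / (c : ℝ) ^ 3)) * (K * (d : ℝ) ^ (3 * r.2) * (1 / (d : ℝ) ^ 3)) :=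
          mul_le_mul e1 e2 (mul_nonneg (by linarith) (uq_nonneg _ _)) (by positivity)
        _ = K ^ 2 * ((c : ℝ) ^ (3 * r.1) * (d : ℝ) ^ (3 * r.2)) * (1 / (c : ℝ) ^ 3 * (1 / (d : ℝ) ^ 3)) := by
          ring
        _ ≤ K ^ 2 * ((b : ℝ) ^ (3 * r.1) * (b : ℝ) ^ (3 * r.2)) * (4 / (b : ℝ) ^ 3 * (1 / (c : ℝ) ^ 2 + 1 / (d : ℝ) ^ 2)) := by
          refine mul_le_mul (mul_le_mul_of_nonneg_left (mul_le_mul ?_ ?_ (by positivity) (by positivity))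
            (by positivity)) ?_ (by positivity) (by positivity)
          · exact pow_le_pow_left₀ (by positivity) (by linarith) _
          · exact pow_le_pow_left₀ (by positivity) (by linarith) _
          · rw [hbcd]; exact inv_cube_mul_le hc1' hd1'
        _ = _ := by rw [← pow_add, ← mul_add, hr]
    refine hsum.trans (le_of_eq ?_)
    rw [sum_const, Finset.Nat.card_antidiagonal, nsmul_eq_mul]
    push_cast
    ring
  refine (sum_le_sum hterm).trans ?_
  rw [← mul_sum, ← mul_sum, sum_add_distrib]
  have s1 := sum_inv_sq_le (b + 1)
  have s2 : ∑ c ∈ range (b + 1), 1 / ((b - c : ℕ) : ℝ) ^ 2 ≤ 2 := by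
    have := sum_range_reflect (fun c : ℕ => 1 / (c : ℝ) ^ 2) (b + 1)
    grind
  calc _ ≤ (q + 1) * K ^ 2 * (b : ℝ) ^ (3 * q) * (4 / (b : ℝ) ^ 3 * (2 + 2)) := by
        refine mul_le_mul_of_nonneg_left (mul_le_mul_of_nonneg_left (add_le_add s1 s2) ?_) ?_ <;> positivity
    _ = _ := by ring

lemma uq_step {k : ℕ} {C : ℝ} (hC : 0 ≤ C) {b : ℕ} (hb : 4 * k + 2 ≤ b)
    (h : ((b : ℝ) + 1 - 2 * ((k + 1 : ℕ) : ℝ)) * uq (k + 2) (b + 1) ≤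
      (b + (k + 1 : ℕ)) * uq (k + 2) b + C * (b : ℝ) ^ (3 * k)) :
    uq (k + 2) (b + 1) / ((b + 1 : ℕ) : ℝ) ^ (3 * k + 2) ≤
      (1 + (2 * ((3 * k + 2) * (2 * k + 1)) + 2 * C) / (b : ℝ) ^ 2) * (uq (k + 2) b / (b : ℝ) ^ (3 * k + 2)) +
        (2 * ((3 * k + 2) * (2 * k + 1)) + 2 * C) / (b : ℝ) ^ 2 := by
  have hb1 : (1 : ℝ) ≤ b := by exact_mod_cast (by omega : 1 ≤ b)
  have hb0 : (0 : ℝ) < b := by linarith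
  have hbk : (4 * k + 2 : ℝ) ≤ b := by exact_mod_cast hb
  obtain ⟨V, hV⟩ : ∃ V, V = uq (k + 2) (b + 1) / ((b + 1 : ℕ) : ℝ) ^ (3 * k + 2) := ⟨_, rfl⟩
  obtain ⟨v, hv⟩ : ∃ v, v = uq (k + 2) b / (b : ℝ) ^ (3 * k + 2) := ⟨_, rfl⟩
  have hV0 : 0 ≤ V := by rw [hV]; exact div_nonneg (uq_nonneg _ _) (by positivity)
  have hv0 : 0 ≤ v := by rw [hv]; exact div_nonneg (uq_nonneg _ _) (by positivity)
  have eV : uq (k + 2) (b + 1) = V * ((b : ℝ) + 1) ^ (3 * k + 2) := by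
    rw [hV]; push_cast; field_simp
  have ev : uq (k + 2) b = v * (b : ℝ) ^ (3 * k + 2) := by rw [hv]; field_simp
  rw [← hV, ← hv]
  rw [eV, ev] at h
  obtain ⟨D, hD⟩ : ∃ D : ℝ, D = b - 1 - 2 * k := ⟨_, rfl⟩
  have hD2 : (b : ℝ) / 2 ≤ D := by linarith
  have hD0 : 0 ≤ D := by linarith
  have hbern : (b : ℝ) ^ (3 * k + 1) * (b + (3 * k + 2)) ≤ ((b : ℝ) + 1) ^ (3 * k + 2) := by
    have h1 := one_add_mul_le_pow (a := 1 / (b : ℝ)) (by have : 0 ≤ 1 / (b : ℝ) := by positivity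
                                                         linarith) (3 * k + 2)
    have h2 : ((b : ℝ) + 1) ^ (3 * k + 2) = (b : ℝ) ^ (3 * k + 2) * (1 + 1 / b) ^ (3 * k + 2) := by
      rw [← mul_pow, mul_add, mul_one_div_cancel hb0.ne', mul_one]
    rw [h2]
    calc _ = (b : ℝ) ^ (3 * k + 2) * (1 + ((3 * k + 2 : ℕ) : ℝ) * (1 / b)) := by
          push_cast
          field_simp
          ring
      _ ≤ _ := mul_le_mul_of_nonneg_left h1 (by positivity)
  have h1 : D * (V * ((b : ℝ) ^ (3 * k + 1) * (b + (3 * k + 2)))) ≤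
      (b + (k + 1)) * (v * (b : ℝ) ^ (3 * k + 2)) + C * (b : ℝ) ^ (3 * k) := by
    calc _ ≤ D * (V * ((b : ℝ) + 1) ^ (3 * k + 2)) :=
          mul_le_mul_of_nonneg_left (mul_le_mul_of_nonneg_left hbern hV0) hD0
      _ = ((b : ℝ) + 1 - 2 * ((k + 1 : ℕ) : ℝ)) * (V * ((b : ℝ) + 1) ^ (3 * k + 2)) := by
          grind
      _ ≤ _ := by
          grind
  have h2 : b * ((b + (3 * k + 2)) * D) * V ≤
      b * ((b + (3 * k + 2)) * D + (3 * k + 2) * (2 * k + 1)) * v + C := by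
    refine le_of_mul_le_mul_right ?_ (pow_pos hb0 (3 * k))
    calc _ = D * (V * ((b : ℝ) ^ (3 * k + 1) * (b + (3 * k + 2)))) := by ring
      _ ≤ _ := h1
      _ = _ := by rw [hD]; ring
  obtain ⟨E, hE⟩ : ∃ E : ℝ, E = (b + (3 * k + 2)) * D := ⟨_, rfl⟩
  have hE2 : (b : ℝ) ^ 2 / 2 ≤ E := by
    rw [hE]
    calc (b : ℝ) ^ 2 / 2 = b * (b / 2) := by ring
      _ ≤ _ := mul_le_mul (by linarith [(Nat.cast_nonneg k : (0 : ℝ) ≤ k)]) hD2 (by linarith) (by positivity)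
  rw [← hE] at h2
  have hE0 : 0 < E := lt_of_lt_of_le (by positivity) hE2
  obtain ⟨P, hP⟩ : ∃ P : ℝ, P = (3 * k + 2) * (2 * k + 1) := ⟨_, rfl⟩
  have hP0 : 0 ≤ P := by rw [hP]; positivity
  rw [← hP] at h2 ⊢
  have h3 : V ≤ (1 + P / E) * v + C / E := by
    have : V ≤ (b * (E + P) * v + C) / (b * E) := by
      rw [le_div_iff₀ (by positivity)]; linarith
    refine this.trans ?_
    have e : (b * (E + P) * v + C) / (b * E) = (1 + P / E) * v + (C / E) * (1 / b) := by
      field_simp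
    rw [e]
    have : (C / E) * (1 / b) ≤ (C / E) * 1 :=
      mul_le_mul_of_nonneg_left (by rw [div_le_one hb0]; exact hb1) (by positivity)
    linarith
  have hinv : ∀ x : ℝ, 0 ≤ x → x / E ≤ 2 * x / (b : ℝ) ^ 2 := by
    intro x hx
    calc x / E ≤ x / ((b : ℝ) ^ 2 / 2) := div_le_div_of_nonneg_left hx (by positivity) hE2
      _ = _ := by field_simp
  have i1 := hinv P hP0
  have i2 := hinv C hC
  have a1 : (1 + P / E) * v ≤ (1 + (2 * P + 2 * C) / (b : ℝ) ^ 2) * v := by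
    refine mul_le_mul_of_nonneg_right ?_ hv0
    have : 0 ≤ 2 * C / (b : ℝ) ^ 2 := by positivity
    rw [add_div]; linarith
  have a2 : C / E ≤ (2 * P + 2 * C) / (b : ℝ) ^ 2 := by
    have : 0 ≤ 2 * P / (b : ℝ) ^ 2 := by positivity
    rw [add_div]; linarith
  linarith

lemma uq_tendsto_of_bound {k : ℕ} {K : ℝ} (hK : 0 ≤ K)
    (h : ∀ r ≤ k + 1, ∀ b : ℕ, 1 ≤ b → uq r b * (b : ℝ) ^ 4 ≤ K * (b : ℝ) ^ (3 * r)) :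
    ∃ l, 0 ≤ l ∧ Tendsto (fun b : ℕ => uq (k + 2) b / (b : ℝ) ^ (3 * k + 2)) atTop (nhds l) := by
  obtain ⟨C, hC⟩ : ∃ C : ℝ, C = (1 + k) * K + 16 * ((k + 1 : ℕ) + 1) * K ^ 2 := ⟨_, rfl⟩
  have hC0 : 0 ≤ C := by rw [hC]; positivity
  refine tendsto_of_almost_decreasing (A := 2 * ((3 * k + 2) * (2 * k + 1)) + 2 * C) (by positivity)
    (fun b => div_nonneg (uq_nonneg _ _) (by positivity)) (4 * k + 2) fun b hb => ?_
  refine uq_step hC0 hb ?_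
  have hb1 : 1 ≤ b := by omega
  have hb1' : (1 : ℝ) ≤ b := by exact_mod_cast hb1
  have hb0 : (0 : ℝ) < b := by linarith
  refine (uq_rec hb1 (k + 1)).trans (add_le_add le_rfl ?_)
  have c1 := cv_le hK h b hb1
  have c2 : uq (k + 1) b * b ≤ K * (b : ℝ) ^ (3 * k) := by
    have := h (k + 1) le_rfl b hb1
    refine le_of_mul_le_mul_right ?_ (pow_pos hb0 3)
    calc _ = uq (k + 1) b * (b : ℝ) ^ 4 := by ring
      _ ≤ _ := this
      _ = _ := by ring
  have e3 : (b : ℝ) ^ (3 * (k + 1)) / (b : ℝ) ^ 3 = (b : ℝ) ^ (3 * k) := by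
    rw [div_eq_iff (by positivity)]; ring
  rw [e3] at c1
  have c3 : (b + (k + 1 : ℕ) - 1) * uq (k + 1) b ≤ (1 + k) * (uq (k + 1) b * b) := by
    push_cast
    have : (b + (k + 1) - 1 : ℝ) ≤ (1 + k) * b := by
      have : (k : ℝ) * 1 ≤ k * b := mul_le_mul_of_nonneg_left hb1' (Nat.cast_nonneg k)
      linarith
    calc _ ≤ ((1 + k) * b) * uq (k + 1) b := mul_le_mul_of_nonneg_right this (uq_nonneg _ _)
      _ = _ := by ring
  have c4 := mul_le_mul_of_nonneg_left c2 (by positivity : (0 : ℝ) ≤ 1 + k)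
  calc _ ≤ (1 + k) * (K * (b : ℝ) ^ (3 * k)) + 16 * ((k + 1 : ℕ) + 1) * K ^ 2 * (b : ℝ) ^ (3 * k) := by
        linarith
    _ = _ := by rw [hC]; ring

lemma uq_zero_bound {b : ℕ} (hb : 1 ≤ b) : uq 0 b * (b : ℝ) ^ 4 ≤ 1 * (b : ℝ) ^ (3 * 0) := by
  rcases eq_or_lt_of_le hb with h | h
  · rw [← h, uq_zero_one]; norm_num
  · rw [uq_zero h]; simp

lemma uq_one_bound {b : ℕ} (hb : 1 ≤ b) : uq 1 b * (b : ℝ) ^ 4 ≤ 1 * (b : ℝ) ^ (3 * 1) := by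
  have hb0 : (0 : ℝ) < b := by exact_mod_cast hb
  by_cases h : 3 ≤ b
  · rw [uq_one h]
    have : 1 / (2 * (b : ℝ)) * (b : ℝ) ^ 4 = (b : ℝ) ^ 3 / 2 := by field_simp
    rw [this]
    have : 0 < (b : ℝ) ^ 3 := by positivity
    rw [mul_one, one_mul]
    linarith
  · rcases uq_one_small (by omega : b < 3) with h1 | h1
    · rw [h1]; simp
    · omega

lemma uq_bound (q : ℕ) : ∃ K : ℝ, 0 ≤ K ∧
    ∀ r ≤ q, ∀ b : ℕ, 1 ≤ b → uq r b * (b : ℝ) ^ 4 ≤ K * (b : ℝ) ^ (3 * r) := by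
  induction q with
  | zero =>
    refine ⟨1, zero_le_one, fun r hr b hb => ?_⟩
    obtain rfl : r = 0 := by omega
    exact uq_zero_bound hb
  | succ q ih =>
    obtain ⟨K, hK, h⟩ := ih
    suffices ∃ K', 0 ≤ K' ∧ ∀ b : ℕ, 1 ≤ b → uq (q + 1) b * (b : ℝ) ^ 4 ≤ K' * (b : ℝ) ^ (3 * (q + 1)) by
      obtain ⟨K', hK', h'⟩ := this
      refine ⟨K + K', by linarith, fun r hr b hb => ?_⟩
      rcases Nat.lt_or_ge q r with h1 | h1
      · obtain rfl : r = q + 1 := by omega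
        refine (h' b hb).trans (mul_le_mul_of_nonneg_right (by linarith) (by positivity))
      · exact (h r h1 b hb).trans (mul_le_mul_of_nonneg_right (by linarith) (by positivity))
    rcases q with _ | k
    · exact ⟨1, zero_le_one, fun b hb => uq_one_bound hb⟩
    · obtain ⟨l, _, hl⟩ := uq_tendsto_of_bound hK h
      obtain ⟨B, hB⟩ := hl.bddAbove_range
      refine ⟨max B 0, le_max_right _ _, fun b hb => ?_⟩
      have hb0 : (0 : ℝ) < b := by exact_mod_cast hb
      have := (hB ⟨b, rfl⟩).trans (le_max_left B 0)
      simp only [div_le_iff₀ (pow_pos hb0 (3 * k + 2))] at this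
      calc _ ≤ (max B 0 * (b : ℝ) ^ (3 * k + 2)) * (b : ℝ) ^ 4 := mul_le_mul_of_nonneg_right this (by positivity)
        _ = _ := by ring

lemma uq_tendsto (q : ℕ) : ∃ l, 0 ≤ l ∧
    Tendsto (fun b : ℕ => uq (q + 1) b * (b : ℝ) ^ 4 / (b : ℝ) ^ (3 * (q + 1))) atTop (nhds l) := by
  rcases q with _ | k
  · refine ⟨1 / 2, by norm_num, Tendsto.congr' ?_ tendsto_const_nhds⟩
    filter_upwards [eventually_ge_atTop 3] with b hb
    have hb0 : (0 : ℝ) < b := by exact_mod_cast (by omega : 0 < b)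
    rw [uq_one hb]
    field_simp
  · obtain ⟨K, hK, h⟩ := uq_bound (k + 1)
    obtain ⟨l, h0, hl⟩ := uq_tendsto_of_bound hK h
    refine ⟨l, h0, hl.congr' ?_⟩
    filter_upwards [eventually_ge_atTop 1] with b hb
    grind

/-- The limit of `uq q b * b ^ 4 / b ^ (3 * q)`. -/
def cq (q : ℕ) : ℝ := limUnder atTop fun b : ℕ => uq q b * (b : ℝ) ^ 4 / (b : ℝ) ^ (3 * q)

lemma cq_tendsto {q : ℕ} (hq : 1 ≤ q) :
    Tendsto (fun b : ℕ => uq q b * (b : ℝ) ^ 4 / (b : ℝ) ^ (3 * q)) atTop (nhds (cq q)) := by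
  obtain ⟨k, rfl⟩ : ∃ k, q = k + 1 := ⟨q - 1, by omega⟩
  obtain ⟨l, _, hl⟩ := uq_tendsto k
  rw [cq, hl.limUnder_eq]
  exact hl

/-- A bridgeless connected graph on `C` extended without creating new cycles through `C` is a
whole component of the core. -/
lemma cc_core_union {U C : Finset ℕ} (hCU : C ⊆ U) {H S : EdgeSet} (hH : H ⊆ KK C)
    (hCB : Conn C H ∧ Bless H) (hS : S ⊆ KK U \ KK C)
    (hr : ∀ a ∈ C, ∀ b ∈ C, a ≠ b → ¬Rch S a b) (hc : ∀ a ∈ C, ¬Cyc a S) {c : ℕ} (hcC : c ∈ C) :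
    cc (core (H ∪ S)) U c = C := by
  have hHc : H ⊆ core (H ∪ S) := fun e he =>
    core_mono subset_union_left (mem_core.2 ⟨he, hCB.2 e he⟩)
  ext z
  rw [mem_cc]
  constructor
  · rintro ⟨_, hz⟩
    refine hz.closed (p := fun z => z ∈ C) ?_ hcC
    intro x y hxy hx
    by_contra hy
    obtain ⟨hmem, hj⟩ := mem_core.1 hxy
    have hj' := (jn_mk.1 hj).symm
    have heH : s(x, y) ∉ H := fun h => hy (mem_KK.1 (hH h)).2.1
    have heS : s(x, y) ∈ S := (mem_union.1 hmem).resolve_left heH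
    have hyx : y ≠ x := fun h => hy (h ▸ hx)
    have key : ∀ a b, s(a, b) ∈ (H ∪ S).erase s(x, y) →
        (Rch (S.erase s(x, y)) y a ∧ a ∉ C) → (Rch (S.erase s(x, y)) y b ∧ b ∉ C) := by
      rintro a b hab ⟨ha, haC⟩
      rw [mem_erase] at hab
      have habS : s(a, b) ∈ S.erase s(x, y) :=
        mem_erase.2 ⟨hab.1, (mem_union.1 hab.2).resolve_left fun h =>
          haC (mem_KK.1 (hH h)).1⟩
      have hb : Rch (S.erase s(x, y)) y b := ha.trans (Rch.single habS)
      refine ⟨hb, fun hbC => ?_⟩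
      by_cases hbx : b = x
      · subst hbx
        exact hc b hx ⟨y, hyx, heS, hb.symm⟩
      · exact hr x hx b hbC (Ne.symm hbx)
          ((Rch.single heS).trans (hb.mono (erase_subset _ _)))
    exact (hj'.closed key ⟨Rch.refl _ _, hy⟩).2 hx
  · intro hz
    exact ⟨hCU hz, (hCB.1 c hcC z hz).mono hHc⟩

section
variable {w : ℝ} {U C : Finset ℕ}

lemma ws_sdiff_le (hw : 0 ≤ w) (hCU : C ⊆ U) {P : EdgeSet → Prop} (hP : Monotone P) {q : ℝ}
    (hq : ev w U (fun S => ind (P S)) ≤ q) :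
    ws w (KK U \ KK C) (fun S => ind (P S)) ≤ (1 + w) ^ (KK U \ KK C).card * q := by
  have h1 := ws_inter w (sdiff_subset : KK U \ KK C ⊆ KK U) fun S => ind (P S)
  have h2 : ws w (KK U) (fun S => ind (P (S ∩ (KK U \ KK C)))) ≤ ws w (KK U) (fun S => ind (P S)) :=
    ws_mono hw fun S _ => ind_mono (hP inter_subset_left)
  have hp : 0 < (1 + w) ^ (KK U).card := by positivity
  rw [ev, div_le_iff₀ hp] at hq
  have hcard : (KK U \ (KK U \ KK C)).card + (KK U \ KK C).card = (KK U).card :=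
    card_sdiff_add_card_eq_card sdiff_subset
  rw [← hcard, pow_add] at hq
  have hp' : 0 < (1 + w) ^ (KK U \ (KK U \ KK C)).card := by positivity
  refine le_of_mul_le_mul_left ?_ hp'
  grind

lemma ev_class_ge (hw : 0 ≤ w) (hw1 : w ≤ 1) (hCU : C ⊆ U) {u : ℕ} (hu : u ∈ C) {q : ℝ}
    (hq : (C.card : ℝ) * (C.card * tau w U.card + (U.card - 1) * (w * tau w U.card)) ≤ q)
    (hU : 2 ≤ U.card) :
    th w C.card * (1 - q) / (1 + w) ^ (C.card.choose 2) ≤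
      ev w U (fun S => ind (cc (core S) U u = C)) := by
  have hdisj : Disjoint (KK C) (KK U \ KK C) := disjoint_sdiff
  have hun : KK C ∪ (KK U \ KK C) = KK U := union_sdiff_of_subset (KK_mono hCU)
  have hcard : (KK U).card = (KK C).card + (KK U \ KK C).card := by
    rw [← hun, card_union_of_disjoint hdisj, hun]
  have hτ := tau_nonneg hw hU
  obtain ⟨g, hg⟩ : ∃ g : EdgeSet → ℝ, g = fun S =>
      1 - (∑ a ∈ C, ((∑ b ∈ C.erase a, ind (Rch S a b)) + ind (Cyc a S))) := ⟨_, rfl⟩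
  have hgw : (1 + w) ^ (KK U \ KK C).card * (1 - q) ≤ ws w (KK U \ KK C) g := by
    have h1 : ∀ a ∈ C, ws w (KK U \ KK C) (fun S => (∑ b ∈ C.erase a, ind (Rch S a b)) + ind (Cyc a S)) ≤
        (1 + w) ^ (KK U \ KK C).card * (C.card * tau w U.card + (U.card - 1) * (w * tau w U.card)) := by
      intro a ha
      rw [ws_add, ws_sum, mul_add]
      refine add_le_add ?_ (ws_sdiff_le hw hCU (fun S T h hc => hc.mono h) (ev_cyc hw (hCU ha)))
      have : ∀ b ∈ C.erase a, ws w (KK U \ KK C) (fun S => ind (Rch S a b)) ≤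
          (1 + w) ^ (KK U \ KK C).card * tau w U.card := fun b hb =>
        ws_sdiff_le hw hCU (fun S T h hc => hc.mono h)
          (ev_rch hw (hCU ha) (hCU (mem_of_mem_erase hb)) (ne_of_mem_erase hb).symm).le
      refine (sum_le_sum this).trans ?_
      rw [sum_const, nsmul_eq_mul]
      have hle : ((C.erase a).card : ℝ) ≤ C.card := by exact_mod_cast card_erase_le
      have := mul_le_mul_of_nonneg_right hle
        (mul_nonneg (by positivity : 0 ≤ (1 + w) ^ (KK U \ KK C).card) hτ)
      linarith
    rw [hg, ws_sub, ws_one, ws_sum, mul_sub, mul_one]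
    have h2 := sum_le_sum h1
    rw [sum_const, nsmul_eq_mul] at h2
    have h3 := mul_le_mul_of_nonneg_left hq (by positivity : 0 ≤ (1 + w) ^ (KK U \ KK C).card)
    linarith
  have hmain : th w C.card * ws w (KK U \ KK C) g ≤ ws w (KK U) (fun S => ind (cc (core S) U u = C)) := by
    have hu' := ws_union w hdisj fun S => ind (cc (core S) U u = C)
    rw [hun] at hu'
    rw [hu', ← theta_eq, theta, ← ws_mul_right (α := Sym2 ℕ)]
    refine ws_mono hw fun H hH => ?_
    rw [← ws_mul_left (α := Sym2 ℕ)]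
    refine ws_mono hw fun S hS => ?_
    by_cases hCB : Conn C H ∧ Bless H
    · rw [ind_true hCB, one_mul]
      by_cases hall : (∀ a ∈ C, ∀ b ∈ C, a ≠ b → ¬Rch S a b) ∧ ∀ a ∈ C, ¬Cyc a S
      · rw [ind_true (cc_core_union hCU hH hCB hS hall.1 hall.2 hu), hg]
        have : 0 ≤ ∑ a ∈ C, ((∑ b ∈ C.erase a, ind (Rch S a b)) + ind (Cyc a S)) :=
          sum_nonneg fun a _ => add_nonneg (sum_nonneg fun b _ => ind_nonneg _) (ind_nonneg _)
        linarith
      · refine le_trans ?_ (ind_nonneg _)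
        rw [hg, sub_nonpos]
        rw [not_and_or] at hall
        rcases hall with h | h
        · push Not at h
          obtain ⟨a, ha, b, hb, hab, hrab⟩ := h
          refine le_trans ?_ (single_le_sum (f := fun a => (∑ b ∈ C.erase a, ind (Rch S a b)) +
            ind (Cyc a S)) (fun a _ => add_nonneg (sum_nonneg fun b _ => ind_nonneg _) (ind_nonneg _)) ha)
          have := single_le_sum (f := fun b => ind (Rch S a b)) (fun b _ => ind_nonneg _)
            (mem_erase.2 ⟨hab.symm, hb⟩)
          rw [ind_true hrab] at this
          linarith [ind_nonneg (Cyc a S)]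
        · push Not at h
          obtain ⟨a, ha, hca⟩ := h
          refine le_trans ?_ (single_le_sum (f := fun a => (∑ b ∈ C.erase a, ind (Rch S a b)) +
            ind (Cyc a S)) (fun a _ => add_nonneg (sum_nonneg fun b _ => ind_nonneg _) (ind_nonneg _)) ha)
          have : 0 ≤ ∑ b ∈ C.erase a, ind (Rch S a b) := sum_nonneg fun b _ => ind_nonneg _
          rw [ind_true hca]
          linarith
    · rw [ind_false hCB, zero_mul]
      exact ind_nonneg _
  rw [ev, ← card_KK, hcard, pow_add, div_le_div_iff₀ (by positivity) (by positivity)]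
  have h5 := (mul_le_mul_of_nonneg_left hgw (th_nonneg hw C.card)).trans hmain
  have h6 := mul_le_mul_of_nonneg_right h5 (by positivity : 0 ≤ (1 + w) ^ (KK C).card)
  linarith

lemma sum_class_le (hw : 0 ≤ w) (hw1 : w ≤ 1) {u v : ℕ} (hu : u ∈ U) (hv : v ∈ U) (huv : u ≠ v) :
    ∑ C ∈ U.powerset.filter (fun C => v ∈ C), ev w U (fun S => ind (cc (core S) U u = C)) ≤
      tau w U.card ^ 2 := by
  refine le_trans ?_ (ev_core_le hw hw1 hu hv huv)
  rw [← ev_sum]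
  refine ev_mono hw fun S _ => ?_
  by_cases h : v ∈ cc (core S) U u
  · rw [ind_true (mem_cc.1 h).2, sum_eq_single (cc (core S) U u)]
    · exact ind_le_one _
    · intro C _ hC
      exact ind_false fun h => hC h.symm
    · intro hn
      exact absurd (mem_filter.2 ⟨mem_powerset.2 (cc_subset _ _ _), h⟩) hn
  · refine le_trans (le_of_eq (sum_eq_zero fun C hC => ind_false ?_)) (ind_nonneg _)
    rintro rfl
    exact h (mem_filter.1 hC).2

end

lemma nn_of_gt {b m : ℕ} (h : b.choose 2 < m) : nn b m = 0 := by
  have : ∀ H ⊆ KK (range b), ind (H.card = m ∧ CB (range b) H) = 0 := by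
    intro H hH
    refine ind_false fun h' => ?_
    have := card_le_card hH
    rw [card_KK, card_range] at this
    omega
  rw [nn, ws_congr this, ws_const, mul_zero]

lemma uq_le_th {w : ℝ} (hw : 0 ≤ w) (q b : ℕ) : w ^ (b + q - 1) * (b.factorial * uq q b) ≤ th w b := by
  rw [← nn_eq_uq, th_eq_nn]
  by_cases h : b + q - 1 ≤ b.choose 2
  · exact single_le_sum (f := fun m => w ^ m * nn b m) (fun m _ => mul_nonneg (pow_nonneg hw _) (nn_nonneg _ _))
      (mem_range.2 (by omega))
  · rw [nn_of_gt (by omega), mul_zero]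
    exact sum_nonneg fun m _ => mul_nonneg (pow_nonneg hw _) (nn_nonneg _ _)

lemma uq_of_gt {q b : ℕ} (h : b ^ 2 + 1 < q) : uq q b = 0 := by
  have h1 : b.choose 2 ≤ b ^ 2 := Nat.choose_le_pow b 2
  rw [uq, nn_of_gt (by omega), zero_div]

lemma sum_choose_le {w : ℝ} (hw : 0 ≤ w) (hw1 : w ≤ 1) {n m : ℕ} (hn : 2 ≤ n) (hm : m ≤ n)
    (hq : (m : ℝ) * (m * tau w n + (n - 1) * (w * tau w n)) ≤ 1 / 2) :
    ∑ b ∈ Icc 3 m, ((n - 2).choose (b - 2) : ℝ) * (th w b * (1 / 2) / (1 + w) ^ (b.choose 2)) ≤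
      tau w n ^ 2 := by
  obtain ⟨U, hU⟩ : ∃ U, U = range n := ⟨_, rfl⟩
  have hUc : U.card = n := by rw [hU, card_range]
  have h0 : 0 ∈ U := by rw [hU, mem_range]; omega
  have h1 : 1 ∈ U := by rw [hU, mem_range]; omega
  have hτ := tau_nonneg hw hn
  have hn1 : (1 : ℝ) ≤ n := by exact_mod_cast (by omega : 1 ≤ n)
  have hmain := sum_class_le hw hw1 h0 h1 (by norm_num)
  rw [hUc] at hmain
  refine le_trans ?_ hmain
  obtain ⟨V, hV⟩ : ∃ V, V = (U.erase 0).erase 1 := ⟨_, rfl⟩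
  have hVc : V.card = n - 2 := by
    rw [hV, card_erase_of_mem (mem_erase.2 ⟨by norm_num, h1⟩), card_erase_of_mem h0, hUc]
    omega
  have hV0 : ∀ D ∈ V.powerset, (0 : ℕ) ∉ D := fun D hD h => by
    have := mem_powerset.1 hD h
    simp [hV] at this
  have hV1 : ∀ D ∈ V.powerset, (1 : ℕ) ∉ D := fun D hD h => by
    have := mem_powerset.1 hD h
    simp [hV] at this
  have hins : ∀ D ∈ V.powerset, ((insert 0 (insert 1 D) : Finset ℕ).erase 0).erase 1 = D := by
    grind
  have hcardD : ∀ D ∈ V.powerset, (insert 0 (insert 1 D) : Finset ℕ).card = D.card + 2 := by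
    intro D hD
    rw [card_insert_of_notMem (by simp [hV0 D hD]), card_insert_of_notMem (hV1 D hD)]
  have hsub : ∀ D ∈ V.powerset, (insert 0 (insert 1 D) : Finset ℕ) ⊆ U := by
    grind
  have himg : V.powerset.image (fun D => insert 0 (insert 1 D)) ⊆ U.powerset.filter (fun C => 1 ∈ C) := by
    grind
  refine le_trans ?_ (sum_le_sum_of_subset_of_nonneg himg fun C _ _ =>
    ev_nonneg hw fun _ _ => ind_nonneg _)
  rw [sum_image fun D hD D' hD' h => by rw [← hins D hD, ← hins D' hD', h]]
  have hterm : ∀ D ∈ V.powerset, (if D.card + 2 ∈ Icc 3 m then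
      th w (D.card + 2) * (1 / 2) / (1 + w) ^ ((D.card + 2).choose 2) else 0) ≤
      ev w U (fun S => ind (cc (core S) U 0 = insert 0 (insert 1 D))) := by
    intro D hD
    split_ifs with hc
    · have hcm : ((D.card + 2 : ℕ) : ℝ) ≤ m := by exact_mod_cast (mem_Icc.1 hc).2
      have := ev_class_ge (q := 1 / 2) hw hw1 (hsub D hD) (u := 0) (by simp) (by
        rw [hcardD D hD, hUc]
        refine le_trans ?_ hq
        have e1 : (0 : ℝ) ≤ (n - 1) * (w * tau w n) := mul_nonneg (by linarith) (mul_nonneg hw hτ)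
        refine mul_le_mul hcm (add_le_add (mul_le_mul_of_nonneg_right hcm hτ) le_rfl) ?_ (Nat.cast_nonneg _)
        exact add_nonneg (mul_nonneg (Nat.cast_nonneg _) hτ) e1) (by omega)
      grind
    · exact ev_nonneg hw fun _ _ => ind_nonneg _
  refine le_trans ?_ (sum_le_sum hterm)
  rw [sum_powerset_apply_card (fun d => if d + 2 ∈ Icc 3 m then
      th w (d + 2) * (1 / 2) / (1 + w) ^ ((d + 2).choose 2) else 0) (x := V), hVc]
  have hinj : ∑ b ∈ Icc 3 m, ((n - 2).choose (b - 2) : ℝ) * (th w b * (1 / 2) / (1 + w) ^ (b.choose 2)) =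
      ∑ d ∈ (Icc 3 m).image (fun b => b - 2), (n - 2).choose d • (if d + 2 ∈ Icc 3 m then
      th w (d + 2) * (1 / 2) / (1 + w) ^ ((d + 2).choose 2) else 0) := by
    rw [sum_image]
    · refine sum_congr rfl fun b hb => ?_
      have hb3 := (mem_Icc.1 hb).1
      rw [show b - 2 + 2 = b by omega, if_pos hb, nsmul_eq_mul]
    · intro b hb b' hb' h
      grind
  rw [hinj]
  refine sum_le_sum_of_subset_of_nonneg ?_ fun d _ _ => ?_
  · grind
  · split_ifs
    · grind
    · simp

lemma exp_neg_two_mul_le {x : ℝ} (h0 : 0 ≤ x) (h1 : x ≤ 1 / 2) : exp (-(2 * x)) ≤ 1 - x := by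
  have h2 := add_one_le_exp (2 * x)
  have h3 : 0 < 2 * x + 1 := by linarith
  rw [exp_neg]
  refine (inv_anti₀ h3 h2).trans ?_
  rw [inv_le_comm₀ h3 (by linarith), inv_le_iff_one_le_mul₀ (by linarith)]
  have := mul_nonneg h0 (sub_nonneg.2 h1)
  linarith [mul_self_nonneg x]

/-- Uniform lower bound for the weight of the placements of a class of size `b ≤ kN` among `N³` vertices. -/
lemma class_weight_ge {k N b κ : ℕ} (hk : 1 ≤ k) (hN : 2 * (k + 8 * k ^ 2) ≤ N) (hb3 : 3 ≤ b) (hb : b ≤ k * N) :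
    exp (-(2 * ((k : ℝ) + 8 * k ^ 2) * k + k ^ 2)) / (16 * (N : ℝ) ^ 6) *
        ((b : ℝ) ^ 2 * uq (κ + 1) b * (1 / (2 * (N : ℝ) ^ 3)) ^ κ) ≤
      ((N ^ 3 - 2).choose (b - 2) : ℝ) * (th ((1 - 8 * k ^ 2 / N) / (N : ℝ) ^ 3) b * (1 / 2) /
        (1 + (1 - 8 * k ^ 2 / N) / (N : ℝ) ^ 3) ^ (b.choose 2)) := by
  have hk' : (1 : ℝ) ≤ k := by exact_mod_cast hk
  have hN' : 2 * ((k : ℝ) + 8 * k ^ 2) ≤ N := by exact_mod_cast hN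
  have hk2 : (1 : ℝ) ≤ (k : ℝ) ^ 2 := one_le_pow₀ hk'
  have hNp : (1 : ℝ) ≤ N := by linarith
  have hN0 : (0 : ℝ) < N := by linarith
  have hN3 : (N : ℝ) ≤ (N : ℝ) ^ 3 := le_self_pow₀ hNp (by norm_num)
  have hbk : (b : ℝ) ≤ k * N := by exact_mod_cast hb
  have hb3' : (3 : ℝ) ≤ b := by exact_mod_cast hb3
  obtain ⟨w, hw⟩ : ∃ w : ℝ, w = (1 - 8 * k ^ 2 / N) / (N : ℝ) ^ 3 := ⟨_, rfl⟩
  rw [← hw]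
  have hL : 8 * (k : ℝ) ^ 2 / N ≤ 1 / 2 := by
    rw [div_le_iff₀ hN0]; linarith
  have hL0 : 0 ≤ 8 * (k : ℝ) ^ 2 / N := by positivity
  have hwl : 1 / (2 * (N : ℝ) ^ 3) ≤ w := by
    rw [hw, ← div_div]
    exact div_le_div_of_nonneg_right (by linarith) (by positivity)
  have hw0 : 0 ≤ w := le_trans (by positivity) hwl
  have hwu : w ≤ 1 / (N : ℝ) ^ 3 := by
    rw [hw]
    exact div_le_div_of_nonneg_right (by linarith) (by positivity)
  -- the power of `1 + w`
  have hpow : (1 + w) ^ (b.choose 2) ≤ exp ((k : ℝ) ^ 2) := by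
    have h1 : (1 + w) ^ (b.choose 2) ≤ exp w ^ (b.choose 2) :=
      pow_le_pow_left₀ (by linarith) (by linarith [add_one_le_exp w]) _
    refine h1.trans ?_
    rw [← exp_nat_mul, exp_le_exp]
    have h2 : ((b.choose 2 : ℕ) : ℝ) ≤ (k * N) ^ 2 := by
      have : ((b.choose 2 : ℕ) : ℝ) ≤ (b : ℝ) ^ 2 := by exact_mod_cast Nat.choose_le_pow b 2
      exact this.trans (pow_le_pow_left₀ (by positivity) hbk 2)
    calc ((b.choose 2 : ℕ) : ℝ) * w ≤ (k * N) ^ 2 * (1 / (N : ℝ) ^ 3) :=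
          mul_le_mul h2 hwu hw0 (by positivity)
      _ = (k : ℝ) ^ 2 / N := by field_simp
      _ ≤ (k : ℝ) ^ 2 := div_le_self (by positivity) hNp
  -- the falling factorial
  have hbN : b ≤ N ^ 3 := by
    have : (b : ℝ) ≤ (N : ℝ) ^ 3 := by
      have e : (k : ℝ) * N ≤ N * N := mul_le_mul_of_nonneg_right (by linarith) hN0.le
      have e2 : (N : ℝ) * N ≤ (N : ℝ) ^ 3 := by
        rw [← pow_two]; exact pow_le_pow_right₀ hNp (by norm_num)
      linarith
    exact_mod_cast this
  have hfac : ((b : ℝ) * (b - 1)) * ((N : ℝ) ^ 3 - b) ^ (b - 2) ≤ ((N ^ 3 - 2).choose (b - 2) : ℝ) * b.factorial := by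
    have h1 := Nat.pow_sub_le_descFactorial (N ^ 3 - 2) (b - 2)
    rw [Nat.descFactorial_eq_factorial_mul_choose] at h1
    have h2 : ((N : ℝ) ^ 3 - b) ^ (b - 2) ≤ (b - 2).factorial * ((N ^ 3 - 2).choose (b - 2) : ℝ) := by
      refine le_trans ?_ (by exact_mod_cast h1 : (((N ^ 3 - 2 + 1 - (b - 2)) ^ (b - 2) : ℕ) : ℝ) ≤ _)
      rw [Nat.cast_pow]
      have hbN' : (b : ℝ) ≤ (N : ℝ) ^ 3 := by exact_mod_cast hbN
      refine pow_le_pow_left₀ (by linarith) ?_ _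
      have : N ^ 3 - b ≤ N ^ 3 - 2 + 1 - (b - 2) := by omega
      calc (N : ℝ) ^ 3 - b = ((N ^ 3 - b : ℕ) : ℝ) := by rw [Nat.cast_sub hbN]; push_cast; ring
        _ ≤ _ := by exact_mod_cast this
    have h3 : (b.factorial : ℝ) = b * (b - 1) * (b - 2).factorial := by
      obtain ⟨c, rfl⟩ : ∃ c, b = c + 2 := ⟨b - 2, by omega⟩
      rw [Nat.add_sub_cancel, Nat.factorial_succ, Nat.factorial_succ]
      push_cast
      ring
    rw [h3]
    have h4 : (0 : ℝ) ≤ b * (b - 1) := mul_nonneg (by linarith) (by linarith)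
    calc _ ≤ (b : ℝ) * (b - 1) * ((b - 2).factorial * ((N ^ 3 - 2).choose (b - 2) : ℝ)) :=
          mul_le_mul_of_nonneg_left h2 h4
      _ = _ := by ring
  have hA : exp (-(2 * ((k : ℝ) + 8 * k ^ 2) * k)) ≤ (((N : ℝ) ^ 3 - b) * w) ^ (b - 2) := by
    have e0 : (((N : ℝ) ^ 3 - b) * w) = (1 - b / (N : ℝ) ^ 3) * (1 - 8 * k ^ 2 / N) := by
      rw [hw]; field_simp
    have e1 : (b : ℝ) / (N : ℝ) ^ 3 ≤ k / N := by
      rw [div_le_div_iff₀ (by positivity) hN0]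
      have : (k : ℝ) * N * N ≤ k * (N : ℝ) ^ 3 := by
        have : (N : ℝ) * N ≤ (N : ℝ) ^ 3 := by
          rw [← pow_two]; exact pow_le_pow_right₀ hNp (by norm_num)
        have := mul_le_mul_of_nonneg_left this (by linarith : (0 : ℝ) ≤ k)
        linarith
      exact (mul_le_mul_of_nonneg_right hbk hN0.le).trans this
    have e2 : (0 : ℝ) ≤ b / (N : ℝ) ^ 3 := by positivity
    have e3 : ((k : ℝ) + 8 * k ^ 2) / N ≤ 1 / 2 := by rw [div_le_iff₀ hN0]; linarith
    have e4 : 1 - ((k : ℝ) + 8 * k ^ 2) / N ≤ (((N : ℝ) ^ 3 - b) * w) := by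
      rw [e0, add_div]
      linarith [mul_nonneg e2 hL0]
    have e5 := exp_neg_two_mul_le (by positivity) e3
    refine le_trans ?_ (pow_le_pow_left₀ (exp_pos _).le (e5.trans e4) _)
    rw [← exp_nat_mul, exp_le_exp]
    have e6 : ((b - 2 : ℕ) : ℝ) ≤ k * N := by
      rw [Nat.cast_sub (by omega)]; push_cast; linarith
    have e7 : ((b - 2 : ℕ) : ℝ) * (2 * (((k : ℝ) + 8 * k ^ 2) / N)) ≤ k * N * (2 * (((k : ℝ) + 8 * k ^ 2) / N)) :=
      mul_le_mul_of_nonneg_right e6 (by positivity)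
    have e8 : (k : ℝ) * N * (2 * (((k : ℝ) + 8 * k ^ 2) / N)) = 2 * ((k : ℝ) + 8 * k ^ 2) * k := by field_simp
    linarith
  have hu : 0 ≤ uq (κ + 1) b := uq_nonneg _ _
  have hth := uq_le_th hw0 (κ + 1) b
  rw [show b + (κ + 1) - 1 = (b - 2) + (2 + κ) by omega, pow_add] at hth
  have hw2 : (1 / (2 * (N : ℝ) ^ 3)) ^ (2 + κ) ≤ w ^ (2 + κ) := pow_le_pow_left₀ (by positivity) hwl _
  have hbb : (b : ℝ) ^ 2 / 2 ≤ b * (b - 1) := by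
    have := mul_nonneg (by linarith : (0 : ℝ) ≤ b) (by linarith : (0 : ℝ) ≤ b - 2)
    linarith
  have hX : (b : ℝ) ^ 2 / 2 * exp (-(2 * ((k : ℝ) + 8 * k ^ 2) * k)) ≤
      ((N ^ 3 - 2).choose (b - 2) : ℝ) * b.factorial * w ^ (b - 2) := by
    calc _ ≤ (b : ℝ) * (b - 1) * (((N : ℝ) ^ 3 - b) * w) ^ (b - 2) :=
          mul_le_mul hbb hA (exp_pos _).le (by linarith [sq_nonneg (b : ℝ)])
      _ = (b : ℝ) * (b - 1) * ((N : ℝ) ^ 3 - b) ^ (b - 2) * w ^ (b - 2) := by rw [mul_pow]; ring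
      _ ≤ _ := mul_le_mul_of_nonneg_right hfac (pow_nonneg hw0 _)
  have hY : (b : ℝ) ^ 2 / 2 * exp (-(2 * ((k : ℝ) + 8 * k ^ 2) * k)) *
      ((1 / (2 * (N : ℝ) ^ 3)) ^ (2 + κ) * uq (κ + 1) b) ≤ ((N ^ 3 - 2).choose (b - 2) : ℝ) * th w b := by
    calc _ ≤ ((N ^ 3 - 2).choose (b - 2) : ℝ) * b.factorial * w ^ (b - 2) * (w ^ (2 + κ) * uq (κ + 1) b) :=
          mul_le_mul hX (mul_le_mul_of_nonneg_right hw2 hu) (by positivity) (by positivity)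
      _ = ((N ^ 3 - 2).choose (b - 2) : ℝ) * (w ^ (b - 2) * w ^ (2 + κ) * (b.factorial * uq (κ + 1) b)) := by ring
      _ ≤ ((N ^ 3 - 2).choose (b - 2) : ℝ) * th w b := mul_le_mul_of_nonneg_left hth (by positivity)
    exact le_rfl
  have hpos : 0 < (1 + w) ^ (b.choose 2) := by positivity
  calc _ = ((b : ℝ) ^ 2 / 2 * exp (-(2 * ((k : ℝ) + 8 * k ^ 2) * k)) *
      ((1 / (2 * (N : ℝ) ^ 3)) ^ (2 + κ) * uq (κ + 1) b)) * (1 / 2) / exp ((k : ℝ) ^ 2) := by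
        rw [neg_add, exp_add, exp_neg ((k : ℝ) ^ 2), pow_add]
        field_simp
        norm_num
    _ ≤ ((b : ℝ) ^ 2 / 2 * exp (-(2 * ((k : ℝ) + 8 * k ^ 2) * k)) *
      ((1 / (2 * (N : ℝ) ^ 3)) ^ (2 + κ) * uq (κ + 1) b)) * (1 / 2) / (1 + w) ^ (b.choose 2) :=
        div_le_div_of_nonneg_left (by positivity) hpos hpow
    _ ≤ ((N ^ 3 - 2).choose (b - 2) : ℝ) * th w b * (1 / 2) / (1 + w) ^ (b.choose 2) :=
        div_le_div_of_nonneg_right (mul_le_mul_of_nonneg_right hY (by norm_num)) hpos.le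
    _ = _ := by ring

lemma sum_sq_uq_le_cube {k : ℕ} (hk : 1 ≤ k) : ∃ C : ℝ, 0 ≤ C ∧ ∀ N : ℕ, 2 * (k + 8 * k ^ 2) ≤ N → ∀ κ : ℕ,
    ∑ b ∈ Icc 3 (k * N), (b : ℝ) ^ 2 * uq (κ + 1) b * (1 / (2 * (N : ℝ) ^ 3)) ^ κ ≤ C * (N : ℝ) ^ 2 := by
  refine ⟨16 * exp (2 * ((k : ℝ) + 8 * k ^ 2) * k + k ^ 2), by positivity, fun N hN κ => ?_⟩
  have hk' : (1 : ℝ) ≤ k := by exact_mod_cast hk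
  have hN' : 2 * ((k : ℝ) + 8 * k ^ 2) ≤ N := by exact_mod_cast hN
  have hk2 : (1 : ℝ) ≤ (k : ℝ) ^ 2 := one_le_pow₀ hk'
  have hNp : (18 : ℝ) ≤ N := by linarith
  have hN0 : (0 : ℝ) < N := by linarith
  have hNn : 18 ≤ N := by exact_mod_cast hNp
  obtain ⟨w, hw⟩ : ∃ w : ℝ, w = (1 - 8 * k ^ 2 / N) / (N : ℝ) ^ 3 := ⟨_, rfl⟩
  have hL : 8 * (k : ℝ) ^ 2 / N ≤ 1 / 2 := by
    rw [div_le_iff₀ hN0]; linarith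
  have hL0 : 0 < 8 * (k : ℝ) ^ 2 / N := by positivity
  have hw0 : 0 ≤ w := by rw [hw]; exact div_nonneg (by linarith) (by positivity)
  have hn2 : 2 ≤ N ^ 3 := le_trans (by omega : 2 ≤ N) (Nat.le_self_pow (by norm_num) N)
  have hN3 : (N : ℝ) ≤ (N : ℝ) ^ 3 := le_self_pow₀ (by linarith) (by norm_num)
  have hnw : ((N ^ 3 : ℕ) : ℝ) * w = 1 - 8 * k ^ 2 / N := by
    grind
  have hw1 : w ≤ 1 := by
    rw [hw, div_le_one (by positivity)]; linarith
  have hchi : chi w (N ^ 3) ≤ N / (8 * k ^ 2) := by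
    have := chi_subcritical hw0 (by omega : 0 < N ^ 3) (by rw [hnw]; linarith)
    rwa [hnw, sub_sub_cancel, inv_div] at this
  have hchi2 := chi_le_card hw0 (by omega : 0 < N ^ 3)
  have hτ0 := tau_nonneg hw0 hn2
  have hn1 : (1 : ℝ) < (N ^ 3 : ℕ) := by push_cast; linarith
  have hτ : tau w (N ^ 3) ≤ 1 / (8 * k ^ 2 * (N : ℝ) ^ 2) := by
    have h1 : tau w (N ^ 3) ≤ chi w (N ^ 3) / (N ^ 3 : ℕ) := by
      rw [tau, div_le_div_iff₀ (by linarith) (by linarith)]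
      linarith
    refine h1.trans ((div_le_div_of_nonneg_right hchi (by linarith)).trans (le_of_eq ?_))
    push_cast
    field_simp
  have hcond : ((k * N : ℕ) : ℝ) * ((k * N : ℕ) * tau w (N ^ 3) + ((N ^ 3 : ℕ) - 1) * (w * tau w (N ^ 3))) ≤ 1 / 2 := by
    have h1 : (((N ^ 3 : ℕ) : ℝ) - 1) * (w * tau w (N ^ 3)) ≤ tau w (N ^ 3) := by
      have e : (((N ^ 3 : ℕ) : ℝ) - 1) * (w * tau w (N ^ 3)) = (((N ^ 3 : ℕ) : ℝ) * w - w) * tau w (N ^ 3) := by ring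
      rw [e, hnw]
      have := mul_le_mul_of_nonneg_right (by linarith : 1 - 8 * (k : ℝ) ^ 2 / N - w ≤ 1) hτ0
      linarith
    have hkN : (1 : ℝ) ≤ (k * N : ℕ) := by
      push_cast
      have := mul_le_mul hk' hNp (by norm_num) (by linarith)
      linarith
    have h2 : ((k * N : ℕ) : ℝ) * tau w (N ^ 3) + ((N ^ 3 : ℕ) - 1) * (w * tau w (N ^ 3)) ≤
        2 * ((k * N : ℕ) * tau w (N ^ 3)) := by
      have := mul_le_mul_of_nonneg_right hkN hτ0
      linarith
    calc _ ≤ ((k * N : ℕ) : ℝ) * (2 * ((k * N : ℕ) * tau w (N ^ 3))) :=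
          mul_le_mul_of_nonneg_left h2 (by linarith)
      _ = 2 * (k * N) ^ 2 * tau w (N ^ 3) := by push_cast; ring
      _ ≤ 2 * (k * N) ^ 2 * (1 / (8 * k ^ 2 * (N : ℝ) ^ 2)) := mul_le_mul_of_nonneg_left hτ (by positivity)
      _ = 1 / 4 := by field_simp; norm_num
      _ ≤ 1 / 2 := by norm_num
  have hmn : k * N ≤ N ^ 3 := by
    have h1 : k ≤ N := by omega
    calc k * N ≤ N * N := Nat.mul_le_mul_right _ h1
      _ = N ^ 2 := (pow_two N).symm
      _ ≤ N ^ 3 := Nat.pow_le_pow_right (by omega) (by norm_num)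
  have hmain := sum_choose_le hw0 hw1 hn2 hmn hcond
  have hlow : ∑ b ∈ Icc 3 (k * N), exp (-(2 * ((k : ℝ) + 8 * k ^ 2) * k + k ^ 2)) / (16 * (N : ℝ) ^ 6) *
        ((b : ℝ) ^ 2 * uq (κ + 1) b * (1 / (2 * (N : ℝ) ^ 3)) ^ κ) ≤ tau w (N ^ 3) ^ 2 := by
    refine le_trans (sum_le_sum fun b hb => ?_) hmain
    rw [hw]
    exact class_weight_ge hk hN (mem_Icc.1 hb).1 (mem_Icc.1 hb).2
  rw [← mul_sum] at hlow
  have hτ2 : tau w (N ^ 3) ^ 2 ≤ 1 / (N : ℝ) ^ 4 := by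
    calc tau w (N ^ 3) ^ 2 ≤ (1 / (8 * k ^ 2 * (N : ℝ) ^ 2)) ^ 2 := pow_le_pow_left₀ hτ0 hτ 2
      _ ≤ (1 / (N : ℝ) ^ 2) ^ 2 := by
        refine pow_le_pow_left₀ (by positivity) ?_ 2
        refine one_div_le_one_div_of_le (by positivity) ?_
        have := mul_le_mul_of_nonneg_right (by linarith : (1 : ℝ) ≤ 8 * k ^ 2) (by positivity : 0 ≤ (N : ℝ) ^ 2)
        linarith
      _ = 1 / (N : ℝ) ^ 4 := by rw [div_pow, one_pow, ← pow_mul]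
  have h3 := hlow.trans hτ2
  rw [exp_neg, div_mul_eq_mul_div, div_le_div_iff₀ (by positivity) (by positivity), inv_mul_eq_div,
    div_mul_eq_mul_div, div_le_iff₀ (exp_pos _)] at h3
  refine le_of_mul_le_mul_right ?_ (by positivity : 0 < (N : ℝ) ^ 4)
  refine h3.trans (le_of_eq ?_)
  ring

lemma sum_sq_uq_le {K : ℝ} (hK : 1 ≤ K) : ∃ C : ℝ, 0 ≤ C ∧ ∀ m : ℕ, 1 ≤ m → ∀ κ : ℕ,
    ∑ b ∈ Icc 3 m, (b : ℝ) ^ 2 * (K ^ κ * uq (κ + 1) b) ≤ C * (m : ℝ) ^ (3 * κ + 2) := by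
  obtain ⟨k, hk⟩ := exists_nat_ge (16 * K)
  have hk1' : (1 : ℝ) ≤ k := by linarith
  have hk1 : 1 ≤ k := by exact_mod_cast hk1'
  have hk3 : 16 * K ≤ (k : ℝ) ^ 3 := hk.trans (le_self_pow₀ hk1' (by norm_num))
  obtain ⟨C₀, hC₀, hC⟩ := sum_sq_uq_le_cube hk1
  obtain ⟨m₀, hm₀⟩ : ∃ m₀, m₀ = k * (2 * (k + 8 * k ^ 2)) := ⟨_, rfl⟩
  obtain ⟨C₁, hC₁⟩ : ∃ C₁ : ℝ, C₁ = ∑ κ ∈ range (m₀ ^ 2 + 2), ∑ b ∈ Icc 3 m₀, (b : ℝ) ^ 2 * (K ^ κ * uq (κ + 1) b) :=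
    ⟨_, rfl⟩
  have hK0 : 0 ≤ K := by linarith
  have hterm : ∀ κ b : ℕ, 0 ≤ (b : ℝ) ^ 2 * (K ^ κ * uq (κ + 1) b) := fun κ b =>
    mul_nonneg (sq_nonneg _) (mul_nonneg (pow_nonneg hK0 _) (uq_nonneg _ _))
  have hC₁0 : 0 ≤ C₁ := by
    rw [hC₁]; exact sum_nonneg fun κ _ => sum_nonneg fun b _ => hterm κ b
  refine ⟨4 * C₀ + C₁, by positivity, fun m hm κ => ?_⟩
  have hm1 : (1 : ℝ) ≤ m := by exact_mod_cast hm
  have hmp : (1 : ℝ) ≤ (m : ℝ) ^ (3 * κ + 2) := one_le_pow₀ hm1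
  rw [add_mul]
  rcases le_or_gt m₀ m with h | h
  · refine le_add_of_le_of_nonneg ?_ (by positivity)
    obtain ⟨N, hN⟩ : ∃ N, N = (m + k - 1) / k := ⟨_, rfl⟩
    have hmN : m ≤ k * N := by
      have := Nat.div_add_mod (m + k - 1) k
      have h2 := Nat.mod_lt (m + k - 1) (by omega : k > 0)
      rw [← hN] at this
      omega
    have hNm : k * N ≤ 2 * m := by
      have := Nat.mul_div_le (m + k - 1) k
      rw [← hN] at this
      have : k ≤ m := by
        refine le_trans ?_ h
        rw [hm₀]
        exact Nat.le_mul_of_pos_right k (by omega)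
      omega
    have hN0 : 2 * (k + 8 * k ^ 2) ≤ N := by
      refine Nat.le_of_mul_le_mul_left ?_ (by omega : 0 < k)
      rw [← hm₀]
      exact h.trans hmN
    have hNm' : (k : ℝ) * N ≤ 2 * m := by exact_mod_cast hNm
    have hNpos : 0 < N := by omega
    have hNpos' : (0 : ℝ) < N := by exact_mod_cast hNpos
    have h1 := hC N hN0 κ
    have h3 : K * (2 * (N : ℝ) ^ 3) ≤ (m : ℝ) ^ 3 := by
      have e := pow_le_pow_left₀ (by positivity) hNm' 3
      rw [mul_pow, mul_pow] at e
      have e2 := mul_le_mul_of_nonneg_right hk3 (by positivity : 0 ≤ (N : ℝ) ^ 3)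
      linarith
    have h4 : (N : ℝ) ^ 2 ≤ 4 * (m : ℝ) ^ 2 := by
      have : (N : ℝ) ≤ 2 * m := le_trans (le_mul_of_one_le_left hNpos'.le hk1') hNm'
      calc (N : ℝ) ^ 2 ≤ (2 * m) ^ 2 := pow_le_pow_left₀ hNpos'.le this 2
        _ = _ := by ring
    calc ∑ b ∈ Icc 3 m, (b : ℝ) ^ 2 * (K ^ κ * uq (κ + 1) b) ≤
          ∑ b ∈ Icc 3 (k * N), (b : ℝ) ^ 2 * (K ^ κ * uq (κ + 1) b) :=
          sum_le_sum_of_subset_of_nonneg (Icc_subset_Icc le_rfl hmN) fun b _ _ => hterm κ b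
      _ = (K * (2 * (N : ℝ) ^ 3)) ^ κ * ∑ b ∈ Icc 3 (k * N), (b : ℝ) ^ 2 * uq (κ + 1) b * (1 / (2 * (N : ℝ) ^ 3)) ^ κ := by
          rw [mul_sum]
          refine sum_congr rfl fun b _ => ?_
          rw [mul_pow, one_div, inv_pow]
          field_simp
      _ ≤ ((m : ℝ) ^ 3) ^ κ * (C₀ * (4 * (m : ℝ) ^ 2)) :=
          mul_le_mul (pow_le_pow_left₀ (by positivity) h3 κ) (h1.trans (mul_le_mul_of_nonneg_left h4 hC₀))
            (sum_nonneg fun b _ => mul_nonneg (mul_nonneg (sq_nonneg _) (uq_nonneg _ _)) (by positivity)) (by positivity)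
      _ = 4 * C₀ * (m : ℝ) ^ (3 * κ + 2) := by rw [pow_add, pow_mul]; ring
  · refine le_add_of_nonneg_of_le (by positivity) ?_
    refine le_trans ?_ (le_mul_of_one_le_right hC₁0 hmp)
    by_cases hκ : κ < m₀ ^ 2 + 2
    · calc _ ≤ ∑ b ∈ Icc 3 m₀, (b : ℝ) ^ 2 * (K ^ κ * uq (κ + 1) b) :=
            sum_le_sum_of_subset_of_nonneg (Icc_subset_Icc le_rfl h.le) fun b _ _ => hterm κ b
        _ ≤ C₁ := by
            rw [hC₁]
            exact single_le_sum (f := fun κ => ∑ b ∈ Icc 3 m₀, (b : ℝ) ^ 2 * (K ^ κ * uq (κ + 1) b))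
              (fun κ _ => sum_nonneg fun b _ => hterm κ b) (mem_range.2 hκ)
    · rw [sum_eq_zero fun b hb => ?_]
      · exact hC₁0
      have hb := (mem_Icc.1 hb).2
      have : b ^ 2 ≤ m₀ ^ 2 := Nat.pow_le_pow_left (by omega) 2
      rw [uq_of_gt (by omega), mul_zero, mul_zero]

lemma sum_uq_le {K : ℝ} (hK : 1 ≤ K) : ∃ C : ℝ, 0 ≤ C ∧ ∀ m κ : ℕ, 1 ≤ κ →
    ∑ b ∈ Icc 3 m, K ^ κ * uq (κ + 1) b ≤ C * (m : ℝ) ^ (3 * κ) := by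
  obtain ⟨C, hC0, hC⟩ := sum_sq_uq_le hK
  have hK0 : 0 ≤ K := by linarith
  have hterm : ∀ κ b : ℕ, 0 ≤ (K ^ κ * uq (κ + 1) b) := fun κ b => (mul_nonneg (pow_nonneg hK0 _) (uq_nonneg _ _))
  refine ⟨8 * C, by positivity, fun m κ hκ => ?_⟩
  induction m using Nat.strong_induction_on with
  | _ m ih =>
  rcases Nat.lt_or_ge m 3 with hm | hm
  · rw [Icc_eq_empty (by omega), sum_empty]; positivity
  have hm0 : (0 : ℝ) < m := by exact_mod_cast (by omega : 0 < m)
  have h1 := ih (m / 2) (by omega)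
  have h2 : ((m / 2 : ℕ) : ℝ) ≤ m / 2 := Nat.cast_div_le
  have h3 : ((m / 2 : ℕ) : ℝ) ^ (3 * κ) ≤ (m : ℝ) ^ (3 * κ) / 8 := by
    calc ((m / 2 : ℕ) : ℝ) ^ (3 * κ) ≤ ((m : ℝ) / 2) ^ (3 * κ) := pow_le_pow_left₀ (Nat.cast_nonneg _) h2 _
      _ = (m : ℝ) ^ (3 * κ) / 8 ^ κ := by rw [div_pow, pow_mul 2]; norm_num
      _ ≤ (m : ℝ) ^ (3 * κ) / 8 := div_le_div_of_nonneg_left (by positivity) (by norm_num) (le_self_pow₀ (by norm_num) (by omega))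
  have h4 : ∑ b ∈ Icc 3 m, K ^ κ * uq (κ + 1) b ≤ ∑ b ∈ Icc 3 (m / 2), K ^ κ * uq (κ + 1) b +
      4 / (m : ℝ) ^ 2 * ∑ b ∈ Icc 3 m, (b : ℝ) ^ 2 * (K ^ κ * uq (κ + 1) b) := by
    have hs : Icc 3 (m / 2) = (Icc 3 m).filter (fun b => b ≤ m / 2) := by
      grind
    rw [hs, sum_filter, mul_sum, ← sum_add_distrib]
    refine sum_le_sum fun b hb => ?_
    have ht := hterm κ b
    split_ifs with hc
    · exact le_add_of_nonneg_right (by positivity)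
    · rw [zero_add, ← mul_assoc]
      refine le_mul_of_one_le_left ht ?_
      rw [div_mul_eq_mul_div, one_le_div (by positivity)]
      have : (m : ℝ) ≤ 2 * b := by exact_mod_cast (by omega : m ≤ 2 * b)
      calc (m : ℝ) ^ 2 ≤ (2 * b) ^ 2 := pow_le_pow_left₀ hm0.le this 2
        _ = 4 * (b : ℝ) ^ 2 := by ring
  have h5 := hC m (by omega) κ
  have h6 : 4 / (m : ℝ) ^ 2 * ∑ b ∈ Icc 3 m, (b : ℝ) ^ 2 * (K ^ κ * uq (κ + 1) b) ≤ 4 * C * (m : ℝ) ^ (3 * κ) := by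
    refine (mul_le_mul_of_nonneg_left h5 (by positivity)).trans (le_of_eq ?_)
    rw [pow_add]
    field_simp
  have h7 := mul_le_mul_of_nonneg_left h3 (by positivity : 0 ≤ 8 * C)
  have h8 : 0 ≤ C * (m : ℝ) ^ (3 * κ) := by positivity
  linarith

lemma integral_floor {E : Type*} [NormedAddCommGroup E] [NormedSpace ℝ E] [CompleteSpace E]
    {f : ℕ → E} {J : ℕ} (hf : ∀ b, J ≤ b → f b = 0) :
    ∫ x in Set.Ioi (0 : ℝ), f ⌊x⌋₊ = ∑ b ∈ range J, f b := by
  have h1 : ∫ x in Set.Ioi (0 : ℝ), f ⌊x⌋₊ = ∫ x in Set.Ioc (0 : ℝ) J, f ⌊x⌋₊ := by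
    refine setIntegral_eq_of_subset_of_forall_sdiff_eq_zero measurableSet_Ioi Set.Ioc_subset_Ioi_self ?_
    rintro x ⟨hx0, hx⟩
    refine hf _ (Nat.le_floor ?_)
    by_contra h
    exact hx ⟨hx0, (not_le.1 h).le⟩
  have hfl : ∀ k : ℕ, Set.EqOn (fun _ : ℝ => f k) (fun x : ℝ => f ⌊x⌋₊) (Set.Ioo (k : ℝ) ((k + 1 : ℕ) : ℝ)) := by
    intro k x hx
    have : ⌊x⌋₊ = k := by
      rw [Nat.floor_eq_iff ((Nat.cast_nonneg k).trans hx.1.le)]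
      exact ⟨hx.1.le, by grind⟩
    simp only [this]
  have hle : ∀ k : ℕ, (k : ℝ) ≤ ((k + 1 : ℕ) : ℝ) := fun k => by push_cast; linarith
  rw [h1, ← intervalIntegral.integral_of_le (Nat.cast_nonneg J)]
  have h2 := intervalIntegral.sum_integral_adjacent_intervals (f := fun x : ℝ => f ⌊x⌋₊)
    (μ := volume) (a := fun k : ℕ => (k : ℝ)) (n := J) (fun k _ => by
      rw [intervalIntegrable_iff_integrableOn_Ioo_of_le (hle k)]
      exact (integrableOn_const (by simp) (by simp)).congr_fun (hfl k) measurableSet_Ioo)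
  simp only [Nat.cast_zero] at h2
  rw [← h2]
  refine sum_congr rfl fun k _ => ?_
  rw [intervalIntegral.integral_of_le (hle k), integral_Ioc_eq_integral_Ioo,
    ← setIntegral_congr_fun measurableSet_Ioo (hfl k)]
  simp

lemma integral_floor_mul {E : Type*} [NormedAddCommGroup E] [NormedSpace ℝ E] [CompleteSpace E]
    {f : ℕ → E} {J : ℕ} (hf : ∀ b, J ≤ b → f b = 0) {T : ℝ} (hT : 0 < T) :
    ∫ x in Set.Ioi (0 : ℝ), f ⌊x * T⌋₊ = T⁻¹ • ∑ b ∈ range J, f b := by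
  rw [integral_comp_mul_right_Ioi (fun x => f ⌊x⌋₊) 0 hT, zero_mul, integral_floor hf]

lemma tendsto_riemann {T : ℕ → ℝ} (hT : Tendsto T atTop atTop) {j : ℕ → ℕ} {y : ℝ} (hy : 0 < y)
    (hj : Tendsto (fun n => (j n : ℝ) / T n) atTop (nhds y)) {g : ℕ → ℕ → ℂ} {G : ℝ → ℂ} {M : ℝ}
    (hM : ∀ᶠ n in atTop, ∀ b, 3 ≤ b → b < j n → ‖g n b‖ ≤ M)
    (hG : ∀ x, 0 < x → x < y → Tendsto (fun n => g n ⌊x * T n⌋₊) atTop (nhds (G x))) :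
    Tendsto (fun n => (∑ b ∈ Ico 3 (j n), g n b) / (T n : ℂ)) atTop (nhds (∫ x in Set.Ioo 0 y, G x)) := by
  obtain ⟨f, hf⟩ : ∃ f : ℕ → ℕ → ℂ, f = fun n b => if 3 ≤ b ∧ b < j n then g n b else 0 := ⟨_, rfl⟩
  have hTpos : ∀ᶠ n in atTop, 0 < T n := hT.eventually_gt_atTop 0
  have hle : ∀ {n : ℕ} {x : ℝ}, 0 < T n → ⌊x * T n⌋₊ < j n → x < j n / T n := by
    intro n x hTn h
    rw [lt_div_iff₀ hTn]
    exact (Nat.lt_floor_add_one _).trans_le (by exact_mod_cast h)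
  have heq : ∀ᶠ n in atTop, (∑ b ∈ Ico 3 (j n), g n b) / (T n : ℂ) = ∫ x in Set.Ioi (0 : ℝ), f n ⌊x * T n⌋₊ := by
    filter_upwards [hTpos] with n hTn
    rw [integral_floor_mul (J := j n) (fun b hb => by rw [hf]; exact if_neg (by omega)) hTn, hf]
    simp only [real_smul, ofReal_inv]
    rw [← sum_filter, div_eq_inv_mul]
    congr 2
    grind
  refine Tendsto.congr' (heq.mono fun n h => h.symm) ?_
  have hlim : ∫ x in Set.Ioo 0 y, G x = ∫ x in Set.Ioi (0 : ℝ), (Set.Ioo 0 y).indicator G x := by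
    rw [setIntegral_indicator measurableSet_Ioo]
    congr 2
    grind
  rw [hlim]
  refine tendsto_integral_filter_of_dominated_convergence
    ((Set.Ioc 0 (y + 1)).indicator fun _ => |M|) ?_ ?_ ?_ ?_
  · refine Eventually.of_forall fun n => ?_
    have : Measurable fun x : ℝ => f n ⌊x * T n⌋₊ :=
      (measurable_from_nat (f := f n)).comp (Nat.measurable_floor.comp (measurable_id.mul_const _))
    exact this.aestronglyMeasurable
  · have hj1 : ∀ᶠ n in atTop, (j n : ℝ) / T n < y + 1 := hj.eventually_lt_const (by linarith)
    filter_upwards [hTpos, hM, hj1] with n hTn hMn hjn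
    refine (ae_restrict_iff' measurableSet_Ioi).2 (Eventually.of_forall fun x hx => ?_)
    rw [hf]
    simp only
    split_ifs with h
    · rw [Set.indicator_of_mem (show x ∈ Set.Ioc 0 (y + 1) from ⟨hx, ((hle hTn h.2).trans hjn).le⟩)]
      exact (hMn _ h.1 h.2).trans (le_abs_self M)
    · rw [norm_zero]
      exact Set.indicator_nonneg (fun _ _ => abs_nonneg M) _
  · refine Integrable.restrict ?_
    rw [integrable_indicator_iff measurableSet_Ioc]
    exact integrableOn_const (by simp) (by simp)
  · have hne : ∀ᵐ x : ℝ ∂(volume.restrict (Set.Ioi 0)), x ≠ y := by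
      refine ae_restrict_of_ae ?_
      simp [ae_iff, measure_singleton]
    filter_upwards [hne, ae_restrict_mem measurableSet_Ioi] with x hxy hx0
    rcases lt_or_gt_of_ne hxy with hlt | hgt
    · rw [Set.indicator_of_mem (show x ∈ Set.Ioo 0 y from ⟨hx0, hlt⟩)]
      refine (hG x hx0 hlt).congr' ?_
      have hxT : Tendsto (fun n => x * T n) atTop atTop := hT.const_mul_atTop hx0
      filter_upwards [hTpos, hj.eventually_const_lt hlt, hxT.eventually_ge_atTop 3] with n hTn h1 h2
      rw [hf]
      refine (if_pos ⟨Nat.le_floor (by exact_mod_cast h2), ?_⟩).symm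
      rw [lt_div_iff₀ hTn] at h1
      exact (Nat.floor_lt (by linarith)).2 h1
    · rw [Set.indicator_of_notMem (fun h => absurd h.2 (not_lt.2 hgt.le))]
      refine tendsto_const_nhds.congr' ?_
      filter_upwards [hTpos, hj.eventually_lt_const hgt] with n hTn h1
      grind

lemma th_div_eq (w : ℝ) {b M : ℕ} (hb : 3 ≤ b) (hM : b ^ 2 + 1 < M) :
    th w b / b.factorial = ∑ κ ∈ range M, w ^ κ * (uq (κ + 1) b * w ^ b) := by
  have h1 : b.choose 2 ≤ b ^ 2 := Nat.choose_le_pow b 2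
  have hfac : (b.factorial : ℝ) ≠ 0 := by positivity
  have h2 : ∀ κ ∈ range M, w ^ κ * (uq (κ + 1) b * w ^ b) = w ^ (b + κ) * nn b (b + κ) / b.factorial := by
    intro κ _
    rw [uq, show b + (κ + 1) - 1 = b + κ by omega, pow_add]
    ring
  rw [sum_congr rfl h2, ← sum_div, th_eq_nn]
  congr 1
  have h3 : ∑ m ∈ range (b.choose 2 + 1), w ^ m * nn b m = ∑ m ∈ range (b + M), w ^ m * nn b m := by
    refine sum_subset (range_mono (by omega)) fun m _ hm => ?_
    rw [mem_range] at hm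
    rw [nn_of_gt (by omega), mul_zero]
  rw [h3, sum_range_add, sum_eq_zero, zero_add]
  intro m hm
  rw [mem_range] at hm
  rcases Nat.lt_or_ge (m + 1) b with h | h
  · rw [nn_of_lt h, mul_zero]
  · have h4 : uq 0 b = 0 := uq_zero (by omega)
    rw [show m = b + 0 - 1 by omega, nn_eq_uq, h4, mul_zero, mul_zero]

/-- The contribution of excess `κ` to the exponent. -/
def sk (w : ℝ) (j : ℕ) (ρ ζ : ℂ) (κ : ℕ) : ℂ :=
  (w : ℂ) ^ κ * ∑ b ∈ Ico 3 j, (uq (κ + 1) b : ℂ) * (ρ ^ b * (1 + b * ζ))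

lemma sum_tb_eq_tsum (w : ℝ) (j : ℕ) (ζ z : ℂ) :
    ∑ b ∈ Ico 3 j, tb w ζ b * z ^ b = ∑' κ, sk w j (w * z) ζ κ := by
  rw [tsum_eq_sum (s := range (j ^ 2 + 2))]
  · simp only [sk, mul_sum]
    rw [sum_comm]
    refine sum_congr rfl fun b hb => ?_
    have hb' := mem_Ico.1 hb
    have h1 : b ^ 2 ≤ j ^ 2 := Nat.pow_le_pow_left hb'.2.le 2
    have h2 := th_div_eq w hb'.1 (by omega : b ^ 2 + 1 < j ^ 2 + 2)
    have h3 : tb w ζ b = ((th w b / b.factorial : ℝ) : ℂ) * (1 + b * ζ) := by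
      rw [tb]; push_cast; ring
    rw [h3, h2]
    push_cast
    rw [sum_mul, sum_mul]
    refine sum_congr rfl fun κ _ => ?_
    rw [mul_pow]
    ring
  · intro κ hκ
    rw [mem_range] at hκ
    rw [sk, sum_eq_zero, mul_zero]
    intro b hb
    have hb' := mem_Ico.1 hb
    have h1 : b ^ 2 ≤ j ^ 2 := Nat.pow_le_pow_left hb'.2.le 2
    rw [uq_of_gt (by omega), ofReal_zero, zero_mul]

lemma sum_norm_tb_eq {w : ℝ} (hw : 0 ≤ w) (j : ℕ) (ζ z : ℂ) :
    ∑ b ∈ Ico 3 j, ‖tb w ζ b‖ * ‖z‖ ^ b =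
      ∑ κ ∈ range (j ^ 2 + 2), w ^ κ * ∑ b ∈ Ico 3 j, uq (κ + 1) b * ‖(w * z) ^ b * (1 + b * ζ)‖ := by
  simp only [mul_sum]
  rw [sum_comm]
  refine sum_congr rfl fun b hb => ?_
  have hb' := mem_Ico.1 hb
  have h1 : b ^ 2 ≤ j ^ 2 := Nat.pow_le_pow_left hb'.2.le 2
  have h2 := th_div_eq w hb'.1 (by omega : b ^ 2 + 1 < j ^ 2 + 2)
  have h3 : ‖tb w ζ b‖ = (th w b / b.factorial) * ‖1 + b * ζ‖ := by
    rw [tb, norm_div, norm_mul, norm_real, Complex.norm_natCast, norm_of_nonneg (th_nonneg hw b)]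
    ring
  rw [h3, h2, sum_mul, sum_mul]
  refine sum_congr rfl fun κ _ => ?_
  rw [norm_mul, norm_pow, norm_mul, norm_real, norm_of_nonneg hw, mul_pow]
  ring

/-! ### Elementary bounds for the summands -/

lemma norm_pow_sub_one_le {ρ : ℂ} {E : ℝ} {b : ℕ} (hE : ∀ i < b, ‖ρ‖ ^ i ≤ E) :
    ‖ρ ^ b - 1‖ ≤ b * E * ‖ρ - 1‖ := by
  rw [← geom_sum_mul, norm_mul]
  refine mul_le_mul_of_nonneg_right ?_ (norm_nonneg _)
  refine (norm_sum_le _ _).trans ?_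
  calc ∑ i ∈ range b, ‖ρ ^ i‖ ≤ ∑ i ∈ range b, E :=
        sum_le_sum fun i hi => by rw [norm_pow]; exact hE i (mem_range.1 hi)
    _ = b * E := by rw [sum_const, card_range, nsmul_eq_mul]

/-- Parameters of the scaling window: `L` is the local time, `s` the spectral variable. -/
structure Win (T L Λ Y : ℝ) (s : ℂ) (j : ℕ) : Prop where
  hT : 1 ≤ T
  hL : |L| ≤ Λ
  hs : 0 ≤ s.re
  hj : (j : ℝ) ≤ Y * T
  hLT : 0 ≤ 1 + L / T

def rh (T L : ℝ) (s : ℂ) : ℂ := (1 + (L / T : ℝ)) / (1 + s / T)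

section
variable {T L Λ Y : ℝ} {s : ℂ} {j : ℕ}

lemma Win.one_le_norm (h : Win T L Λ Y s j) : 1 ≤ ‖1 + s / T‖ := by
  have h1 := abs_re_le_norm (1 + s / T)
  have h2 : (1 + s / T).re = 1 + s.re / T := by simp
  have h3 : 0 ≤ s.re / T := div_nonneg h.hs (by linarith [h.hT])
  rw [h2, abs_of_nonneg (by linarith)] at h1
  linarith

lemma Win.norm_rh_le (h : Win T L Λ Y s j) : ‖rh T L s‖ ≤ 1 + Λ / T := by
  have hT0 : 0 < T := by linarith [h.hT]
  rw [rh, norm_div]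
  have h1 : ‖(1 + (L / T : ℝ) : ℂ)‖ ≤ 1 + Λ / T := by
    have : (1 + (L / T : ℝ) : ℂ) = ((1 + L / T : ℝ) : ℂ) := by push_cast; ring
    rw [this, norm_real, norm_of_nonneg h.hLT]
    have := div_le_div_of_nonneg_right ((le_abs_self L).trans h.hL) hT0.le
    linarith
  exact (div_le_self (norm_nonneg _) h.one_le_norm).trans h1

lemma Win.norm_rh_pow_le (h : Win T L Λ Y s j) {b : ℕ} (hb : b ≤ j) : ‖rh T L s‖ ^ b ≤ exp (Λ * Y) := by
  have hT0 : 0 < T := by linarith [h.hT]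
  have hΛ : 0 ≤ Λ := (abs_nonneg _).trans h.hL
  have h1 : ‖rh T L s‖ ≤ exp (Λ / T) := h.norm_rh_le.trans (by linarith [add_one_le_exp (Λ / T)])
  refine (pow_le_pow_left₀ (norm_nonneg _) h1 b).trans ?_
  rw [← exp_nat_mul, exp_le_exp]
  have h2 : (b : ℝ) ≤ Y * T := (Nat.cast_le.2 hb).trans h.hj
  calc (b : ℝ) * (Λ / T) ≤ Y * T * (Λ / T) := mul_le_mul_of_nonneg_right h2 (by positivity)
    _ = Λ * Y := by field_simp

lemma Win.norm_rh_sub_one_le (h : Win T L Λ Y s j) : ‖rh T L s - 1‖ ≤ (Λ + ‖s‖) / T := by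
  have hT0 : 0 < T := by linarith [h.hT]
  have h1 := h.one_le_norm
  have hne : (1 + s / T : ℂ) ≠ 0 := fun h0 => by rw [h0, norm_zero] at h1; linarith
  have e : rh T L s - 1 = (((L : ℂ) - s) / T) / (1 + s / T) := by
    rw [rh, div_sub_one hne]; congr 1; push_cast; ring
  rw [e, norm_div, norm_div, norm_real, norm_of_nonneg hT0.le]
  refine (div_le_self (by positivity) h1).trans (div_le_div_of_nonneg_right ?_ hT0.le)
  refine (norm_sub_le _ _).trans (add_le_add ?_ le_rfl)
  rw [norm_real]
  exact h.hL

lemma Win.norm_lin_le (h : Win T L Λ Y s j) {b : ℕ} (hb : b ≤ j) : ‖1 + b * (s / T)‖ ≤ 1 + Y * ‖s‖ := by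
  have hT0 : 0 < T := by linarith [h.hT]
  have h2 : (b : ℝ) ≤ Y * T := (Nat.cast_le.2 hb).trans h.hj
  refine (norm_add_le _ _).trans ?_
  rw [norm_one, norm_mul, norm_div, Complex.norm_natCast, norm_real, norm_of_nonneg hT0.le]
  have : (b : ℝ) * (‖s‖ / T) ≤ Y * T * (‖s‖ / T) := mul_le_mul_of_nonneg_right h2 (by positivity)
  have e : Y * T * (‖s‖ / T) = Y * ‖s‖ := by field_simp
  linarith

lemma Win.norm_term_le (h : Win T L Λ Y s j) {b : ℕ} (hb : b ≤ j) :
    ‖rh T L s ^ b * (1 + b * (s / T))‖ ≤ exp (Λ * Y) * (1 + Y * ‖s‖) := by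
  rw [norm_mul, norm_pow]
  exact mul_le_mul (h.norm_rh_pow_le hb) (h.norm_lin_le hb) (norm_nonneg _) (exp_pos _).le

lemma Win.norm_term_sub_one_le (h : Win T L Λ Y s j) {b : ℕ} (hb : b ≤ j) :
    ‖rh T L s ^ b * (1 + b * (s / T)) - 1‖ ≤ b / T * (exp (Λ * Y) * (Λ + 2 * ‖s‖)) := by
  have hT0 : 0 < T := by linarith [h.hT]
  have e : rh T L s ^ b * (1 + b * (s / T)) - 1 = (rh T L s ^ b - 1) + rh T L s ^ b * (b * (s / T)) := by ring
  have h1 : ‖rh T L s ^ b - 1‖ ≤ b * exp (Λ * Y) * ((Λ + ‖s‖) / T) :=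
    (norm_pow_sub_one_le fun i hi => h.norm_rh_pow_le (by omega)).trans
      (mul_le_mul_of_nonneg_left h.norm_rh_sub_one_le (by positivity))
  have h2 : ‖rh T L s ^ b * (b * (s / T))‖ ≤ exp (Λ * Y) * (b * (‖s‖ / T)) := by
    rw [norm_mul, norm_pow, norm_mul, norm_div, Complex.norm_natCast, norm_real, norm_of_nonneg hT0.le]
    exact mul_le_mul_of_nonneg_right (h.norm_rh_pow_le hb) (by positivity)
  rw [e]
  refine (norm_add_le _ _).trans ((add_le_add h1 h2).trans (le_of_eq ?_))
  field_simp
  ring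

end

lemma sum_inv_le_log {j : ℕ} (hj : 3 ≤ j) : ∑ b ∈ Ico 3 j, 1 / (2 * (b : ℝ)) ≤ 1 / 2 * log j := by
  have key : ∑ b ∈ Ico 3 j, 1 / (2 * (b : ℝ)) ≤ 1 / 2 * log (j - 1) := by
    induction j, hj using Nat.le_induction with
    | base => rw [Ico_self, sum_empty]; exact mul_nonneg (by norm_num) (log_nonneg (by norm_num))
    | succ j hj ih =>
      have hj3 : (3 : ℝ) ≤ j := by exact_mod_cast hj
      have h1 := log_le_sub_one_of_pos (x := ((j : ℝ) - 1) / j) (div_pos (by linarith) (by linarith))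
      rw [log_div (by linarith) (by linarith)] at h1
      have h2 : ((j : ℝ) - 1) / j - 1 = -(2 * (1 / (2 * j))) := by field_simp; ring
      rw [sum_Ico_succ_top hj]
      grind
  have hj3 : (3 : ℝ) ≤ j := by exact_mod_cast hj
  have := log_le_log (by linarith) (by linarith : (j : ℝ) - 1 ≤ j)
  linarith

lemma tendsto_sum_inv_sub_log : ∃ γ : ℝ, Tendsto (fun j : ℕ => ∑ b ∈ Ico 3 j, 1 / (2 * (b : ℝ)) - 1 / 2 * log j)
    atTop (nhds γ) := by
  have h1 : Tendsto (fun j : ℕ => 1 / 2 * (((harmonic j : ℚ) : ℝ) - log j) - 3 / 4 - 1 / 2 * (1 / (j : ℝ))) atTop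
      (nhds (1 / 2 * eulerMascheroniConstant - 3 / 4 - 1 / 2 * 0)) :=
    ((tendsto_harmonic_sub_log.const_mul (1 / 2)).sub_const _).sub (tendsto_one_div_atTop_nhds_zero_nat.const_mul _)
  refine ⟨_, h1.congr' ?_⟩
  filter_upwards [eventually_ge_atTop 3] with j hj
  have key : ∑ b ∈ Ico 3 j, 1 / (2 * (b : ℝ)) = 1 / 2 * ((harmonic j : ℚ) : ℝ) - 3 / 4 - 1 / 2 * (1 / (j : ℝ)) := by
    induction j, hj using Nat.le_induction with
    | base =>
      rw [Ico_self, sum_empty]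
      norm_num [harmonic_succ]
    | succ j hj ih =>
      rw [sum_Ico_succ_top hj, ih, harmonic_succ]
      have : (0 : ℝ) < j := by exact_mod_cast (by omega : 0 < j)
      push_cast
      field_simp
      ring
  rw [key]
  ring

section
variable {T L Λ Y : ℝ} {s : ℂ} {j : ℕ}

lemma Win.sum_term_le (h : Win T L Λ Y s j) {K C w : ℝ} (hK : 1 ≤ K) (hC0 : 0 ≤ C)
    (hC : ∀ m κ : ℕ, 1 ≤ κ → ∑ b ∈ Icc 3 m, K ^ κ * uq (κ + 1) b ≤ C * (m : ℝ) ^ (3 * κ))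
    (hw : 0 ≤ w) (hwj : w * (j : ℝ) ^ 3 ≤ K / 2) {κ : ℕ} (hκ : 1 ≤ κ) :
    w ^ κ * ∑ b ∈ Ico 3 j, uq (κ + 1) b * ‖rh T L s ^ b * (1 + b * (s / T))‖ ≤
      exp (Λ * Y) * (1 + Y * ‖s‖) * C * (1 / 2) ^ κ := by
  have hK0 : 0 < K := by linarith
  have hΛ : 0 ≤ Λ := (abs_nonneg _).trans h.hL
  have hY : 0 ≤ 1 + Y * ‖s‖ := (norm_nonneg _).trans (h.norm_lin_le le_rfl)
  have hE : 0 ≤ exp (Λ * Y) * (1 + Y * ‖s‖) := mul_nonneg (exp_pos _).le hY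
  have h1 : ∑ b ∈ Ico 3 j, uq (κ + 1) b * ‖rh T L s ^ b * (1 + b * (s / T))‖ ≤
      (∑ b ∈ Icc 3 j, uq (κ + 1) b) * (exp (Λ * Y) * (1 + Y * ‖s‖)) := by
    rw [sum_mul]
    calc _ ≤ ∑ b ∈ Ico 3 j, uq (κ + 1) b * (exp (Λ * Y) * (1 + Y * ‖s‖)) :=
          sum_le_sum fun b hb => mul_le_mul_of_nonneg_left (h.norm_term_le (mem_Ico.1 hb).2.le) (uq_nonneg _ _)
      _ ≤ _ := sum_le_sum_of_subset_of_nonneg Ico_subset_Icc_self fun b _ _ =>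
          mul_nonneg (uq_nonneg _ _) hE
  have h2 := hC j κ hκ
  rw [← mul_sum] at h2
  have h3 : w ^ κ * ∑ b ∈ Icc 3 j, uq (κ + 1) b ≤ C * (1 / 2) ^ κ := by
    have e1 : ∑ b ∈ Icc 3 j, uq (κ + 1) b ≤ C * (j : ℝ) ^ (3 * κ) / K ^ κ := by
      rw [le_div_iff₀ (by positivity)]; linarith
    have e2 : w * (j : ℝ) ^ 3 / K ≤ 1 / 2 := by rw [div_le_iff₀ hK0]; linarith
    calc w ^ κ * ∑ b ∈ Icc 3 j, uq (κ + 1) b ≤ w ^ κ * (C * (j : ℝ) ^ (3 * κ) / K ^ κ) :=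
          mul_le_mul_of_nonneg_left e1 (pow_nonneg hw _)
      _ = C * (w * (j : ℝ) ^ 3 / K) ^ κ := by rw [div_pow, mul_pow, pow_mul]; ring
      _ ≤ C * (1 / 2) ^ κ := mul_le_mul_of_nonneg_left (pow_le_pow_left₀ (by positivity) e2 _) hC0
  calc _ ≤ w ^ κ * ((∑ b ∈ Icc 3 j, uq (κ + 1) b) * (exp (Λ * Y) * (1 + Y * ‖s‖))) :=
        mul_le_mul_of_nonneg_left h1 (pow_nonneg hw _)
    _ = (w ^ κ * ∑ b ∈ Icc 3 j, uq (κ + 1) b) * (exp (Λ * Y) * (1 + Y * ‖s‖)) := by ring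
    _ ≤ (C * (1 / 2) ^ κ) * (exp (Λ * Y) * (1 + Y * ‖s‖)) := mul_le_mul_of_nonneg_right h3 hE
    _ = _ := by ring

lemma Win.norm_sk_le (h : Win T L Λ Y s j) {K C w : ℝ} (hK : 1 ≤ K) (hC0 : 0 ≤ C)
    (hC : ∀ m κ : ℕ, 1 ≤ κ → ∑ b ∈ Icc 3 m, K ^ κ * uq (κ + 1) b ≤ C * (m : ℝ) ^ (3 * κ))
    (hw : 0 ≤ w) (hwj : w * (j : ℝ) ^ 3 ≤ K / 2) {κ : ℕ} (hκ : 1 ≤ κ) :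
    ‖sk w j (rh T L s) (s / T) κ‖ ≤ exp (Λ * Y) * (1 + Y * ‖s‖) * C * (1 / 2) ^ κ := by
  refine le_trans ?_ (h.sum_term_le hK hC0 hC hw hwj hκ)
  rw [sk, norm_mul, norm_pow, norm_real, norm_of_nonneg hw]
  refine mul_le_mul_of_nonneg_left ((norm_sum_le _ _).trans (sum_le_sum fun b _ => ?_)) (pow_nonneg hw _)
  rw [norm_mul, norm_real, norm_of_nonneg (uq_nonneg _ _)]

lemma Win.sum_norm_le (h : Win T L Λ Y s j) (hj3 : 3 ≤ j) {K C w : ℝ} (hK : 1 ≤ K) (hC0 : 0 ≤ C)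
    (hC : ∀ m κ : ℕ, 1 ≤ κ → ∑ b ∈ Icc 3 m, K ^ κ * uq (κ + 1) b ≤ C * (m : ℝ) ^ (3 * κ))
    (hw : 0 ≤ w) (hwj : w * (j : ℝ) ^ 3 ≤ K / 2) (M : ℕ) :
    ∑ κ ∈ range M, w ^ κ * ∑ b ∈ Ico 3 j, uq (κ + 1) b * ‖rh T L s ^ b * (1 + b * (s / T))‖ ≤
      1 / 2 * log j + exp (Λ * Y) * (Y * (Λ + 1) + C * (1 + Y)) * (1 + ‖s‖) := by
  have hT0 : 0 < T := by linarith [h.hT]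
  have hΛ : 0 ≤ Λ := (abs_nonneg _).trans h.hL
  have hY : 0 ≤ Y := by
    by_contra hneg
    have := mul_neg_of_neg_of_pos (not_le.1 hneg) hT0
    linarith [h.hj, (Nat.cast_nonneg j : (0 : ℝ) ≤ j)]
  have hs := norm_nonneg s
  have hE := exp_pos (Λ * Y)
  have h0 : ∑ b ∈ Ico 3 j, uq (0 + 1) b * ‖rh T L s ^ b * (1 + b * (s / T))‖ ≤
      1 / 2 * log j + exp (Λ * Y) * (Y * (Λ + 1)) * (1 + ‖s‖) := by
    calc _ ≤ ∑ b ∈ Ico 3 j, (1 / (2 * (b : ℝ)) + 1 / (2 * T) * (exp (Λ * Y) * (Λ + 2 * ‖s‖))) := by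
          refine sum_le_sum fun b hb => ?_
          have hb' := mem_Ico.1 hb
          have hb0 : (0 : ℝ) < b := by exact_mod_cast (by omega : 0 < b)
          rw [uq_one hb'.1]
          have e := norm_add_le (rh T L s ^ b * (1 + b * (s / T)) - 1) 1
          rw [sub_add_cancel, norm_one] at e
          have e2 := e.trans (add_le_add (h.norm_term_sub_one_le hb'.2.le) le_rfl)
          refine (mul_le_mul_of_nonneg_left e2 (by positivity)).trans (le_of_eq ?_)
          field_simp
          ring
      _ = ∑ b ∈ Ico 3 j, 1 / (2 * (b : ℝ)) + ((j - 3 : ℕ) : ℝ) * (1 / (2 * T) * (exp (Λ * Y) * (Λ + 2 * ‖s‖))) := by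
          rw [sum_add_distrib, sum_const, Nat.card_Ico, nsmul_eq_mul]
      _ ≤ 1 / 2 * log j + Y * T * (1 / (2 * T) * (exp (Λ * Y) * (Λ + 2 * ‖s‖))) := by
          refine add_le_add (sum_inv_le_log hj3) (mul_le_mul_of_nonneg_right ?_ (by positivity))
          exact (Nat.cast_le.2 (Nat.sub_le j 3)).trans h.hj
      _ = 1 / 2 * log j + exp (Λ * Y) * Y * (Λ / 2 + ‖s‖) := by field_simp
      _ ≤ _ := by
          have : exp (Λ * Y) * Y * (Λ / 2 + ‖s‖) ≤ exp (Λ * Y) * Y * ((Λ + 1) * (1 + ‖s‖)) :=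
            mul_le_mul_of_nonneg_left (by linarith [mul_nonneg hΛ hs]) (by positivity)
          linarith
  rcases M with _ | M
  · rw [range_zero, sum_empty]
    exact add_nonneg (mul_nonneg (by norm_num) (log_nonneg (by exact_mod_cast (by omega : 1 ≤ j)))) (by positivity)
  rw [sum_range_succ', pow_zero, one_mul]
  have h1 : ∑ κ ∈ range M, w ^ (κ + 1) * ∑ b ∈ Ico 3 j, uq (κ + 1 + 1) b * ‖rh T L s ^ b * (1 + b * (s / T))‖ ≤
      exp (Λ * Y) * (C * (1 + Y)) * (1 + ‖s‖) := by
    have hE2 : 0 ≤ exp (Λ * Y) * (1 + Y * ‖s‖) * C := by positivity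
    calc _ ≤ ∑ κ ∈ range M, exp (Λ * Y) * (1 + Y * ‖s‖) * C * (1 / 2) ^ (κ + 1) :=
          sum_le_sum fun κ _ => h.sum_term_le hK hC0 hC hw hwj (by omega)
      _ = exp (Λ * Y) * (1 + Y * ‖s‖) * C * (1 / 2 * ∑ κ ∈ range M, (1 / 2) ^ κ) := by
          rw [← mul_sum]; congr 1; rw [mul_sum]; exact sum_congr rfl fun κ _ => pow_succ' _ _
      _ ≤ exp (Λ * Y) * (1 + Y * ‖s‖) * C * 1 := by
          refine mul_le_mul_of_nonneg_left ?_ hE2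
          have := sum_geometric_two_le M
          linarith
      _ ≤ _ := by
          have := mul_le_mul_of_nonneg_left (by linarith : 1 + Y * ‖s‖ ≤ (1 + Y) * (1 + ‖s‖)) (by positivity : 0 ≤ exp (Λ * Y) * C)
          linarith
  linarith

end

lemma tendsto_one_add_pow_exp {z : ℕ → ℂ} {b : ℕ → ℕ} {u : ℂ} (hz : Tendsto z atTop (nhds 0))
    (hb : Tendsto (fun n => (b n : ℂ) * z n) atTop (nhds u)) :
    Tendsto (fun n => (1 + z n) ^ b n) atTop (nhds (Complex.exp u)) := by
  have hz1 : ∀ᶠ n in atTop, ‖z n‖ < 1 / 2 := by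
    have := hz.norm
    rw [norm_zero] at this
    exact this.eventually_lt_const (by norm_num)
  have h1 : Tendsto (fun n => (b n : ℂ) * Complex.log (1 + z n)) atTop (nhds u) := by
    have h2 : Tendsto (fun n => (b n : ℂ) * Complex.log (1 + z n) - b n * z n) atTop (nhds 0) := by
      refine squeeze_zero_norm' (a := fun n => ‖(b n : ℂ) * z n‖ * ‖z n‖) ?_ ?_
      · filter_upwards [hz1] with n hn
        rw [← mul_sub, norm_mul, norm_mul]
        have := norm_log_one_add_sub_self_le (show ‖z n‖ < 1 by linarith)
        have h3 : ‖z n‖ ^ 2 * (1 - ‖z n‖)⁻¹ / 2 ≤ ‖z n‖ * ‖z n‖ := by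
          have e : (1 - ‖z n‖)⁻¹ ≤ 2 := by
            rw [inv_le_comm₀ (by linarith) (by norm_num)]; linarith
          have := mul_le_mul_of_nonneg_left e (sq_nonneg ‖z n‖)
          linarith
        rw [mul_assoc]
        exact mul_le_mul_of_nonneg_left (this.trans h3) (norm_nonneg _)
      · have := hb.norm.mul hz.norm
        simpa using this
    have := h2.add hb
    simpa using this
  refine ((Complex.continuous_exp.tendsto u).comp h1).congr' ?_
  filter_upwards [hz1] with n hn
  have hne : 1 + z n ≠ 0 := by
    intro h0
    have : z n = -1 := by linear_combination h0
    rw [this, norm_neg, norm_one] at hn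
    norm_num at hn
  rw [Function.comp_apply, Complex.exp_nat_mul, Complex.exp_log hne]

/-- Scaling hypotheses for the critical window. -/
structure Scal (T w : ℕ → ℝ) (j : ℕ → ℕ) (lam y : ℝ) : Prop where
  hTn : ∀ n, T n ^ 3 = n
  hT : Tendsto T atTop atTop
  hL : Tendsto (fun n : ℕ => T n * ((n : ℝ) * w n - 1)) atTop (nhds lam)
  hy : 0 < y
  hj : Tendsto (fun n => (j n : ℝ) / T n) atTop (nhds y)

section
variable {T w : ℕ → ℝ} {j : ℕ → ℕ} {lam y : ℝ}

/-- The rescaled time parameter. -/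
def Lt (T w : ℕ → ℝ) (n : ℕ) : ℝ := T n * ((n : ℝ) * w n - 1)

lemma Scal.tendsto_inv (h : Scal T w j lam y) : Tendsto (fun n => (T n)⁻¹) atTop (nhds 0) :=
  tendsto_inv_atTop_zero.comp h.hT

lemma Scal.tendsto_nw (h : Scal T w j lam y) : Tendsto (fun n : ℕ => (n : ℝ) * w n) atTop (nhds 1) := by
  have h1 : Tendsto (fun n => 1 + T n * (n * w n - 1) * (T n)⁻¹) atTop (nhds (1 + lam * 0)) :=
    (h.hL.mul h.tendsto_inv).const_add 1
  rw [mul_zero, add_zero] at h1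
  refine h1.congr' ?_
  filter_upwards [h.hT.eventually_gt_atTop 0] with n hn
  field_simp
  ring

lemma Scal.one_add (h : Scal T w j lam y) {n : ℕ} (hn : 0 < T n) : 1 + Lt T w n / T n = n * w n := by
  rw [Lt]; field_simp; ring

lemma Scal.tendsto_wT (h : Scal T w j lam y) : Tendsto (fun n => w n * T n ^ 3) atTop (nhds 1) := by
  refine h.tendsto_nw.congr fun n => ?_
  rw [h.hTn, mul_comm]

lemma Scal.w_pos (h : Scal T w j lam y) : ∀ᶠ n in atTop, 0 < w n := by
  filter_upwards [h.tendsto_nw.eventually_const_lt one_pos] with n hn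
  by_contra h0
  have := mul_nonpos_of_nonneg_of_nonpos (Nat.cast_nonneg (α := ℝ) n) (not_lt.1 h0)
  linarith

lemma Scal.j_large (h : Scal T w j lam y) (N : ℕ) : ∀ᶠ n in atTop, N ≤ j n := by
  have h1 : Tendsto (fun n => (j n : ℝ) / T n * T n) atTop atTop := h.hj.pos_mul_atTop h.hy h.hT
  filter_upwards [h1.eventually_ge_atTop (N : ℝ), h.hT.eventually_gt_atTop 0] with n hn hT
  rw [div_mul_cancel₀ _ hT.ne'] at hn
  exact_mod_cast hn

lemma Scal.win (h : Scal T w j lam y) :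
    ∀ᶠ n in atTop, ∀ s : ℂ, 0 ≤ s.re → Win (T n) (Lt T w n) (|lam| + 1) (y + 1) s (j n) := by
  filter_upwards [h.hT.eventually_ge_atTop 1, h.hL.abs.eventually_lt_const (lt_add_one |lam|),
    h.hj.eventually_lt_const (lt_add_one y), h.tendsto_nw.eventually_const_lt one_pos] with n h1 h2 h3 h4 s hs
  have hT0 : 0 < T n := by linarith
  refine ⟨h1, h2.le, hs, ?_, ?_⟩
  · rw [div_lt_iff₀ hT0] at h3
    exact h3.le
  · rw [h.one_add hT0]; exact h4.le

lemma Scal.w_mul_cube (h : Scal T w j lam y) : ∀ᶠ n in atTop, w n * (j n : ℝ) ^ 3 ≤ 4 * (y + 1) ^ 3 / 2 := by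
  have h1 : Tendsto (fun n => w n * T n ^ 3 * ((j n : ℝ) / T n) ^ 3) atTop (nhds (1 * y ^ 3)) :=
    h.tendsto_wT.mul (h.hj.pow 3)
  have hy := h.hy
  have h2 : 1 * y ^ 3 < 4 * (y + 1) ^ 3 / 2 := by
    have := pow_le_pow_left₀ hy.le (by linarith : y ≤ y + 1) 3
    have h3 : 0 < (y + 1) ^ 3 := by positivity
    linarith
  filter_upwards [h1.eventually_lt_const h2, h.hT.eventually_gt_atTop 0] with n hn hT
  refine le_trans (le_of_eq ?_) hn.le
  field_simp

lemma Scal.tendsto_rh_pow (h : Scal T w j lam y) {s : ℂ} {x : ℝ} {b : ℕ → ℕ}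
    (hb : Tendsto (fun n => (b n : ℝ) / T n) atTop (nhds x)) :
    Tendsto (fun n => rh (T n) (Lt T w n) s ^ b n) atTop (nhds (Complex.exp ((lam - s) * x))) := by
  have hinv : Tendsto (fun n => (T n : ℂ)⁻¹) atTop (nhds 0) := by
    have := (continuous_ofReal.tendsto 0).comp h.tendsto_inv
    simpa [Function.comp_def] using this
  have hLc : Tendsto (fun n => (Lt T w n : ℂ)) atTop (nhds lam) := (continuous_ofReal.tendsto lam).comp h.hL
  have hbc : Tendsto (fun n => (b n : ℂ) / T n) atTop (nhds x) := by
    have := (continuous_ofReal.tendsto x).comp hb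
    simpa [Function.comp_def] using this
  have hden : Tendsto (fun n => 1 + s / T n) atTop (nhds 1) := by
    have := (hinv.const_mul s).const_add 1
    simpa [div_eq_mul_inv] using this
  have hq : Tendsto (fun n => ((Lt T w n : ℂ) - s) / (1 + s / T n)) atTop (nhds (lam - s)) := by
    have := (hLc.sub_const s).div hden one_ne_zero
    rw [div_one] at this
    exact this
  have hz : ∀ᶠ n in atTop, rh (T n) (Lt T w n) s - 1 = ((Lt T w n : ℂ) - s) / (1 + s / T n) * (T n : ℂ)⁻¹ := by
    filter_upwards [hden.eventually_ne one_ne_zero] with n hn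
    rw [rh, div_sub_one hn]
    push_cast
    field_simp
    ring
  have h0 : Tendsto (fun n => rh (T n) (Lt T w n) s - 1) atTop (nhds 0) := by
    have := hq.mul hinv
    rw [mul_zero] at this
    exact this.congr' (hz.mono fun n hn => hn.symm)
  have h1 : Tendsto (fun n => (b n : ℂ) * (rh (T n) (Lt T w n) s - 1)) atTop (nhds ((lam - s) * x)) := by
    refine (hq.mul hbc).congr' (hz.mono fun n hn => ?_)
    grind
  refine (tendsto_one_add_pow_exp h0 h1).congr fun n => ?_
  rw [add_sub_cancel]

lemma Scal.tendsto_floor (h : Scal T w j lam y) {x : ℝ} (hx : 0 < x) :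
    Tendsto (fun n => (⌊x * T n⌋₊ : ℝ) / T n) atTop (nhds x) := by
  exact (tendsto_nat_floor_mul_div_atTop hx.le).comp h.hT

lemma Scal.tendsto_term (h : Scal T w j lam y) {s : ℂ} {x : ℝ} (hx : 0 < x) :
    Tendsto (fun n => rh (T n) (Lt T w n) s ^ ⌊x * T n⌋₊ * (1 + (⌊x * T n⌋₊ : ℂ) * (s / T n))) atTop
      (nhds (Complex.exp ((lam - s) * x) * (1 + x * s))) := by
  refine (h.tendsto_rh_pow (h.tendsto_floor hx)).mul ?_
  have hbc : Tendsto (fun n => (⌊x * T n⌋₊ : ℂ) / T n) atTop (nhds x) := by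
    have := (continuous_ofReal.tendsto x).comp (h.tendsto_floor hx)
    simpa [Function.comp_def] using this
  refine ((hbc.mul_const s).const_add 1).congr fun n => ?_
  ring

lemma tendsto_uq_floor {κ : ℕ} (hT : Tendsto T atTop atTop) {x : ℝ} (hx : 0 < x) (hκ : 1 ≤ κ) :
    Tendsto (fun n => uq (κ + 1) ⌊x * T n⌋₊ * (T n / T n ^ (3 * κ))) atTop (nhds (cq (κ + 1) * x ^ (3 * κ - 1))) := by
  have hxT : Tendsto (fun n => ⌊x * T n⌋₊) atTop atTop := tendsto_nat_floor_atTop.comp (hT.const_mul_atTop hx)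
  have h1 := (cq_tendsto (q := κ + 1) (by omega)).comp hxT
  have h2 : Tendsto (fun n => ((⌊x * T n⌋₊ : ℝ) / T n) ^ (3 * κ - 1)) atTop (nhds (x ^ (3 * κ - 1))) :=
    ((tendsto_nat_floor_mul_div_atTop hx.le).comp hT).pow _
  refine (h1.mul h2).congr' ?_
  filter_upwards [hT.eventually_gt_atTop 0, hxT.eventually_gt_atTop 0] with n hn hb
  have hb' : (0 : ℝ) < (⌊x * T n⌋₊ : ℝ) := by exact_mod_cast hb
  simp only [Function.comp_apply]
  obtain ⟨m, hm⟩ : ∃ m, 3 * κ = m + 1 := ⟨3 * κ - 1, by omega⟩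
  rw [show 3 * (κ + 1) = m + 4 by omega, hm, Nat.add_sub_cancel, div_pow, pow_succ, pow_add]
  field_simp
  ring

/-- Limit of the contribution of excess `κ ≥ 1`. -/
def Rk (lam : ℝ) (s : ℂ) (y : ℝ) (κ : ℕ) : ℂ :=
  ∫ x in Set.Ioo 0 y, ((cq (κ + 1) * x ^ (3 * κ - 1) : ℝ) : ℂ) * (Complex.exp ((lam - s) * x) * (1 + x * s))

/-- Limit of the regularised contribution of excess `0`. -/
def Rz (lam : ℝ) (s : ℂ) (y : ℝ) : ℂ :=
  ∫ x in Set.Ioo 0 y, (Complex.exp ((lam - s) * x) * (1 + x * s) - 1) / (2 * x)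

lemma Scal.tendsto_sk (h : Scal T w j lam y) {s : ℂ} (hs : 0 ≤ s.re) {κ : ℕ} (hκ : 1 ≤ κ) :
    Tendsto (fun n => sk (w n) (j n) (rh (T n) (Lt T w n) s) (s / T n) κ) atTop (nhds (Rk lam s y κ)) := by
  obtain ⟨K, hK0, hK⟩ := uq_bound (κ + 1)
  have hwT : Tendsto (fun n => ((w n * T n ^ 3) ^ κ : ℝ)) atTop (nhds 1) := by
    have := h.tendsto_wT.pow κ
    rwa [one_pow] at this
  have hwTc : Tendsto (fun n => (((w n * T n ^ 3) ^ κ : ℝ) : ℂ)) atTop (nhds 1) := by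
    have := (continuous_ofReal.tendsto 1).comp hwT
    simpa [Function.comp_def] using this
  have hmain := tendsto_riemann h.hT h.hy h.hj
    (g := fun n b => ((uq (κ + 1) b * (T n / T n ^ (3 * κ)) : ℝ) : ℂ) * (rh (T n) (Lt T w n) s ^ b * (1 + b * (s / T n))))
    (G := fun x => ((cq (κ + 1) * x ^ (3 * κ - 1) : ℝ) : ℂ) * (Complex.exp ((lam - s) * x) * (1 + x * s)))
    (M := K * (y + 1) ^ (3 * κ - 1) * (exp ((|lam| + 1) * (y + 1)) * (1 + (y + 1) * ‖s‖))) ?_ ?_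
  · have := hwTc.mul hmain
    rw [one_mul] at this
    refine this.congr' ?_
    filter_upwards [h.hT.eventually_gt_atTop 0] with n hn
    have hn' : (T n : ℂ) ≠ 0 := by exact_mod_cast hn.ne'
    rw [sk, sum_div, mul_sum, mul_sum]
    refine sum_congr rfl fun b _ => ?_
    push_cast
    rw [mul_pow, ← pow_mul]
    field_simp
  · filter_upwards [h.win] with n hw b hb3 hbj
    have hwin := hw s hs
    have hT0 : 0 < T n := by linarith [hwin.hT]
    rw [norm_mul, norm_real]
    have hu := uq_nonneg (κ + 1) b
    have hb0 : (0 : ℝ) < b := by exact_mod_cast (by omega : 0 < b)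
    rw [norm_of_nonneg (by positivity)]
    refine mul_le_mul ?_ (hwin.norm_term_le hbj.le) (norm_nonneg _) (by have := h.hy; positivity)
    have h1 := hK (κ + 1) le_rfl b (by omega)
    obtain ⟨m, hm⟩ : ∃ m, 3 * κ = m + 1 := ⟨3 * κ - 1, by omega⟩
    rw [show 3 * (κ + 1) = m + 4 by omega, pow_add, ← mul_assoc] at h1
    have h2 := le_of_mul_le_mul_right h1 (by positivity : 0 < (b : ℝ) ^ 4)
    have h3 : (b : ℝ) / T n ≤ y + 1 := by
      rw [div_le_iff₀ hT0]
      exact (Nat.cast_le.2 hbj.le).trans hwin.hj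
    rw [hm, Nat.add_sub_cancel]
    calc uq (κ + 1) b * (T n / T n ^ (m + 1)) ≤ K * (b : ℝ) ^ m * (T n / T n ^ (m + 1)) :=
          mul_le_mul_of_nonneg_right h2 (by positivity)
      _ = K * ((b : ℝ) / T n) ^ m := by rw [div_pow, pow_succ]; field_simp
      _ ≤ K * (y + 1) ^ m := mul_le_mul_of_nonneg_left (pow_le_pow_left₀ (by positivity) h3 m) hK0
  · intro x hx hxy
    refine Tendsto.mul ?_ (h.tendsto_term hx)
    exact (continuous_ofReal.tendsto _).comp (tendsto_uq_floor h.hT hx hκ)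

lemma Scal.tendsto_sk_zero (h : Scal T w j lam y) {s : ℂ} (hs : 0 ≤ s.re) :
    Tendsto (fun n => sk (w n) (j n) (rh (T n) (Lt T w n) s) (s / T n) 0 - ((∑ b ∈ Ico 3 (j n), 1 / (2 * (b : ℝ)) : ℝ) : ℂ))
      atTop (nhds (Rz lam s y)) := by
  have hmain := tendsto_riemann h.hT h.hy h.hj
    (g := fun n b => (rh (T n) (Lt T w n) s ^ b * (1 + b * (s / T n)) - 1) / (2 * ((b : ℂ) / T n)))
    (G := fun x => (Complex.exp ((lam - s) * x) * (1 + x * s) - 1) / (2 * x))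
    (M := 1 / 2 * (exp ((|lam| + 1) * (y + 1)) * ((|lam| + 1) + 2 * ‖s‖))) ?_ ?_
  · refine hmain.congr' ?_
    filter_upwards [h.hT.eventually_gt_atTop 0] with n hn
    have hn' : (T n : ℂ) ≠ 0 := by exact_mod_cast hn.ne'
    rw [sk, pow_zero, one_mul, sum_div, ofReal_sum, ← sum_sub_distrib]
    refine sum_congr rfl fun b hb => ?_
    have hb3 := (mem_Ico.1 hb).1
    have hb0 : (b : ℂ) ≠ 0 := by exact_mod_cast (by omega : b ≠ 0)
    rw [zero_add, uq_one hb3]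
    push_cast
    field_simp
  · filter_upwards [h.win] with n hw b hb3 hbj
    have hwin := hw s hs
    have hT0 : 0 < T n := by linarith [hwin.hT]
    have hb0 : (0 : ℝ) < b := by exact_mod_cast (by omega : 0 < b)
    have h1 := hwin.norm_term_sub_one_le hbj.le
    rw [norm_div, norm_mul, norm_div, Complex.norm_natCast, norm_real, norm_of_nonneg hT0.le, RCLike.norm_ofNat,
      div_le_iff₀ (by positivity)]
    refine h1.trans (le_of_eq ?_)
    field_simp
  · intro x hx hxy
    have hbc : Tendsto (fun n => (⌊x * T n⌋₊ : ℂ) / T n) atTop (nhds x) := by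
      have := (continuous_ofReal.tendsto x).comp (h.tendsto_floor hx)
      simpa [Function.comp_def] using this
    have hx' : (2 * x : ℂ) ≠ 0 := by
      have : (x : ℂ) ≠ 0 := by exact_mod_cast hx.ne'
      simpa using this
    exact ((h.tendsto_term hx).sub_const 1).div (hbc.const_mul 2) hx'

end

/-- Limit of the regularised exponent. -/
def Rt (lam : ℝ) (s : ℂ) (y : ℝ) : ℂ := Rz lam s y + ∑' κ, Rk lam s y (κ + 1)

/-- Limit of the harmonic sum minus its logarithm. -/
def gam : ℝ := tendsto_sum_inv_sub_log.choose

/-- The normalised generating function coefficient. -/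
def FV (T w : ℕ → ℝ) (j : ℕ → ℕ) (n : ℕ) (s : ℂ) : ℂ :=
  n.factorial * Vn (1 + s / T n) (tb (w n) (s / T n)) (j n) n / (1 + s / T n) ^ n

section
variable {T w : ℕ → ℝ} {j : ℕ → ℕ} {lam y : ℝ}

lemma Scal.rh_eq (h : Scal T w j lam y) {n : ℕ} (hn : 0 < T n) (s : ℂ) :
    (w n : ℂ) * ((n : ℂ) / (1 + s / T n)) = rh (T n) (Lt T w n) s := by
  have := h.one_add hn
  rw [rh, ← ofReal_one, ← ofReal_add, this]; push_cast; ring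

lemma den_ne {T : ℝ} (hT : 0 < T) {s : ℂ} (hs : 0 ≤ s.re) : 1 + s / T ≠ 0 := by
  intro h0
  have := congrArg re h0
  rw [add_re, div_ofReal_re, one_re, zero_re] at this
  have : 0 ≤ s.re / T := by positivity
  linarith

lemma Scal.exists_const (h : Scal T w j lam y) : ∃ C : ℝ, 0 ≤ C ∧ ∀ᶠ n in atTop, ∀ s : ℂ, 0 ≤ s.re →
    (∀ κ, 1 ≤ κ → ‖sk (w n) (j n) (rh (T n) (Lt T w n) s) (s / T n) κ‖ ≤ C * (1 + ‖s‖) * (1 / 2) ^ κ) ∧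
    ∑ b ∈ Ico 3 (j n), ‖tb (w n) (s / T n) b‖ * ‖((n : ℂ) / (1 + s / T n) : ℂ)‖ ^ b ≤
      1 / 2 * log (j n) + C * (1 + ‖s‖) := by
  have hy := h.hy
  have hK : 1 ≤ 4 * (y + 1) ^ 3 := by
    have := one_le_pow₀ (by linarith : 1 ≤ y + 1) (n := 3)
    linarith
  obtain ⟨C, hC0, hC⟩ := sum_uq_le hK
  set E := exp ((|lam| + 1) * (y + 1))
  have hE : 0 ≤ E := (exp_pos _).le
  refine ⟨E * ((y + 1) * (|lam| + 1 + 1) + C * (1 + (y + 1))), by positivity, ?_⟩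
  filter_upwards [h.win, h.w_pos, h.w_mul_cube, h.j_large 3] with n h1 h2 h3 h4 s hs
  have hwin := h1 s hs
  have hT0 : 0 < T n := by linarith [hwin.hT]
  refine ⟨fun κ hκ => ?_, ?_⟩
  · refine (hwin.norm_sk_le hK hC0 hC h2.le h3 hκ).trans (mul_le_mul_of_nonneg_right ?_ (by positivity))
    rw [mul_assoc, mul_assoc]
    refine mul_le_mul_of_nonneg_left ?_ hE
    have a1 : 0 ≤ (y + 1) * (|lam| + 1 + 1) * (1 + ‖s‖) := by positivity
    have a2 : 0 ≤ C * (‖s‖ + (y + 1)) := by positivity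
    linarith
  · rw [sum_norm_tb_eq h2.le, h.rh_eq hT0]
    exact hwin.sum_norm_le h4 hK hC0 hC h2.le h3 _

lemma Scal.tendsto_sum (h : Scal T w j lam y) {s : ℂ} (hs : 0 ≤ s.re) :
    Tendsto (fun n => ∑ b ∈ Ico 3 (j n), tb (w n) (s / T n) b * ((n : ℂ) / (1 + s / T n) : ℂ) ^ b -
      ((1 / 2 * log (j n) : ℝ) : ℂ)) atTop (nhds (gam + Rt lam s y)) := by
  obtain ⟨C, hC0, hC⟩ := h.exists_const
  have hb : Summable fun κ : ℕ => C * (1 + ‖s‖) * (1 / 2 : ℝ) ^ (κ + 1) :=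
    ((summable_nat_add_iff 1).2 (summable_geometric_of_lt_one (by norm_num) (by norm_num))).mul_left _
  have ht := tendsto_tsum_of_dominated_convergence hb (fun κ => h.tendsto_sk hs (κ := κ + 1) (by omega))
    (by filter_upwards [hC] with n hn κ using (hn s hs).1 (κ + 1) (by omega))
  have hj : Tendsto j atTop atTop := tendsto_atTop.2 h.j_large
  have hg : Tendsto (fun n => ((∑ b ∈ Ico 3 (j n), 1 / (2 * (b : ℝ)) - 1 / 2 * log (j n) : ℝ) : ℂ)) atTop
      (nhds gam) := (continuous_ofReal.tendsto _).comp (tendsto_sum_inv_sub_log.choose_spec.comp hj)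
  refine (hg.add ((h.tendsto_sk_zero hs).add ht)).congr' ?_
  filter_upwards [hC, h.hT.eventually_gt_atTop 0] with n hn hT
  have hsum : Summable fun κ => sk (w n) (j n) (rh (T n) (Lt T w n) s) (s / T n) κ :=
    (summable_nat_add_iff 1).1 (hb.of_norm_bounded fun κ => (hn s hs).1 (κ + 1) (by omega))
  rw [sum_tb_eq_tsum, h.rh_eq hT, hsum.tsum_eq_zero_add]
  push_cast
  ring

lemma exp_half_log {j : ℕ} (hj : 0 < j) : exp (1 / 2 * log j) = √(j : ℝ) := by
  rw [sqrt_eq_rpow, rpow_def_of_pos (by exact_mod_cast hj), mul_comm]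

lemma Scal.norm_FV_le (h : Scal T w j lam y) : ∃ C : ℝ, 0 ≤ C ∧ ∀ᶠ n in atTop, ∀ s : ℂ, 0 ≤ s.re →
    ‖FV T w j n s‖ ≤ √(j n : ℝ) * exp (C * (1 + ‖s‖)) := by
  obtain ⟨C, hC0, hC⟩ := h.exists_const
  refine ⟨C, hC0, ?_⟩
  filter_upwards [hC, h.j_large 3, eventually_gt_atTop 0, h.hT.eventually_gt_atTop 0] with n hn hj h0 hT s hs
  refine (norm_Vn_le (den_ne hT hs) h0 rfl).trans ((exp_le_exp.2 (hn s hs).2).trans ?_)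
  rw [exp_add, exp_half_log (by omega)]

lemma Scal.tendsto_FV (h : Scal T w j lam y) {s : ℂ} (hs : 0 ≤ s.re) :
    Tendsto (fun n => FV T w j n s / (√(j n : ℝ) : ℝ)) atTop (nhds (Complex.exp (gam + Rt lam s y))) := by
  obtain ⟨C, hC0, hC⟩ := h.exists_const
  set S := fun n => ∑ b ∈ Ico 3 (j n), tb (w n) (s / T n) b * ((n : ℂ) / (1 + s / T n) : ℂ) ^ b with hS
  have h1 : Tendsto (fun n => Complex.exp (S n - ((1 / 2 * log (j n) : ℝ) : ℂ))) atTop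
      (nhds (Complex.exp (gam + Rt lam s y))) := (Complex.continuous_exp.tendsto _).comp (h.tendsto_sum hs)
  have h2 : Tendsto (fun n => (FV T w j n s - Complex.exp (S n)) / (√(j n : ℝ) : ℝ)) atTop (nhds 0) := by
    have h3 : Tendsto (fun n => 4 * exp (3 / 2 * (C * (1 + ‖s‖))) * (((j n : ℝ) / T n) ^ 2 * √((j n : ℝ) / T n) * √((T n)⁻¹)))
        atTop (nhds 0) := by
      have := (((h.hj.pow 2).mul h.hj.sqrt).mul h.tendsto_inv.sqrt).const_mul (4 * exp (3 / 2 * (C * (1 + ‖s‖))))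
      simpa using this
    refine squeeze_zero_norm' ?_ h3
    filter_upwards [hC, h.j_large 3, eventually_gt_atTop 0, h.hT.eventually_gt_atTop 0] with n hn hj h0 hT
    have hj0 : (0 : ℝ) < j n := by exact_mod_cast (by omega : 0 < j n)
    have hsq : 0 < √(j n : ℝ) := sqrt_pos.2 hj0
    rw [norm_div, norm_real, norm_of_nonneg hsq.le, div_le_iff₀ hsq]
    refine (norm_Vn_sub_le (den_ne hT hs) h0 rfl).trans ?_
    have h4 := (hn s hs).2
    have h5 : exp (3 / 2 * ∑ b ∈ Ico 3 (j n), ‖tb (w n) (s / T n) b‖ * ‖((n : ℂ) / (1 + s / T n) : ℂ)‖ ^ b) ≤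
        j n * exp (3 / 2 * (C * (1 + ‖s‖))) := by
      have hl : 0 ≤ log (j n) := log_nonneg (by exact_mod_cast (by omega : 1 ≤ j n))
      rw [← exp_log hj0, ← exp_add, exp_le_exp]
      linarith
    refine (mul_le_mul_of_nonneg_left (mul_le_mul_of_nonneg_left h5 (by positivity)) (by norm_num)).trans (le_of_eq ?_)
    rw [div_eq_mul_inv (j n : ℝ) (T n), sqrt_mul hj0.le, ← h.hTn n]
    have e1 := mul_self_sqrt hj0.le
    have e2 := mul_self_sqrt (inv_nonneg.2 hT.le)
    grind
  refine (h1.add h2).congr' ?_ |>.trans (by rw [add_zero])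
  filter_upwards [h.j_large 3] with n hj
  have hj0 : (0 : ℝ) < j n := by exact_mod_cast (by omega : 0 < j n)
  have hsq : ((√(j n : ℝ) : ℝ) : ℂ) ≠ 0 := by exact_mod_cast (sqrt_pos.2 hj0).ne'
  rw [Complex.exp_sub, ← ofReal_exp, exp_half_log (by omega)]
  field_simp
  ring

end

lemma tendsto_mul_log_sub {z : ℕ → ℂ} {N : ℕ → ℂ} (k : ℕ) (hz : Tendsto z atTop (nhds 0))
    (hN : Tendsto (fun n => N n * z n ^ (k + 1)) atTop (nhds 0)) :
    Tendsto (fun n => N n * (Complex.log (1 + z n) - Complex.logTaylor (k + 1) (z n))) atTop (nhds 0) := by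
  have h2 : Tendsto (fun n => 2 * ‖N n * z n ^ (k + 1)‖) atTop (nhds 0) := by
    have := hN.norm.const_mul 2
    simpa using this
  refine squeeze_zero_norm' ?_ h2
  have hz1 := hz.norm
  rw [norm_zero] at hz1
  filter_upwards [hz1.eventually_lt_const (by norm_num : (0 : ℝ) < 1 / 2)] with n hn
  have h3 := norm_log_sub_logTaylor_le k (show ‖z n‖ < 1 by linarith)
  have e : (1 - ‖z n‖)⁻¹ ≤ 2 := by rw [inv_le_comm₀ (by linarith) (by norm_num)]; linarith
  have h4 : ‖z n‖ ^ (k + 1) * (1 - ‖z n‖)⁻¹ / (k + 1) ≤ ‖z n‖ ^ (k + 1) * 2 := by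
    rw [div_le_iff₀ (by positivity)]
    have a1 := mul_le_mul_of_nonneg_left e (pow_nonneg (norm_nonneg (z n)) (k + 1))
    have a2 : 0 ≤ ‖z n‖ ^ (k + 1) * 2 * k := by positivity
    linarith
  rw [norm_mul, norm_mul, norm_pow]
  have := mul_le_mul_of_nonneg_left (h3.trans h4) (norm_nonneg (N n))
  linarith

/-- The normalised kernel on the line of abscissa `c`. -/
def PS (T w : ℕ → ℝ) (c : ℝ) (n : ℕ) (τ : ℝ) : ℂ :=
  gk n (w n) (c / T n) (τ / T n) * (1 + (c + τ * I) / T n) ^ n / (1 + w n) ^ n.choose 2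

section
variable {T w : ℕ → ℝ} {j : ℕ → ℕ} {lam y : ℝ}

lemma Scal.tendsto_w (h : Scal T w j lam y) : Tendsto w atTop (nhds 0) := by
  have h1 : Tendsto (fun n : ℕ => (n : ℝ) * w n * (n : ℝ)⁻¹) atTop (nhds (1 * 0)) :=
    h.tendsto_nw.mul tendsto_inv_atTop_nhds_zero_nat
  rw [mul_zero] at h1
  refine h1.congr' ?_
  filter_upwards [eventually_gt_atTop 0] with n hn
  have : (n : ℝ) ≠ 0 := by exact_mod_cast hn.ne'
  field_simp

lemma Scal.tendsto_const_exponent (h : Scal T w j lam y) :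
    Tendsto (fun n : ℕ => (w n : ℂ) * n ^ 2 / 2 - (n.choose 2 : ℂ) * Complex.log (1 + w n)) atTop (nhds (3 / 4)) := by
  have hw : Tendsto (fun n => (w n : ℂ)) atTop (nhds 0) := by
    have := (continuous_ofReal.tendsto 0).comp h.tendsto_w
    simpa [Function.comp_def] using this
  have hx : Tendsto (fun n : ℕ => (n : ℂ) * w n) atTop (nhds 1) := by
    have := (continuous_ofReal.tendsto 1).comp h.tendsto_nw
    simpa [Function.comp_def] using this
  have h1 := tendsto_mul_log_sub (N := fun n => (n.choose 2 : ℂ)) 2 hw (by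
    have : Tendsto (fun n : ℕ => (((n : ℂ) * w n) ^ 2 * w n - (n : ℂ) * w n * w n * w n) / 2) atTop
        (nhds ((1 ^ 2 * 0 - 1 * 0 * 0) / 2)) :=
      ((((hx.pow 2).mul hw).sub ((hx.mul hw).mul hw)).div_const 2)
    rw [show ((1 ^ 2 * 0 - 1 * 0 * 0) / 2 : ℂ) = 0 by norm_num] at this
    refine this.congr fun n => ?_
    rw [Nat.cast_choose_two]; ring)
  have h2 : Tendsto (fun n : ℕ => (n : ℂ) * w n / 2 + (((n : ℂ) * w n) ^ 2 - (n : ℂ) * w n * w n) / 4) atTop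
      (nhds (1 / 2 + (1 ^ 2 - 1 * 0) / 4)) :=
    (hx.div_const 2).add (((hx.pow 2).sub (hx.mul hw)).div_const 4)
  have h3 := h2.sub h1
  rw [show (1 / 2 + (1 ^ 2 - 1 * 0) / 4 - 0 : ℂ) = 3 / 4 by norm_num] at h3
  refine h3.congr fun n => ?_
  rw [Nat.cast_choose_two, show Complex.logTaylor (2 + 1) (w n : ℂ) = w n - (w n : ℂ) ^ 2 / 2 by
    simp [Complex.logTaylor, sum_range_succ]; ring]
  ring

lemma Scal.tendsto_exponent (h : Scal T w j lam y) (s : ℂ) :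
    Tendsto (fun n : ℕ => (s / T n) ^ 2 / (2 * w n) - n * (s / T n) + n * Complex.log (1 + s / T n)) atTop
      (nhds (s ^ 3 / 3 - lam * s ^ 2 / 2)) := by
  have hinv : Tendsto (fun n => (T n : ℂ)⁻¹) atTop (nhds 0) := by
    have := (continuous_ofReal.tendsto 0).comp h.tendsto_inv
    simpa [Function.comp_def] using this
  have hx : Tendsto (fun n : ℕ => (n : ℂ) * w n) atTop (nhds 1) := by
    have := (continuous_ofReal.tendsto 1).comp h.tendsto_nw
    simpa [Function.comp_def] using this
  have hLc : Tendsto (fun n => (Lt T w n : ℂ)) atTop (nhds lam) := (continuous_ofReal.tendsto lam).comp h.hL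
  have hz : Tendsto (fun n => s / T n) atTop (nhds 0) := by
    have := hinv.const_mul s
    simpa [div_eq_mul_inv] using this
  have hTn : ∀ n : ℕ, (n : ℂ) = (T n : ℂ) ^ 3 := fun n => by exact_mod_cast (h.hTn n).symm
  have h1 := tendsto_mul_log_sub (N := fun n => (n : ℂ)) 3 hz (by
    have := hinv.const_mul (s ^ 4)
    rw [mul_zero] at this
    refine this.congr' ?_
    filter_upwards [h.hT.eventually_gt_atTop 0] with n hn
    grind)
  have h2 : Tendsto (fun n : ℕ => s ^ 3 / 3 - Lt T w n / (n * w n) * s ^ 2 / 2) atTop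
      (nhds (s ^ 3 / 3 - lam / 1 * s ^ 2 / 2)) :=
    (((hLc.div hx one_ne_zero).mul_const _).div_const 2).const_sub _
  have h3 := h1.add h2
  rw [zero_add, div_one] at h3
  refine h3.congr' ?_
  filter_upwards [h.hT.eventually_gt_atTop 0, h.w_pos] with n hn hw
  have hn' : (T n : ℂ) ≠ 0 := by exact_mod_cast hn.ne'
  have hw' : (w n : ℂ) ≠ 0 := by exact_mod_cast hw.ne'
  rw [show Complex.logTaylor (3 + 1) (s / T n) = s / T n - (s / T n) ^ 2 / 2 + (s / T n) ^ 3 / 3 by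
    simp [Complex.logTaylor, sum_range_succ]; ring, Lt, hTn]
  push_cast
  grind

lemma Scal.PS_eq (h : Scal T w j lam y) {c : ℝ} (hc : 0 ≤ c) {n : ℕ} (hT : 0 < T n) (hw : 0 < w n) (τ : ℝ) :
    PS T w c n τ = Complex.exp (((w n : ℂ) * n ^ 2 / 2 - (n.choose 2 : ℂ) * Complex.log (1 + w n)) +
      (((c + τ * I) / T n) ^ 2 / (2 * w n) - n * ((c + τ * I) / T n) +
        n * Complex.log (1 + (c + τ * I) / T n))) := by
  have h1 : (1 + (c + τ * I) / T n : ℂ) ≠ 0 := den_ne hT (by simpa using hc)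
  have h2 : (1 + w n : ℂ) ≠ 0 := by exact_mod_cast (by linarith : 1 + w n ≠ 0)
  have hw' : (w n : ℂ) ≠ 0 := by exact_mod_cast hw.ne'
  rw [PS, gk]
  nth_rw 1 [← Complex.exp_log h1]
  nth_rw 1 [← Complex.exp_log h2]
  rw [← Complex.exp_nat_mul, ← Complex.exp_nat_mul, ← Complex.exp_add, ← Complex.exp_sub]
  have hT' : (T n : ℂ) ≠ 0 := by exact_mod_cast hT.ne'
  generalize Complex.log (1 + (c + τ * I) / T n) = l
  congr 1
  push_cast
  field_simp
  ring

lemma Scal.tendsto_PS (h : Scal T w j lam y) {c : ℝ} (hc : 0 ≤ c) (τ : ℝ) :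
    Tendsto (fun n => PS T w c n τ) atTop
      (nhds (Complex.exp (3 / 4 + ((c + τ * I) ^ 3 / 3 - lam * (c + τ * I) ^ 2 / 2)))) := by
  refine ((Complex.continuous_exp.tendsto _).comp (h.tendsto_const_exponent.add (h.tendsto_exponent _))).congr' ?_
  filter_upwards [h.hT.eventually_gt_atTop 0, h.w_pos] with n hn hw
  rw [h.PS_eq hc hn hw]
  rfl

lemma one_add_line_pow_le {a t : ℝ} (ha : 0 ≤ a) (n : ℕ) :
    ‖(1 + (a + t * I) : ℂ)‖ ^ n ≤ (1 + a) ^ n * exp (n * (t ^ 2 / (2 * (1 + a) ^ 2))) := by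
  have h1 : ‖(1 + (a + t * I) : ℂ)‖ ≤ (1 + a) * exp (t ^ 2 / (2 * (1 + a) ^ 2)) := by
    refine le_of_sq_le_sq ?_ (by positivity)
    rw [← normSq_eq_norm_sq, normSq_apply, mul_pow, ← exp_nat_mul]
    have h2 := add_one_le_exp (t ^ 2 / (1 + a) ^ 2)
    have h3 : ((2 : ℕ) : ℝ) * (t ^ 2 / (2 * (1 + a) ^ 2)) = t ^ 2 / (1 + a) ^ 2 := by push_cast; field_simp
    have h4 := mul_le_mul_of_nonneg_left h2 (by positivity : 0 ≤ (1 + a) ^ 2)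
    rw [h3]
    refine le_trans (le_of_eq ?_) h4
    simp
    field_simp
    ring
  refine (pow_le_pow_left₀ (norm_nonneg _) h1 n).trans (le_of_eq ?_)
  rw [mul_pow, ← exp_nat_mul]

lemma Scal.norm_PS_le (h : Scal T w j lam y) {c : ℝ} (hc : 0 < c) (hcl : lam < 2 * c) :
    ∃ B δ : ℝ, 0 < δ ∧ 0 ≤ B ∧ ∀ᶠ n in atTop, ∀ τ, ‖PS T w c n τ‖ ≤ B * exp (-δ * τ ^ 2) := by
  obtain ⟨B, hB⟩ : ∃ B, ∀ᶠ n in atTop, ‖PS T w c n 0‖ ≤ B := by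
    have := (h.tendsto_PS hc.le 0).norm
    exact ⟨_, this.eventually_le_const (lt_add_one _)⟩
  have hB0 : 0 ≤ B := by
    obtain ⟨n, hn⟩ := hB.exists
    exact (norm_nonneg _).trans hn
  refine ⟨B, (2 * c - lam) / 4, by linarith, hB0, ?_⟩
  have hx : Tendsto (fun n => (Lt T w n)) atTop (nhds lam) := h.hL
  have hd : Tendsto (fun n : ℕ => (2 * c + c ^ 2 * (T n)⁻¹ - Lt T w n) / (n * w n * (1 + c * (T n)⁻¹) ^ 2)) atTop
      (nhds ((2 * c + c ^ 2 * 0 - lam) / (1 * (1 + c * 0) ^ 2))) :=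
    (((h.tendsto_inv.const_mul _).const_add _).sub hx).div
      (h.tendsto_nw.mul (((h.tendsto_inv.const_mul c).const_add 1).pow 2)) (by norm_num)
  have hlim : (2 * c - lam) / 2 < (2 * c + c ^ 2 * 0 - lam) / (1 * (1 + c * 0) ^ 2) := by
    norm_num; linarith
  filter_upwards [hB, hd.eventually_const_lt hlim, h.hT.eventually_gt_atTop 0, h.w_pos, eventually_gt_atTop 0]
    with n h1 h2 hT hw hn0 τ
  have hn0' : (n : ℝ) ≠ 0 := by exact_mod_cast hn0.ne'
  have hline := one_add_line_pow_le (a := c / T n) (t := τ / T n) (by positivity) n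
  have hbase : ‖PS T w c n 0‖ = exp ((c / T n - w n * n) ^ 2 / (2 * w n)) * (1 + c / T n) ^ n / (1 + w n) ^ n.choose 2 := by
    have e1 : ‖(1 + w n : ℂ)‖ = 1 + w n := by
      rw [← ofReal_one, ← ofReal_add, norm_real, norm_of_nonneg (by linarith)]
    have e2 : ‖(1 + (c + (0 : ℝ) * I) / T n : ℂ)‖ = 1 + c / T n := by
      rw [show (1 + (c + (0 : ℝ) * I) / T n : ℂ) = ((1 + c / T n : ℝ) : ℂ) by push_cast; ring, norm_real,
        norm_of_nonneg (by positivity)]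
    rw [PS, norm_div, norm_mul, norm_pow, norm_pow, norm_gk hw, e1, e2]
    norm_num
  have e1 : ‖(1 + w n : ℂ)‖ = 1 + w n := by
    rw [← ofReal_one, ← ofReal_add, norm_real, norm_of_nonneg (by linarith)]
  have e2 : (1 + (c + τ * I) / T n : ℂ) = 1 + ((c / T n : ℝ) + (τ / T n : ℝ) * I) := by push_cast; ring
  have hexp : (τ / T n) ^ 2 * (n / (2 * (1 + c / T n) ^ 2) - 1 / (2 * w n)) =
      -(τ ^ 2 / 2 * ((2 * c + c ^ 2 * (T n)⁻¹ - Lt T w n) / (n * w n * (1 + c * (T n)⁻¹) ^ 2))) := by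
    have hL : w n * T n ^ 3 = 1 + Lt T w n / T n := by rw [h.one_add hT, h.hTn]; ring
    have hL' : Lt T w n = (w n * T n ^ 3 - 1) * T n := by grind
    have : T n + c ≠ 0 := by positivity
    rw [hL', ← h.hTn n]
    field_simp
    ring
  rw [PS, norm_div, norm_mul, norm_pow, norm_pow, norm_gk hw, e1, e2]
  calc _ ≤ exp (((c / T n - w n * n) ^ 2 - (τ / T n) ^ 2) / (2 * w n)) *
        ((1 + c / T n) ^ n * exp (n * ((τ / T n) ^ 2 / (2 * (1 + c / T n) ^ 2)))) / (1 + w n) ^ n.choose 2 := by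
        have : 0 < 1 + w n := by linarith
        gcongr
    _ = ‖PS T w c n 0‖ * exp ((τ / T n) ^ 2 * (n / (2 * (1 + c / T n) ^ 2) - 1 / (2 * w n))) := by
        rw [hbase, show ((c / T n - w n * n) ^ 2 - (τ / T n) ^ 2) / (2 * w n) =
          (c / T n - w n * n) ^ 2 / (2 * w n) + -((τ / T n) ^ 2 / (2 * w n)) by ring, exp_add,
          show (τ / T n) ^ 2 * (n / (2 * (1 + c / T n) ^ 2) - 1 / (2 * w n)) =
          -((τ / T n) ^ 2 / (2 * w n)) + n * ((τ / T n) ^ 2 / (2 * (1 + c / T n) ^ 2)) by ring, exp_add]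
        ring
    _ ≤ _ := by
        refine mul_le_mul h1 (exp_le_exp.2 ?_) (exp_pos _).le hB0
        rw [hexp]
        have := mul_le_mul_of_nonneg_left h2.le (by positivity : 0 ≤ τ ^ 2 / 2)
        linarith

end

/-- The limiting integrand. -/
def QI (lam y : ℝ) (s : ℂ) : ℂ :=
  Complex.exp (3 / 4 + (s ^ 3 / 3 - lam * s ^ 2 / 2)) * Complex.exp (gam + Rt lam s y) / s ^ 2

/-- The limiting probability, as a contour integral over the line of abscissa `c`. -/
def Qc (lam y c : ℝ) : ℂ := (√y / √(2 * Real.pi) : ℝ) * ∫ τ : ℝ, QI lam y (c + τ * I)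

lemma continuous_WW (w : ℝ) (j : ℕ) (U : Finset ℕ) : Continuous fun ζ => WW w j ζ U := by
  unfold WW PH
  fun_prop

section
variable {T w : ℕ → ℝ} {j : ℕ → ℕ} {lam y c : ℝ}

lemma continuous_PS {n : ℕ} (hw : 0 < w n) : Continuous (PS T w c n) := by
  unfold PS
  refine Continuous.div_const (((continuous_gk _ _ _).comp (by fun_prop)).mul (by fun_prop)) _

lemma continuous_FV {n : ℕ} (hT : 0 < T n) (hc : 0 ≤ c) (hj : 2 ≤ j n) :
    Continuous fun τ : ℝ => FV T w j n (c + τ * I) := by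
  have h1 : (fun τ : ℝ => FV T w j n (c + τ * I)) = fun τ : ℝ => WW (w n) (j n) ((c + τ * I) / T n) (range n) /
      (1 + (c + τ * I) / T n) ^ n := by
    funext τ
    rw [FV, WW_eq _ hj, card_range]
  rw [h1]
  refine ((continuous_WW _ _ _).comp (by fun_prop)).div (by fun_prop) fun τ => pow_ne_zero _ (den_ne hT (by simpa using hc))

lemma Scal.ev_eq (h : Scal T w j lam y) (hc : 0 < c) {n : ℕ} (hT : 0 < T n) (hw : 0 < w n) (hj : 2 ≤ j n) :
    ((ev (w n) (range n) (fun S => ind (SmallC (range n) (j n) (core S))) : ℝ) : ℂ) =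
      (√(w n * T n ^ 3 * ((j n : ℝ) / T n)) / √(2 * Real.pi) : ℝ) *
        ∫ τ : ℝ, PS T w c n τ * (FV T w j n (c + τ * I) / (√(j n : ℝ) : ℝ)) / (c + τ * I) ^ 2 := by
  have hT' : (T n : ℂ) ≠ 0 := by exact_mod_cast hT.ne'
  have hj0 : (0 : ℝ) < j n := by exact_mod_cast (by omega : 0 < j n)
  have hsq := sqrt_pos.2 hj0
  have hsq' : ((√(j n : ℝ) : ℝ) : ℂ) ≠ 0 := by exact_mod_cast hsq.ne'
  have hw1 : ((1 + w n : ℝ) : ℂ) ^ n.choose 2 ≠ 0 := pow_ne_zero _ (by exact_mod_cast (by linarith : 1 + w n ≠ 0))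
  have h1 := ws_smallC hw (div_pos hc hT) hj (range n)
  rw [card_range] at h1
  set g := fun t : ℝ => gk n (w n) (c / T n) t * ((n.factorial * Vn (1 + ((c / T n : ℝ) + t * I)) (tb (w n) ((c / T n : ℝ) + t * I)) (j n) n) /
    ((c / T n : ℝ) + t * I : ℂ) ^ 2) with hg
  have h2 := Measure.integral_comp_div g (T n)
  have h3 : ∀ τ : ℝ, g (τ / T n) = (((1 + w n : ℝ) : ℂ) ^ n.choose 2 * T n ^ 2 * (√(j n : ℝ) : ℝ)) *
      (PS T w c n τ * (FV T w j n (c + τ * I) / (√(j n : ℝ) : ℝ)) / (c + τ * I) ^ 2) := by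
    intro τ
    have e : ((c / T n : ℝ) + (τ / T n : ℝ) * I : ℂ) = (c + τ * I) / T n := by push_cast; ring
    have hs : (c + τ * I : ℂ) ≠ 0 := line_ne_zero hc τ
    have hd : (1 + (c + τ * I) / T n : ℂ) ^ n ≠ 0 := pow_ne_zero _ (den_ne hT (by simpa using hc.le))
    simp only [hg]
    rw [e, PS, FV]
    push_cast at hw1 ⊢
    grind
  simp_rw [h3] at h2
  rw [integral_const_mul, abs_of_pos hT, real_smul] at h2
  have h4 : ((w n / √(2 * Real.pi * w n) : ℝ) : ℂ) * (T n * (√(j n : ℝ) : ℝ)) =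
      (√(w n * T n ^ 3 * ((j n : ℝ) / T n)) / √(2 * Real.pi) : ℝ) := by
    rw [← ofReal_mul, ← ofReal_mul]
    congr 1
    rw [show w n * T n ^ 3 * ((j n : ℝ) / T n) = w n * (T n ^ 2 * j n) by field_simp, sqrt_mul hw.le,
      sqrt_mul (x := T n ^ 2) (by positivity), sqrt_sq hT.le, sqrt_mul (by positivity) (w n)]
    have hp : 0 < √(2 * Real.pi) := sqrt_pos.2 (by positivity)
    have hp' := sqrt_pos.2 hw
    have := mul_self_sqrt hw.le
    field_simp
    linear_combination -this
  rw [ev, ofReal_div, h1, card_KK, card_range, ← h4]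
  push_cast at hw1 h2 ⊢
  grind

lemma Scal.tendsto_ev (h : Scal T w j lam y) (hc : 0 < c) (hcl : lam < 2 * c) :
    Tendsto (fun n => ((ev (w n) (range n) (fun S => ind (SmallC (range n) (j n) (core S))) : ℝ) : ℂ)) atTop
      (nhds (Qc lam y c)) := by
  have hK : Tendsto (fun n => ((√(w n * T n ^ 3 * ((j n : ℝ) / T n)) / √(2 * Real.pi) : ℝ) : ℂ)) atTop
      (nhds (√y / √(2 * Real.pi) : ℝ)) := by
    refine (continuous_ofReal.tendsto _).comp (Tendsto.div_const ?_ _)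
    have := (h.tendsto_wT.mul h.hj).sqrt
    rwa [one_mul] at this
  obtain ⟨B, δ, hδ, hB0, hB⟩ := h.norm_PS_le hc hcl
  obtain ⟨C, hC0, hC⟩ := h.norm_FV_le
  have hre : ∀ τ : ℝ, 0 ≤ (c + τ * I : ℂ).re := fun τ => by simpa using hc.le
  have hI : Tendsto (fun n => ∫ τ : ℝ, PS T w c n τ * (FV T w j n (c + τ * I) / (√(j n : ℝ) : ℝ)) / (c + τ * I) ^ 2)
      atTop (nhds (∫ τ : ℝ, QI lam y (c + τ * I))) := by
    refine tendsto_integral_filter_of_dominated_convergence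
      (fun τ => B * exp (C * (1 + c) + C ^ 2 / (2 * δ)) / c ^ 2 * exp (-(δ / 2) * τ ^ 2)) ?_ ?_ ?_ ?_
    · filter_upwards [h.hT.eventually_gt_atTop 0, h.w_pos, h.j_large 2] with n hT hw hj
      refine Continuous.aestronglyMeasurable ?_
      exact ((continuous_PS hw).mul ((continuous_FV hT hc.le hj).div_const _)).div (by fun_prop)
        fun τ => pow_ne_zero _ (line_ne_zero hc τ)
    · filter_upwards [hB, hC, h.j_large 2] with n h1 h2 hj
      refine Eventually.of_forall fun τ => ?_
      have hj0 : (0 : ℝ) < j n := by exact_mod_cast (by omega : 0 < j n)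
      have hsq := sqrt_pos.2 hj0
      have h3 := h2 _ (hre τ)
      rw [norm_div, norm_mul, norm_div, norm_pow, norm_real, norm_of_nonneg hsq.le]
      have h4 : ‖FV T w j n (c + τ * I)‖ / √(j n : ℝ) ≤ exp (C * (1 + c) + C ^ 2 / (2 * δ) + δ / 2 * τ ^ 2) := by
        rw [div_le_iff₀ hsq, mul_comm (exp _)]
        refine h3.trans (mul_le_mul_of_nonneg_left (exp_le_exp.2 ?_) hsq.le)
        have h5 := mul_le_mul_of_nonneg_left (norm_line_le hc τ) hC0
        have h6 : C * |τ| ≤ C ^ 2 / (2 * δ) + δ / 2 * τ ^ 2 := by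
          have := sq_nonneg (C - δ * |τ|)
          rw [sub_sq, mul_pow, sq_abs] at this
          rw [show C ^ 2 / (2 * δ) + δ / 2 * τ ^ 2 = (C ^ 2 + δ ^ 2 * τ ^ 2) / (2 * δ) by field_simp, le_div_iff₀ (by positivity)]
          linarith
        linarith
      have h7 : c ^ 2 ≤ ‖(c + τ * I : ℂ)‖ ^ 2 := pow_le_pow_left₀ hc.le (norm_line_ge hc τ) 2
      calc _ ≤ B * exp (-δ * τ ^ 2) * exp (C * (1 + c) + C ^ 2 / (2 * δ) + δ / 2 * τ ^ 2) / c ^ 2 :=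
            div_le_div₀ (by positivity) (mul_le_mul (h1 τ) h4 (by positivity) (by positivity)) (by positivity) h7
        _ = _ := by
            have e : exp (-(δ / 2) * τ ^ 2) = exp (-δ * τ ^ 2) * exp (δ / 2 * τ ^ 2) := by
              rw [← exp_add]; congr 1; ring
            rw [exp_add (C * (1 + c) + C ^ 2 / (2 * δ)), e]
            ring
    · exact (integrable_exp_neg_mul_sq (by positivity)).const_mul _
    · exact Eventually.of_forall fun τ => ((h.tendsto_PS hc.le τ).mul (h.tendsto_FV (hre τ))).div_const _
  refine (hK.mul hI).congr' ?_
  filter_upwards [h.hT.eventually_gt_atTop 0, h.w_pos, h.j_large 2] with n hT hw hj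
  rw [h.ev_eq hc hT hw hj]

end

section
variable {α : Type*} [DecidableEq α] {A : Finset α} {f : Finset α → ℝ}

/-- Average over the subsets of size `m`. -/
def av (A : Finset α) (m : ℕ) (f : Finset α → ℝ) : ℝ :=
  (∑ S ∈ A.powersetCard m, f S) / (A.card.choose m)

lemma av_le_one {m : ℕ} (hf : ∀ S, f S ≤ 1) : av A m f ≤ 1 := by
  refine div_le_one_of_le₀ ?_ (Nat.cast_nonneg _)
  have := sum_le_card_nsmul (A.powersetCard m) f 1 fun S _ => hf S
  rwa [card_powersetCard, nsmul_eq_mul, mul_one] at this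

lemma av_nonneg {m : ℕ} (hf : ∀ S, 0 ≤ f S) : 0 ≤ av A m f :=
  div_nonneg (sum_nonneg fun S _ => hf S) (Nat.cast_nonneg _)

lemma av_mono_succ (hf : ∀ S S', S ⊆ S' → f S ≤ f S') {m : ℕ} (hm : m < A.card) : av A m f ≤ av A (m + 1) f := by
  have h1 : ∑ S ∈ A.powersetCard m, f S * (A.card - m : ℕ) ≤ ∑ S ∈ A.powersetCard (m + 1), f S * (m + 1 : ℕ) := by
    calc _ = ∑ S ∈ A.powersetCard m, ∑ e ∈ A \ S, f S := by
          refine sum_congr rfl fun S hS => ?_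
          rw [mem_powersetCard] at hS
          rw [sum_const, card_sdiff_of_subset hS.1, hS.2, nsmul_eq_mul, mul_comm]
      _ = ∑ S ∈ A.powersetCard (m + 1), ∑ e ∈ S, f (S.erase e) := by
          rw [sum_sigma', sum_sigma']
          refine sum_bij' (fun x _ => ⟨insert x.2 x.1, x.2⟩) (fun x _ => ⟨x.1.erase x.2, x.2⟩) ?_ ?_ ?_ ?_ ?_
          · grind
          · grind
          · rintro ⟨S, e⟩ h
            simp only [mem_sigma, Finset.mem_sdiff] at h
            simp [erase_insert h.2.2]
          · rintro ⟨S, e⟩ h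
            simp only [mem_sigma] at h
            simp [insert_erase h.2]
          · rintro ⟨S, e⟩ h
            simp only [mem_sigma, Finset.mem_sdiff] at h
            simp [erase_insert h.2.2]
      _ ≤ _ := by
          refine sum_le_sum fun S hS => ?_
          rw [mem_powersetCard] at hS
          have := sum_le_card_nsmul S (fun e => f (S.erase e)) (f S) fun e _ => hf _ _ (erase_subset _ _)
          rwa [hS.2, nsmul_eq_mul, mul_comm] at this
  rw [← sum_mul, ← sum_mul] at h1
  have h2 : ((A.card.choose (m + 1) * (m + 1) : ℕ) : ℝ) = ((A.card.choose m * (A.card - m) : ℕ) : ℝ) := by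
    rw [Nat.choose_succ_right_eq]
  have p1 : (0 : ℝ) < A.card.choose m := by exact_mod_cast Nat.choose_pos hm.le
  have p2 : (0 : ℝ) < A.card.choose (m + 1) := by exact_mod_cast Nat.choose_pos hm
  have p3 : (0 : ℝ) < (m + 1 : ℕ) := by positivity
  rw [Nat.cast_mul, Nat.cast_mul] at h2
  rw [av, av, div_le_div_iff₀ p1 p2]
  refine le_of_mul_le_mul_right ?_ p3
  rw [mul_assoc, h2]
  have := mul_le_mul_of_nonneg_left h1 p1.le
  linarith

lemma av_mono (hf : ∀ S S', S ⊆ S' → f S ≤ f S') {m M : ℕ} (hmM : m ≤ M) (hM : M ≤ A.card) : av A m f ≤ av A M f := by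
  induction M, hmM using Nat.le_induction with
  | base => exact le_rfl
  | succ k hk ih => exact (ih (by omega)).trans (av_mono_succ hf (by omega))

/-- The probability that a binomial variable takes the value `m`. -/
def pm (w : ℝ) (K m : ℕ) : ℝ := K.choose m * w ^ m / (1 + w) ^ K

lemma pm_nonneg {w : ℝ} (hw : 0 ≤ w) (K m : ℕ) : 0 ≤ pm w K m := by unfold pm; positivity

lemma sum_pm {w : ℝ} (hw : 0 ≤ w) (K : ℕ) : ∑ m ∈ range (K + 1), pm w K m = 1 := by
  have h1 : (1 + w) ^ K ≠ 0 := by positivity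
  simp_rw [pm]
  rw [← sum_div, div_eq_one_iff_eq h1, add_comm 1 w, add_pow]
  exact sum_congr rfl fun m _ => by rw [one_pow]; ring

lemma sum_pm_sq {w : ℝ} (hw : 0 ≤ w) (K : ℕ) :
    ∑ m ∈ range (K + 1), pm w K m * (m - K * (w / (1 + w))) ^ 2 ≤ K * w := by
  have h0 : 0 < 1 + w := by linarith
  have h1 := congrArg (Polynomial.eval (w / (1 + w))) (bernsteinPolynomial.variance ℝ K)
  rw [Polynomial.eval_finsetSum] at h1
  simp only [bernsteinPolynomial, Polynomial.eval_mul, Polynomial.eval_pow, Polynomial.eval_sub, Polynomial.eval_natCast,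
    Polynomial.eval_X, Polynomial.eval_one, nsmul_eq_mul] at h1
  have h2 : (1 : ℝ) - w / (1 + w) = 1 / (1 + w) := by field_simp; ring
  have h3 : (K : ℝ) * (w / (1 + w)) * (1 - w / (1 + w)) ≤ K * w := by
    rw [h2, mul_assoc, div_mul_div_comm, mul_one]
    exact mul_le_mul_of_nonneg_left (div_le_self hw (by nlinarith)) (Nat.cast_nonneg _)
  refine le_trans (le_of_eq ?_) (h1.le.trans h3)
  refine sum_congr rfl fun m hm => ?_
  obtain ⟨i, rfl⟩ := Nat.exists_eq_add_of_le (Nat.lt_succ_iff.1 (mem_range.1 hm))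
  rw [h2, pm, div_pow, div_pow, one_pow, Nat.add_sub_cancel_left, pow_add]
  field_simp
  ring

lemma sum_pm_le {w d : ℝ} (hw : 0 ≤ w) (hd : 0 < d) {K : ℕ} {I : Finset ℕ} (hI : I ⊆ range (K + 1))
    (h : ∀ m ∈ I, d ^ 2 ≤ (m - K * (w / (1 + w))) ^ 2) : ∑ m ∈ I, pm w K m ≤ K * w / d ^ 2 := by
  rw [le_div_iff₀ (by positivity), sum_mul]
  calc _ ≤ ∑ m ∈ I, pm w K m * (m - K * (w / (1 + w))) ^ 2 :=
        sum_le_sum fun m hm => mul_le_mul_of_nonneg_left (h m hm) (pm_nonneg hw K m)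
    _ ≤ _ := (sum_le_sum_of_subset_of_nonneg hI fun m _ _ => mul_nonneg (pm_nonneg hw K m) (sq_nonneg _)).trans (sum_pm_sq hw K)

lemma ws_div_eq (w : ℝ) : ws w A f / (1 + w) ^ A.card = ∑ m ∈ range (A.card + 1), pm w A.card m * av A m f := by
  rw [ws, sum_powerset, sum_div]
  refine sum_congr rfl fun m hm => ?_
  have hp : (A.card.choose m : ℝ) ≠ 0 := by
    exact_mod_cast (Nat.choose_pos (Nat.lt_succ_iff.1 (mem_range.1 hm))).ne'
  rw [sum_congr rfl (g := fun S => w ^ m * f S) fun S hS => by rw [(mem_powersetCard.1 hS).2], ← mul_sum,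
    pm, av]
  field_simp

lemma av_mul_le {w d : ℝ} (hw : 0 ≤ w) (hd : 0 < d) (hf0 : ∀ S, 0 ≤ f S) (hf : ∀ S S', S ⊆ S' → f S ≤ f S') {M : ℕ}
    (hM : M ≤ A.card) (h : M + d ≤ A.card * (w / (1 + w))) :
    av A M f * (1 - A.card * w / d ^ 2) ≤ ws w A f / (1 + w) ^ A.card := by
  have h1 := sum_pm_le hw hd (K := A.card) (I := range M) (range_subset_range.2 (by omega)) fun m hm => by
    have : (m : ℝ) ≤ M := by exact_mod_cast (mem_range.1 hm).le
    rw [← neg_sub, neg_sq]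
    exact pow_le_pow_left₀ hd.le (by linarith) 2
  have h2 := sum_pm hw A.card
  rw [← sum_range_add_sum_Ico _ (by omega : M ≤ A.card + 1)] at h2
  rw [ws_div_eq, ← sum_range_add_sum_Ico _ (by omega : M ≤ A.card + 1)]
  have h3 : 0 ≤ ∑ m ∈ range M, pm w A.card m * av A m f :=
    sum_nonneg fun m _ => mul_nonneg (pm_nonneg hw _ _) (av_nonneg hf0)
  have h4 : av A M f * ∑ m ∈ Ico M (A.card + 1), pm w A.card m ≤ ∑ m ∈ Ico M (A.card + 1), pm w A.card m * av A m f := by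
    rw [mul_sum]
    refine sum_le_sum fun m hm => ?_
    rw [mem_Ico] at hm
    rw [mul_comm]
    exact mul_le_mul_of_nonneg_left (av_mono hf hm.1 (by omega)) (pm_nonneg hw _ _)
  have h5 : av A M f * (1 - A.card * w / d ^ 2) ≤ av A M f * ∑ m ∈ Ico M (A.card + 1), pm w A.card m :=
    mul_le_mul_of_nonneg_left (by linarith) (av_nonneg hf0)
  linarith

lemma le_av_add {w d : ℝ} (hw : 0 ≤ w) (hd : 0 < d) (hf0 : ∀ S, 0 ≤ f S) (hf1 : ∀ S, f S ≤ 1)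
    (hf : ∀ S S', S ⊆ S' → f S ≤ f S') {M : ℕ} (hM : M ≤ A.card) (h : A.card * (w / (1 + w)) + d ≤ M) :
    ws w A f / (1 + w) ^ A.card ≤ av A M f + A.card * w / d ^ 2 := by
  have h1 := sum_pm_le hw hd (K := A.card) (I := Ico M (A.card + 1))
    (fun m hm => mem_range.2 (mem_Ico.1 hm).2) fun m hm => by
    have : (M : ℝ) ≤ m := by exact_mod_cast (mem_Ico.1 hm).1
    exact pow_le_pow_left₀ hd.le (by linarith) 2
  have h2 := sum_pm hw A.card
  rw [← sum_range_add_sum_Ico _ (by omega : M ≤ A.card + 1)] at h2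
  rw [ws_div_eq, ← sum_range_add_sum_Ico _ (by omega : M ≤ A.card + 1)]
  have h3 : ∑ m ∈ Ico M (A.card + 1), pm w A.card m * av A m f ≤ ∑ m ∈ Ico M (A.card + 1), pm w A.card m :=
    sum_le_sum fun m _ => mul_le_of_le_one_right (pm_nonneg hw _ _) (av_le_one hf1)
  have h4 : ∑ m ∈ range M, pm w A.card m * av A m f ≤ av A M f * ∑ m ∈ range M, pm w A.card m := by
    rw [mul_sum]
    refine sum_le_sum fun m hm => ?_
    rw [mem_range] at hm
    rw [mul_comm (av A M f)]
    exact mul_le_mul_of_nonneg_left (av_mono hf hm.le hM) (pm_nonneg hw _ _)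
  have h5 : 0 ≤ ∑ m ∈ Ico M (A.card + 1), pm w A.card m := sum_nonneg fun m _ => pm_nonneg hw _ _
  have h6 : av A M f * ∑ m ∈ range M, pm w A.card m ≤ av A M f * 1 :=
    mul_le_mul_of_nonneg_left (by linarith) (av_nonneg hf0)
  linarith

end

section
variable {n : ℕ} {G : SimpleGraph (Fin n)}

open Classical in
/-- The edges of a graph on `Fin n`, as pairs of natural numbers. -/
def edg (G : SimpleGraph (Fin n)) : EdgeSet :=
  (univ.filter fun e => e ∈ G.edgeSet).map ⟨Sym2.map Fin.val, Sym2.map.injective Fin.val_injective⟩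

lemma mem_edg {a b : Fin n} : s((a : ℕ), (b : ℕ)) ∈ edg G ↔ G.Adj a b := by
  classical
  rw [edg, Finset.mem_map]
  constructor
  · rintro ⟨e, he, h⟩
    rw [show s((a : ℕ), (b : ℕ)) = Sym2.map Fin.val s(a, b) from rfl] at h
    rw [Sym2.map.injective Fin.val_injective h] at he
    simpa using he
  · exact fun h => ⟨s(a, b), by simpa using h, rfl⟩

lemma exists_of_mem_edg {x y : ℕ} (h : s(x, y) ∈ edg G) : ∃ a b : Fin n, (a : ℕ) = x ∧ (b : ℕ) = y ∧ G.Adj a b := by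
  classical
  have h0 := h
  rw [edg, Finset.mem_map] at h
  obtain ⟨e, he, h⟩ := h
  induction e with
  | _ a b =>
    rcases Sym2.eq_iff.1 (show s((a : ℕ), (b : ℕ)) = s(x, y) from h) with ⟨rfl, rfl⟩ | ⟨rfl, rfl⟩
    · exact ⟨a, b, rfl, rfl, mem_edg.1 h0⟩
    · exact ⟨b, a, rfl, rfl, mem_edg.1 h0⟩

lemma edg_subset : edg G ⊆ KK (range n) := by
  intro e he
  induction e with
  | _ x y =>
    obtain ⟨a, b, rfl, rfl, h⟩ := exists_of_mem_edg he
    rw [mem_KK]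
    exact ⟨by simp, by simp, fun h' => h.ne (Fin.ext h')⟩

lemma card_edg : (edg G).card = G.edgeSet.ncard := by
  classical
  rw [edg, card_map, Set.ncard_eq_toFinset_card']
  congr 1
  ext e
  simp

lemma connected_iff {B : Finset (Fin n)} (hB : B.Nonempty) :
    (G.induce (B : Set (Fin n))).Connected ↔
      Conn (B.map Fin.valEmbedding) (edg G ∩ KK (B.map Fin.valEmbedding)) := by
  constructor
  · intro h a ha b hb
    obtain ⟨a, ha', rfl⟩ := Finset.mem_map.1 ha
    obtain ⟨b, hb', rfl⟩ := Finset.mem_map.1 hb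
    have := h.preconnected ⟨a, ha'⟩ ⟨b, hb'⟩
    rw [SimpleGraph.reachable_iff_reflTransGen] at this
    refine Relation.ReflTransGen.lift (fun x : (B : Set (Fin n)) => ((x : Fin n) : ℕ)) (fun x y hxy => ?_) _ _ this
    have hxy' : G.Adj x y := hxy
    refine mem_inter.2 ⟨mem_edg.2 hxy', mem_KK.2 ⟨?_, ?_, fun h' => hxy'.ne (Fin.ext h')⟩⟩
    · exact mem_map_of_mem Fin.valEmbedding (mem_coe.1 x.2)
    · exact mem_map_of_mem Fin.valEmbedding (mem_coe.1 y.2)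
  · intro h
    have : Nonempty (B : Set (Fin n)) := hB.to_subtype
    refine SimpleGraph.Connected.mk fun a b => ?_
    have h1 := h (a : Fin n) (mem_map_of_mem Fin.valEmbedding (mem_coe.1 a.2))
      (b : Fin n) (mem_map_of_mem Fin.valEmbedding (mem_coe.1 b.2))
    have key := h1.closed (p := fun x => ∀ c : (B : Set (Fin n)), ((c : Fin n) : ℕ) = x → (G.induce (B : Set (Fin n))).Reachable a c)
      (fun x y hxy hx c hc => ?_) (fun c hc => ?_)
    · exact key b rfl
    · rw [mem_inter, mem_KK] at hxy
      obtain ⟨u, v, rfl, rfl, huv⟩ := exists_of_mem_edg hxy.1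
      obtain ⟨u', hu', hu''⟩ := Finset.mem_map.1 hxy.2.1
      have e1 : u' = u := Fin.ext hu''
      subst e1
      have e2 : (c : Fin n) = v := Fin.ext hc
      refine (hx ⟨u', hu'⟩ rfl).trans (SimpleGraph.Adj.reachable ?_)
      change G.Adj u' c
      rwa [e2]
    · have e : c = a := Subtype.ext (Fin.ext hc)
      rw [e]

lemma bi_iff {B : Finset (Fin n)} (h2 : 2 ≤ B.card) :
    ((G.induce (B : Set (Fin n))).Connected ∧ ∀ v ∈ (B : Set (Fin n)), (G.induce ((B : Set (Fin n)) \ {v})).Connected) ↔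
      Bi (edg G) (B.map Fin.valEmbedding) := by
  have he : ∀ v ∈ B, ((G.induce ((B : Set (Fin n)) \ {v})).Connected ↔
      Conn ((B.map Fin.valEmbedding).erase v) (edg G ∩ KK ((B.map Fin.valEmbedding).erase v))) := by
    intro v hv
    have e1 : ((B : Set (Fin n)) \ {v}) = ((B.erase v : Finset (Fin n)) : Set (Fin n)) := by
      rw [coe_erase]
    have e2 : (B.map Fin.valEmbedding).erase (v : ℕ) = (B.erase v).map Fin.valEmbedding := by
      rw [map_erase]; rfl
    rw [e1, e2]
    refine connected_iff ?_
    rw [← card_pos, card_erase_of_mem hv]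
    omega
  rw [Bi, card_map, connected_iff (card_pos.1 (by omega))]
  constructor
  · rintro ⟨h, h'⟩
    refine ⟨h2, h, fun v hv => ?_⟩
    obtain ⟨v, hv', rfl⟩ := Finset.mem_map.1 hv
    exact (he v hv').1 (h' v hv')
  · rintro ⟨-, h, h'⟩
    exact ⟨h, fun v hv => (he v hv).2 (h' v (mem_map_of_mem Fin.valEmbedding hv))⟩

lemma maxBlockSize_lt_iff {j : ℕ} (hj : 1 ≤ j) :
    maxBlockSize G < j ↔ SmallB (range n) j (edg G) := by
  classical
  have hbd : BddAbove {k | ∃ S : Set (Fin n), S.ncard = k ∧ 2 ≤ k ∧ (G.induce S).Connected ∧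
      ∀ v ∈ S, (G.induce (S \ {v})).Connected} := by
    refine ⟨n, ?_⟩
    rintro k ⟨S, rfl, -⟩
    exact (Set.ncard_le_card S).trans (by simp)
  constructor
  · intro h B hB hBi
    have hB' : (B.preimage (Fin.val : Fin n → ℕ) Fin.val_injective.injOn).map Fin.valEmbedding = B := by
      ext x
      simp only [Finset.mem_map, mem_preimage, Fin.valEmbedding_apply]
      exact ⟨by rintro ⟨a, ha, rfl⟩; exact ha, fun hx => ⟨⟨x, mem_range.1 (hB hx)⟩, hx, rfl⟩⟩
    set B' := B.preimage (Fin.val : Fin n → ℕ) Fin.val_injective.injOn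
    have hc : B'.card = B.card := by rw [← hB', card_map]
    have h2 : 2 ≤ B'.card := hc ▸ hBi.1
    rw [← hB', ← bi_iff h2] at hBi
    rw [← hc]
    refine lt_of_le_of_lt (le_csSup hbd ⟨B', ?_, h2, hBi⟩) h
    exact Set.ncard_coe_finset B'
  · intro h
    by_contra hcon
    have hne : {k | ∃ S : Set (Fin n), S.ncard = k ∧ 2 ≤ k ∧ (G.induce S).Connected ∧
      ∀ v ∈ S, (G.induce (S \ {v})).Connected}.Nonempty := by
      by_contra he
      rw [Set.not_nonempty_iff_eq_empty] at he
      rw [maxBlockSize, he, csSup_empty] at hcon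
      simp at hcon
      omega
    obtain ⟨S, hS, h2, hbi⟩ := Nat.sSup_mem hne hbd
    obtain ⟨B, rfl⟩ : ∃ B : Finset (Fin n), (B : Set (Fin n)) = S := ⟨S.toFinset, by simp⟩
    rw [Set.ncard_coe_finset] at hS
    have := h (B.map Fin.valEmbedding) (fun x hx => by
      obtain ⟨a, -, rfl⟩ := Finset.mem_map.1 hx
      simp) ((bi_iff (hS ▸ h2)).1 hbi)
    rw [card_map, hS] at this
    exact hcon this

lemma maxBlockSize_eq : (maxBlockSize G : ℝ) =
    ∑ k ∈ range n, ind (¬SmallB (range n) (k + 1) (edg G)) := by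
  classical
  have hle : maxBlockSize G < n + 1 := by
    rw [maxBlockSize_lt_iff (by omega)]
    intro B hB _
    have := card_le_card hB
    simp at this
    omega
  have : ∀ k, ¬SmallB (range n) (k + 1) (edg G) ↔ k < maxBlockSize G := by
    intro k
    rw [← maxBlockSize_lt_iff (by omega)]
    omega
  simp only [this, ind]
  rw [sum_ite, sum_const_zero, add_zero, sum_const, nsmul_eq_mul, mul_one]
  congr 1
  rw [show (range n).filter (· < maxBlockSize G) = range (maxBlockSize G) by
    grind, card_range]

lemma expMaxBlock_eq (n M : ℕ) : expMaxBlock n M = ∑ k ∈ range n,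
    av (KK (range n)) M (fun S => ind (¬SmallB (range n) (k + 1) S)) := by
  classical
  simp only [av, card_KK, card_range]
  rw [← sum_div, sum_comm, expMaxBlock]
  congr 1
  refine sum_bij (fun G _ => edg G) ?_ ?_ ?_ ?_
  · intro G hG
    rw [mem_powersetCard, card_edg]
    exact ⟨edg_subset, (mem_filter.1 hG).2⟩
  · intro G _ G' _ h
    ext a b
    rw [← mem_edg, h, mem_edg]
  · intro S hS
    rw [mem_powersetCard] at hS
    let G : SimpleGraph (Fin n) := SimpleGraph.fromRel fun a b => s((a : ℕ), (b : ℕ)) ∈ S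
    have hG : edg G = S := by
      ext e
      induction e with
      | _ x y =>
        have hA : ∀ a b : Fin n, G.Adj a b ↔ s((a : ℕ), (b : ℕ)) ∈ S := by
          intro a b
          rw [SimpleGraph.fromRel_adj, Sym2.eq_swap (a := (b : ℕ)), or_self]
          refine ⟨fun h => h.2, fun h => ⟨fun hab => ?_, h⟩⟩
          exact (mem_KK.1 (hS.1 h)).2.2 (congrArg _ hab)
        constructor
        · intro h
          obtain ⟨a, b, rfl, rfl, hab⟩ := exists_of_mem_edg h
          exact (hA a b).1 hab
        · intro h
          have := mem_KK.1 (hS.1 h)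
          exact mem_edg.2 ((hA ⟨x, mem_range.1 this.1⟩ ⟨y, mem_range.1 this.2.1⟩).2 h)
    refine ⟨G, ?_, hG⟩
    rw [mem_filter, ← card_edg, hG]
    exact ⟨mem_univ _, hS.2⟩
  · exact fun G _ => maxBlockSize_eq

end

def T3 (n : ℕ) : ℝ := (n : ℝ) ^ ((1 : ℝ) / 3)

lemma T3_pow (n : ℕ) : T3 n ^ 3 = n := by
  rw [T3, ← rpow_natCast, ← rpow_mul (Nat.cast_nonneg n)]
  norm_num

lemma tendsto_T3 : Tendsto T3 atTop atTop :=
  (tendsto_rpow_atTop (by norm_num)).comp tendsto_natCast_atTop_atTop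

/-- Edge weight in the critical window. -/
def wL (L : ℕ → ℝ) (n : ℕ) : ℝ := (1 + L n / T3 n) / n

/-- The limiting probability that all classes are small. -/
def Qr (lam y : ℝ) : ℝ := (Qc lam y (|lam| + 1)).re

section
variable {L : ℕ → ℝ} {lam y : ℝ} {T w : ℕ → ℝ} {j : ℕ → ℕ}

lemma wL_mul {n : ℕ} (hn : 1 ≤ n) : (n : ℝ) * wL L n = 1 + L n / T3 n := by
  have : (n : ℝ) ≠ 0 := by positivity
  rw [wL]
  field_simp

lemma tendsto_floor_div (hT : Tendsto T atTop atTop) (hy : 0 < y) :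
    Tendsto (fun n => ((⌊y * T n⌋₊ + 1 : ℕ) : ℝ) / T n) atTop (nhds y) := by
  have h1 := (tendsto_nat_floor_mul_div_atTop hy.le).comp hT
  have h2 := h1.add (tendsto_inv_atTop_zero.comp hT)
  grind

lemma scal_mk (hL : Tendsto L atTop (nhds lam)) (hy : 0 < y) :
    Scal T3 (wL L) (fun n => ⌊y * T3 n⌋₊ + 1) lam y where
  hTn := T3_pow
  hT := tendsto_T3
  hL := by
    refine hL.congr' ?_
    filter_upwards [eventually_ge_atTop 1, tendsto_T3.eventually_gt_atTop 0] with n hn hT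
    rw [wL_mul hn]
    field_simp
    ring
  hy := hy
  hj := tendsto_floor_div tendsto_T3 hy

lemma Qc_eq (hy : 0 < y) {c : ℝ} (hc : 0 < c) (hcl : lam < 2 * c) : Qc lam y c = (Qr lam y : ℂ) := by
  have hs := scal_mk (L := fun _ => lam) tendsto_const_nhds hy
  have h1 := hs.tendsto_ev hc hcl
  have h2 := hs.tendsto_ev (c := |lam| + 1) (by positivity) (by linarith [le_abs_self lam, abs_nonneg lam])
  have h3 := (continuous_re.tendsto _).comp h2
  have h4 := (continuous_ofReal.tendsto _).comp h3
  exact tendsto_nhds_unique h1 h4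

lemma Scal.tendsto_Qr (h : Scal T w j lam y) :
    Tendsto (fun n => ev (w n) (range n) (fun S => ind (SmallC (range n) (j n) (core S))))
      atTop (nhds (Qr lam y)) := by
  have h2 := h.tendsto_ev (c := |lam| + 1) (by positivity) (by linarith [le_abs_self lam, abs_nonneg lam])
  exact (continuous_re.tendsto _).comp h2

lemma wL_bounds (hL : Tendsto L atTop (nhds lam)) : ∃ C : ℝ, 0 ≤ C ∧ ∀ᶠ n in atTop,
    0 ≤ wL L n ∧ wL L n ≤ 1 ∧ (n : ℝ) * wL L n ≤ 2 ∧ chi (wL L n) n ≤ C * T3 n := by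
  obtain ⟨C, hC, h⟩ := chi_bound (L := |lam| + 1) (by positivity)
  refine ⟨C, hC, ?_⟩
  have h0 : Tendsto (fun n => 1 + L n / T3 n) atTop (nhds (1 + 0)) :=
    tendsto_const_nhds.add (hL.div_atTop tendsto_T3)
  rw [add_zero] at h0
  filter_upwards [eventually_ge_atTop 2, tendsto_T3.eventually_ge_atTop 1,
    h0.eventually (lt_mem_nhds (show (0 : ℝ) < 1 by norm_num)),
    h0.eventually (gt_mem_nhds (show (1 : ℝ) < 2 by norm_num)),
    hL.eventually (gt_mem_nhds (show lam < |lam| + 1 by linarith [le_abs_self lam]))] with n hn hT h1 h2 h3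
  have hn' : (2 : ℝ) ≤ n := by exact_mod_cast hn
  have hw : 0 ≤ wL L n := div_nonneg h1.le (Nat.cast_nonneg n)
  refine ⟨hw, ?_, ?_, h n (T3 n) _ hT (T3_pow n) hw ?_⟩
  · rw [wL, div_le_one (by linarith)]
    linarith
  · rw [wL_mul (by omega)]
    exact h2.le
  · rw [wL_mul (by omega)]
    gcongr

lemma tau_le {w C t : ℝ} {n : ℕ} (hn : 2 ≤ n) (h : chi w n ≤ C * t) : (n - 1 : ℝ) * tau w n ≤ C * t := by
  have hn' : (2 : ℝ) ≤ n := by exact_mod_cast hn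
  rw [tau, mul_div_cancel₀ _ (by linarith)]
  linarith

lemma ev_not_smallC_le {w B : ℝ} {n : ℕ} (hn : 2 ≤ n) (hw : 0 ≤ w) (hw1 : w ≤ 1) (h : (n - 1 : ℝ) * tau w n ≤ B)
    (j : ℕ) : ev w (range n) (fun S => ind (¬SmallC (range n) j (core S))) * (j * (j - 1)) ≤
      n / (n - 1) * B ^ 2 := by
  have hn' : (2 : ℝ) ≤ n := by exact_mod_cast hn
  have h1 := ev_not_smallC (U := range n) hw hw1 j
  rw [card_range] at h1
  have h2 : 0 ≤ (n - 1 : ℝ) * tau w n := mul_nonneg (by linarith) (tau_nonneg hw hn)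
  have h3 : ((n - 1 : ℝ) * tau w n) ^ 2 ≤ B ^ 2 := by gcongr
  calc _ ≤ _ := h1
    _ = n / (n - 1) * ((n - 1 : ℝ) * tau w n) ^ 2 := by
        have : (n - 1 : ℝ) ≠ 0 := by linarith
        field_simp
    _ ≤ _ := by
        refine mul_le_mul_of_nonneg_left h3 (div_nonneg ?_ ?_) <;> linarith

lemma tendsto_bad (hL : Tendsto L atTop (nhds lam)) :
    Tendsto (fun n => ev (wL L n) (range n) (fun S => ind (Bad (range n) S))) atTop (nhds 0) := by
  obtain ⟨C, hC, h⟩ := wL_bounds hL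
  have h1 : Tendsto (fun n => 4 * C ^ 2 * (T3 n)⁻¹) atTop (nhds (4 * C ^ 2 * 0)) :=
    (tendsto_inv_atTop_zero.comp tendsto_T3).const_mul _
  rw [mul_zero] at h1
  refine tendsto_of_tendsto_of_tendsto_of_le_of_le' tendsto_const_nhds h1 ?_ ?_
  · filter_upwards [h] with n hn
    exact ev_nonneg hn.1 fun S _ => ind_nonneg _
  · filter_upwards [h, eventually_ge_atTop 2, tendsto_T3.eventually_gt_atTop 0] with n hn hn2 hT
    obtain ⟨hw, hw1, hnw, hchi⟩ := hn
    have hn' : (2 : ℝ) ≤ n := by exact_mod_cast hn2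
    have hb := ev_bad (U := range n) hw hw1
    rw [card_range] at hb
    have h2 : 0 ≤ (n - 1 : ℝ) * tau (wL L n) n := mul_nonneg (by linarith) (tau_nonneg hw hn2)
    have h3 : ((n - 1 : ℝ) * tau (wL L n) n) ^ 2 ≤ (C * T3 n) ^ 2 := by
      have := tau_le hn2 hchi
      gcongr
    have h4 : ((n : ℝ) * wL L n) ^ 2 ≤ 2 ^ 2 := by
      have : 0 ≤ (n : ℝ) * wL L n := by positivity
      gcongr
    have hT3 := T3_pow n
    calc _ ≤ _ := hb
      _ = ((n : ℝ) * wL L n) ^ 2 * ((n - 1 : ℝ) * tau (wL L n) n) ^ 2 / n := by field_simp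
      _ ≤ 2 ^ 2 * (C * T3 n) ^ 2 / n := by gcongr
      _ = _ := by grind

lemma ev_not {w : ℝ} (hw : 0 ≤ w) (U : Finset ℕ) (P : EdgeSet → Prop) :
    ev w U (fun S => ind (¬P S)) = 1 - ev w U (fun S => ind (P S)) := by
  simp only [ind_not]
  rw [ev_sub, ev_const hw]

end

def rt (n : ℕ) : ℝ := (n : ℝ) ^ ((1 : ℝ) / 12)

lemma rt_pow_four (n : ℕ) : rt n ^ 4 = T3 n := by
  rw [T3, rt, ← rpow_natCast, ← rpow_mul (Nat.cast_nonneg n)]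
  norm_num

lemma rt_pow (n : ℕ) : rt n ^ 12 = n := by
  rw [← T3_pow n, ← rt_pow_four]
  ring

lemma tendsto_rt : Tendsto rt atTop atTop :=
  (tendsto_rpow_atTop (by norm_num)).comp tendsto_natCast_atTop_atTop

def lamE (lam e : ℝ) (n : ℕ) : ℝ := lam + e * (rt n)⁻¹

lemma tendsto_lamE (lam e : ℝ) : Tendsto (lamE lam e) atTop (nhds lam) := by
  have := ((tendsto_inv_atTop_zero.comp tendsto_rt).const_mul e).const_add lam
  rw [mul_zero, add_zero] at this
  exact this

/-- The number of edges. -/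
def Me (lam : ℝ) (n : ℕ) : ℕ := ⌈((n : ℝ) / 2) * (1 + lam * (n : ℝ) ^ (-(1 / 3 : ℝ)))⌉₊

lemma Me_bounds (lam : ℝ) : ∀ᶠ n : ℕ in atTop, (n : ℝ) / 2 * (1 + lam / T3 n) ≤ Me lam n ∧
    (Me lam n : ℝ) ≤ (n : ℝ) / 2 * (1 + lam / T3 n) + 1 := by
  have h0 : Tendsto (fun n => 1 + lam / T3 n) atTop (nhds (1 + 0)) :=
    tendsto_const_nhds.add (tendsto_const_nhds.div_atTop tendsto_T3)
  rw [add_zero] at h0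
  filter_upwards [h0.eventually (lt_mem_nhds (show (0 : ℝ) < 1 by norm_num))] with n hn
  have : (n : ℝ) / 2 * (1 + lam / T3 n) = ((n : ℝ) / 2) * (1 + lam * (n : ℝ) ^ (-(1 / 3 : ℝ))) := by
    rw [rpow_neg (Nat.cast_nonneg n), T3, div_eq_mul_inv lam]
  rw [Me, ← this]
  exact ⟨Nat.le_ceil _, (Nat.ceil_lt_add_one (by positivity)).le⟩

lemma window_error (lam e : ℝ) : ∀ᶠ n : ℕ in atTop,
    (n.choose 2 : ℕ) * wL (lamE lam e) n / (rt n ^ 7 / 4) ^ 2 ≤ 16 * ((rt n)⁻¹) ^ 2 := by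
  obtain ⟨C, hC, h⟩ := wL_bounds (tendsto_lamE lam e)
  filter_upwards [h, tendsto_rt.eventually_gt_atTop 0] with n hn hr
  obtain ⟨hw, -, hnw, -⟩ := hn
  rw [Nat.cast_choose_two]
  have h1 : (n : ℝ) * (n - 1) / 2 * wL (lamE lam e) n ≤ n := by
    have h2 : (n : ℝ) * (n * wL (lamE lam e) n) ≤ n * 2 := by gcongr
    have h3 : 0 ≤ (n : ℝ) * wL (lamE lam e) n := by positivity
    linarith
  calc _ ≤ (n : ℝ) / (rt n ^ 7 / 4) ^ 2 := by gcongr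
    _ = _ := by
      rw [← rt_pow n]
      field_simp
      norm_num

lemma window_up (lam : ℝ) : ∀ᶠ n : ℕ in atTop, (Me lam n : ℝ) + rt n ^ 7 / 4 ≤
    (n.choose 2 : ℕ) * (wL (lamE lam 1) n / (1 + wL (lamE lam 1) n)) := by
  obtain ⟨C, hC, h⟩ := wL_bounds (tendsto_lamE lam 1)
  filter_upwards [h, Me_bounds lam, tendsto_rt.eventually_ge_atTop 2, eventually_ge_atTop 1] with n hn hM hr hn1
  obtain ⟨hw, -, hnw, -⟩ := hn
  have hn' : (0 : ℝ) < n := by exact_mod_cast hn1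
  have hr0 : 0 < rt n := by linarith
  rw [Nat.cast_choose_two]
  set a := (n : ℝ) * wL (lamE lam 1) n with ha
  have ha0 : 0 ≤ a := by positivity
  have hwa : wL (lamE lam 1) n = a / n := by rw [ha]; field_simp
  have hae : a = 1 + lam / T3 n + (rt n)⁻¹ / T3 n := by rw [ha, wL_mul hn1, lamE]; ring
  have h1 : (n : ℝ) * a / 2 - 3 ≤ n * (n - 1) / 2 * (wL (lamE lam 1) n / (1 + wL (lamE lam 1) n)) := by
    have : n * (n - 1) / 2 * (wL (lamE lam 1) n / (1 + wL (lamE lam 1) n)) = (n * (n - 1) * a / 2) / (n + a) := by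
      rw [hwa]
      field_simp
    rw [this, le_div_iff₀ (by positivity)]
    have h2 : (n : ℝ) * (a * a) ≤ n * 4 := by
      have : a * a ≤ 2 * 2 := mul_le_mul hnw hnw ha0 (by norm_num)
      have := mul_le_mul_of_nonneg_left this hn'.le
      linarith
    have h3 : (n : ℝ) * a ≤ n * 2 := mul_le_mul_of_nonneg_left hnw hn'.le
    linarith
  have h4 : (n : ℝ) * a / 2 = (n : ℝ) / 2 * (1 + lam / T3 n) + rt n ^ 7 / 2 := by
    rw [hae, mul_add, add_div]
    congr 1
    · ring
    · rw [← rt_pow_four, ← rt_pow n]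
      field_simp
  have h5 : (2 : ℝ) ^ 7 ≤ rt n ^ 7 := by gcongr
  linarith [hM.2]

lemma window_down (lam : ℝ) : ∀ᶠ n : ℕ in atTop,
    (n.choose 2 : ℕ) * (wL (lamE lam (-1)) n / (1 + wL (lamE lam (-1)) n)) + rt n ^ 7 / 4 ≤ Me lam n := by
  obtain ⟨C, hC, h⟩ := wL_bounds (tendsto_lamE lam (-1))
  filter_upwards [h, Me_bounds lam, tendsto_rt.eventually_ge_atTop 2, eventually_ge_atTop 1] with n hn hM hr hn1
  obtain ⟨hw, -, hnw, -⟩ := hn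
  have hn' : (1 : ℝ) ≤ n := by exact_mod_cast hn1
  have hr0 : 0 < rt n := by linarith
  rw [Nat.cast_choose_two]
  have h1 : wL (lamE lam (-1)) n / (1 + wL (lamE lam (-1)) n) ≤ wL (lamE lam (-1)) n := div_le_self hw (by linarith)
  have h2 : (n : ℝ) * (n - 1) / 2 * (wL (lamE lam (-1)) n / (1 + wL (lamE lam (-1)) n)) ≤
      (n : ℝ) / 2 * (n * wL (lamE lam (-1)) n) := by
    have : (0 : ℝ) ≤ n * (n - 1) / 2 := div_nonneg (mul_nonneg (by linarith) (by linarith)) (by norm_num)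
    have h3 := mul_le_mul_of_nonneg_left h1 this
    have h4 : 0 ≤ (n : ℝ) * wL (lamE lam (-1)) n := by positivity
    linarith
  have h4 : (n : ℝ) / 2 * (n * wL (lamE lam (-1)) n) = (n : ℝ) / 2 * (1 + lam / T3 n) - rt n ^ 7 / 2 := by
    rw [wL_mul hn1, lamE, ← rt_pow_four, ← rt_pow n]
    field_simp
    ring
  have h5 : 0 ≤ rt n ^ 7 := by positivity
  linarith [hM.1]

/-- The probability that some block has at least `j` vertices. -/
def An (lam : ℝ) (n j : ℕ) : ℝ :=
  av (KK (range n)) (Me lam n) (fun S => ind (¬SmallB (range n) j S))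

lemma ind_not_smallB_mono (U : Finset ℕ) (j : ℕ) (S S' : EdgeSet) (h : S ⊆ S') :
    ind (¬SmallB U j S) ≤ ind (¬SmallB U j S') := ind_mono fun h1 h2 => h1 (h2.anti h)

lemma An_le_one (lam : ℝ) (n j : ℕ) : An lam n j ≤ 1 := av_le_one fun S => ind_le_one _

lemma An_nonneg (lam : ℝ) (n j : ℕ) : 0 ≤ An lam n j := av_nonneg fun S => ind_nonneg _

lemma Me_le (lam : ℝ) : ∀ᶠ n : ℕ in atTop, Me lam n ≤ (KK (range n)).card := by
  obtain ⟨C, hC, h⟩ := wL_bounds (tendsto_lamE lam 1)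
  filter_upwards [h, window_up lam, tendsto_rt.eventually_gt_atTop 0] with n hn hu hr
  obtain ⟨hw, -⟩ := hn
  rw [card_KK, card_range, ← Nat.cast_le (α := ℝ)]
  have h1 : (n.choose 2 : ℕ) * (wL (lamE lam 1) n / (1 + wL (lamE lam 1) n)) ≤ (n.choose 2 : ℝ) :=
    mul_le_of_le_one_right (Nat.cast_nonneg _) (div_le_one_of_le₀ (by linarith) (by linarith))
  have h2 : 0 ≤ rt n ^ 7 := by positivity
  linarith

lemma An_le (lam : ℝ) : ∀ᶠ n : ℕ in atTop, ∀ j, 3 ≤ j → An lam n j * (1 - 16 * ((rt n)⁻¹) ^ 2) ≤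
    ev (wL (lamE lam 1) n) (range n) (fun S => ind (¬SmallC (range n) j (core S))) := by
  obtain ⟨C, hC, h⟩ := wL_bounds (tendsto_lamE lam 1)
  filter_upwards [h, window_up lam, window_error lam 1, tendsto_rt.eventually_gt_atTop 0, Me_le lam] with n hn hu he hr hM j hj
  obtain ⟨hw, -⟩ := hn
  have hK : (KK (range n)).card = n.choose 2 := by rw [card_KK, card_range]
  have h1 := av_mul_le (A := KK (range n)) (f := fun S => ind (¬SmallB (range n) j S)) hw
    (d := rt n ^ 7 / 4) (by positivity) (fun S => ind_nonneg _) (ind_not_smallB_mono _ j) hM (by rw [hK]; exact hu)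
  rw [hK] at h1
  refine le_trans ?_ (h1.trans ?_)
  · exact mul_le_mul_of_nonneg_left (by linarith) (An_nonneg lam n j)
  · rw [← hK]
    exact ev_ind_mono hw fun S _ h2 h3 => h2 (smallB_of_smallC hj h3)

lemma le_An (lam : ℝ) : ∀ᶠ n : ℕ in atTop, ∀ j, 3 ≤ j →
    1 - ev (wL (lamE lam (-1)) n) (range n) (fun S => ind (SmallC (range n) j (core S))) -
      ev (wL (lamE lam (-1)) n) (range n) (fun S => ind (Bad (range n) S)) -
      16 * ((rt n)⁻¹) ^ 2 ≤ An lam n j := by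
  obtain ⟨C, hC, h⟩ := wL_bounds (tendsto_lamE lam (-1))
  filter_upwards [h, window_down lam, window_error lam (-1), tendsto_rt.eventually_gt_atTop 0, Me_le lam]
    with n hn hd he hr hM j hj
  obtain ⟨hw, -⟩ := hn
  have hK : (KK (range n)).card = n.choose 2 := by rw [card_KK, card_range]
  have h1 := le_av_add (A := KK (range n)) (f := fun S => ind (¬SmallB (range n) j S)) hw
    (d := rt n ^ 7 / 4) (by positivity) (fun S => ind_nonneg _) (fun S => ind_le_one _)
    (ind_not_smallB_mono _ j) hM (by rw [hK]; exact hd)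
  rw [hK] at h1
  have h2 : ev (wL (lamE lam (-1)) n) (range n) (fun S => ind (SmallB (range n) j S)) ≤
      ev (wL (lamE lam (-1)) n) (range n) (fun S => ind (SmallC (range n) j (core S))) +
      ev (wL (lamE lam (-1)) n) (range n) (fun S => ind (Bad (range n) S)) := by
    rw [← ev_add]
    refine ev_mono hw fun S hS => (ind_mono fun h => ?_).trans (ind_or_le _ _)
    by_cases hb : Bad (range n) S
    · exact Or.inr hb
    · exact Or.inl (smallC_of_smallB (by omega) hS hb h)
  have h3 := ev_not hw (range n) (fun S => SmallB (range n) j S)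
  rw [ev, hK] at h3
  have h4 : av (KK (range n)) (Me lam n) (fun S => ind (¬SmallB (range n) j S)) = An lam n j := rfl
  linarith

lemma tendsto_An (lam : ℝ) {y : ℝ} (hy : 0 < y) :
    Tendsto (fun n => An lam n (⌊y * T3 n⌋₊ + 1)) atTop (nhds (1 - Qr lam y)) := by
  have hr : Tendsto (fun n => 16 * ((rt n)⁻¹) ^ 2) atTop (nhds 0) := by
    have := ((tendsto_inv_atTop_zero.comp tendsto_rt).pow 2).const_mul 16
    simpa using this
  have hj : ∀ᶠ n : ℕ in atTop, 3 ≤ ⌊y * T3 n⌋₊ + 1 := by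
    filter_upwards [(tendsto_T3.const_mul_atTop hy).eventually_ge_atTop 2] with n hn
    have : 2 ≤ ⌊y * T3 n⌋₊ := Nat.le_floor (by exact_mod_cast hn)
    omega
  have hl := (((scal_mk (tendsto_lamE lam (-1)) hy).tendsto_Qr.const_sub 1).sub (tendsto_bad (tendsto_lamE lam (-1)))).sub hr
  have hu := ((scal_mk (tendsto_lamE lam 1) hy).tendsto_Qr.const_sub 1).div (hr.const_sub 1) (by norm_num)
  simp only [sub_zero, div_one] at hl hu
  obtain ⟨C, hC, h⟩ := wL_bounds (tendsto_lamE lam 1)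
  refine tendsto_of_tendsto_of_tendsto_of_le_of_le' hl hu ?_ ?_
  · filter_upwards [hj, le_An lam] with n h1 h2 using h2 _ h1
  · filter_upwards [hj, An_le lam, hr.eventually (gt_mem_nhds (show (0 : ℝ) < 1 by norm_num)), h] with n h1 h2 h3 h4
    have := h2 _ h1
    rw [ev_not h4.1] at this
    exact (le_div_iff₀ (by linarith)).2 this

lemma An_bound (lam : ℝ) : ∃ C : ℝ, ∀ᶠ n : ℕ in atTop, ∀ y : ℝ, 0 < y →
    An lam n (⌊y * T3 n⌋₊ + 1) ≤ C * (1 + y ^ 2)⁻¹ := by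
  obtain ⟨C, hC, h⟩ := wL_bounds (tendsto_lamE lam 1)
  have hr : Tendsto (fun n => 16 * ((rt n)⁻¹) ^ 2) atTop (nhds 0) := by
    have := ((tendsto_inv_atTop_zero.comp tendsto_rt).pow 2).const_mul 16
    simpa using this
  refine ⟨2 + 8 * C ^ 2, ?_⟩
  filter_upwards [h, An_le lam, hr.eventually (gt_mem_nhds (show (0 : ℝ) < 1 / 2 by norm_num)),
    tendsto_T3.eventually_ge_atTop 2, eventually_ge_atTop 2] with n hn hA hr hT hn2 y hy
  obtain ⟨hw, hw1, -, hchi⟩ := hn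
  have hn' : (2 : ℝ) ≤ n := by exact_mod_cast hn2
  rw [← div_eq_mul_inv, le_div_iff₀ (by positivity)]
  have h0 := An_nonneg lam n (⌊y * T3 n⌋₊ + 1)
  have h1 := An_le_one lam n (⌊y * T3 n⌋₊ + 1)
  have hlt := Nat.lt_floor_add_one (y * T3 n)
  set k := ⌊y * T3 n⌋₊ with hk
  by_cases hj : 3 ≤ k + 1
  · have h2 := ev_not_smallC_le hn2 hw hw1 (tau_le hn2 hchi) (k + 1)
    have h3 : (n : ℝ) / (n - 1) ≤ 2 := by rw [div_le_iff₀ (by linarith)]; linarith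
    have h4 := hA _ hj
    have h5 : An lam n (k + 1) * (1 / 2) ≤ An lam n (k + 1) * (1 - 16 * (rt n)⁻¹ ^ 2) :=
      mul_le_mul_of_nonneg_left (by linarith) h0
    have hk2 : (2 : ℝ) ≤ k := by exact_mod_cast (show 2 ≤ k by omega)
    push_cast at h2
    have h6 : (y * T3 n) ^ 2 / 2 ≤ ((k : ℝ) + 1) * ((k : ℝ) + 1 - 1) := by
      have : (y * T3 n) ^ 2 ≤ ((k : ℝ) + 1) ^ 2 := by gcongr
      nlinarith
    have h7 : An lam n (k + 1) * (1 / 2) * ((y * T3 n) ^ 2 / 2) ≤ 2 * (C * T3 n) ^ 2 := by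
      calc _ ≤ ev (wL (lamE lam 1) n) (range n) (fun S => ind (¬SmallC (range n) (k + 1) (core S))) *
            (((k : ℝ) + 1) * ((k : ℝ) + 1 - 1)) := mul_le_mul (h5.trans h4) h6 (by positivity) (le_trans (by positivity) (h5.trans h4))
        _ ≤ _ := h2
        _ ≤ _ := by gcongr
    have h8 : An lam n (k + 1) * y ^ 2 ≤ 8 * C ^ 2 := by
      have : 0 < T3 n ^ 2 := by positivity
      refine le_of_mul_le_mul_right ?_ this
      linarith
    linarith
  · have h2 : (k : ℝ) + 1 ≤ 2 := by exact_mod_cast (show k + 1 ≤ 2 by omega)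
    have h3 : y ≤ 1 := by
      have : y * 2 ≤ y * T3 n := by gcongr
      linarith
    have h4 : An lam n (k + 1) * (1 + y ^ 2) ≤ 1 * (1 + 1 ^ 2) := by gcongr
    linarith [sq_nonneg C]

lemma integral_An (lam : ℝ) {n : ℕ} (hn : 1 ≤ n) :
    expMaxBlock n (Me lam n) / T3 n = ∫ y in Set.Ioi (0 : ℝ), An lam n (⌊y * T3 n⌋₊ + 1) := by
  have hT : 0 < T3 n := by
    rw [T3]
    have : (0 : ℝ) < n := by exact_mod_cast hn
    positivity
  rw [integral_floor_mul (f := fun k => An lam n (k + 1)) (J := n) _ hT, expMaxBlock_eq, smul_eq_mul, div_eq_inv_mul]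
  · rfl
  · intro b hb
    have : ∀ S, ind (¬SmallB (range n) (b + 1) S) = 0 := fun S => ind_false <| not_not.2 fun B hB _ => by
      have := card_le_card hB
      rw [card_range] at this
      omega
    simp [An, av, this]

lemma tendsto_expMaxBlock (lam : ℝ) :
    Tendsto (fun n : ℕ => expMaxBlock n (Me lam n) / T3 n) atTop (nhds (∫ y in Set.Ioi (0 : ℝ), (1 - Qr lam y))) := by
  obtain ⟨C, hC⟩ := An_bound lam
  have h1 := tendsto_integral_filter_of_dominated_convergence
    (μ := volume.restrict (Set.Ioi (0 : ℝ))) (l := atTop)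
    (F := fun (n : ℕ) (y : ℝ) => An lam n (⌊y * T3 n⌋₊ + 1)) (f := fun y => 1 - Qr lam y)
    (fun y => C * (1 + y ^ 2)⁻¹) ?_ ?_ ?_ ?_
  · refine h1.congr' ?_
    filter_upwards [eventually_ge_atTop 1] with n hn using (integral_An lam hn).symm
  · refine Eventually.of_forall fun n => Measurable.aestronglyMeasurable ?_
    have h2 : Measurable fun k : ℕ => An lam n (k + 1) := measurable_from_nat
    exact h2.comp (Nat.measurable_floor.comp (measurable_id.mul_const _))
  · filter_upwards [hC] with n hn
    refine (ae_restrict_iff' measurableSet_Ioi).2 (Eventually.of_forall fun y hy => ?_)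
    rw [norm_of_nonneg (An_nonneg _ _ _)]
    exact hn y hy
  · exact (integrable_inv_one_add_sq.const_mul C).integrableOn
  · exact (ae_restrict_iff' measurableSet_Ioi).2 (Eventually.of_forall fun y hy => tendsto_An lam hy)

lemma setIntegral_Ioo_scale {a v : ℝ} (ha : 0 < a) (hv : 0 < v) (g : ℝ → ℂ) :
    ∫ x in Set.Ioo 0 (v / a), g (a * x) = (a : ℂ)⁻¹ * ∫ x in Set.Ioo 0 v, g x := by
  have h := intervalIntegral.integral_comp_mul_left (a := 0) (b := v / a) g ha.ne'
  rw [mul_zero, mul_div_cancel₀ _ ha.ne', intervalIntegral.integral_of_le (by positivity),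
    intervalIntegral.integral_of_le hv.le, integral_Ioc_eq_integral_Ioo,
    integral_Ioc_eq_integral_Ioo, real_smul] at h
  rw [h]
  push_cast
  rfl

lemma Rz_scale {a v : ℝ} (ha : 0 < a) (hv : 0 < v) (e : ℂ) : Rz (-a) (a * e) (v / a) = Rz (-1) e v := by
  have ha' : (a : ℂ) ≠ 0 := by exact_mod_cast ha.ne'
  have h := setIntegral_Ioo_scale ha hv
    fun x : ℝ => (Complex.exp (((-1 : ℝ) - e) * x) * (1 + x * e) - 1) / (2 * x)
  rw [Rz, Rz, ← mul_inv_cancel_left₀ ha' (∫ x in Set.Ioo 0 v, _), ← h, ← integral_const_mul]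
  congr 1
  ext x
  push_cast
  rw [show (2 * ((a : ℂ) * x)) = a * (2 * x) by ring, mul_div_assoc', mul_div_mul_left _ _ ha']
  congr 4 <;> ring_nf

lemma Rk_scale {a v : ℝ} (ha : 0 < a) (hv : 0 < v) (e : ℂ) (κ : ℕ) :
    Rk (-a) (a * e) (v / a) (κ + 1) = (((a⁻¹) ^ 3) ^ (κ + 1) : ℝ) * Rk (-1) e v (κ + 1) := by
  have ha' : (a : ℂ) ≠ 0 := by exact_mod_cast ha.ne'
  have h := setIntegral_Ioo_scale ha hv
    fun x : ℝ => ((cq (κ + 1 + 1) * x ^ (3 * (κ + 1) - 1) : ℝ) : ℂ) * (Complex.exp (((-1 : ℝ) - e) * x) * (1 + x * e))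
  rw [Rk, Rk, ← mul_inv_cancel_left₀ ha' (∫ x in Set.Ioo 0 v, _), ← h, ← integral_const_mul,
    ← integral_const_mul]
  congr 1
  ext x
  rw [show 3 * (κ + 1) - 1 = 3 * κ + 2 by omega]
  push_cast
  rw [show ((-1 : ℂ) - e) * (a * x) = (-a - a * e) * x by ring, show (a : ℂ) * x * e = x * (a * e) by ring]
  simp only [mul_pow, inv_pow, ← mul_assoc]
  congr 2
  field_simp
  ring

lemma norm_exp_neg_sub_one_le {z : ℂ} (hz : 0 ≤ z.re) : ‖Complex.exp (-z) - 1‖ ≤ ‖z‖ := by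
  have h := (convex_halfSpace_re_le 0).norm_image_sub_le_of_norm_deriv_le (f := Complex.exp) (C := 1)
    (x := 0) (y := -z) (fun x _ => Complex.differentiableAt_exp) ?_ ?_ ?_
  · simpa using h
  · intro x hx
    rw [Complex.deriv_exp, norm_exp]
    exact exp_le_one_iff.2 hx
  · simp
  · simpa using hz

lemma norm_exp_neg_le_one {z : ℂ} (hz : 0 ≤ z.re) : ‖Complex.exp (-z)‖ ≤ 1 := by
  rw [norm_exp]
  exact exp_le_one_iff.2 (by simpa using hz)

lemma integrableOn_Rz {e : ℂ} (he : 0 ≤ e.re) (v : ℝ) :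
    IntegrableOn (fun x : ℝ => (Complex.exp (((-1 : ℝ) - e) * x) * (1 + x * e) - 1) / (2 * x)) (Set.Ioo 0 v) := by
  refine Measure.integrableOn_of_bounded (M := (1 + 2 * ‖e‖) / 2) (by simp) ?_ ?_
  · exact Measurable.aestronglyMeasurable (by fun_prop)
  · refine (ae_restrict_mem measurableSet_Ioo).mono fun x hx => ?_
    have hx0 := hx.1
    have hz : 0 ≤ ((1 + e) * x : ℂ).re := by
      simp
      exact mul_nonneg (by linarith) hx0.le
    have h1 := norm_exp_neg_sub_one_le hz
    have h2 := norm_exp_neg_le_one hz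
    rw [show (((-1 : ℝ) : ℂ) - e) * x = -((1 + e) * x) by push_cast; ring]
    rw [norm_div, norm_mul, Complex.norm_ofNat, norm_real, norm_of_nonneg hx0.le, div_le_div_iff₀ (by positivity) (by norm_num)]
    have h3 : ‖Complex.exp (-((1 + e) * x)) * (1 + x * e) - 1‖ ≤ (1 + ‖e‖) * x + x * ‖e‖ := by
      rw [show Complex.exp (-((1 + e) * x)) * (1 + x * e) - 1 = (Complex.exp (-((1 + e) * x)) - 1) + Complex.exp (-((1 + e) * x)) * (x * e) by ring]
      refine (norm_add_le _ _).trans (add_le_add (h1.trans ?_) ?_)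
      · rw [norm_mul, norm_real, norm_of_nonneg hx0.le]
        gcongr
        exact (norm_add_le _ _).trans (by rw [norm_one])
      · rw [norm_mul, norm_mul, norm_real, norm_of_nonneg hx0.le]
        exact mul_le_of_le_one_left (by positivity) h2
    linarith

lemma norm_Rz_sub_le {e : ℂ} (he : 0 ≤ e.re) {v : ℝ} (hv : 0 < v) : ‖Rz (-1) e v - Rz (-1) 0 v‖ ≤ ‖e‖ * v := by
  rw [Rz, Rz, ← integral_sub (integrableOn_Rz he v) (integrableOn_Rz (by simp) v)]
  have h := norm_setIntegral_le_of_norm_le_const (s := Set.Ioo 0 v) (C := ‖e‖) (μ := volume)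
    (f := fun x : ℝ => (Complex.exp (((-1 : ℝ) - e) * x) * (1 + x * e) - 1) / (2 * x) - (Complex.exp (((-1 : ℝ) - 0) * x) * (1 + x * 0) - 1) / (2 * x))
    (by simp) ?_
  · simpa [hv.le] using h
  · intro x hx
    have hx0 := hx.1
    have hz : 0 ≤ (e * x : ℂ).re := by
      simp
      exact mul_nonneg he hx0.le
    have h1 := norm_exp_neg_sub_one_le hz
    have h2 := norm_exp_neg_le_one hz
    have h3 := norm_exp_neg_le_one (z := x) (by simpa using hx0.le)
    rw [show (Complex.exp (((-1 : ℝ) - e) * x) * (1 + x * e) - 1) / (2 * x) - (Complex.exp (((-1 : ℝ) - 0) * x) * (1 + x * 0) - 1) / (2 * x)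
      = Complex.exp (-x) * ((Complex.exp (-(e * x)) - 1) + Complex.exp (-(e * x)) * (x * e)) / (2 * x) by
        rw [show (((-1 : ℝ) : ℂ) - e) * x = -x + -(e * x) by push_cast; ring, Complex.exp_add]
        push_cast
        ring_nf]
    rw [norm_div, norm_mul, norm_mul, Complex.norm_ofNat, norm_real, norm_of_nonneg hx0.le, div_le_iff₀ (by positivity)]
    refine (mul_le_of_le_one_left (norm_nonneg _) h3).trans ((norm_add_le _ _).trans ?_)
    have h4 : ‖Complex.exp (-(e * x)) * (x * e)‖ ≤ ‖(x * e : ℂ)‖ := by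
      rw [norm_mul]
      exact mul_le_of_le_one_left (norm_nonneg _) h2
    have h5 : ‖(x * e : ℂ)‖ = x * ‖e‖ := by rw [norm_mul, norm_real, norm_of_nonneg hx0.le]
    rw [h5] at h4
    rw [norm_mul, norm_real, norm_of_nonneg hx0.le] at h1
    linarith

lemma norm_Rk_le {v : ℝ} (hv : 0 < v) : ∃ C : ℝ, 0 ≤ C ∧ ∀ e : ℂ, 0 ≤ e.re → ∀ κ : ℕ,
    ‖Rk (-1) e v (κ + 1)‖ ≤ C * (1 + ‖e‖) * (1 / 2) ^ (κ + 1) := by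
  have h := scal_mk (L := fun _ => (-1 : ℝ)) tendsto_const_nhds hv
  obtain ⟨C, hC, hb⟩ := h.exists_const
  refine ⟨C, hC, fun e he κ => ?_⟩
  refine le_of_tendsto (h.tendsto_sk he (Nat.le_add_left 1 κ)).norm ?_
  filter_upwards [hb] with n hn using (hn e he).1 _ (Nat.le_add_left 1 κ)

/-- The contribution of the excess in the scaled variables. -/
def Ez (c v : ℝ) (u : ℂ) : ℂ :=
  ∑' κ : ℕ, (((c ^ 2) ^ 3) ^ (κ + 1) : ℝ) * Rk (-1) (c ^ 3 * u) v (κ + 1)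

lemma norm_Ez_le {v : ℝ} (hv : 0 < v) : ∃ C : ℝ, 0 ≤ C ∧ ∀ (c : ℝ) (u : ℂ), 0 < c → c ≤ 1 → 0 ≤ u.re →
    ‖Ez c v u‖ ≤ c * (C * (1 + ‖u‖)) := by
  obtain ⟨C, hC, h⟩ := norm_Rk_le hv
  refine ⟨C, hC, fun c u hc hc1 hu => ?_⟩
  have hre : 0 ≤ ((c : ℂ) ^ 3 * u).re := by
    rw [← ofReal_pow, re_ofReal_mul]
    positivity
  have hn : ‖(c : ℂ) ^ 3 * u‖ ≤ ‖u‖ := by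
    rw [norm_mul, norm_pow, norm_real, norm_of_nonneg hc.le]
    exact mul_le_of_le_one_left (norm_nonneg _) (pow_le_one₀ hc.le hc1)
  have hg : HasSum (fun κ : ℕ => c * (C * (1 + ‖u‖)) * (1 / 2) * (1 / 2) ^ κ) (c * (C * (1 + ‖u‖))) := by
    have := (hasSum_geometric_two).mul_left (c * (C * (1 + ‖u‖)) * (1 / 2))
    rwa [mul_assoc _ _ (2 : ℝ), one_div_mul_cancel (two_ne_zero), mul_one] at this
  refine tsum_of_norm_bounded hg fun κ => ?_
  rw [norm_mul, norm_real, norm_of_nonneg (by positivity)]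
  have h1 : ((c ^ 2) ^ 3) ^ (κ + 1) ≤ c := by
    rw [← pow_mul, ← pow_mul]
    exact pow_le_of_le_one hc.le hc1 (by omega)
  calc _ ≤ c * (C * (1 + ‖u‖) * (1 / 2) ^ (κ + 1)) := by
        refine mul_le_mul h1 ((h _ hre κ).trans ?_) (norm_nonneg _) hc.le
        gcongr
    _ = _ := by ring

/-- The contour integrand in the scaled variables. -/
def Gc (c v : ℝ) (u : ℂ) : ℂ :=
  Complex.exp (3 / 4 + (c ^ 3 * u ^ 3 / 3 + u ^ 2 / 2)) * Complex.exp (gam + (Rz (-1) (c ^ 3 * u) v + Ez c v u)) / u ^ 2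

lemma QI_scale {c v : ℝ} (hc : 0 < c) (hv : 0 < v) (u : ℂ) :
    QI (-(c ^ 2)⁻¹) (v * c ^ 2) (c * u) = ((c : ℂ) ^ 2)⁻¹ * Gc c v u := by
  have hc' : (c : ℂ) ≠ 0 := by exact_mod_cast hc.ne'
  have e1 : (c * u : ℂ) = ((c ^ 2)⁻¹ : ℝ) * (c ^ 3 * u) := by
    push_cast
    field_simp
  have e2 : v * c ^ 2 = v / (c ^ 2)⁻¹ := by rw [div_inv_eq_mul]
  have h1 : Rt (-(c ^ 2)⁻¹) (c * u) (v * c ^ 2) = Rz (-1) (c ^ 3 * u) v + Ez c v u := by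
    rw [Rt, Ez, e2, e1, Rz_scale (by positivity) hv]
    simp_rw [Rk_scale (inv_pos.2 (pow_pos hc 2)) hv, inv_inv]
  rw [QI, Gc, h1, mul_pow, mul_pow]
  push_cast
  grind

lemma Qc_scale {c v : ℝ} (hc : 0 < c) (hv : 0 < v) :
    Qc (-(c ^ 2)⁻¹) (v * c ^ 2) c = (√v / √(2 * Real.pi) : ℝ) * ∫ τ : ℝ, Gc c v (1 + τ * I) := by
  have hc' : (c : ℂ) ≠ 0 := by exact_mod_cast hc.ne'
  have h := Measure.integral_comp_mul_left (fun τ : ℝ => QI (-(c ^ 2)⁻¹) (v * c ^ 2) (c + τ * I)) c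
  have h2 : (fun τ : ℝ => QI (-(c ^ 2)⁻¹) (v * c ^ 2) (c + (c * τ : ℝ) * I)) = fun τ : ℝ => ((c : ℂ) ^ 2)⁻¹ * Gc c v (1 + τ * I) := by
    ext τ
    rw [← QI_scale hc hv]
    congr 1
    push_cast
    ring
  rw [h2, integral_const_mul, abs_of_pos (inv_pos.2 hc), real_smul] at h
  have h3 : ∫ τ : ℝ, QI (-(c ^ 2)⁻¹) (v * c ^ 2) (c + τ * I) = (c : ℂ)⁻¹ * ∫ τ : ℝ, Gc c v (1 + τ * I) := by
    rw [ofReal_inv] at h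
    rw [← mul_inv_cancel_left₀ hc' (∫ τ : ℝ, QI _ _ _), ← h, ← mul_assoc, sq, mul_inv, mul_inv_cancel_left₀ hc']
  rw [Qc, h3, sqrt_mul' _ (sq_nonneg c), sqrt_sq hc.le]
  rw [← mul_assoc]
  congr 1
  push_cast
  rw [← div_eq_mul_inv, div_right_comm, mul_div_cancel_right₀ _ hc']

lemma aestronglyMeasurable_QI {lam y c : ℝ} (hy : 0 < y) (hc : 0 < c) :
    AEStronglyMeasurable (fun τ : ℝ => QI lam y (c + τ * I)) := by
  have h := scal_mk (L := fun _ => lam) tendsto_const_nhds hy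
  obtain ⟨N, hN⟩ := eventually_atTop.1 ((h.hT.eventually_gt_atTop 0).and (h.w_pos.and (h.j_large 2)))
  refine aestronglyMeasurable_of_tendsto_ae (u := atTop) (f := fun n (τ : ℝ) => PS T3 (wL fun _ => lam) c (n + N) τ *
    (FV T3 (wL fun _ => lam) (fun n => ⌊y * T3 n⌋₊ + 1) (n + N) (c + τ * I) /
      (√((⌊y * T3 (n + N)⌋₊ + 1 : ℕ) : ℝ) : ℝ)) / (c + τ * I) ^ 2) (fun n => ?_) ?_
  · obtain ⟨hT, hw, hj⟩ := hN (n + N) (Nat.le_add_left _ _)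
    exact (((continuous_PS hw).mul ((continuous_FV hT hc.le hj).div_const _)).div (by fun_prop)
      fun τ => pow_ne_zero _ (line_ne_zero hc τ)).aestronglyMeasurable
  · refine Eventually.of_forall fun τ => ?_
    exact (((h.tendsto_PS hc.le τ).mul (h.tendsto_FV (by simpa using hc.le))).div_const _).comp (tendsto_add_atTop_nat N)

lemma aestronglyMeasurable_Gc {c v : ℝ} (hc : 0 < c) (hv : 0 < v) :
    AEStronglyMeasurable (fun τ : ℝ => Gc c v (1 + τ * I)) := by
  have hc' : (c : ℂ) ≠ 0 := by exact_mod_cast hc.ne'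
  have h := (aestronglyMeasurable_QI (lam := -(c ^ 2)⁻¹) (y := v * c ^ 2) (by positivity) hc)
  have h2 := (h.comp_quasiMeasurePreserving (Measure.quasiMeasurePreserving_smul volume hc.ne')).const_mul ((c : ℂ) ^ 2)
  refine h2.congr (Eventually.of_forall fun τ => ?_)
  have e : (c + (c * τ : ℝ) * I : ℂ) = c * (1 + τ * I) := by push_cast; ring
  change (c : ℂ) ^ 2 * QI _ _ (c + (c * τ : ℝ) * I) = _
  rw [e, QI_scale hc hv, mul_inv_cancel_left₀ (pow_ne_zero 2 hc')]

lemma re_line_sq (τ : ℝ) : ((1 + τ * I : ℂ) ^ 2).re = 1 - τ ^ 2 := by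
  simp [sq]

lemma re_line_cube (τ : ℝ) : ((1 + τ * I : ℂ) ^ 3).re = 1 - 3 * τ ^ 2 := by
  simp [pow_succ]
  ring

lemma norm_exp_line_le {c : ℝ} (hc : 0 < c) (hc1 : c ≤ 1) (τ : ℝ) :
    ‖Complex.exp (3 / 4 + (c ^ 3 * (1 + τ * I) ^ 3 / 3 + (1 + τ * I) ^ 2 / 2))‖ ≤ exp (2 - τ ^ 2 / 2) := by
  rw [norm_exp, exp_le_exp]
  have e : (3 / 4 + ((c : ℂ) ^ 3 * (1 + τ * I) ^ 3 / 3 + (1 + τ * I) ^ 2 / 2)).re =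
      3 / 4 + (c ^ 3 * (1 - 3 * τ ^ 2) / 3 + (1 - τ ^ 2) / 2) := by
    rw [show (3 / 4 + ((c : ℂ) ^ 3 * (1 + τ * I) ^ 3 / 3 + (1 + τ * I) ^ 2 / 2)) =
      ((3 / 4 : ℝ) : ℂ) + (((c ^ 3 / 3 : ℝ) : ℂ) * (1 + τ * I) ^ 3 + ((1 / 2 : ℝ) : ℂ) * (1 + τ * I) ^ 2) by push_cast; ring,
      add_re, add_re, re_ofReal_mul, re_ofReal_mul, ofReal_re, re_line_sq, re_line_cube]
    ring
  rw [e]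
  have h1 : c ^ 3 ≤ 1 := pow_le_one₀ hc.le hc1
  have h2 : 0 ≤ c ^ 3 * τ ^ 2 := by positivity
  linarith

lemma tendsto_integral_Gc {v : ℝ} (hv : 0 < v) :
    Tendsto (fun c : ℝ => ∫ τ : ℝ, Gc c v (1 + τ * I)) (nhdsWithin 0 (Set.Ioi 0))
      (nhds (∫ τ : ℝ, Complex.exp (3 / 4 + (1 + τ * I) ^ 2 / 2) * Complex.exp (gam + Rz (-1) 0 v) / (1 + τ * I) ^ 2)) := by
  obtain ⟨C, hC, hE⟩ := norm_Ez_le hv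
  have hsm : ∀ᶠ c : ℝ in nhdsWithin 0 (Set.Ioi 0), 0 < c ∧ c ≤ 1 := by
    filter_upwards [self_mem_nhdsWithin, mem_nhdsWithin_of_mem_nhds (Iic_mem_nhds (zero_lt_one' ℝ))] with c h1 h2 using ⟨h1, h2⟩
  have hid : Tendsto (fun c : ℝ => c) (nhdsWithin 0 (Set.Ioi 0)) (nhds 0) := tendsto_id.mono_left nhdsWithin_le_nhds
  have hre : ∀ (c τ : ℝ), 0 < c → 0 ≤ ((c : ℂ) ^ 3 * (1 + τ * I)).re := fun c τ hc => by
    rw [← ofReal_pow, re_ofReal_mul]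
    simp
    positivity
  have hn : ∀ (c : ℝ) (u : ℂ), 0 < c → c ≤ 1 → ‖(c : ℂ) ^ 3 * u‖ ≤ c * ‖u‖ := fun c u hc hc1 => by
    rw [norm_mul, norm_pow, norm_real, norm_of_nonneg hc.le]
    gcongr
    exact pow_le_of_le_one hc.le hc1 (by norm_num)
  have hu : ∀ τ : ℝ, 0 ≤ (1 + τ * I : ℂ).re := fun τ => by simp
  have hline : ∀ τ : ℝ, ‖(1 + τ * I : ℂ)‖ ≤ 1 + |τ| := fun τ => by
    simpa using norm_line_le (zero_lt_one' ℝ) τ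
  have hline1 : ∀ τ : ℝ, 1 ≤ ‖(1 + τ * I : ℂ)‖ := fun τ => by
    simpa using norm_line_ge (zero_lt_one' ℝ) τ
  refine tendsto_integral_filter_of_dominated_convergence
    (fun τ => exp (2 + |gam| + ‖Rz (-1) 0 v‖ + v + 2 * C + (v + C) ^ 2) * exp (-(1 / 4) * τ ^ 2)) ?_ ?_ ?_ ?_
  · filter_upwards [hsm] with c hc using aestronglyMeasurable_Gc hc.1 hv
  · filter_upwards [hsm] with c hc
    refine Eventually.of_forall fun τ => ?_
    have h1 := norm_exp_line_le hc.1 hc.2 τ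
    have h2 := hE c _ hc.1 hc.2 (hu τ)
    have h3 := norm_Rz_sub_le (hre c τ hc.1) hv
    have h4 := hn c (1 + τ * I) hc.1 hc.2
    have h5 := hline τ
    have h6 : ‖(c : ℂ) ^ 3 * (1 + τ * I)‖ ≤ 1 + |τ| := by
      have := mul_le_of_le_one_left (norm_nonneg (1 + τ * I : ℂ)) hc.2
      linarith
    have h7 : ‖Ez c v (1 + τ * I)‖ ≤ C * (2 + |τ|) := by
      exact h2.trans ((mul_le_of_le_one_left (by positivity) hc.2).trans (mul_le_mul_of_nonneg_left (by linarith) hC))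
    have h8 : ‖(gam : ℂ) + (Rz (-1) (c ^ 3 * (1 + τ * I)) v + Ez c v (1 + τ * I))‖ ≤
        |gam| + ‖Rz (-1) 0 v‖ + (1 + |τ|) * v + C * (2 + |τ|) := by
      have a1 := norm_add_le (gam : ℂ) (Rz (-1) (c ^ 3 * (1 + τ * I)) v + Ez c v (1 + τ * I))
      have a2 := norm_add_le (Rz (-1) (c ^ 3 * (1 + τ * I)) v) (Ez c v (1 + τ * I))
      have a3 := norm_le_norm_add_norm_sub' (Rz (-1) (c ^ 3 * (1 + τ * I)) v) (Rz (-1) 0 v)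
      have a4 := mul_le_mul_of_nonneg_right h6 hv.le
      rw [norm_real, norm_eq_abs] at a1
      linarith
    rw [Gc, norm_div, norm_mul, norm_pow]
    refine (div_le_self (by positivity) (one_le_pow₀ (hline1 τ))).trans ?_
    refine (mul_le_mul h1 ((norm_exp_le_exp_norm _).trans (exp_le_exp.2 h8)) (norm_nonneg _) (exp_nonneg _)).trans ?_
    rw [← exp_add, ← exp_add, exp_le_exp]
    have h9 := sq_nonneg (v + C - |τ| / 2)
    rw [sub_sq, div_pow, sq_abs] at h9
    linarith
  · exact (integrable_exp_neg_mul_sq (by norm_num)).const_mul _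
  · refine Eventually.of_forall fun τ => ?_
    have hcc : Tendsto (fun c : ℝ => (c : ℂ)) (nhdsWithin 0 (Set.Ioi 0)) (nhds 0) := by
      simpa [Function.comp_def] using (continuous_ofReal.tendsto 0).comp hid
    have h1 : Tendsto (fun c : ℝ => (3 / 4 + (c ^ 3 * (1 + τ * I) ^ 3 / 3 + (1 + τ * I) ^ 2 / 2) : ℂ))
        (nhdsWithin 0 (Set.Ioi 0)) (nhds (3 / 4 + (1 + τ * I) ^ 2 / 2)) := by
      have := ((((hcc.pow 3).mul_const ((1 + τ * I) ^ 3)).div_const 3).add_const ((1 + τ * I) ^ 2 / 2)).const_add (3 / 4)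
      simpa using this
    have h2 : Tendsto (fun c : ℝ => Rz (-1) (c ^ 3 * (1 + τ * I)) v) (nhdsWithin 0 (Set.Ioi 0)) (nhds (Rz (-1) 0 v)) := by
      rw [tendsto_iff_norm_sub_tendsto_zero]
      refine squeeze_zero' (Eventually.of_forall fun _ => norm_nonneg _) (g := fun c => c * (‖(1 + τ * I : ℂ)‖ * v)) ?_ ?_
      · filter_upwards [hsm] with c hc
        have a1 := norm_Rz_sub_le (hre c τ hc.1) hv
        have a2 := mul_le_mul_of_nonneg_right (hn c (1 + τ * I) hc.1 hc.2) hv.le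
        linarith
      · simpa using hid.mul_const (‖(1 + τ * I : ℂ)‖ * v)
    have h3 : Tendsto (fun c : ℝ => Ez c v (1 + τ * I)) (nhdsWithin 0 (Set.Ioi 0)) (nhds 0) := by
      refine squeeze_zero_norm' (a := fun c => c * (C * (1 + ‖(1 + τ * I : ℂ)‖))) ?_ ?_
      · filter_upwards [hsm] with c hc using hE c _ hc.1 hc.2 (hu τ)
      · simpa using hid.mul_const (C * (1 + ‖(1 + τ * I : ℂ)‖))
    have h4 := (h2.add h3).const_add (gam : ℂ)
    rw [add_zero] at h4
    exact (((Complex.continuous_exp.tendsto _).comp h1).mul ((Complex.continuous_exp.tendsto _).comp h4)).div_const _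

/-- The value at zero of the scaled exponent. -/
def rz (v : ℝ) : ℝ := ∫ x in Set.Ioo 0 v, (exp (-x) - 1) / (2 * x)

lemma Rz_zero (v : ℝ) : Rz (-1) 0 v = (rz v : ℂ) := by
  rw [Rz, rz, ← integral_complex_ofReal]
  congr 1
  ext x
  push_cast
  ring_nf

lemma exists_tendsto_Qc : ∃ K : ℂ, ∀ v : ℝ, 0 < v →
    Tendsto (fun c : ℝ => Qc (-(c ^ 2)⁻¹) (v * c ^ 2) c) (nhdsWithin 0 (Set.Ioi 0)) (nhds (K * (√v * exp (rz v) : ℝ))) := by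
  refine ⟨(1 / √(2 * Real.pi) : ℝ) * ∫ τ : ℝ, Complex.exp (3 / 4 + (1 + τ * I) ^ 2 / 2) * Complex.exp gam / (1 + τ * I : ℂ) ^ 2,
    fun v hv => ?_⟩
  have h := (tendsto_integral_Gc hv).const_mul ((√v / √(2 * Real.pi) : ℝ) : ℂ)
  have e : (∫ τ : ℝ, Complex.exp (3 / 4 + (1 + τ * I) ^ 2 / 2) * Complex.exp (gam + Rz (-1) 0 v) / (1 + τ * I : ℂ) ^ 2) =
      (∫ τ : ℝ, Complex.exp (3 / 4 + (1 + τ * I) ^ 2 / 2) * Complex.exp gam / (1 + τ * I : ℂ) ^ 2) * (exp (rz v) : ℂ) := by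
    rw [← integral_mul_const]
    congr 1
    ext τ
    rw [Complex.exp_add (gam : ℂ), Rz_zero, ofReal_exp]
    ring
  rw [e] at h
  convert h.congr' ?_ using 2
  · push_cast
    ring
  · filter_upwards [self_mem_nhdsWithin] with c hc
    rw [Qc_scale hc hv]

lemma integrableOn_exp_neg_div {a : ℝ} (ha : 0 < a) :
    IntegrableOn (fun t : ℝ => exp (-t) / t) (Set.Ioi a) := by
  refine Integrable.mono' (g := fun t => a⁻¹ * exp (-t)) ((integrableOn_exp_neg_Ioi a).const_mul _)
    (Measurable.aestronglyMeasurable (by fun_prop)) ?_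
  refine (ae_restrict_mem measurableSet_Ioi).mono fun x hx => ?_
  have hx' : a < x := hx
  have hx0 : 0 < x := ha.trans hx'
  rw [norm_of_nonneg (by positivity), div_eq_mul_inv, mul_comm]
  gcongr

lemma E1_nonneg {v : ℝ} (hv : 0 < v) : 0 ≤ E1 v := by
  refine mul_nonneg (by norm_num) (setIntegral_nonneg measurableSet_Ioi fun t ht => ?_)
  have : 0 < t := hv.trans ht
  positivity

lemma E1_le {v : ℝ} (hv : 1 ≤ v) : E1 v ≤ exp (-v) := by
  have h0 : 0 < v := by linarith
  have h : ∫ t in Set.Ioi v, exp (-t) / t ≤ ∫ t in Set.Ioi v, exp (-t) := by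
    refine setIntegral_mono_on (integrableOn_exp_neg_div h0) (integrableOn_exp_neg_Ioi v)
      measurableSet_Ioi fun t ht => ?_
    exact div_le_self (exp_nonneg _) (hv.trans (le_of_lt ht))
  rw [integral_exp_neg_Ioi] at h
  rw [E1]
  linarith [exp_pos (-v)]

lemma tendsto_E1 : Tendsto E1 atTop (nhds 0) := by
  refine squeeze_zero' ?_ ?_ tendsto_exp_neg_atTop_nhds_zero
  · filter_upwards [eventually_gt_atTop 0] with v hv using E1_nonneg hv
  · filter_upwards [eventually_ge_atTop 1] with v hv using E1_le hv

lemma rz_add_E1 {v : ℝ} (hv : 0 < v) : 1 / 2 * log v + rz v + E1 v = rz 1 + E1 1 := by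
  have hi : ∀ a b : ℝ, 0 ≤ a → 0 ≤ b →
      IntervalIntegrable (fun x : ℝ => (exp (-x) - 1) / (2 * x)) volume a b := by
    have key : ∀ b : ℝ, 0 ≤ b → IntervalIntegrable (fun x : ℝ => (exp (-x) - 1) / (2 * x)) volume 0 b := by
      intro b hb
      rw [intervalIntegrable_iff_integrableOn_Ioo_of_le hb]
      have := (integrableOn_Rz (e := 0) (by simp) b).re
      refine this.congr (Eventually.of_forall fun x => ?_)
      have e : (Complex.exp (((-1 : ℝ) - 0) * x) * (1 + x * 0) - 1) / (2 * x) = (((exp (-x) - 1) / (2 * x) : ℝ) : ℂ) := by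
        push_cast
        ring_nf
      simp only [e]
      exact ofReal_re _
    exact fun a b ha hb => (key a ha).symm.trans (key b hb)
  have hrz : ∀ b : ℝ, 0 ≤ b → rz b = ∫ x in (0 : ℝ)..b, (exp (-x) - 1) / (2 * x) := fun b hb => by
    rw [intervalIntegral.integral_of_le hb, integral_Ioc_eq_integral_Ioo, rz]
  have h1 : rz 1 - rz v = ∫ x in v..1, (exp (-x) - 1) / (2 * x) := by
    rw [hrz 1 zero_le_one, hrz v hv.le, intervalIntegral.integral_interval_sub_left (hi _ _ le_rfl zero_le_one) (hi _ _ le_rfl hv.le)]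
  have h2 : (∫ t in Set.Ioi v, exp (-t) / t) - ∫ t in Set.Ioi 1, exp (-t) / t = ∫ t in v..1, exp (-t) / t :=
    intervalIntegral.integral_Ioi_sub_Ioi' (integrableOn_exp_neg_div hv) (integrableOn_exp_neg_div zero_lt_one)
  have hc : Set.uIcc v 1 ⊆ Set.Ioi 0 := fun x hx => lt_of_lt_of_le (lt_min hv zero_lt_one) hx.1
  have h3 : (∫ x in v..1, (exp (-x) - 1) / (2 * x)) - 1 / 2 * (∫ t in v..1, exp (-t) / t) = ∫ x in v..1, -(1 / 2) * x⁻¹ := by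
    rw [← intervalIntegral.integral_const_mul, ← intervalIntegral.integral_sub (hi _ _ hv.le zero_le_one)]
    · grind
    · refine ContinuousOn.intervalIntegrable fun x hx => ?_
      have : x ≠ 0 := ne_of_gt (hc hx)
      exact ContinuousAt.continuousWithinAt (by fun_prop (disch := assumption))
  rw [intervalIntegral.integral_const_mul, integral_inv_of_pos hv zero_lt_one, one_div v, log_inv] at h3
  rw [E1, E1]
  linarith

lemma sqrt_mul_exp_rz {v : ℝ} (hv : 0 < v) : √v * exp (rz v) = exp (rz 1 + E1 1) * exp (-E1 v) := by
  have h : √v = exp (1 / 2 * log v) := by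
    rw [sqrt_eq_rpow, rpow_def_of_pos hv, mul_comm]
  rw [h, ← exp_add, ← exp_add, ← rz_add_E1 hv]
  congr 1
  ring

lemma Qr_le_one (lam : ℝ) {y : ℝ} (hy : 0 < y) : Qr lam y ≤ 1 := by
  have := ge_of_tendsto' (tendsto_An lam hy) (fun n => An_nonneg lam n _)
  linarith

lemma Qr_nonneg (lam : ℝ) {y : ℝ} (hy : 0 < y) : 0 ≤ Qr lam y := by
  have := le_of_tendsto' (tendsto_An lam hy) (fun n => An_le_one lam n _)
  linarith

lemma one_sub_Qr_le {lam y : ℝ} (hl : lam < 0) (hy : 0 < y) : (1 - Qr lam y) * (y * y) ≤ (1 / -lam) ^ 2 := by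
  have h := scal_mk (L := fun _ => lam) tendsto_const_nhds hy
  have hl' : 0 < -lam := by linarith
  have hn1 : Tendsto (fun n : ℕ => (n : ℝ) / (n - 1)) atTop (nhds 1) := tendsto_natCast_div_add_atTop (-1 : ℝ)
  have hj1 : Tendsto (fun n => (((⌊y * T3 n⌋₊ + 1 : ℕ) : ℝ) - 1) / T3 n) atTop (nhds y) := by
    have := h.hj.sub h.tendsto_inv
    rw [sub_zero] at this
    exact this.congr fun n => by rw [sub_div, one_div]
  have hlim := (h.tendsto_Qr.const_sub 1).mul (h.hj.mul hj1)
  have hR := hn1.mul_const ((1 / -lam) ^ 2)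
  rw [one_mul] at hR
  refine le_of_tendsto_of_tendsto hlim hR ?_
  filter_upwards [eventually_ge_atTop 2, tendsto_T3.eventually_gt_atTop 0, tendsto_T3.eventually_ge_atTop (-lam), h.w_pos,
    h.tendsto_w.eventually (gt_mem_nhds (zero_lt_one' ℝ))] with n hn hT hTl hw hw1
  have e : 1 - (n : ℝ) * wL (fun _ => lam) n = -lam / T3 n := by
    rw [wL_mul (by omega)]
    ring
  have hpos : 0 < -lam / T3 n := by positivity
  have hchi := chi_subcritical hw.le (show 0 < n by omega) (by linarith)
  rw [e, inv_div, div_eq_mul_one_div, mul_comm] at hchi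
  have h4 := ev_not_smallC_le hn hw.le hw1.le (tau_le hn hchi) (⌊y * T3 n⌋₊ + 1)
  rw [ev_not hw.le] at h4
  have h5 := div_le_div_of_nonneg_right h4 (sq_nonneg (T3 n))
  calc _ = _ := by rw [div_mul_div_comm, mul_div_assoc', ← sq (T3 n)]
    _ ≤ _ := h5
    _ = _ := by
      rw [mul_pow, mul_div_assoc, mul_div_cancel_right₀ _ (pow_ne_zero 2 hT.ne')]

lemma one_sub_Qr_scaled_le {lam v : ℝ} (hl : lam < 0) (hv : 0 < v) : (1 - Qr lam (v / -lam)) * v ^ 2 ≤ 1 := by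
  have hl' : 0 < -lam := by linarith
  have h := one_sub_Qr_le hl (div_pos hv hl')
  rw [← sq, div_pow, div_pow, one_pow, mul_div_assoc'] at h
  exact (div_le_div_iff_of_pos_right (by positivity)).1 h

lemma exists_tendsto_Qr : ∃ A : ℝ, ∀ v : ℝ, 0 < v →
    Tendsto (fun lam : ℝ => Qr lam (v / -lam)) atBot (nhds (A * exp (-E1 v))) := by
  obtain ⟨K, hK⟩ := exists_tendsto_Qc
  refine ⟨K.re * exp (rz 1 + E1 1), fun v hv => ?_⟩
  have h1 := (continuous_re.tendsto _).comp (hK v hv)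
  rw [re_mul_ofReal, sqrt_mul_exp_rz hv, ← mul_assoc] at h1
  have h2 : Tendsto (fun lam : ℝ => (√(-lam))⁻¹) atBot (nhdsWithin 0 (Set.Ioi 0)) :=
    tendsto_inv_atTop_nhdsGT_zero.comp (tendsto_sqrt_atTop.comp tendsto_neg_atBot_atTop)
  refine (h1.comp h2).congr' ?_
  filter_upwards [eventually_lt_atBot 0] with lam hl
  have hl' : 0 < -lam := by linarith
  have e : ((√(-lam))⁻¹) ^ 2 = (-lam)⁻¹ := by rw [inv_pow, sq_sqrt hl'.le]
  have hs : 0 < (√(-lam))⁻¹ := inv_pos.2 (sqrt_pos.2 hl')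
  simp only [Function.comp_apply]
  rw [e, inv_inv, neg_neg, ← div_eq_mul_inv, Qc_eq (div_pos hv hl') hs (by linarith), ofReal_re]

lemma tendsto_Qr {v : ℝ} (hv : 0 < v) :
    Tendsto (fun lam : ℝ => Qr lam (v / -lam)) atBot (nhds (exp (-E1 v))) := by
  obtain ⟨A, hA⟩ := exists_tendsto_Qr
  suffices A = 1 by
    have h := hA v hv
    rwa [this, one_mul] at h
  have h1 : Tendsto (fun v => A * exp (-E1 v)) atTop (nhds A) := by
    have := ((continuous_exp.tendsto _).comp tendsto_E1.neg).const_mul A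
    simpa [Function.comp_def] using this
  have h2 : Tendsto (fun v : ℝ => 1 - (v ^ 2)⁻¹) atTop (nhds 1) := by
    have := (tendsto_inv_atTop_zero.comp (tendsto_pow_atTop (α := ℝ) two_ne_zero)).const_sub 1
    simpa [Function.comp_def] using this
  refine tendsto_nhds_unique h1 (tendsto_of_tendsto_of_tendsto_of_le_of_le' h2 tendsto_const_nhds ?_ ?_)
  · filter_upwards [eventually_gt_atTop 0] with v hv
    refine ge_of_tendsto (hA v hv) ?_
    filter_upwards [eventually_lt_atBot 0] with lam hl
    have := (le_div_iff₀ (by positivity)).2 (one_sub_Qr_scaled_le hl hv)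
    rw [one_div] at this
    linarith
  · filter_upwards [eventually_gt_atTop 0] with v hv
    refine le_of_tendsto (hA v hv) ?_
    filter_upwards [eventually_lt_atBot 0] with lam hl
    exact Qr_le_one lam (div_pos hv (by linarith))

lemma aestronglyMeasurable_Qr (lam : ℝ) {b : ℝ} (hb : 0 < b) :
    AEStronglyMeasurable (fun v : ℝ => 1 - Qr lam (v / b)) (volume.restrict (Set.Ioi 0)) := by
  refine aestronglyMeasurable_of_tendsto_ae (u := atTop) (f := fun n v => An lam n (⌊v / b * T3 n⌋₊ + 1)) (fun n => ?_) ?_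
  · have : Measurable fun v : ℝ => ⌊v / b * T3 n⌋₊ := Nat.measurable_floor.comp (by fun_prop)
    exact ((measurable_from_nat (f := fun k : ℕ => An lam n (k + 1))).comp this).aestronglyMeasurable
  · exact (ae_restrict_mem measurableSet_Ioi).mono fun v hv => tendsto_An lam (div_pos hv hb)

lemma tendsto_abs_mul_integral_Qr :
    Tendsto (fun lam : ℝ => |lam| * ∫ y in Set.Ioi (0 : ℝ), (1 - Qr lam y)) atBot (nhds c1) := by
  have h : Tendsto (fun lam : ℝ => ∫ v in Set.Ioi (0 : ℝ), (1 - Qr lam (v / -lam))) atBot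
      (nhds (∫ v in Set.Ioi (0 : ℝ), (1 - exp (-(E1 v))))) := by
    refine tendsto_integral_filter_of_dominated_convergence (fun v => 2 * (1 + v ^ 2)⁻¹) ?_ ?_ ?_ ?_
    · filter_upwards [eventually_lt_atBot 0] with lam hl using aestronglyMeasurable_Qr lam (by linarith)
    · filter_upwards [eventually_lt_atBot 0] with lam hl
      refine (ae_restrict_mem measurableSet_Ioi).mono fun v hv => ?_
      have hv0 : 0 < v := hv
      have h1 := one_sub_Qr_scaled_le hl hv0
      have h2 := Qr_le_one lam (div_pos hv0 (show 0 < -lam by linarith))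
      have h3 := Qr_nonneg lam (div_pos hv0 (show 0 < -lam by linarith))
      rw [norm_of_nonneg (by linarith), ← div_eq_mul_inv, le_div_iff₀ (by positivity)]
      linarith
    · exact (integrable_inv_one_add_sq.const_mul 2).integrableOn
    · exact (ae_restrict_mem measurableSet_Ioi).mono fun v hv => (tendsto_Qr hv).const_sub 1
  refine h.congr' ?_
  filter_upwards [eventually_lt_atBot 0] with lam hl
  have hl' : 0 < -lam := by linarith
  have := integral_comp_mul_left_Ioi (fun y => 1 - Qr lam y) 0 (inv_pos.2 hl')
  rw [mul_zero, inv_inv, smul_eq_mul] at this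
  rw [abs_of_neg hl, ← this]
  simp_rw [div_eq_inv_mul]

end

theorem expectation_maxBlock_critical :
    ∃ c2 : ℝ → ℝ,
      (∀ lam : ℝ,
        Tendsto
          (fun n : ℕ =>
            expMaxBlock n ⌈((n : ℝ) / 2) * (1 + lam * (n : ℝ) ^ (-(1 / 3 : ℝ)))⌉₊ /
              (n : ℝ) ^ ((1 : ℝ) / 3))
          atTop (nhds (c2 lam))) ∧
      Tendsto (fun lam : ℝ => |lam| * c2 lam) atBot (nhds c1) :=
  ⟨fun lam => ∫ y in Set.Ioi (0 : ℝ), (1 - Qr lam y), tendsto_expMaxBlock, tendsto_abs_mul_integral_Qr⟩
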